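/- Fix a ∈ [−1,1], μ > 0, γ > 1 and τ ∈ (0,1). There exists a constant C₀ > 0, independent of τ and of the initial data, and a threshold ε₀ > 0, such that for every initial datum (v₀, u₀, S₀) with (v₀ − 1, u₀, √τ S₀) ∈ H²(ℝ) and E₀ := ‖v₀ − 1‖²_{H²} + ‖u₀‖²_{H²} + τ‖S₀‖²_{H²} < ε₀, the Cauchy problem for the relaxed system has a unique global solution (v, u, S) ∈ C¹([0,∞) × ℝ) with (v − 1, u, S) ∈ C([0,∞); H²(ℝ)) ∩ C¹([0,∞); H¹(ℝ)), and this solution satisfies sup_{0 ≤ t < ∞} (‖(v−1)(t)‖²_{H²} + ‖u(t)‖²_{H²} + τ‖S(t)‖²_{H²}) + ∫₀^∞ (‖v_x(t)‖²_{H¹} + ‖u_x(t)‖²_{H¹} + ‖S(t)‖²_{H²}) dt ≤ C₀ E₀. -/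

import Mathlib

open MeasureTheory Filter Set intervalIntegral

noncomputable section

/-- Squared `H^k(ℝ)` norm: sum of the squared `L²` norms of the derivatives up to order `k`. -/
def HSq (k : ℕ) (f : ℝ → ℝ) : ℝ :=
  ∑ j ∈ Finset.range (k + 1), ∫ x : ℝ, (iteratedDeriv j f x) ^ 2

/-- Classical membership in `H^k(ℝ)`. -/
def MemH (k : ℕ) (f : ℝ → ℝ) : Prop :=
  ContDiff ℝ k f ∧ ∀ j ≤ k, Integrable fun x => (iteratedDeriv j f x) ^ 2

/-- Partial derivative in time. -/
def pt (f : ℝ → ℝ → ℝ) (t x : ℝ) : ℝ := deriv (fun s => f s x) t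

/-- Partial derivative in space. -/
def px (f : ℝ → ℝ → ℝ) (t x : ℝ) : ℝ := deriv (f t) x

/-- Continuity of `t ↦ f t` as an `H^k`-valued map on `I`. -/
def ContH (k : ℕ) (I : Set ℝ) (f : ℝ → ℝ → ℝ) : Prop :=
  ∀ s ∈ I, Tendsto (fun t => HSq k fun x => f t x - f s x) (nhdsWithin s I) (nhds 0)

/-- `f ∈ C⁰(I; H^k) ∩ C¹(I; H^(k-1))`. -/
def RegH (k : ℕ) (I : Set ℝ) (f : ℝ → ℝ → ℝ) : Prop :=
  (∀ t ∈ I, MemH k (f t)) ∧ ContH k I f ∧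
  (∀ x, ∀ t ∈ I, DifferentiableAt ℝ (fun s => f s x) t) ∧
  (∀ t ∈ I, MemH (k - 1) fun x => pt f t x) ∧ ContH (k - 1) I fun t x => pt f t x

/-- The 1-d isentropic compressible Navier–Stokes system with Oldroyd-type constitutive
law, in Lagrangian coordinates, at a point `(t, x)`:
`v_t = u_x`, `u_t + (v^(-γ))_x = S_x`, `τ (S_t - (2 a S / v) u_x) + S = μ u_x / v`. -/
def RelaxedSystem (a μ γ τ : ℝ) (v u S : ℝ → ℝ → ℝ) (t x : ℝ) : Prop :=
  pt v t x = px u t x ∧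
  pt u t x + deriv (fun y => v t y ^ (-γ)) x = px S t x ∧
  τ * (pt S t x - 2 * a * S t x / v t x * px u t x) + S t x = μ * px u t x / v t x

/-- The energy functional `E(t)`. -/
def En (τ : ℝ) (v u S : ℝ → ℝ → ℝ) (t : ℝ) : ℝ :=
  sSup ((fun s => HSq 2 (fun x => v s x - 1) + HSq 2 (u s) + τ * HSq 2 (S s)) '' Icc 0 t)

/-- The dissipation functional `D(t)`. -/
def Dn (v u S : ℝ → ℝ → ℝ) (t : ℝ) : ℝ :=
  HSq 1 (fun x => px v t x) + HSq 1 (fun x => px u t x) + HSq 2 (S t)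

/-- A solution of the relaxed system on `[0,T] × ℝ` in the class
`C⁰([0,T]; H²) ∩ C¹([0,T]; H¹)` with `v > 0` and `2τaS + μ > 0`. -/
def IsSolOn (a μ γ τ T : ℝ) (v u S : ℝ → ℝ → ℝ) : Prop :=
  (∀ t ∈ Icc (0 : ℝ) T, ∀ x : ℝ,
      0 < v t x ∧ 0 < 2 * τ * a * S t x + μ ∧ RelaxedSystem a μ γ τ v u S t x) ∧
  RegH 2 (Icc 0 T) (fun t x => v t x - 1) ∧ RegH 2 (Icc 0 T) u ∧ RegH 2 (Icc 0 T) S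

/-- `(v, u, S)` is a global solution of the Cauchy problem for the relaxed system
with data `(v₀, u₀, S₀)`, of class `C¹([0,∞) × ℝ)` with
`(v - 1, u, S) ∈ C([0,∞);H²) ∩ C¹([0,∞);H¹)` and `v > 0`. -/
def IsGlobalSolution (a μ γ τ : ℝ) (v₀ u₀ S₀ : ℝ → ℝ) (v u S : ℝ → ℝ → ℝ) : Prop :=
  (∀ x : ℝ, v 0 x = v₀ x ∧ u 0 x = u₀ x ∧ S 0 x = S₀ x) ∧
  (∀ t ∈ Ici (0 : ℝ), ∀ x : ℝ, 0 < v t x ∧ RelaxedSystem a μ γ τ v u S t x) ∧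
  ContDiffOn ℝ 1 (fun p : ℝ × ℝ => v p.1 p.2) (Ici 0 ×ˢ univ) ∧
  ContDiffOn ℝ 1 (fun p : ℝ × ℝ => u p.1 p.2) (Ici 0 ×ˢ univ) ∧
  ContDiffOn ℝ 1 (fun p : ℝ × ℝ => S p.1 p.2) (Ici 0 ×ˢ univ) ∧
  RegH 2 (Ici 0) (fun t x => v t x - 1) ∧ RegH 2 (Ici 0) u ∧ RegH 2 (Ici 0) S

section

/-- `g` is `C^{1,1}` on `K`, with derivative `g'`, and all relevant constants are at most `κ`. -/
structure CtrlOn {E : Type*} [NormedAddCommGroup E] [NormedSpace ℝ E] (K : Set E) (κ : ℝ)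
    (g : E → ℝ) (g' : E → E →L[ℝ] ℝ) : Prop where
  hasDeriv : ∀ w ∈ K, HasFDerivAt g (g' w) w
  bdd : ∀ w ∈ K, |g w| ≤ κ
  bdd' : ∀ w ∈ K, ‖g' w‖ ≤ κ
  lip : ∀ w ∈ K, ∀ z ∈ K, |g w - g z| ≤ κ * ‖w - z‖
  lip' : ∀ w ∈ K, ∀ z ∈ K, ‖g' w - g' z‖ ≤ κ * ‖w - z‖

section Scheme

variable {ι : Type*} [Fintype ι]

/-- One step of the semi-Lagrangian scheme for `∂ₜ Wᵢ + λᵢ(W) ∂ₓ Wᵢ = fᵢ(W)`. -/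
def slStep (lam f : ι → (ι → ℝ) → ℝ) (δ : ℝ) (g : ℝ → ι → ℝ) : ℝ → ι → ℝ :=
  fun x i => g (x - δ * lam i (g x)) i + δ * f i (g x)

/-- The spatial derivative of `slStep`. -/
def slStepDeriv (lam : ι → (ι → ℝ) → ℝ) (dl df : ι → (ι → ℝ) → (ι → ℝ) →L[ℝ] ℝ) (δ : ℝ)
    (g g' : ℝ → ι → ℝ) : ℝ → ι → ℝ :=
  fun x i => g' (x - δ * lam i (g x)) i * (1 - δ * dl i (g x) (g' x)) + δ * (df i (g x) (g' x) : ℝ)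

/-- Affine modulus of continuity. -/
def AffMod {F : Type*} [NormedAddCommGroup F] (ε C : ℝ) (g : ℝ → F) : Prop :=
  ∀ x y, ‖g x - g y‖ ≤ ε + C * |x - y|

lemma norm_sub_le_of_deriv_bound {F : Type*} [NormedAddCommGroup F] [NormedSpace ℝ F]
    {g g' : ℝ → F} {M : ℝ} (hd : ∀ x, HasDerivAt g (g' x) x) (hM : ∀ x, ‖g' x‖ ≤ M) (x y : ℝ) :
    ‖g x - g y‖ ≤ M * |x - y| := by
  have := Convex.norm_image_sub_le_of_norm_hasDerivWithin_le (f := g) (f' := g') (s := univ)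
    (C := M) (fun z _ => (hd z).hasDerivWithinAt) (fun z _ => hM z) convex_univ (mem_univ y)
    (mem_univ x)
  simpa using this

lemma taylor_of_affMod {F : Type*} [NormedAddCommGroup F] [NormedSpace ℝ F]
    {g g' : ℝ → F} {ε C : ℝ} (hC : 0 ≤ C) (hd : ∀ x, HasDerivAt g (g' x) x)
    (hm : AffMod ε C g') (x y : ℝ) :
    ‖g y - g x - (y - x) • g' x‖ ≤ (ε + C * |y - x|) * |y - x| := by
  have hh : ∀ z, HasDerivAt (fun z => g z - z • g' x) (g' z - g' x) z := by
    intro z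
    have := (hd z).sub ((hasDerivAt_id z).smul_const (g' x))
    rw [one_smul] at this
    exact this
  have := Convex.norm_image_sub_le_of_norm_hasDerivWithin_le (f := fun z => g z - z • g' x)
    (f' := fun z => g' z - g' x) (s := uIcc x y)
    (C := ε + C * |y - x|) (fun z _ => (hh z).hasDerivWithinAt) (fun z hz => ?_)
    (convex_uIcc x y) left_mem_uIcc right_mem_uIcc
  · rw [Real.norm_eq_abs] at this
    refine le_trans (le_of_eq ?_) this
    congr 1
    rw [sub_smul]
    abel
  · refine (hm z x).trans ?_
    have : |z - x| ≤ |y - x| := abs_sub_left_of_mem_uIcc hz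
    gcongr

variable {lam f : ι → (ι → ℝ) → ℝ} {dl df : ι → (ι → ℝ) → (ι → ℝ) →L[ℝ] ℝ}
  {K : Set (ι → ℝ)} {κ : ℝ}

lemma slStep_hasDerivAt (hl : ∀ i, CtrlOn K κ (lam i) (dl i)) (hf : ∀ i, CtrlOn K κ (f i) (df i))
    {δ : ℝ} {g g' : ℝ → ι → ℝ} (hK : ∀ x, g x ∈ K) (hd : ∀ x, HasDerivAt g (g' x) x) (x : ℝ) :
    HasDerivAt (slStep lam f δ g) (slStepDeriv lam dl df δ g g' x) x := by
  rw [hasDerivAt_pi]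
  intro i
  have h1 : HasDerivAt (fun x => lam i (g x)) (dl i (g x) (g' x)) x :=
    ((hl i).hasDeriv _ (hK x)).comp_hasDerivAt x (hd x)
  have h2 : HasDerivAt (fun x => f i (g x)) (df i (g x) (g' x)) x :=
    ((hf i).hasDeriv _ (hK x)).comp_hasDerivAt x (hd x)
  have h3 : HasDerivAt (fun x => x - δ * lam i (g x)) (1 - δ * dl i (g x) (g' x)) x :=
    (hasDerivAt_id x).sub (h1.const_mul δ)
  have h4 := (hasDerivAt_pi.1 (hd (x - δ * lam i (g x))) i)
  exact (h4.comp x h3).add (h2.const_mul δ)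

lemma slStep_sub_le (hl : ∀ i, CtrlOn K κ (lam i) (dl i)) (hf : ∀ i, CtrlOn K κ (f i) (df i))
    {δ M : ℝ} (hκ : 0 ≤ κ) (hδ : 0 ≤ δ) (hM0 : 0 ≤ M) {g g' : ℝ → ι → ℝ} (hK : ∀ x, g x ∈ K)
    (hd : ∀ x, HasDerivAt g (g' x) x) (hM : ∀ x, ‖g' x‖ ≤ M) (x : ℝ) :
    ‖slStep lam f δ g x - g x‖ ≤ δ * (κ * (1 + M)) := by
  rw [pi_norm_le_iff_of_nonneg (by positivity)]
  intro i
  have h1 := norm_sub_le_of_deriv_bound hd hM (x - δ * lam i (g x)) x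
  have h2 := (norm_le_pi_norm _ i).trans h1
  have h3 := (hl i).bdd _ (hK x)
  have h4 := (hf i).bdd _ (hK x)
  simp only [Pi.sub_apply, Real.norm_eq_abs, slStep] at h2 ⊢
  have h5 : |x - δ * lam i (g x) - x| ≤ δ * κ := by
    rw [sub_sub_cancel_left, abs_neg, abs_mul, abs_of_nonneg hδ]; gcongr
  have h6 : |δ * f i (g x)| ≤ δ * κ := by
    rw [abs_mul, abs_of_nonneg hδ]; gcongr
  calc _ = |(g (x - δ * lam i (g x)) i - g x i) + δ * f i (g x)| := by ring_nf
    _ ≤ |g (x - δ * lam i (g x)) i - g x i| + |δ * f i (g x)| := abs_add_le _ _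
    _ ≤ M * (δ * κ) + δ * κ := by
      refine add_le_add (h2.trans ?_) h6
      gcongr
    _ = _ := by ring

lemma slStepDeriv_le (hl : ∀ i, CtrlOn K κ (lam i) (dl i)) (hf : ∀ i, CtrlOn K κ (f i) (df i))
    {δ M Mk : ℝ} (hκ : 0 ≤ κ) (hδ : 0 ≤ δ) (hM0 : 0 ≤ Mk) {g g' : ℝ → ι → ℝ}
    (hK : ∀ x, g x ∈ K) (hMk : Mk ≤ M) (hM : ∀ x, ‖g' x‖ ≤ Mk) (x : ℝ) :
    ‖slStepDeriv lam dl df δ g g' x‖ ≤ Mk * (1 + δ * (κ * (1 + M))) := by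
  have hM0' := hM0.trans hMk
  rw [pi_norm_le_iff_of_nonneg (by positivity)]
  intro i
  have h1 : |g' (x - δ * lam i (g x)) i| ≤ Mk := (norm_le_pi_norm (g' _) i).trans (hM _)
  have h2 : |dl i (g x) (g' x)| ≤ κ * M :=
    ((dl i (g x)).le_opNorm (g' x)).trans
      (mul_le_mul ((hl i).bdd' _ (hK x)) ((hM x).trans hMk) (norm_nonneg _) hκ)
  have h3 : |df i (g x) (g' x)| ≤ κ * Mk :=
    ((df i (g x)).le_opNorm (g' x)).trans
      (mul_le_mul ((hf i).bdd' _ (hK x)) (hM x) (norm_nonneg _) hκ)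
  simp only [slStepDeriv, Real.norm_eq_abs]
  have h4 : |1 - δ * dl i (g x) (g' x)| ≤ 1 + δ * (κ * M) := by
    refine (abs_sub _ _).trans ?_
    rw [abs_one, abs_mul, abs_of_nonneg hδ]; gcongr
  refine (abs_add_le _ _).trans ?_
  rw [abs_mul, abs_mul, abs_of_nonneg hδ]
  calc _ ≤ Mk * (1 + δ * (κ * M)) + δ * (κ * Mk) := by gcongr
    _ = _ := by ring

lemma clm_apply_sub_le (L L' : (ι → ℝ) →L[ℝ] ℝ) (z z' : ι → ℝ) {κ a M b : ℝ}
    (hκ : 0 ≤ κ) (h1 : ‖L - L'‖ ≤ a) (h2 : ‖L'‖ ≤ κ) (h3 : ‖z‖ ≤ M) (h4 : ‖z - z'‖ ≤ b) :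
    |L z - L' z'| ≤ a * M + κ * b := by
  have : L z - L' z' = (L - L') z + L' (z - z') := by simp
  rw [this]
  refine (abs_add_le _ _).trans (add_le_add ?_ ?_)
  · exact ((L - L').le_opNorm z).trans
      (mul_le_mul h1 h3 (norm_nonneg _) ((norm_nonneg _).trans h1))
  · exact (L'.le_opNorm _).trans (mul_le_mul h2 h4 (norm_nonneg _) hκ)

lemma slStepDeriv_affMod (hl : ∀ i, CtrlOn K κ (lam i) (dl i))
    (hf : ∀ i, CtrlOn K κ (f i) (df i))
    {δ M ε C : ℝ} (hκ : 0 ≤ κ) (hδ : 0 ≤ δ) (hM0 : 0 ≤ M) (hε : 0 ≤ ε) (hC : 1 ≤ C)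
    (hsmall : δ * (κ * (1 + M)) ≤ 1)
    {g g' : ℝ → ι → ℝ} (hK : ∀ x, g x ∈ K) (hd : ∀ x, HasDerivAt g (g' x) x)
    (hM : ∀ x, ‖g' x‖ ≤ M) (hm : AffMod ε C g') :
    AffMod (ε * (1 + δ * (4 * κ * (1 + M) ^ 3))) (C * (1 + δ * (4 * κ * (1 + M) ^ 3)))
      (slStepDeriv lam dl df δ g g') := by
  intro x y
  have hC0 : 0 ≤ C := zero_le_one.trans hC
  set d := |x - y| with hdd
  have hd0 : 0 ≤ d := abs_nonneg _
  rw [pi_norm_le_iff_of_nonneg (by positivity)]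
  intro i
  have hgxy : ‖g x - g y‖ ≤ M * d := norm_sub_le_of_deriv_bound hd hM x y
  have hg' : ‖g' x - g' y‖ ≤ ε + C * d := hm x y
  set ξ := x - δ * lam i (g x)
  set η := y - δ * lam i (g y)
  have hξη : |ξ - η| ≤ d * (1 + δ * κ * M) := by
    have : ξ - η = (x - y) - δ * (lam i (g x) - lam i (g y)) := by simp only [ξ, η]; ring
    rw [this]
    refine (abs_sub _ _).trans ?_
    rw [abs_mul, abs_of_nonneg hδ]
    have := ((hl i).lip _ (hK x) _ (hK y)).trans (mul_le_mul_of_nonneg_left hgxy hκ)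
    calc _ ≤ d + δ * (κ * (M * d)) := by gcongr
      _ = _ := by ring
  have t1 : |g' ξ i - g' η i| ≤ ε + C * (d * (1 + δ * κ * M)) := by
    have := (norm_le_pi_norm (g' ξ - g' η) i).trans (hm ξ η)
    simp only [Pi.sub_apply, Real.norm_eq_abs] at this
    refine this.trans ?_
    gcongr
  have t1' : |g' η i| ≤ M := (norm_le_pi_norm (g' _) i).trans (hM _)
  have tl : |dl i (g x) (g' x)| ≤ κ * M :=
    ((dl i (g x)).le_opNorm (g' x)).trans
      (mul_le_mul ((hl i).bdd' _ (hK x)) (hM x) (norm_nonneg _) hκ)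
  have t2 : |dl i (g x) (g' x) - dl i (g y) (g' y)| ≤ κ * (M * d) * M + κ * (ε + C * d) :=
    clm_apply_sub_le _ _ _ _ hκ (((hl i).lip' _ (hK x) _ (hK y)).trans (by gcongr))
      ((hl i).bdd' _ (hK y)) (hM x) hg'
  have t3 : |df i (g x) (g' x) - df i (g y) (g' y)| ≤ κ * (M * d) * M + κ * (ε + C * d) :=
    clm_apply_sub_le _ _ _ _ hκ (((hf i).lip' _ (hK x) _ (hK y)).trans (by gcongr))
      ((hf i).bdd' _ (hK y)) (hM x) hg'
  have t4 : |1 - δ * dl i (g x) (g' x)| ≤ 1 + δ * (κ * M) := by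
    refine (abs_sub _ _).trans ?_
    rw [abs_one, abs_mul, abs_of_nonneg hδ]; gcongr
  have key : slStepDeriv lam dl df δ g g' x i - slStepDeriv lam dl df δ g g' y i
      = (g' ξ i - g' η i) * (1 - δ * dl i (g x) (g' x))
        - g' η i * (δ * (dl i (g x) (g' x) - dl i (g y) (g' y)))
        + δ * (df i (g x) (g' x) - df i (g y) (g' y)) := by
    simp only [slStepDeriv, ξ, η]; ring
  simp only [Pi.sub_apply, Real.norm_eq_abs]
  rw [key]
  have b1 : |(g' ξ i - g' η i) * (1 - δ * dl i (g x) (g' x))|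
      ≤ (ε + C * (d * (1 + δ * κ * M))) * (1 + δ * (κ * M)) := by
    rw [abs_mul]; gcongr
  have b2 : |g' η i * (δ * (dl i (g x) (g' x) - dl i (g y) (g' y)))|
      ≤ M * (δ * (κ * (M * d) * M + κ * (ε + C * d))) := by
    rw [abs_mul, abs_mul, abs_of_nonneg hδ]; gcongr
  have b3 : |δ * (df i (g x) (g' x) - df i (g y) (g' y))|
      ≤ δ * (κ * (M * d) * M + κ * (ε + C * d)) := by
    rw [abs_mul, abs_of_nonneg hδ]; gcongr
  refine (abs_add_le _ _).trans ((add_le_add ((abs_sub _ _).trans (add_le_add b1 b2)) b3).trans ?_)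
  set e := δ * κ with he
  have he0 : 0 ≤ e := by positivity
  have heM : e * M ≤ 1 := by
    have : e * M ≤ e * (1 + M) := by gcongr; linarith
    linarith [mul_assoc δ κ (1 + M)]
  have hE : ε * (1 + 2 * e * M + e) ≤ ε * (1 + 4 * e * (1 + M) ^ 3) := by
    gcongr ε * ?_
    have : 0 ≤ e * (3 + 10 * M + 12 * M ^ 2 + 4 * M ^ 3) := by positivity
    nlinarith
  have hD : C * (1 + e * M) ^ 2 + e * M ^ 2 * (M + 1) + e * C * (M + 1)
      ≤ C * (1 + 4 * e * (1 + M) ^ 3) := by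
    have h1 : (1 + e * M) ^ 2 ≤ 1 + 3 * (e * M) := by nlinarith [mul_nonneg he0 hM0]
    have h2 : e * M ^ 2 * (M + 1) ≤ C * (e * M ^ 2 * (M + 1)) :=
      le_mul_of_one_le_left (by positivity) hC
    have h3 : C * (1 + e * M) ^ 2 ≤ C * (1 + 3 * (e * M)) := by gcongr
    have h4 : 0 ≤ C * e * (3 + 8 * M + 11 * M ^ 2 + 3 * M ^ 3) := by positivity
    nlinarith
  have hD' := mul_le_mul_of_nonneg_right hD hd0
  calc _ = ε * (1 + 2 * e * M + e)
        + (C * (1 + e * M) ^ 2 + e * M ^ 2 * (M + 1) + e * C * (M + 1)) * d := by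
        simp only [he]; ring
    _ ≤ ε * (1 + 4 * e * (1 + M) ^ 3) + C * (1 + 4 * e * (1 + M) ^ 3) * d := add_le_add hE hD'
    _ = _ := by simp only [he]; ring

end Scheme

end

section

section Iteration

variable {ι : Type*} [Fintype ι]

/-- The iterates of `slStep`. -/
def slIter (lam f : ι → (ι → ℝ) → ℝ) (δ : ℝ) (W0 : ℝ → ι → ℝ) : ℕ → ℝ → ι → ℝ
  | 0 => W0
  | k + 1 => slStep lam f δ (slIter lam f δ W0 k)

/-- The spatial derivatives of the iterates of `slStep`. -/
def slIterDeriv (lam f : ι → (ι → ℝ) → ℝ) (dl df : ι → (ι → ℝ) → (ι → ℝ) →L[ℝ] ℝ) (δ : ℝ)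
    (W0 W0' : ℝ → ι → ℝ) : ℕ → ℝ → ι → ℝ
  | 0 => W0'
  | k + 1 => slStepDeriv lam dl df δ (slIter lam f δ W0 k) (slIterDeriv lam f dl df δ W0 W0' k)

variable {lam f : ι → (ι → ℝ) → ℝ} {dl df : ι → (ι → ℝ) → (ι → ℝ) →L[ℝ] ℝ}
  {K : Set (ι → ℝ)} {κ δ M₀ ρ : ℝ} {W0 W0' : ℝ → ι → ℝ}

lemma one_add_pow_le_exp {y : ℝ} (hy : 0 ≤ y) (k : ℕ) : (1 + y) ^ k ≤ Real.exp (k * y) := by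
  rw [Real.exp_nat_mul]
  have := Real.add_one_le_exp y
  gcongr
  linarith

lemma slIter_basic (hl : ∀ i, CtrlOn K κ (lam i) (dl i)) (hf : ∀ i, CtrlOn K κ (f i) (df i))
    (hκ : 0 ≤ κ) (hδ : 0 ≤ δ) (hM0 : 0 ≤ M₀)
    (hW : ∀ x, HasDerivAt W0 (W0' x) x) (hM : ∀ x, ‖W0' x‖ ≤ M₀)
    (hK : ∀ x, Metric.closedBall (W0 x) ρ ⊆ K) (k : ℕ)
    (hk : k * (δ * (κ * (1 + 2 * M₀))) ≤ min ρ (1 / 2)) :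
    (∀ x, ‖slIter lam f δ W0 k x - W0 x‖ ≤ k * (δ * (κ * (1 + 2 * M₀)))) ∧
    (∀ x, slIter lam f δ W0 k x ∈ K) ∧
    (∀ x, HasDerivAt (slIter lam f δ W0 k) (slIterDeriv lam f dl df δ W0 W0' k x) x) ∧
    (∀ x, ‖slIterDeriv lam f dl df δ W0 W0' k x‖
      ≤ M₀ * (1 + δ * (κ * (1 + 2 * M₀))) ^ k) ∧
    (∀ x, ‖slIterDeriv lam f dl df δ W0 W0' k x‖ ≤ 2 * M₀) := by
  set A := δ * (κ * (1 + 2 * M₀)) with hA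
  have hA0 : 0 ≤ A := by positivity
  have h2 : M₀ * (1 + A) ^ k ≤ 2 * M₀ := by
    have h1 := one_add_pow_le_exp hA0 k
    have h3 : Real.exp (k * A) ≤ Real.exp (1 / 2) :=
      Real.exp_le_exp.2 (hk.trans (min_le_right _ _))
    have h4 : Real.exp (1 / 2) ≤ 2 := by
      have h5 : Real.exp (1 / 2) ^ 2 = Real.exp 1 := by
        rw [← Real.exp_nat_mul]; norm_num
      have := Real.exp_one_lt_three
      nlinarith [Real.exp_pos (1 / 2)]
    nlinarith
  suffices h : (∀ x, ‖slIter lam f δ W0 k x - W0 x‖ ≤ k * A) ∧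
      (∀ x, slIter lam f δ W0 k x ∈ K) ∧
      (∀ x, HasDerivAt (slIter lam f δ W0 k) (slIterDeriv lam f dl df δ W0 W0' k x) x) ∧
      (∀ x, ‖slIterDeriv lam f dl df δ W0 W0' k x‖ ≤ M₀ * (1 + A) ^ k) from
    ⟨h.1, h.2.1, h.2.2.1, h.2.2.2, fun x => (h.2.2.2 x).trans h2⟩
  clear h2
  induction k with
  | zero =>
    simp only [Nat.cast_zero, zero_mul] at hk
    refine ⟨fun x => by simp [slIter], fun x => hK x ?_, hW, fun x => by
      simpa [slIterDeriv] using hM x⟩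
    exact Metric.mem_closedBall_self (hk.trans (min_le_left _ _))
  | succ k ih =>
    have hk' : k * A ≤ min ρ (1 / 2) := by
      refine le_trans ?_ hk
      push_cast; nlinarith
    obtain ⟨i1, i2, i3, i4⟩ := ih hk'
    have h1 := one_add_pow_le_exp hA0 k
    have h3 : Real.exp (k * A) ≤ Real.exp (1 / 2) :=
      Real.exp_le_exp.2 (hk'.trans (min_le_right _ _))
    have h4 : Real.exp (1 / 2) ≤ 2 := by
      have h5 : Real.exp (1 / 2) ^ 2 = Real.exp 1 := by
        rw [← Real.exp_nat_mul]; norm_num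
      have := Real.exp_one_lt_three
      nlinarith [Real.exp_pos (1 / 2)]
    have h2 : M₀ * (1 + A) ^ k ≤ 2 * M₀ := by nlinarith
    have hb : ∀ x, ‖slIter lam f δ W0 (k + 1) x - W0 x‖ ≤ (k + 1 : ℕ) * A := by
      intro x
      have := slStep_sub_le (lam := lam) (f := f) (dl := dl) (df := df) (δ := δ) hl hf hκ hδ
        (by positivity : 0 ≤ 2 * M₀) i2 i3 (fun x => (i4 x).trans h2) x
      calc _ = ‖(slIter lam f δ W0 (k + 1) x - slIter lam f δ W0 k x)
            + (slIter lam f δ W0 k x - W0 x)‖ := by rw [sub_add_sub_cancel]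
        _ ≤ A + k * A := (norm_add_le _ _).trans (add_le_add this (i1 x))
        _ = _ := by push_cast; ring
    refine ⟨hb, fun x => hK x ?_, fun x => ?_, fun x => ?_⟩
    · rw [Metric.mem_closedBall, dist_eq_norm]
      exact (hb x).trans (hk.trans (min_le_left _ _))
    · exact slStep_hasDerivAt hl hf i2 i3 x
    · have := slStepDeriv_le (lam := lam) (f := f) (dl := dl) (df := df) (δ := δ) hl hf hκ hδ
        (by positivity : 0 ≤ M₀ * (1 + A) ^ k) i2 h2 i4 x
      refine this.trans (le_of_eq ?_)
      rw [pow_succ, hA]; ring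

lemma slIterDeriv_affMod (hl : ∀ i, CtrlOn K κ (lam i) (dl i))
    (hf : ∀ i, CtrlOn K κ (f i) (df i))
    (hκ : 0 ≤ κ) (hδ : 0 ≤ δ) (hM0 : 0 ≤ M₀)
    (hW : ∀ x, HasDerivAt W0 (W0' x) x) (hM : ∀ x, ‖W0' x‖ ≤ M₀)
    (hK : ∀ x, Metric.closedBall (W0 x) ρ ⊆ K) {ε C : ℝ} (hε : 0 ≤ ε) (hC : 1 ≤ C)
    (hm : AffMod ε C W0') (n : ℕ)
    (hn : n * (δ * (κ * (1 + 2 * M₀))) ≤ min ρ (1 / 2)) (k : ℕ) (hk : k ≤ n) (hn1 : 1 ≤ n) :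
    AffMod (ε * (1 + δ * (4 * κ * (1 + 2 * M₀) ^ 3)) ^ k)
      (C * (1 + δ * (4 * κ * (1 + 2 * M₀) ^ 3)) ^ k)
      (slIterDeriv lam f dl df δ W0 W0' k) := by
  set A := δ * (κ * (1 + 2 * M₀)) with hA
  have hA0 : 0 ≤ A := by positivity
  induction k with
  | zero => simpa [slIterDeriv] using hm
  | succ k ih =>
    have hkA : (k : ℝ) * A ≤ min ρ (1 / 2) := by
      refine le_trans ?_ hn
      gcongr; omega
    have hsm : A ≤ 1 := by
      have : (1 : ℝ) * A ≤ n * A := by gcongr; exact_mod_cast hn1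
      have := hn.trans (min_le_right _ _)
      linarith
    obtain ⟨-, i2, i3, -, i5⟩ := slIter_basic hl hf hκ hδ hM0 hW hM hK k hkA
    have hone : 1 ≤ (1 + δ * (4 * κ * (1 + 2 * M₀) ^ 3)) ^ k :=
      one_le_pow₀ (by linarith [show 0 ≤ δ * (4 * κ * (1 + 2 * M₀) ^ 3) by positivity])
    have := slStepDeriv_affMod (lam := lam) (f := f) (dl := dl) (df := df) (δ := δ) hl hf hκ hδ
      (by positivity : 0 ≤ 2 * M₀)
      (ε := ε * (1 + δ * (4 * κ * (1 + 2 * M₀) ^ 3)) ^ k)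
      (C := C * (1 + δ * (4 * κ * (1 + 2 * M₀) ^ 3)) ^ k) (by positivity)
      (by nlinarith) hsm i2 i3 i5 (ih (by omega))
    rw [pow_succ, ← mul_assoc ε, ← mul_assoc C]
    exact this

lemma slIter_time_lip (hl : ∀ i, CtrlOn K κ (lam i) (dl i)) (hf : ∀ i, CtrlOn K κ (f i) (df i))
    (hκ : 0 ≤ κ) (hδ : 0 ≤ δ) (hM0 : 0 ≤ M₀)
    (hW : ∀ x, HasDerivAt W0 (W0' x) x) (hM : ∀ x, ‖W0' x‖ ≤ M₀)
    (hK : ∀ x, Metric.closedBall (W0 x) ρ ⊆ K) (n : ℕ)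
    (hn : n * (δ * (κ * (1 + 2 * M₀))) ≤ min ρ (1 / 2)) (j l : ℕ) (hjl : j + l ≤ n) (x : ℝ) :
    ‖slIter lam f δ W0 (j + l) x - slIter lam f δ W0 j x‖
      ≤ l * δ * (κ * (1 + 2 * M₀)) := by
  induction l with
  | zero => simp
  | succ l ih =>
    have hkA : ((j + l : ℕ) : ℝ) * (δ * (κ * (1 + 2 * M₀))) ≤ min ρ (1 / 2) := by
      refine le_trans ?_ hn
      gcongr; omega
    obtain ⟨-, i2, i3, -, i5⟩ := slIter_basic hl hf hκ hδ hM0 hW hM hK (j + l) hkA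
    have := slStep_sub_le (lam := lam) (f := f) (dl := dl) (df := df) (δ := δ) hl hf hκ hδ
        (by positivity : 0 ≤ 2 * M₀) i2 i3 i5 x
    calc _ = ‖(slIter lam f δ W0 (j + l + 1) x - slIter lam f δ W0 (j + l) x)
            + (slIter lam f δ W0 (j + l) x - slIter lam f δ W0 j x)‖ := by
          rw [sub_add_sub_cancel]; rfl
      _ ≤ δ * (κ * (1 + 2 * M₀)) + l * δ * (κ * (1 + 2 * M₀)) :=
        (norm_add_le _ _).trans (add_le_add this (ih (by omega)))
      _ = _ := by push_cast; ring

lemma slIter_semiLag (hl : ∀ i, CtrlOn K κ (lam i) (dl i)) (hf : ∀ i, CtrlOn K κ (f i) (df i))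
    (hκ : 0 ≤ κ) (hδ : 0 ≤ δ) (hM0 : 0 ≤ M₀)
    (hW : ∀ x, HasDerivAt W0 (W0' x) x) (hM : ∀ x, ‖W0' x‖ ≤ M₀)
    (hK : ∀ x, Metric.closedBall (W0 x) ρ ⊆ K) (n : ℕ)
    (hn : n * (δ * (κ * (1 + 2 * M₀))) ≤ min ρ (1 / 2)) (j l : ℕ) (hjl : j + l ≤ n) (x : ℝ)
    (i : ι) :
    |slIter lam f δ W0 (j + l) x i
      - slIter lam f δ W0 j (x - l * δ * lam i (slIter lam f δ W0 j x)) i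
      - l * δ * f i (slIter lam f δ W0 j x)|
      ≤ (κ * (1 + 2 * M₀)) ^ 2 * (l * δ) ^ 2 := by
  induction l generalizing x with
  | zero => simp
  | succ l ih =>
    have hA0 : 0 ≤ δ * (κ * (1 + 2 * M₀)) := by positivity
    have hM2 : 0 ≤ 2 * M₀ := by positivity
    have hkA : ((j + l : ℕ) : ℝ) * (δ * (κ * (1 + 2 * M₀))) ≤ min ρ (1 / 2) := by
      refine le_trans ?_ hn
      gcongr; omega
    have hjA : ((j : ℕ) : ℝ) * (δ * (κ * (1 + 2 * M₀))) ≤ min ρ (1 / 2) := by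
      refine le_trans ?_ hn
      gcongr; omega
    obtain ⟨-, i2, -, -, -⟩ := slIter_basic hl hf hκ hδ hM0 hW hM hK (j + l) hkA
    obtain ⟨-, j2, j3, -, j5⟩ := slIter_basic hl hf hκ hδ hM0 hW hM hK j hjA
    set G := slIter lam f δ W0 (j + l) with hG
    set g := slIter lam f δ W0 j with hg
    set s : ℝ := l * δ with hs
    have hs0 : 0 ≤ s := by positivity
    set y := x - δ * lam i (G x) with hy
    have e0 : slIter lam f δ W0 (j + (l + 1)) x i = G y i + δ * f i (G x) := rfl
    have e1 := ih (by omega) y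
    have hxy : |y - x| ≤ δ * κ := by
      rw [hy, sub_sub_cancel_left, abs_neg, abs_mul, abs_of_nonneg hδ]
      gcongr; exact (hl i).bdd _ (i2 x)
    have gyx : ‖g y - g x‖ ≤ 2 * M₀ * (δ * κ) :=
      (norm_sub_le_of_deriv_bound j3 j5 y x).trans (by gcongr)
    have Gg : ‖G x - g x‖ ≤ s * (κ * (1 + 2 * M₀)) :=
      slIter_time_lip hl hf hκ hδ hM0 hW hM hK n hn j l (by omega) x
    have e2 : |g (y - s * lam i (g y)) i - g (x - ((l + 1 : ℕ) * δ) * lam i (g x)) i|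
        ≤ 2 * M₀ * (δ * (κ * (s * (κ * (1 + 2 * M₀)))) + s * (κ * (2 * M₀ * (δ * κ)))) := by
      have h1 := (norm_le_pi_norm _ i).trans (norm_sub_le_of_deriv_bound j3 j5
        (y - s * lam i (g y)) (x - ((l + 1 : ℕ) * δ) * lam i (g x)))
      simp only [Pi.sub_apply, Real.norm_eq_abs] at h1
      refine h1.trans ?_
      gcongr
      have : y - s * lam i (g y) - (x - ((l + 1 : ℕ) * δ) * lam i (g x))
          = -(δ * (lam i (G x) - lam i (g x))) - s * (lam i (g y) - lam i (g x)) := by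
        simp only [hy, hs]; push_cast; ring
      rw [this]
      refine (abs_sub _ _).trans ?_
      rw [abs_neg, abs_mul, abs_mul, abs_of_nonneg hδ, abs_of_nonneg hs0]
      have l1 := ((hl i).lip _ (i2 x) _ (j2 x)).trans (mul_le_mul_of_nonneg_left Gg hκ)
      have l2 := ((hl i).lip _ (j2 y) _ (j2 x)).trans (mul_le_mul_of_nonneg_left gyx hκ)
      gcongr
    have e3 : |s * (f i (g y) - f i (g x))| ≤ s * (κ * (2 * M₀ * (δ * κ))) := by
      rw [abs_mul, abs_of_nonneg hs0]
      have l2 := ((hf i).lip _ (j2 y) _ (j2 x)).trans (mul_le_mul_of_nonneg_left gyx hκ)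
      gcongr
    have e4 : |δ * (f i (G x) - f i (g x))| ≤ δ * (κ * (s * (κ * (1 + 2 * M₀)))) := by
      rw [abs_mul, abs_of_nonneg hδ]
      have l1 := ((hf i).lip _ (i2 x) _ (j2 x)).trans (mul_le_mul_of_nonneg_left Gg hκ)
      gcongr
    rw [e0]
    have key : G y i + δ * f i (G x) - g (x - ((l + 1 : ℕ) * δ) * lam i (g x)) i
          - (l + 1 : ℕ) * δ * f i (g x)
        = (G y i - g (y - s * lam i (g y)) i - s * f i (g y))
          + (g (y - s * lam i (g y)) i - g (x - ((l + 1 : ℕ) * δ) * lam i (g x)) i)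
          + s * (f i (g y) - f i (g x)) + δ * (f i (G x) - f i (g x)) := by
      simp only [hs]; push_cast; ring
    rw [key]
    refine (abs_add_le _ _).trans ((add_le_add ((abs_add_le _ _).trans (add_le_add
      ((abs_add_le _ _).trans (add_le_add e1 e2)) e3)) e4).trans ?_)
    have : ((l + 1 : ℕ) : ℝ) * δ = s + δ := by simp only [hs]; push_cast; ring
    rw [this]
    have h1 : 0 ≤ (κ * (1 + 2 * M₀)) ^ 2 * δ ^ 2 := by positivity
    have h2 : 0 ≤ s * δ * κ ^ 2 := by positivity
    have h3 : 0 ≤ s * δ * κ ^ 2 * M₀ := by positivity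
    nlinarith

lemma slIter_outside (hl : ∀ i, CtrlOn K κ (lam i) (dl i)) (hf : ∀ i, CtrlOn K κ (f i) (df i))
    (hκ : 0 ≤ κ) (hδ : 0 ≤ δ) (hM0 : 0 ≤ M₀)
    (hW : ∀ x, HasDerivAt W0 (W0' x) x) (hM : ∀ x, ‖W0' x‖ ≤ M₀)
    (hK : ∀ x, Metric.closedBall (W0 x) ρ ⊆ K) {w : ι → ℝ} {R : ℝ} (hw : ∀ i, f i w = 0)
    (hR : ∀ x, R < |x| → W0 x = w) (k : ℕ)
    (hk : k * (δ * (κ * (1 + 2 * M₀))) ≤ min ρ (1 / 2)) (x : ℝ)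
    (hx : R + k * δ * κ < |x|) : slIter lam f δ W0 k x = w := by
  induction k generalizing x with
  | zero => exact hR x (by simpa using hx)
  | succ k ih =>
    have hkA : ((k : ℕ) : ℝ) * (δ * (κ * (1 + 2 * M₀))) ≤ min ρ (1 / 2) := by
      refine le_trans ?_ hk
      gcongr; omega
    obtain ⟨-, i2, -, -, -⟩ := slIter_basic hl hf hκ hδ hM0 hW hM hK k hkA
    push_cast at hx
    have hδκ : 0 ≤ δ * κ := by positivity
    have hgx : slIter lam f δ W0 k x = w := ih hkA x (by nlinarith)
    ext i
    have h1 : |δ * lam i (slIter lam f δ W0 k x)| ≤ δ * κ := by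
      rw [abs_mul, abs_of_nonneg hδ]
      gcongr; exact (hl i).bdd _ (i2 x)
    have h2 : slIter lam f δ W0 k (x - δ * lam i (slIter lam f δ W0 k x)) = w := by
      apply ih hkA
      have := abs_sub_abs_le_abs_sub x (δ * lam i (slIter lam f δ W0 k x))
      nlinarith
    show slIter lam f δ W0 k (x - δ * lam i (slIter lam f δ W0 k x)) i
      + δ * f i (slIter lam f δ W0 k x) = w i
    rw [h2, hgx, hw]; ring

end Iteration

end

section

/-- Clamp a time to `[0, T]`. -/
def clampT (T t : ℝ) : ℝ := max 0 (min t T)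

lemma clampT_mem {T : ℝ} (hT : 0 ≤ T) (t : ℝ) : clampT T t ∈ Icc 0 T := by
  unfold clampT
  constructor
  · exact le_max_left _ _
  · exact max_le hT (min_le_right _ _)

lemma clampT_of_mem {T t : ℝ} (ht : t ∈ Icc 0 T) : clampT T t = t := by
  unfold clampT
  rw [min_eq_left ht.2, max_eq_right ht.1]

lemma clampT_of_nonpos {T t : ℝ} (ht : t ≤ 0) : clampT T t = 0 := by
  unfold clampT
  exact max_eq_left ((min_le_left _ _).trans ht)

lemma continuous_clampT (T : ℝ) : Continuous (clampT T) := by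
  unfold clampT; fun_prop

lemma abs_clampT_sub_le (T t t' : ℝ) : |clampT T t - clampT T t'| ≤ |t - t'| := by
  unfold clampT
  rw [max_comm 0, max_comm 0]
  refine (abs_max_sub_max_le_abs _ _ _).trans ((abs_min_sub_min_le_max _ _ _ _).trans ?_)
  simp

lemma clampT_mono {T t t' : ℝ} (h : t ≤ t') : clampT T t ≤ clampT T t' := by
  unfold clampT; gcongr

section Limit

variable {ι : Type*} [Fintype ι]

/-- Number of steps of size `T / (n + 1)` needed to reach time `t`. -/
def stepIdx (T : ℝ) (n : ℕ) (t : ℝ) : ℕ := ⌊clampT T t / (T / (n + 1))⌋₊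

lemma stepIdx_le {T : ℝ} (hT : 0 < T) (n : ℕ) (t : ℝ) : stepIdx T n t ≤ n + 1 := by
  unfold stepIdx
  have hd : 0 < T / (n + 1) := by positivity
  have : clampT T t / (T / (n + 1)) ≤ ((n + 1 : ℕ) : ℝ) := by
    rw [div_le_iff₀ hd]
    push_cast
    rw [mul_div_cancel₀ _ (by positivity)]
    exact (clampT_mem hT.le t).2
  exact_mod_cast (Nat.floor_le_floor this).trans_eq (Nat.floor_natCast _)

lemma stepIdx_mono {T : ℝ} (hT : 0 < T) (n : ℕ) {t t' : ℝ} (h : t ≤ t') :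
    stepIdx T n t ≤ stepIdx T n t' := by
  unfold stepIdx
  have := clampT_mono (T := T) h
  gcongr

lemma stepIdx_tendsto {T : ℝ} (hT : 0 < T) (t : ℝ) :
    Tendsto (fun n : ℕ => (stepIdx T n t : ℝ) * (T / (n + 1))) atTop (nhds (clampT T t)) := by
  have h0 : Tendsto (fun n : ℕ => T / ((n : ℝ) + 1)) atTop (nhds 0) :=
    tendsto_const_div_atTop_nhds_zero_nat T |>.comp (tendsto_add_atTop_nat 1) |>.congr
      (fun n => by simp)
  have h1 : Tendsto (fun n : ℕ => clampT T t - T / ((n : ℝ) + 1)) atTop (nhds (clampT T t)) := by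
    simpa using h0.const_sub (clampT T t)
  refine tendsto_of_tendsto_of_tendsto_of_le_of_le h1 tendsto_const_nhds (fun n => ?_)
    (fun n => ?_)
  · have hd : 0 < T / ((n : ℝ) + 1) := by positivity
    have := Nat.lt_floor_add_one (clampT T t / (T / ((n : ℝ) + 1)))
    rw [div_lt_iff₀ hd] at this
    simp only [stepIdx]
    linarith
  · have hd : 0 < T / ((n : ℝ) + 1) := by positivity
    have := Nat.floor_le (div_nonneg (clampT_mem hT.le t).1 hd.le)
    rwa [le_div_iff₀ hd] at this

lemma exists_hyperfilter_limit {F : Type*} [TopologicalSpace F] {K : Set F} (hK : IsCompact K)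
    {s : ℕ → F} (hs : ∀ n, s n ∈ K) :
    ∃ w ∈ K, Tendsto s (hyperfilter ℕ) (nhds w) := by
  have h := isCompact_iff_ultrafilter_le_nhds.1 hK ((hyperfilter ℕ).map s) (by
    simp only [Ultrafilter.coe_map, le_principal_iff, mem_map]
    exact Filter.Eventually.of_forall hs)
  exact h

variable {lam f : ι → (ι → ℝ) → ℝ} {dl df : ι → (ι → ℝ) → (ι → ℝ) →L[ℝ] ℝ}
  {K : Set (ι → ℝ)} {κ T M₀ ρ R : ℝ} {W0 W0' : ℝ → ι → ℝ} {w : ι → ℝ}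

lemma exists_scheme_limit (hKc : IsCompact K) (hl : ∀ i, CtrlOn K κ (lam i) (dl i))
    (hf : ∀ i, CtrlOn K κ (f i) (df i)) (hκ : 0 ≤ κ) (hT : 0 < T) (hM0 : 0 ≤ M₀)
    (hTs : T * (κ * (1 + 2 * M₀)) ≤ min ρ (1 / 2))
    (hW : ∀ x, HasDerivAt W0 (W0' x) x) (hM : ∀ x, ‖W0' x‖ ≤ M₀)
    (hmod : ∀ ε > 0, ∃ C ≥ 1, AffMod ε C W0')
    (hK : ∀ x, Metric.closedBall (W0 x) ρ ⊆ K) (hw : ∀ i, f i w = 0)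
    (hR : ∀ x, R < |x| → W0 x = w) :
    ∃ W Z : ℝ → ℝ → ι → ℝ, (∀ t x, W t x ∈ K) ∧ (∀ x, W 0 x = W0 x) ∧
      (∀ t x, W t x = W (clampT T t) x) ∧ (∀ t x, Z t x = Z (clampT T t) x) ∧
      (∀ t x y, ‖W t x - W t y‖ ≤ 2 * M₀ * |x - y|) ∧
      (∀ t t' x, ‖W t x - W t' x‖ ≤ κ * (1 + 2 * M₀) * |t - t'|) ∧
      (∀ ε > 0, ∃ C ≥ 0, ∀ t x y,
        ‖W t y - W t x - (y - x) • Z t x‖ ≤ (ε + C * |y - x|) * |y - x|) ∧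
      (∀ t ∈ Icc 0 T, ∀ t' ∈ Icc 0 T, t ≤ t' → ∀ x i,
        |W t' x i - W t (x - (t' - t) * lam i (W t x)) i - (t' - t) * f i (W t x)|
          ≤ (κ * (1 + 2 * M₀)) ^ 2 * (t' - t) ^ 2) ∧
      (∀ t x, ‖Z t x‖ ≤ 2 * M₀) ∧ (∀ t x, R + T * κ < |x| → W t x = w) := by
  set Wn : ℕ → ℝ → ℝ → ι → ℝ := fun n t => slIter lam f (T / (n + 1)) W0 (stepIdx T n t) with hWn
  set Zn : ℕ → ℝ → ℝ → ι → ℝ := fun n t =>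
    slIterDeriv lam f dl df (T / (n + 1)) W0 W0' (stepIdx T n t) with hZn
  have hδ : ∀ n : ℕ, 0 ≤ T / ((n : ℝ) + 1) := fun n => by positivity
  have hn : ∀ n : ℕ, ((n + 1 : ℕ) : ℝ) * (T / ((n : ℝ) + 1) * (κ * (1 + 2 * M₀)))
      ≤ min ρ (1 / 2) := by
    intro n
    refine le_trans (le_of_eq ?_) hTs
    push_cast; field_simp
  have hkn : ∀ (n : ℕ) (t : ℝ), ((stepIdx T n t : ℕ) : ℝ) *
      (T / ((n : ℝ) + 1) * (κ * (1 + 2 * M₀))) ≤ min ρ (1 / 2) := by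
    intro n t
    refine le_trans ?_ (hn n)
    have := stepIdx_le hT n t
    have h2 : ((stepIdx T n t : ℕ) : ℝ) ≤ ((n + 1 : ℕ) : ℝ) := by exact_mod_cast this
    have := hδ n
    gcongr
  have hbas := fun (n : ℕ) (t : ℝ) =>
    slIter_basic hl hf hκ (hδ n) hM0 hW hM hK (stepIdx T n t) (hkn n t)
  have hWlim : ∀ t x, ∃ w ∈ K, Tendsto (fun n => Wn n t x) (hyperfilter ℕ) (nhds w) :=
    fun t x => exists_hyperfilter_limit hKc (fun n => (hbas n t).2.1 x)
  have hZlim : ∀ t x, ∃ w ∈ Metric.closedBall (0 : ι → ℝ) (2 * M₀),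
      Tendsto (fun n => Zn n t x) (hyperfilter ℕ) (nhds w) :=
    fun t x => exists_hyperfilter_limit (isCompact_closedBall _ _)
      (fun n => by simpa using (hbas n t).2.2.2.2 x)
  choose W hWK hWt using hWlim
  choose Z hZK hZt using hZlim
  have hclamp : ∀ n t, stepIdx T n (clampT T t) = stepIdx T n t := by
    intro n t
    unfold stepIdx
    rw [clampT_of_mem (clampT_mem hT.le t)]
  have hlipx : ∀ n t x y, ‖Wn n t x - Wn n t y‖ ≤ 2 * M₀ * |x - y| := fun n t =>
    norm_sub_le_of_deriv_bound (hbas n t).2.2.1 (hbas n t).2.2.2.2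
  have hst : ∀ t t', Tendsto (fun n : ℕ => ((stepIdx T n t' : ℝ) - stepIdx T n t)
      * (T / ((n : ℝ) + 1))) (hyperfilter ℕ) (nhds (clampT T t' - clampT T t)) := by
    intro t t'
    have := (stepIdx_tendsto hT t').sub (stepIdx_tendsto hT t)
    refine (this.congr fun n => ?_).mono_left Nat.hyperfilter_le_atTop
    ring
  refine ⟨W, Z, hWK, ?_, ?_, ?_, ?_, ?_, ?_, ?_, ?_, ?_⟩
  · intro x
    refine tendsto_nhds_unique (hWt 0 x) ?_
    refine tendsto_const_nhds.congr fun n => ?_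
    simp [hWn, stepIdx, clampT_of_nonpos le_rfl, slIter]
  · intro t x
    refine tendsto_nhds_unique (hWt t x) ((hWt _ x).congr fun n => ?_)
    simp only [hWn, hclamp]
  · intro t x
    refine tendsto_nhds_unique (hZt t x) ((hZt _ x).congr fun n => ?_)
    simp only [hZn, hclamp]
  · intro t x y
    exact le_of_tendsto' ((hWt t x).sub (hWt t y)).norm (fun n => hlipx n t x y)
  · have main : ∀ t t' x, t ≤ t' → ‖W t' x - W t x‖ ≤ κ * (1 + 2 * M₀) * |t' - t| := by
      intro t t' x htt
      have hlim : Tendsto (fun n : ℕ => ((stepIdx T n t' : ℝ) - stepIdx T n t)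
          * (T / ((n : ℝ) + 1)) * (κ * (1 + 2 * M₀))) (hyperfilter ℕ)
          (nhds ((clampT T t' - clampT T t) * (κ * (1 + 2 * M₀)))) := (hst t t').mul_const _
      refine (le_of_tendsto_of_tendsto' ((hWt t' x).sub (hWt t x)).norm hlim fun n => ?_).trans ?_
      · obtain ⟨l, hl'⟩ := Nat.exists_eq_add_of_le (stepIdx_mono hT n htt)
        have hle := stepIdx_le hT n t'
        have := slIter_time_lip hl hf hκ (hδ n) hM0 hW hM hK (n + 1) (hn n) (stepIdx T n t) l
          (by omega) x
        simp only [hWn]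
        rw [hl']
        refine this.trans (le_of_eq ?_)
        push_cast; ring
      · rw [mul_comm]
        gcongr
        exact (le_abs_self _).trans (abs_clampT_sub_le T t' t)
    intro t t' x
    rcases le_total t t' with h | h
    · rw [norm_sub_rev, abs_sub_comm]; exact main t t' x h
    · exact main t' t x h
  · intro ε hε
    set L := 4 * κ * (1 + 2 * M₀) ^ 3 with hL
    have hL0 : 0 ≤ L := by positivity
    obtain ⟨C, hC1, hC⟩ := hmod (ε * Real.exp (-(T * L))) (by positivity)
    have hmn : ∀ n t, AffMod ε (C * Real.exp (T * L)) (Zn n t) := by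
      intro n t x y
      have h1 := slIterDeriv_affMod hl hf hκ (hδ n) hM0 hW hM hK
        (by positivity : 0 ≤ ε * Real.exp (-(T * L))) hC1 hC (n + 1) (hn n) (stepIdx T n t)
        (stepIdx_le hT n t) (by omega) x y
      have h2 : (1 + T / ((n : ℝ) + 1) * L) ^ (stepIdx T n t) ≤ Real.exp (T * L) := by
        refine (one_add_pow_le_exp (mul_nonneg (hδ n) hL0) _).trans (Real.exp_le_exp.2 ?_)
        have : ((stepIdx T n t : ℕ) : ℝ) ≤ ((n + 1 : ℕ) : ℝ) := by
          exact_mod_cast stepIdx_le hT n t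
        calc (stepIdx T n t : ℝ) * (T / (n + 1) * L)
            ≤ ((n + 1 : ℕ) : ℝ) * (T / (n + 1) * L) := by
              have := hδ n
              gcongr
          _ = T * L := by push_cast; field_simp
      refine h1.trans ?_
      have hC0 : 0 ≤ C := zero_le_one.trans hC1
      refine add_le_add ?_ ?_
      · calc _ ≤ ε * Real.exp (-(T * L)) * Real.exp (T * L) := by gcongr
          _ = ε := by rw [mul_assoc, ← Real.exp_add]; simp
      · gcongr
    refine ⟨C * Real.exp (T * L), by positivity, fun t x y => ?_⟩
    refine le_of_tendsto' (((hWt t y).sub (hWt t x)).sub ((hZt t x).const_smul (y - x))).norm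
      fun n => ?_
    exact taylor_of_affMod (by positivity) (hbas n t).2.2.1 (hmn n t) x y
  · intro t ht t' ht' htt x i
    have hct : clampT T t = t := clampT_of_mem ht
    have hct' : clampT T t' = t' := clampT_of_mem ht'
    have hs := hst t t'
    rw [hct, hct'] at hs
    have hlam : Tendsto (fun n => lam i (Wn n t x)) (hyperfilter ℕ) (nhds (lam i (W t x))) :=
      ((hl i).hasDeriv _ (hWK t x)).continuousAt.tendsto.comp (hWt t x)
    have hff : Tendsto (fun n => f i (Wn n t x)) (hyperfilter ℕ) (nhds (f i (W t x))) :=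
      ((hf i).hasDeriv _ (hWK t x)).continuousAt.tendsto.comp (hWt t x)
    have hcomp := fun z => tendsto_pi_nhds.1 (hWt t z) i
    have hfoot : Tendsto (fun n : ℕ => Wn n t (x - ((stepIdx T n t' : ℝ) - stepIdx T n t)
        * (T / ((n : ℝ) + 1)) * lam i (Wn n t x)) i) (hyperfilter ℕ)
        (nhds (W t (x - (t' - t) * lam i (W t x)) i)) := by
      have h1 : Tendsto (fun n : ℕ => x - ((stepIdx T n t' : ℝ) - stepIdx T n t)
        * (T / ((n : ℝ) + 1)) * lam i (Wn n t x)) (hyperfilter ℕ)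
        (nhds (x - (t' - t) * lam i (W t x))) := (hs.mul hlam).const_sub x
      have h2 := hcomp (x - (t' - t) * lam i (W t x))
      refine tendsto_of_tendsto_of_dist h2 ?_
      have h3 : Tendsto (fun n : ℕ => 2 * M₀ * |(x - (t' - t) * lam i (W t x)) -
          (x - ((stepIdx T n t' : ℝ) - stepIdx T n t)
          * (T / ((n : ℝ) + 1)) * lam i (Wn n t x))|) (hyperfilter ℕ) (nhds 0) := by
        have := ((h1.const_sub (x - (t' - t) * lam i (W t x))).abs).const_mul (2 * M₀)
        simpa using this
      refine squeeze_zero (fun _ => dist_nonneg) (fun n => ?_) h3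
      rw [Real.dist_eq]
      exact (norm_le_pi_norm (Wn n t _ - Wn n t _) i).trans (hlipx n t _ _)
    refine le_of_tendsto_of_tendsto' (((hcomp x |> fun _ => tendsto_pi_nhds.1 (hWt t' x) i).sub
      hfoot).sub (hs.mul hff)).abs ((hs.pow 2).const_mul ((κ * (1 + 2 * M₀)) ^ 2)) fun n => ?_
    obtain ⟨l, hl'⟩ := Nat.exists_eq_add_of_le (stepIdx_mono hT n htt)
    have hle := stepIdx_le hT n t'
    have := slIter_semiLag hl hf hκ (hδ n) hM0 hW hM hK (n + 1) (hn n) (stepIdx T n t) l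
      (by omega) x i
    have e : ((stepIdx T n t' : ℝ) - stepIdx T n t) = l := by rw [hl']; push_cast; ring
    rw [e]
    simp only [hWn]
    rw [hl']
    exact this
  · intro t x
    simpa using hZK t x
  · intro t x hx
    refine tendsto_nhds_unique (hWt t x) (tendsto_const_nhds.congr fun n => ?_)
    refine (slIter_outside hl hf hκ (hδ n) hM0 hW hM hK hw hR _ (hkn n t) x ?_).symm
    refine lt_of_le_of_lt ?_ hx
    gcongr
    calc (stepIdx T n t : ℝ) * (T / (n + 1)) ≤ ((n + 1 : ℕ) : ℝ) * (T / (n + 1)) := by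
          have := hδ n
          gcongr
          exact_mod_cast stepIdx_le hT n t
      _ = T := by push_cast; field_simp

end Limit

end

section

section LocalExistence

variable {ι : Type*} [Fintype ι]

/-- Classical `C¹` solution on `[0, T]` of `∂ₜ Wᵢ + λᵢ(W) ∂ₓ Wᵢ = fᵢ(W)`, constant equal to `w`
far away; `Z` is the spatial derivative of `W`. The fields are defined for all times. -/
structure DiagSol (lam f : ι → (ι → ℝ) → ℝ) (K : Set (ι → ℝ)) (w : ι → ℝ) (T : ℝ)
    (W Z : ℝ → ℝ → ι → ℝ) : Prop where
  cont : Continuous fun p : ℝ × ℝ => W p.1 p.2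
  contZ : Continuous fun p : ℝ × ℝ => Z p.1 p.2
  mem : ∀ t x, W t x ∈ K
  dx : ∀ t x, HasDerivAt (W t) (Z t x) x
  dt : ∀ t ∈ Ioo 0 T, ∀ x i,
    HasDerivAt (fun s => W s x i) (f i (W t x) - lam i (W t x) * Z t x i) t
  far : ∃ R, ∀ t x, R < |x| → W t x = w

lemma exists_affMod {F : Type*} [NormedAddCommGroup F] {g : ℝ → F} {M R : ℝ}
    (hg : Continuous g) (hM : ∀ x, ‖g x‖ ≤ M) (hR : ∀ x, R < |x| → g x = 0) :
    ∀ ε > 0, ∃ C ≥ 1, AffMod ε C g := by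
  intro ε hε
  have hcs : HasCompactSupport g := by
    refine HasCompactSupport.intro (isCompact_Icc (a := -R) (b := R)) fun x hx => hR x ?_
    by_contra h
    exact hx (abs_le.1 (not_lt.1 h))
  have huc : UniformContinuous g := hcs.uniformContinuous_of_continuous hg
  obtain ⟨η, hη, h⟩ := Metric.uniformContinuous_iff.1 huc ε hε
  have hM0 : 0 ≤ M := (norm_nonneg _).trans (hM 0)
  refine ⟨max 1 (2 * M / η), le_max_left _ _, fun x y => ?_⟩
  have hc1 : 1 ≤ max 1 (2 * M / η) := le_max_left _ _
  rcases lt_or_ge |x - y| η with h1 | h1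
  · have := h (a := x) (b := y) (by rwa [Real.dist_eq])
    rw [dist_eq_norm] at this
    have : 0 ≤ max 1 (2 * M / η) * |x - y| := by positivity
    linarith
  · have h2 : ‖g x - g y‖ ≤ 2 * M := (norm_sub_le _ _).trans (by linarith [hM x, hM y])
    have h3 : 2 * M ≤ max 1 (2 * M / η) * |x - y| := by
      calc 2 * M = 2 * M / η * η := by field_simp
        _ ≤ _ := by
          gcongr
          exact le_max_right _ _
    linarith

lemma hasDerivAt_of_taylor {F : Type*} [NormedAddCommGroup F] [NormedSpace ℝ F]
    {g : ℝ → F} {z : F} {x : ℝ}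
    (h : ∀ ε > 0, ∃ C ≥ (0 : ℝ), ∀ y, ‖g y - g x - (y - x) • z‖ ≤ (ε + C * |y - x|) * |y - x|) :
    HasDerivAt g z x := by
  rw [hasDerivAt_iff_isLittleO, Asymptotics.isLittleO_iff]
  intro c hc
  obtain ⟨C, hC0, hC⟩ := h (c / 2) (by positivity)
  have : ∀ᶠ y in nhds x, C * |y - x| < c / 2 := by
    have h1 : Tendsto (fun y => C * |y - x|) (nhds x) (nhds (C * |x - x|)) :=
      (Continuous.tendsto (by fun_prop) x)
    rw [sub_self, abs_zero, mul_zero] at h1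
    exact h1.eventually (gt_mem_nhds (by positivity))
  filter_upwards [this] with y hy
  refine (hC y).trans ?_
  rw [Real.norm_eq_abs]
  gcongr
  linarith

lemma continuous_of_taylor {F : Type*} [NormedAddCommGroup F] [NormedSpace ℝ F]
    {W Z : ℝ → ℝ → F} (hW : Continuous fun p : ℝ × ℝ => W p.1 p.2)
    (h : ∀ ε > 0, ∃ C ≥ (0 : ℝ), ∀ t x y,
      ‖W t y - W t x - (y - x) • Z t x‖ ≤ (ε + C * |y - x|) * |y - x|) :
    Continuous fun p : ℝ × ℝ => Z p.1 p.2 := by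
  apply continuous_of_uniform_approx_of_continuous
  intro u hu
  obtain ⟨ε, hε, hu⟩ := Metric.mem_uniformity_dist.1 hu
  obtain ⟨C, hC0, hC⟩ := h (ε / 3) (by positivity)
  set r := ε / 3 / (C + 1) with hr
  have hr0 : 0 < r := by positivity
  refine ⟨fun p => r⁻¹ • (W p.1 (p.2 + r) - W p.1 p.2), ?_, fun p => hu ?_⟩
  · have : Continuous fun p : ℝ × ℝ => W p.1 (p.2 + r) :=
      hW.comp (by fun_prop : Continuous fun p : ℝ × ℝ => (p.1, p.2 + r))
    exact (this.sub hW).const_smul _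
  · have h1 := hC p.1 p.2 (p.2 + r)
    rw [add_sub_cancel_left, abs_of_pos hr0] at h1
    rw [dist_comm, dist_eq_norm]
    have h2 : r⁻¹ • (W p.1 (p.2 + r) - W p.1 p.2) - Z p.1 p.2
        = r⁻¹ • (W p.1 (p.2 + r) - W p.1 p.2 - r • Z p.1 p.2) := by
      rw [smul_sub _ _ (r • Z p.1 p.2), inv_smul_smul₀ hr0.ne']
    rw [h2, norm_smul, norm_inv, Real.norm_eq_abs, abs_of_pos hr0]
    calc _ ≤ r⁻¹ * ((ε / 3 + C * r) * r) := by gcongr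
      _ = ε / 3 + C * r := by field_simp
      _ < ε := by
        have : C * r ≤ (C + 1) * r := by gcongr; linarith
        have h3 : (C + 1) * r = ε / 3 := by rw [hr]; field_simp
        linarith

/-- A continuous function with continuous right derivative is differentiable. -/
lemma hasDerivAt_of_right_deriv {g G : ℝ → ℝ} {T : ℝ} (hg : Continuous g) (hG : Continuous G)
    (h : ∀ t ∈ Ioo 0 T, HasDerivWithinAt g (G t) (Ioi t) t) {t : ℝ} (ht : t ∈ Ioo 0 T) :
    HasDerivAt g (G t) t := by
  have h1 : ∀ s ∈ Ioo 0 T, g s = g t + ∫ r in t..s, G r := by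
    intro s hs
    rw [integral_eq_sub_of_hasDeriv_right hg.continuousOn (fun r hr => h r ?_)
      (hG.intervalIntegrable _ _)]
    · ring
    · exact ⟨(lt_min ht.1 hs.1).trans hr.1, hr.2.trans (max_lt ht.2 hs.2)⟩
  have h2 : HasDerivAt (fun s => g t + ∫ r in t..s, G r) (G t) t :=
    (integral_hasDerivAt_right (hG.intervalIntegrable _ _)
      (hG.stronglyMeasurableAtFilter _ _) hG.continuousAt).const_add _
  refine h2.congr_of_eventuallyEq ?_
  filter_upwards [Ioo_mem_nhds ht.1 ht.2] with s hs using h1 s hs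

variable {lam f : ι → (ι → ℝ) → ℝ} {dl df : ι → (ι → ℝ) → (ι → ℝ) →L[ℝ] ℝ}
  {K : Set (ι → ℝ)} {κ T M₀ ρ R : ℝ} {W0 W0' : ℝ → ι → ℝ} {w : ι → ℝ}

theorem diag_local_existence (hKc : IsCompact K) (hl : ∀ i, CtrlOn K κ (lam i) (dl i))
    (hf : ∀ i, CtrlOn K κ (f i) (df i)) (hκ : 0 ≤ κ) (hM0 : 0 ≤ M₀) (hρ : 0 < ρ) :
    ∃ T > 0, ∀ (W0 W0' : ℝ → ι → ℝ) (w : ι → ℝ) (R : ℝ), (∀ x, HasDerivAt W0 (W0' x) x) →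
      (∀ x, ‖W0' x‖ ≤ M₀) → Continuous W0' → (∀ x, Metric.closedBall (W0 x) ρ ⊆ K) →
      (∀ i, f i w = 0) → (∀ x, R < |x| → W0 x = w) →
      ∃ W Z, DiagSol lam f K w T W Z ∧ W 0 = W0 := by
  set A := κ * (1 + 2 * M₀) with hA
  have hA0 : 0 ≤ A := by positivity
  have hm0 : 0 < min ρ (1 / 2) := lt_min hρ (by norm_num)
  refine ⟨min ρ (1 / 2) / (A + 1), by positivity, ?_⟩
  set T := min ρ (1 / 2) / (A + 1) with hTd
  have hT : 0 < T := by positivity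
  have hTs : T * A ≤ min ρ (1 / 2) := by
    have : T * (A + 1) = min ρ (1 / 2) := by rw [hTd]; field_simp
    nlinarith
  intro W0 W0' w R hW hM hc hK hw hR
  have hmod : ∀ ε > 0, ∃ C ≥ 1, AffMod ε C W0' := by
    refine exists_affMod (R := R) hc hM fun x hx => ?_
    have h1 : W0 =ᶠ[nhds x] fun _ => w := by
      have : ∀ᶠ y in nhds x, R < |y| := continuous_abs.continuousAt.eventually (lt_mem_nhds hx)
      filter_upwards [this] with y hy using hR y hy
    exact (hW x).unique ((hasDerivAt_const x w).congr_of_eventuallyEq h1)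
  obtain ⟨W, Z, hWK, hW0, hWc, hZc, hx, ht, hTay, hSL, hZ, hfar⟩ :=
    exists_scheme_limit hKc hl hf hκ hT hM0 hTs hW hM hmod hK hw hR
  have hWcont : Continuous fun p : ℝ × ℝ => W p.1 p.2 := by
    refine continuous_iff_continuousAt.2 fun p => ?_
    rw [ContinuousAt, tendsto_iff_norm_sub_tendsto_zero]
    have h1 : Tendsto (fun q : ℝ × ℝ => A * |q.1 - p.1| + 2 * M₀ * |q.2 - p.2|) (nhds p)
        (nhds (A * |p.1 - p.1| + 2 * M₀ * |p.2 - p.2|)) :=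
      Continuous.tendsto (by fun_prop) p
    simp only [sub_self, abs_zero, mul_zero, add_zero] at h1
    refine squeeze_zero (fun _ => norm_nonneg _) (fun q => ?_) h1
    calc _ = ‖(W q.1 q.2 - W p.1 q.2) + (W p.1 q.2 - W p.1 p.2)‖ := by rw [sub_add_sub_cancel]
      _ ≤ _ := (norm_add_le _ _).trans (add_le_add (ht _ _ _) (hx _ _ _))
  have hZcont := continuous_of_taylor hWcont hTay
  refine ⟨W, Z, ⟨hWcont, hZcont, hWK, fun t x => hasDerivAt_of_taylor fun ε hε => ?_, ?_,
    ⟨_, hfar⟩⟩, funext hW0⟩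
  · obtain ⟨C, h0, hC⟩ := hTay ε hε
    exact ⟨C, h0, fun y => hC t x y⟩
  intro t htI x i
  have hlc : ∀ g : (ι → ℝ) → ℝ, ∀ g', CtrlOn K κ g g' → Continuous fun s => g (W s x) :=
    fun g g' hg => continuous_iff_continuousAt.2 fun s =>
      ContinuousAt.comp (f := fun s => W s x) (g := g) (hg.hasDeriv _ (hWK s x)).continuousAt
        ((hWcont.comp (by fun_prop : Continuous fun s : ℝ => (s, x)))).continuousAt
  have hWx : Continuous fun s => W s x :=
    hWcont.comp (by fun_prop : Continuous fun s : ℝ => (s, x))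
  have hZx : Continuous fun s => Z s x :=
    hZcont.comp (by fun_prop : Continuous fun s : ℝ => (s, x))
  refine hasDerivAt_of_right_deriv (g := fun s => W s x i)
    (G := fun s => f i (W s x) - lam i (W s x) * Z s x i) (T := T)
    ((continuous_apply i).comp hWx)
    ((hlc _ _ (hf i)).sub ((hlc _ _ (hl i)).mul ((continuous_apply i).comp hZx))) ?_ htI
  intro t ht
  rw [hasDerivWithinAt_iff_isLittleO, Asymptotics.isLittleO_iff]
  intro c hc
  set Λ := |lam i (W t x)| with hΛ
  have hΛ0 : 0 ≤ Λ := abs_nonneg _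
  obtain ⟨C, hC0, hC⟩ := hTay (c / 2 / (Λ + 1)) (by positivity)
  have hsm : ∀ᶠ s in nhds t, (A ^ 2 + C * Λ ^ 2) * |s - t| < c / 2 := by
    have h1 : Tendsto (fun s => (A ^ 2 + C * Λ ^ 2) * |s - t|) (nhds t)
        (nhds ((A ^ 2 + C * Λ ^ 2) * |t - t|)) := Continuous.tendsto (by fun_prop) t
    rw [sub_self, abs_zero, mul_zero] at h1
    exact h1.eventually (gt_mem_nhds (by positivity))
  have hlt : ∀ᶠ s in nhds t, s < T := gt_mem_nhds ht.2
  filter_upwards [nhdsWithin_le_nhds hsm, nhdsWithin_le_nhds hlt, self_mem_nhdsWithin]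
    with s hs hsT hst
  have hst : t < s := hst
  have hd : 0 < s - t := by linarith
  have b1 := hSL t ⟨ht.1.le, ht.2.le⟩ s ⟨(ht.1.trans hst).le, hsT.le⟩ hst.le x i
  have b2 := (norm_le_pi_norm _ i).trans (hC t x (x - (s - t) * lam i (W t x)))
  simp only [Pi.sub_apply, Pi.smul_apply, smul_eq_mul, Real.norm_eq_abs, sub_sub_cancel_left,
    abs_neg, abs_mul, abs_of_pos hd] at b2
  simp only [smul_eq_mul, Real.norm_eq_abs]
  rw [abs_of_pos hd] at hs ⊢
  have key : W s x i - W t x i - (s - t) * (f i (W t x) - lam i (W t x) * Z t x i)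
      = (W s x i - W t (x - (s - t) * lam i (W t x)) i - (s - t) * f i (W t x))
      + (W t (x - (s - t) * lam i (W t x)) i - W t x i
        - -((s - t) * lam i (W t x)) * Z t x i) := by ring
  rw [key]
  refine (abs_add_le _ _).trans ((add_le_add b1 b2).trans ?_)
  have h3 : c / 2 / (Λ + 1) * Λ ≤ c / 2 := by
    rw [div_mul_eq_mul_div, div_le_iff₀ (by positivity)]
    nlinarith
  calc (κ * (1 + 2 * M₀)) ^ 2 * (s - t) ^ 2
        + (c / 2 / (Λ + 1) + C * ((s - t) * Λ)) * ((s - t) * Λ)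
      = ((A ^ 2 + C * Λ ^ 2) * (s - t) + c / 2 / (Λ + 1) * Λ) * (s - t) := by rw [hA]; ring
    _ ≤ (c / 2 + c / 2) * (s - t) := by gcongr
    _ = c * (s - t) := by ring

end LocalExistence

end

section

lemma deriv_nonneg_of_left_max {g : ℝ → ℝ} {d t a : ℝ} (hg : HasDerivAt g d t) (ha : a < t)
    (h : ∀ s ∈ Ioo a t, g s ≤ g t) : 0 ≤ d := by
  have h1 := (hasDerivAt_iff_tendsto_slope.1 hg).mono_left
    (nhdsWithin_mono t (fun s (hs : s < t) => hs.ne) : nhdsWithin t (Iio t) ≤ _)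
  refine ge_of_tendsto h1 ?_
  filter_upwards [Ioo_mem_nhdsLT ha] with s hs
  rw [slope_def_field]
  exact div_nonneg_of_nonpos (by linarith [h s hs]) (by linarith [hs.2])

lemma transport_max_principle {z zt zx lam : ℝ → ℝ → ℝ} {φ φ' : ℝ → ℝ} {T R : ℝ} (hT : 0 < T)
    (hz : Continuous fun p : ℝ × ℝ => z p.1 p.2) (hR : ∀ t x, R < |x| → z t x = 0)
    (hzt : ∀ t ∈ Ioo 0 T, ∀ x, HasDerivAt (fun s => z s x) (zt t x) t)
    (hzx : ∀ t ∈ Ioo 0 T, ∀ x, HasDerivAt (z t) (zx t x) x)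
    (heq : ∀ t ∈ Ioo 0 T, ∀ x, zt t x + lam t x * zx t x ≤ φ' t)
    (hφ : ∀ t, HasDerivAt φ (φ' t) t) (hφ0 : ∀ t, 0 ≤ φ t) (hz0 : ∀ x, z 0 x ≤ φ 0) :
    ∀ t ∈ Icc 0 T, ∀ x, z t x ≤ φ t := by
  have hφc : Continuous φ := continuous_iff_continuousAt.2 fun t => (hφ t).continuousAt
  have main : ∀ ε > 0, ∀ T' ∈ Ioo 0 T, ∀ t ∈ Icc 0 T', ∀ x, z t x ≤ φ t + ε * (1 + t) := by
    intro ε hε T' hT' t ht x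
    by_contra! hcon
    have hR0 : |x| ≤ R := by
      by_contra! h
      rw [hR t x h] at hcon
      have := hφ0 t
      have : 0 ≤ ε * (1 + t) := mul_nonneg hε.le (by linarith [ht.1])
      linarith
    obtain ⟨p, hp, hmax⟩ := (isCompact_Icc (a := (0 : ℝ)) (b := T')).prod
      (isCompact_Icc (a := -R) (b := R)) |>.exists_isMaxOn (f := fun p : ℝ × ℝ =>
        z p.1 p.2 - (φ p.1 + ε * (1 + p.1))) ⟨(t, x), ht, abs_le.1 hR0⟩
        (by fun_prop : Continuous _).continuousOn
    have hpv : 0 < z p.1 p.2 - (φ p.1 + ε * (1 + p.1)) := by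
      have := hmax (show (t, x) ∈ Icc 0 T' ×ˢ Icc (-R) R from ⟨ht, abs_le.1 hR0⟩)
      simp only [mem_ofPred_eq] at this
      linarith
    have hall : ∀ s ∈ Icc 0 T', ∀ y, z s y - (φ s + ε * (1 + s))
        ≤ z p.1 p.2 - (φ p.1 + ε * (1 + p.1)) := by
      intro s hs y
      by_cases hy : |y| ≤ R
      · exact hmax (show (s, y) ∈ Icc 0 T' ×ˢ Icc (-R) R from ⟨hs, abs_le.1 hy⟩)
      · rw [hR s y (not_le.1 hy)]
        have := hφ0 s
        have : 0 ≤ ε * (1 + s) := mul_nonneg hε.le (by linarith [hs.1])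
        linarith
    obtain ⟨⟨hp1, hp2⟩, -⟩ := hp
    have hp0 : 0 < p.1 := by
      rcases hp1.eq_or_lt with h | h
      · rw [← h] at hpv
        have := hz0 p.2
        linarith
      · exact h
    have hpI : p.1 ∈ Ioo 0 T := ⟨hp0, hp2.trans_lt hT'.2⟩
    have hx0 : zx p.1 p.2 = 0 := by
      refine IsLocalMax.hasDerivAt_eq_zero (f := z p.1) (a := p.2) ?_ (hzx p.1 hpI p.2)
      filter_upwards with y
      have := hall p.1 ⟨hp1, hp2⟩ y
      linarith
    have hd : HasDerivAt (fun s => z s p.2 - (φ s + ε * (1 + s))) (zt p.1 p.2 - (φ' p.1 + ε))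
        p.1 := by
      have h1 := ((hasDerivAt_id p.1).const_add 1).const_mul ε
      simp only [mul_one] at h1
      exact (hzt p.1 hpI p.2).sub ((hφ p.1).add h1)
    have := deriv_nonneg_of_left_max hd hp0 fun s hs =>
      hall s ⟨hs.1.le, hs.2.le.trans hp2⟩ p.2
    have h2 := heq p.1 hpI p.2
    rw [hx0] at h2
    linarith
  have main2 : ∀ t ∈ Ico 0 T, ∀ x, z t x ≤ φ t := by
    intro t ht x
    refine le_of_forall_pos_le_add fun ε hε => ?_
    have h1 : 0 < 1 + t := by linarith [ht.1]
    have := main (ε / (1 + t)) (by positivity) ((t + T) / 2)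
      ⟨by linarith [ht.1], by linarith [ht.2]⟩ t ⟨ht.1, by linarith [ht.2]⟩ x
    rwa [div_mul_cancel₀ _ h1.ne'] at this
  intro t ht x
  rcases ht.2.eq_or_lt with h | h
  · subst h
    have hc : Continuous fun s => z s x := hz.comp (by fun_prop : Continuous fun s : ℝ => (s, x))
    refine le_of_tendsto_of_tendsto (b := nhdsWithin t (Iio t))
      (hc.continuousWithinAt (s := Iio t)) (hφc.continuousWithinAt (s := Iio t)) ?_
    filter_upwards [Ioo_mem_nhdsLT hT] with s hs using main2 s ⟨hs.1.le, hs.2⟩ x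
  · exact main2 t ⟨ht.1, h⟩ x

lemma transport_abs_max_principle {z zt zx lam : ℝ → ℝ → ℝ} {φ φ' : ℝ → ℝ} {T R : ℝ}
    (hT : 0 < T)
    (hz : Continuous fun p : ℝ × ℝ => z p.1 p.2) (hR : ∀ t x, R < |x| → z t x = 0)
    (hzt : ∀ t ∈ Ioo 0 T, ∀ x, HasDerivAt (fun s => z s x) (zt t x) t)
    (hzx : ∀ t ∈ Ioo 0 T, ∀ x, HasDerivAt (z t) (zx t x) x)
    (heq : ∀ t ∈ Ioo 0 T, ∀ x, |zt t x + lam t x * zx t x| ≤ φ' t)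
    (hφ : ∀ t, HasDerivAt φ (φ' t) t) (hφ0 : ∀ t, 0 ≤ φ t) (hz0 : ∀ x, |z 0 x| ≤ φ 0) :
    ∀ t ∈ Icc 0 T, ∀ x, |z t x| ≤ φ t := by
  intro t ht x
  refine abs_le'.2 ⟨transport_max_principle hT hz hR hzt hzx
    (fun t ht x => (le_abs_self _).trans (heq t ht x)) hφ hφ0
    (fun x => (le_abs_self _).trans (hz0 x)) t ht x, ?_⟩
  refine transport_max_principle (z := fun t x => -z t x) (zt := fun t x => -zt t x)
    (zx := fun t x => -zx t x) (lam := lam) (R := R) hT hz.neg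
    (fun t x h => by rw [hR t x h, neg_zero])
    (fun t ht x => (hzt t ht x).neg) (fun t ht x => (hzx t ht x).neg) (fun t ht x => ?_) hφ hφ0
    (fun x => (neg_le_abs _).trans (hz0 x)) t ht x
  refine le_trans (le_of_eq ?_) ((neg_le_abs _).trans (heq t ht x))
  ring

section LipGrowth

variable {ι : Type*} [Fintype ι]
variable {lam f : ι → (ι → ℝ) → ℝ} {dl df : ι → (ι → ℝ) → (ι → ℝ) →L[ℝ] ℝ}
  {K : Set (ι → ℝ)} {κ T : ℝ} {w : ι → ℝ} {W Z : ℝ → ℝ → ι → ℝ}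

lemma DiagSol.far_both (h : DiagSol lam f K w T W Z) :
    ∃ R ≥ 0, ∀ t x, R < |x| → W t x = w ∧ Z t x = 0 := by
  obtain ⟨R, hR⟩ := h.far
  refine ⟨max R 0, le_max_right _ _, fun t x hx => ?_⟩
  have hx : R < |x| := (le_max_left _ _).trans_lt hx
  refine ⟨hR t x hx, ?_⟩
  have h1 : W t =ᶠ[nhds x] fun _ => w := by
    have : ∀ᶠ y in nhds x, R < |y| := continuous_abs.continuousAt.eventually (lt_mem_nhds hx)
    filter_upwards [this] with y hy using hR t y hy
  exact (h.dx t x).unique ((hasDerivAt_const x w).congr_of_eventuallyEq h1)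

lemma DiagSol.exists_bound (h : DiagSol lam f K w T W Z) :
    ∃ B, ∀ t ∈ Icc 0 T, ∀ x, ‖Z t x‖ ≤ B := by
  obtain ⟨R, hR0, hR⟩ := h.far_both
  obtain ⟨B, hB⟩ := ((isCompact_Icc (a := (0 : ℝ)) (b := T)).prod
    (isCompact_Icc (a := -R) (b := R))).exists_bound_of_continuousOn h.contZ.continuousOn
  refine ⟨max B 0, fun t ht x => ?_⟩
  by_cases hx : |x| ≤ R
  · exact (hB (t, x) ⟨ht, abs_le.1 hx⟩).trans (le_max_left _ _)
  · rw [(hR t x (not_le.1 hx)).2, norm_zero]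
    exact le_max_right _ _

lemma DiagSol.lip_growth (h : DiagSol lam f K w T W Z) (hT : 0 < T)
    (hl : ∀ i, CtrlOn K κ (lam i) (dl i)) (hf : ∀ i, CtrlOn K κ (f i) (df i)) (hκ : 0 < κ)
    {K₁ M₀ : ℝ} (hK₁ : 0 ≤ K₁) (hM0 : ∀ x, ‖Z 0 x‖ ≤ M₀)
    (hdl : ∀ t ∈ Icc 0 T, ∀ x i, |dl i (W t x) (Z t x)| ≤ K₁) :
    ∀ t ∈ Icc 0 T, ∀ x, ‖Z t x‖ ≤ 2 * M₀ * Real.exp (2 * (κ + K₁) * t) := by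
  set C := κ + K₁ with hC
  have hC0 : 0 < C := by positivity
  set Λ := 2 * C with hΛ
  have hΛ0 : 0 < Λ := by positivity
  obtain ⟨B0, hB0⟩ := h.exists_bound
  obtain ⟨R, hR0, hR⟩ := h.far_both
  have hM00 : 0 ≤ M₀ := (norm_nonneg _).trans (hM0 0)
  set s : Set ℝ := {r | ∃ t ∈ Icc 0 T, ∃ x, r = ‖Z t x‖ * Real.exp (-(Λ * t))} with hs
  have hbdd : BddAbove s := by
    refine ⟨B0, ?_⟩
    rintro r ⟨t, ht, x, rfl⟩
    have h1 : Real.exp (-(Λ * t)) ≤ 1 := Real.exp_le_one_iff.2 (by nlinarith [ht.1])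
    calc _ ≤ ‖Z t x‖ * 1 := by gcongr
      _ ≤ B0 := by rw [mul_one]; exact hB0 t ht x
  have hne : s.Nonempty := ⟨_, 0, ⟨le_rfl, hT.le⟩, 0, rfl⟩
  set B := sSup s with hB
  have hZB : ∀ t ∈ Icc 0 T, ∀ x, ‖Z t x‖ ≤ B * Real.exp (Λ * t) := by
    intro t ht x
    have h1 : ‖Z t x‖ * Real.exp (-(Λ * t)) ≤ B := le_csSup hbdd ⟨t, ht, x, rfl⟩
    rwa [Real.exp_neg, ← div_eq_mul_inv, div_le_iff₀ (Real.exp_pos _)] at h1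
  have hBnn : 0 ≤ B := by
    have := (norm_nonneg _).trans (hZB 0 ⟨le_rfl, hT.le⟩ 0)
    simpa using this
  have hstep : ∀ t ∈ Icc 0 T, ∀ x, ‖Z t x‖ ≤ M₀ + B / 2 * Real.exp (Λ * t) := by
    intro t ht x
    have hexp0 : 0 < Real.exp (Λ * t) := Real.exp_pos _
    rw [pi_norm_le_iff_of_nonneg (by positivity)]
    intro i
    have hq : ∀ r > 0, |W t (x + r) i - W t x i| ≤ r * (M₀ + B / 2 * Real.exp (Λ * t)) := by
      intro r hr
      refine transport_abs_max_principle (T := T) (R := R + r)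
        (z := fun t x => W t (x + r) i - W t x i)
        (zt := fun t x => (f i (W t (x + r)) - lam i (W t (x + r)) * Z t (x + r) i)
          - (f i (W t x) - lam i (W t x) * Z t x i))
        (zx := fun t x => Z t (x + r) i - Z t x i) (lam := fun t x => lam i (W t x))
        (φ := fun t => r * (M₀ + B / 2 * Real.exp (Λ * t)))
        (φ' := fun t => r * (C * (B * Real.exp (Λ * t)))) hT ?_ ?_ ?_ ?_ ?_ ?_ ?_ ?_ t ht x
      · have h1 : Continuous fun p : ℝ × ℝ => W p.1 (p.2 + r) :=
          h.cont.comp (by fun_prop : Continuous fun p : ℝ × ℝ => (p.1, p.2 + r))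
        exact ((continuous_apply i).comp h1).sub ((continuous_apply i).comp h.cont)
      · intro t x hx
        have h1 : R < |x + r| := by
          have h2 := abs_sub_abs_le_abs_sub x (-r)
          rw [abs_neg, abs_of_pos hr, sub_neg_eq_add] at h2
          linarith
        rw [(hR t _ h1).1, (hR t x (by linarith)).1, sub_self]
      · intro t ht x
        exact (h.dt t ht (x + r) i).sub (h.dt t ht x i)
      · intro t ht x
        exact ((hasDerivAt_pi.1 (h.dx t (x + r)) i).comp_add_const x r).sub
          (hasDerivAt_pi.1 (h.dx t x) i)
      · intro t ht x
        have ht' : t ∈ Icc 0 T := ⟨ht.1.le, ht.2.le⟩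
        have k1 : ‖W t (x + r) - W t x‖ ≤ B * Real.exp (Λ * t) * r := by
          have := norm_sub_le_of_deriv_bound (h.dx t) (hZB t ht') (x + r) x
          rwa [add_sub_cancel_left, abs_of_pos hr] at this
        have k2 : |lam i (W t (x + r)) - lam i (W t x)| ≤ K₁ * r := by
          have := norm_sub_le_of_deriv_bound (g := fun y => lam i (W t y))
            (fun y => ((hl i).hasDeriv _ (h.mem t y)).comp_hasDerivAt y (h.dx t y))
            (fun y => hdl t ht' y i) (x + r) x
          rwa [add_sub_cancel_left, abs_of_pos hr] at this
        have k3 := ((hf i).lip _ (h.mem t (x + r)) _ (h.mem t x)).trans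
          (mul_le_mul_of_nonneg_left k1 hκ.le)
        have k4 : |Z t (x + r) i| ≤ B * Real.exp (Λ * t) :=
          (norm_le_pi_norm (Z t (x + r)) i).trans (hZB t ht' _)
        have key : (f i (W t (x + r)) - lam i (W t (x + r)) * Z t (x + r) i)
            - (f i (W t x) - lam i (W t x) * Z t x i) + lam i (W t x) * (Z t (x + r) i - Z t x i)
            = (f i (W t (x + r)) - f i (W t x))
              - (lam i (W t (x + r)) - lam i (W t x)) * Z t (x + r) i := by ring
        rw [key]
        refine (abs_sub _ _).trans ?_
        rw [abs_mul]
        calc _ ≤ κ * (B * Real.exp (Λ * t) * r) + K₁ * r * (B * Real.exp (Λ * t)) := by gcongr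
          _ = _ := by rw [hC]; ring
      · intro t
        have h1 : HasDerivAt (fun t => Real.exp (Λ * t)) (Real.exp (Λ * t) * (Λ * 1)) t :=
          ((hasDerivAt_id t).const_mul Λ).exp
        have h2 := ((h1.const_mul (B / 2)).const_add M₀).const_mul r
        exact h2.congr_deriv (by rw [hΛ]; ring)
      · intro t
        positivity
      · intro x
        have := (norm_le_pi_norm _ i).trans (norm_sub_le_of_deriv_bound (h.dx 0) hM0 (x + r) x)
        rw [add_sub_cancel_left, abs_of_pos hr] at this
        simp only [Pi.sub_apply, Real.norm_eq_abs] at this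
        simp only [mul_zero, Real.exp_zero, mul_one]
        nlinarith
    have hd := hasDerivAt_iff_tendsto_slope.1 (hasDerivAt_pi.1 (h.dx t x) i)
    have hd' := (hd.mono_left (nhdsWithin_mono x (fun y (hy : x < y) => hy.ne') :
      nhdsWithin x (Ioi x) ≤ _)).abs
    refine le_of_tendsto hd' ?_
    filter_upwards [self_mem_nhdsWithin] with y hy
    have hy : x < y := hy
    have := hq (y - x) (by linarith)
    rw [add_sub_cancel] at this
    rw [slope_def_field, abs_div, abs_of_pos (by linarith : 0 < y - x),
      div_le_iff₀ (by linarith)]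
    linarith
  have hBle : B ≤ M₀ + B / 2 := by
    refine csSup_le hne ?_
    rintro r ⟨t, ht, x, rfl⟩
    have h1 : Real.exp (-(Λ * t)) ≤ 1 := Real.exp_le_one_iff.2 (by nlinarith [ht.1])
    calc _ ≤ (M₀ + B / 2 * Real.exp (Λ * t)) * Real.exp (-(Λ * t)) := by
          gcongr; exact hstep t ht x
      _ = M₀ * Real.exp (-(Λ * t)) + B / 2 * (Real.exp (Λ * t) * Real.exp (-(Λ * t))) := by ring
      _ ≤ M₀ * 1 + B / 2 * 1 := by
        rw [← Real.exp_add, add_neg_cancel, Real.exp_zero]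
        gcongr
      _ = _ := by ring
  intro t ht x
  refine (hZB t ht x).trans ?_
  have : B ≤ 2 * M₀ := by linarith
  gcongr

end LipGrowth

end

section

lemma hasDerivAt_of_punctured {g G : ℝ → ℝ} {a b c : ℝ} (hb : b ∈ Ioo a c) (hg : Continuous g)
    (hG : Continuous G) (h : ∀ t ∈ Ioo a c, t ≠ b → HasDerivAt g (G t) t) :
    HasDerivAt g (G b) b := by
  have h1 : HasDerivWithinAt g (G b) (Ici b) b := by
    refine hasDerivWithinAt_Ici_of_tendsto_deriv (s := Ioo b c) (fun t ht =>
      (h t ⟨hb.1.trans ht.1, ht.2⟩ ht.1.ne').differentiableAt.differentiableWithinAt)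
      hg.continuousWithinAt (Ioo_mem_nhdsGT hb.2) ?_
    refine (hG.continuousWithinAt (s := Ioi b) (x := b)).tendsto.congr' ?_
    filter_upwards [Ioo_mem_nhdsGT hb.2] with t ht
    exact (h t ⟨hb.1.trans ht.1, ht.2⟩ ht.1.ne').deriv.symm
  have h2 : HasDerivWithinAt g (G b) (Iic b) b := by
    refine hasDerivWithinAt_Iic_of_tendsto_deriv (s := Ioo a b) (fun t ht =>
      (h t ⟨ht.1, ht.2.trans hb.2⟩ ht.2.ne).differentiableAt.differentiableWithinAt)
      hg.continuousWithinAt (Ioo_mem_nhdsLT hb.1) ?_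
    refine (hG.continuousWithinAt (s := Iio b) (x := b)).tendsto.congr' ?_
    filter_upwards [Ioo_mem_nhdsLT hb.1] with t ht
    exact (h t ⟨ht.1, ht.2.trans hb.2⟩ ht.2.ne).deriv.symm
  have := h2.union h1
  rwa [Iic_union_Ici, hasDerivWithinAt_univ] at this

section Glue

variable {ι : Type*} [Fintype ι]
variable {lam f : ι → (ι → ℝ) → ℝ} {dl df : ι → (ι → ℝ) → (ι → ℝ) →L[ℝ] ℝ}
  {K : Set (ι → ℝ)} {κ T₁ T₂ M₀ ρ : ℝ} {w : ι → ℝ} {W₁ Z₁ W₂ Z₂ : ℝ → ℝ → ι → ℝ}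

lemma DiagSol.mono (h : DiagSol lam f K w T₁ W₁ Z₁) (hT : T₂ ≤ T₁) :
    DiagSol lam f K w T₂ W₁ Z₁ :=
  ⟨h.cont, h.contZ, h.mem, h.dx, fun t ht => h.dt t ⟨ht.1, ht.2.trans_le hT⟩, h.far⟩

lemma DiagSol.glue (hl : ∀ i, CtrlOn K κ (lam i) (dl i)) (hf : ∀ i, CtrlOn K κ (f i) (df i))
    (h₁ : DiagSol lam f K w T₁ W₁ Z₁) (h₂ : DiagSol lam f K w T₂ W₂ Z₂)
    (h : W₂ 0 = W₁ T₁) :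
    DiagSol lam f K w (T₁ + T₂) (fun t x => if t ≤ T₁ then W₁ t x else W₂ (t - T₁) x)
      (fun t x => if t ≤ T₁ then Z₁ t x else Z₂ (t - T₁) x) := by
  have hZ : Z₂ 0 = Z₁ T₁ := by
    ext1 x
    have h1 := h₂.dx 0 x
    rw [h] at h1
    exact h1.unique (h₁.dx T₁ x)
  have hc : Continuous fun p : ℝ × ℝ => if p.1 ≤ T₁ then W₁ p.1 p.2 else W₂ (p.1 - T₁) p.2 := by
    refine Continuous.if_le h₁.cont (h₂.cont.comp (by fun_prop : Continuous fun p : ℝ × ℝ =>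
      (p.1 - T₁, p.2))) (by fun_prop) (by fun_prop) fun p hp => ?_
    simp only [hp, sub_self, h]
  have hcZ : Continuous fun p : ℝ × ℝ => if p.1 ≤ T₁ then Z₁ p.1 p.2 else Z₂ (p.1 - T₁) p.2 := by
    refine Continuous.if_le h₁.contZ (h₂.contZ.comp (by fun_prop : Continuous fun p : ℝ × ℝ =>
      (p.1 - T₁, p.2))) (by fun_prop) (by fun_prop) fun p hp => ?_
    simp only [hp, sub_self, hZ]
  have hmem : ∀ t x, (if t ≤ T₁ then W₁ t x else W₂ (t - T₁) x) ∈ K := by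
    intro t x
    split_ifs
    · exact h₁.mem _ _
    · exact h₂.mem _ _
  refine ⟨hc, hcZ, hmem, ?_, ?_, ?_⟩
  · intro t x
    by_cases ht : t ≤ T₁
    · simpa only [ht, if_true] using h₁.dx t x
    · simpa only [ht, if_false] using h₂.dx (t - T₁) x
  · intro t ht x i
    set W : ℝ → ι → ℝ := fun s => if s ≤ T₁ then W₁ s x else W₂ (s - T₁) x with hW
    set Z : ℝ → ι → ℝ := fun s => if s ≤ T₁ then Z₁ s x else Z₂ (s - T₁) x with hZd
    have hpc : Continuous fun s : ℝ => (s, x) := by fun_prop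
    have hWc : Continuous W := hc.comp hpc
    have hZc : Continuous Z := hcZ.comp hpc
    have hcomp : ∀ g g', CtrlOn K κ g g' → Continuous fun s => g (W s) := fun g g' hg =>
      continuous_iff_continuousAt.2 fun s =>
        ContinuousAt.comp (f := W) (g := g) (hg.hasDeriv _ (hmem s x)).continuousAt
          hWc.continuousAt
    have hne : ∀ s ∈ Ioo 0 (T₁ + T₂), s ≠ T₁ →
        HasDerivAt (fun s => W s i) (f i (W s) - lam i (W s) * Z s i) s := by
      intro s hs hne
      rcases hne.lt_or_gt with hlt | hlt
      · have h1 := h₁.dt s ⟨hs.1, hlt⟩ x i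
        have e : (fun s => W s i) =ᶠ[nhds s] fun s => W₁ s x i := by
          filter_upwards [gt_mem_nhds hlt] with r hr
          simp only [hW, hr.le, if_true]
        have := h1.congr_of_eventuallyEq e
        simpa only [hW, hZd, hlt.le, if_true] using this
      · have h1 := (h₂.dt (s - T₁) ⟨by linarith, by linarith [hs.2]⟩ x i).comp_sub_const s T₁
        have e : (fun s => W s i) =ᶠ[nhds s] fun s => W₂ (s - T₁) x i := by
          filter_upwards [lt_mem_nhds hlt] with r hr
          simp only [hW, not_le.2 hr, if_false]
        have := h1.congr_of_eventuallyEq e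
        simpa only [hW, hZd, not_le.2 hlt, if_false] using this
    show HasDerivAt (fun s => W s i) (f i (W t) - lam i (W t) * Z t i) t
    rcases eq_or_ne t T₁ with h0 | h0
    · exact hasDerivAt_of_punctured (g := fun s => W s i)
        (G := fun t => f i (W t) - lam i (W t) * Z t i) ht ((continuous_apply i).comp hWc)
        ((hcomp _ _ (hf i)).sub ((hcomp _ _ (hl i)).mul ((continuous_apply i).comp hZc)))
        fun s hs hs' => hne s hs (by rwa [h0] at hs')
    · exact hne t ht h0
  · obtain ⟨R₁, hR₁⟩ := h₁.far
    obtain ⟨R₂, hR₂⟩ := h₂.far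
    refine ⟨max R₁ R₂, fun t x hx => ?_⟩
    split_ifs
    · exact hR₁ _ _ ((le_max_left _ _).trans_lt hx)
    · exact hR₂ _ _ ((le_max_right _ _).trans_lt hx)

theorem diag_continuation (hKc : IsCompact K) (hl : ∀ i, CtrlOn K κ (lam i) (dl i))
    (hf : ∀ i, CtrlOn K κ (f i) (df i)) (hκ : 0 ≤ κ) (hM0 : 0 ≤ M₀) (hρ : 0 < ρ)
    (hw : ∀ i, f i w = 0) {W0 W0' : ℝ → ι → ℝ} {R T : ℝ} (hT : 0 < T)
    (hW : ∀ x, HasDerivAt W0 (W0' x) x) (hM : ∀ x, ‖W0' x‖ ≤ M₀) (hc : Continuous W0')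
    (hK : ∀ x, Metric.closedBall (W0 x) ρ ⊆ K) (hR : ∀ x, R < |x| → W0 x = w)
    (hap : ∀ T' ∈ Ioc 0 T, ∀ W Z, DiagSol lam f K w T' W Z → W 0 = W0 →
      ∀ x, Metric.closedBall (W T' x) ρ ⊆ K ∧ ‖Z T' x‖ ≤ M₀) :
    ∃ W Z, DiagSol lam f K w T W Z ∧ W 0 = W0 := by
  obtain ⟨r, hr, hex⟩ := diag_local_existence (M₀ := M₀) hKc hl hf hκ hM0 hρ
  obtain ⟨N, hN⟩ := exists_nat_gt (T / r)
  have hN0 : (0 : ℝ) < N := (div_pos hT hr).trans hN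
  have hstep : T / N ≤ r := by
    rw [div_lt_iff₀ hr] at hN
    rw [div_le_iff₀ hN0]; linarith
  have hd : 0 < T / N := by positivity
  have main : ∀ k : ℕ, k + 1 ≤ N → ∃ W Z, DiagSol lam f K w ((k + 1) * (T / N)) W Z ∧
      W 0 = W0 := by
    intro k
    induction k with
    | zero =>
      intro _
      obtain ⟨W, Z, h, h0⟩ := hex W0 W0' w R hW hM hc hK hw hR
      exact ⟨W, Z, h.mono (by simpa using hstep), h0⟩
    | succ k ih =>
      intro hk
      obtain ⟨W, Z, h, h0⟩ := ih (by omega)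
      have hT' : ((k : ℝ) + 1) * (T / N) ∈ Ioc 0 T := by
        refine ⟨by positivity, ?_⟩
        have : ((k : ℝ) + 1) ≤ N := by exact_mod_cast (by omega : k + 1 ≤ N)
        calc _ ≤ N * (T / N) := by gcongr
          _ = T := by field_simp
      have hb := hap _ hT' W Z h h0
      obtain ⟨R', hR'⟩ := h.far
      obtain ⟨W2, Z2, h2, h20⟩ := hex (W (((k : ℝ) + 1) * (T / N)))
        (Z (((k : ℝ) + 1) * (T / N))) w R' (h.dx _) (fun x => (hb x).2)
        (h.contZ.comp (by fun_prop : Continuous fun x : ℝ => (((k : ℝ) + 1) * (T / N), x)))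
        (fun x => (hb x).1) hw (hR' _)
      have hg := DiagSol.glue hl hf h (h2.mono hstep) h20
      refine ⟨_, _, (by convert hg using 1; push_cast; ring), ?_⟩
      ext1 x
      simp only [hT'.1.le, if_true, h0]
  obtain ⟨n, rfl⟩ : ∃ n, N = n + 1 := Nat.exists_eq_succ_of_ne_zero (by
    rintro rfl; simp at hN0)
  obtain ⟨W, Z, h, h0⟩ := main n le_rfl
  refine ⟨W, Z, ?_, h0⟩
  convert h using 1
  push_cast at hN0 ⊢
  field_simp

end Glue

end

section

lemma CtrlOn.mono {E : Type*} [NormedAddCommGroup E] [NormedSpace ℝ E] {K : Set E} {κ κ' : ℝ}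
    {g : E → ℝ} {g' : E → E →L[ℝ] ℝ} (h : CtrlOn K κ g g') (hκ : κ ≤ κ') : CtrlOn K κ' g g' :=
  ⟨h.hasDeriv, fun w hw => (h.bdd w hw).trans hκ, fun w hw => (h.bdd' w hw).trans hκ,
    fun w hw z hz => (h.lip w hw z hz).trans (by gcongr),
    fun w hw z hz => (h.lip' w hw z hz).trans (by gcongr)⟩

lemma exists_ctrlOn {E : Type*} [NormedAddCommGroup E] [NormedSpace ℝ E] {K : Set E}
    (hK : IsCompact K) (hconv : Convex ℝ K) {g : E → ℝ} (hg : ∀ w ∈ K, ContDiffAt ℝ 2 g w) :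
    ∃ κ > 0, CtrlOn K κ g (fderiv ℝ g) := by
  have hd : ∀ w ∈ K, HasFDerivAt g (fderiv ℝ g w) w := fun w hw =>
    ((hg w hw).differentiableAt (by norm_num)).hasFDerivAt
  have h1 : ∀ w ∈ K, ContDiffAt ℝ 1 (fderiv ℝ g) w := fun w hw =>
    (hg w hw).fderiv_right (by norm_num)
  have hd' : ∀ w ∈ K, HasFDerivAt (fderiv ℝ g) (fderiv ℝ (fderiv ℝ g) w) w := fun w hw =>
    ((h1 w hw).differentiableAt (by norm_num)).hasFDerivAt
  obtain ⟨b0, hb0⟩ := hK.exists_bound_of_continuousOn (f := g)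
    (fun w hw => (hg w hw).continuousAt.continuousWithinAt)
  obtain ⟨b1, hb1⟩ := hK.exists_bound_of_continuousOn (f := fderiv ℝ g)
    (fun w hw => (h1 w hw).continuousAt.continuousWithinAt)
  obtain ⟨b2, hb2⟩ := hK.exists_bound_of_continuousOn (f := fderiv ℝ (fderiv ℝ g))
    (fun w hw => ((h1 w hw).fderiv_right (m := 0) (by norm_num)).continuousAt.continuousWithinAt)
  set κ := max (max b0 b1) (max b2 1) with hκ
  have k0 : b0 ≤ κ := (le_max_left _ _).trans (le_max_left _ _)
  have k1 : b1 ≤ κ := (le_max_right _ _).trans (le_max_left _ _)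
  have k2 : b2 ≤ κ := (le_max_left _ _).trans (le_max_right _ _)
  have k3 : 1 ≤ κ := (le_max_right _ _).trans (le_max_right _ _)
  refine ⟨κ, by linarith, hd, fun w hw => (hb0 w hw).trans k0, fun w hw => (hb1 w hw).trans k1,
    fun w hw z hz => ?_, fun w hw z hz => ?_⟩
  · exact hconv.norm_image_sub_le_of_norm_hasFDerivWithin_le
      (fun x hx => (hd x hx).hasFDerivWithinAt) (fun x hx => (hb1 x hx).trans k1) hz hw
  · exact hconv.norm_image_sub_le_of_norm_hasFDerivWithin_le
      (fun x hx => (hd' x hx).hasFDerivWithinAt) (fun x hx => (hb2 x hx).trans k2) hz hw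

lemma exists_ctrlOn_family {ι E : Type*} [Fintype ι] [NormedAddCommGroup E] [NormedSpace ℝ E]
    {K : Set E} (hK : IsCompact K) (hconv : Convex ℝ K) {g : ι → E → ℝ}
    (hg : ∀ i, ∀ w ∈ K, ContDiffAt ℝ 2 (g i) w) :
    ∃ κ > 0, ∀ i, CtrlOn K κ (g i) (fderiv ℝ (g i)) := by
  choose κ hκ h using fun i => exists_ctrlOn hK hconv (hg i)
  refine ⟨1 + ∑ i, κ i, by
    have := Finset.sum_nonneg fun i (_ : i ∈ Finset.univ) => (hκ i).le
    linarith, fun i => (h i).mono ?_⟩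
  have := Finset.single_le_sum (fun i _ => (hκ i).le) (Finset.mem_univ i)
  linarith

/-- Grönwall's inequality, with the differential inequality on the open interval only. -/
lemma gronwall_Ioo {y y' : ℝ → ℝ} {L T : ℝ} (hy : ContinuousOn y (Icc 0 T))
    (hd : ∀ t ∈ Ioo 0 T, HasDerivAt y (y' t) t) (hle : ∀ t ∈ Ioo 0 T, y' t ≤ L * y t) :
    ∀ t ∈ Icc 0 T, y t ≤ y 0 * Real.exp (L * t) := by
  have hder : ∀ t ∈ Ioo 0 T, HasDerivAt (fun t => y t * Real.exp (-(L * t)))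
      ((y' t - L * y t) * Real.exp (-(L * t))) t := by
    intro t ht
    have h1 : HasDerivAt (fun t => Real.exp (-(L * t))) (Real.exp (-(L * t)) * -(L * 1)) t :=
      ((hasDerivAt_id t).const_mul L).neg.exp
    exact ((hd t ht).mul h1).congr_deriv (by ring)
  have hanti : AntitoneOn (fun t => y t * Real.exp (-(L * t))) (Icc 0 T) := by
    refine antitoneOn_of_deriv_nonpos (convex_Icc _ _)
      (hy.mul (by fun_prop : Continuous fun t => Real.exp (-(L * t))).continuousOn) ?_ ?_
    · rw [interior_Icc]
      exact fun t ht => (hder t ht).differentiableAt.differentiableWithinAt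
    · rw [interior_Icc]
      intro t ht
      rw [(hder t ht).deriv]
      exact mul_nonpos_of_nonpos_of_nonneg (by linarith [hle t ht]) (Real.exp_pos _).le
  intro t ht
  have := hanti ⟨le_rfl, ht.1.trans ht.2⟩ ht ht.1
  simp only [mul_zero, neg_zero, Real.exp_zero, mul_one] at this
  rw [Real.exp_neg, ← div_eq_mul_inv, div_le_iff₀ (Real.exp_pos _)] at this
  exact this

lemma sub_eq_integral_of_Ioo {g G : ℝ → ℝ} {T s t : ℝ} (hg : Continuous g) (hG : Continuous G)
    (h : ∀ t ∈ Ioo 0 T, HasDerivAt g (G t) t) (hs : 0 ≤ s) (hst : s ≤ t) (ht : t ≤ T) :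
    g t - g s = ∫ r in s..t, G r :=
  (integral_eq_sub_of_hasDerivAt_of_le hst hg.continuousOn
    (fun r hr => h r ⟨hs.trans_lt hr.1, hr.2.trans_le ht⟩) (hG.intervalIntegrable _ _)).symm

/-- If `g_t = A` and both `g` and `A` are `C¹` in `x`, then `(g_x)_t = A_x`. -/
lemma hasDerivAt_mixed {g gx A Ax : ℝ → ℝ → ℝ} {T : ℝ}
    (hg : Continuous fun p : ℝ × ℝ => g p.1 p.2)
    (hgx : Continuous fun p : ℝ × ℝ => gx p.1 p.2) (hA : Continuous fun p : ℝ × ℝ => A p.1 p.2)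
    (hAx : Continuous fun p : ℝ × ℝ => Ax p.1 p.2) (hx : ∀ t x, HasDerivAt (g t) (gx t x) x)
    (hAdx : ∀ t x, HasDerivAt (A t) (Ax t x) x)
    (ht : ∀ t ∈ Ioo 0 T, ∀ x, HasDerivAt (fun s => g s x) (A t x) t) :
    ∀ t ∈ Ioo 0 T, ∀ x, HasDerivAt (fun s => gx s x) (Ax t x) t := by
  have hpt : ∀ {F : ℝ → ℝ → ℝ}, (Continuous fun p : ℝ × ℝ => F p.1 p.2) → ∀ x,
      Continuous fun s => F s x := fun hF x =>
    hF.comp (by fun_prop : Continuous fun s : ℝ => (s, x))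
  have key : ∀ s t, 0 < s → s ≤ t → t < T → ∀ x, gx t x - gx s x = ∫ r in s..t, Ax r x := by
    intro s t hs hst htT x
    have h1 : ∀ y, g t y - g s y = ∫ r in s..t, A r y := fun y =>
      sub_eq_integral_of_Ioo (hpt hg y) (hpt hA y) (fun r hr => ht r hr y) hs.le hst htT.le
    obtain ⟨B, hB⟩ := ((isCompact_Icc (a := s) (b := t)).prod
      (isCompact_Icc (a := x - 1) (b := x + 1))).exists_bound_of_continuousOn hAx.continuousOn
    have h2 := (intervalIntegral.hasDerivAt_integral_of_dominated_loc_of_deriv_le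
      (F := fun y r => A r y) (F' := fun y r => Ax r y) (x₀ := x) (s := Ioo (x - 1) (x + 1))
      (bound := fun _ => B) (μ := volume) (a := s) (b := t)
      (Ioo_mem_nhds (by linarith) (by linarith))
      (Eventually.of_forall fun y => (hpt hA y).aestronglyMeasurable)
      ((hpt hA x).intervalIntegrable _ _) ((hpt hAx x).aestronglyMeasurable)
      (Eventually.of_forall fun r hr y hy => hB (r, y) ⟨?_, hy.1.le, hy.2.le⟩)
      (by simp) (Eventually.of_forall fun r _ y _ => hAdx r y)).2
    · exact ((hx t x).sub (hx s x)).unique (h2.congr_of_eventuallyEq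
        (Eventually.of_forall h1))
    · rw [uIoc_of_le hst] at hr
      exact ⟨hr.1.le, hr.2⟩
  intro t htI x
  refine hasDerivAt_of_right_deriv (hpt hgx x) (hpt hAx x) (fun s hs => ?_) htI
  have h2 : HasDerivAt (fun r => gx s x + ∫ r in s..r, Ax r x) (Ax s x) s :=
    (integral_hasDerivAt_right ((hpt hAx x).intervalIntegrable _ _)
      ((hpt hAx x).stronglyMeasurableAtFilter _ _) (hpt hAx x).continuousAt).const_add _
  refine h2.hasDerivWithinAt.congr_of_eventuallyEq ?_ (by simp)
  filter_upwards [Ioo_mem_nhdsGT hs.2] with r hr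
  rw [← key s r hs.1 hr.1.le hr.2 x]
  ring

end

section

/-- The coefficient `k` in `S_t = k u_x - ν S`, where `ν = 1/τ`. -/
def kF (a μ ν v S : ℝ) : ℝ := (2 * a * S + μ * ν) / v

/-- `-p'(v)` for the pressure `p(v) = v^(-γ)`. -/
def bF (γ v : ℝ) : ℝ := γ * v ^ (-γ - 1)

/-- `-p''(v)` for the pressure `p(v) = v^(-γ)`. -/
def bdF (γ v : ℝ) : ℝ := -(γ * (γ + 1)) * v ^ (-γ - 2)

/-- The squared characteristic speed. -/
def qF (a μ γ ν v S : ℝ) : ℝ := kF a μ ν v S + bF γ v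

/-- The characteristic speed. -/
def cF (a μ γ ν v S : ℝ) : ℝ := √(qF a μ γ ν v S)

/-- `∂c/∂v`. -/
def cvF (a μ γ ν v S : ℝ) : ℝ := (-kF a μ ν v S / v + bdF γ v) / (2 * cF a μ γ ν v S)

/-- `∂c/∂S`. -/
def cSF (a μ γ ν v S : ℝ) : ℝ := (2 * a / v) / (2 * cF a μ γ ν v S)

section Scalar

variable {a μ γ ν : ℝ}

lemma bF_pos (hγ : 1 < γ) {v : ℝ} (hv : 0 < v) : 0 < bF γ v :=
  mul_pos (by linarith) (Real.rpow_pos_of_pos hv _)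

lemma hasDerivAt_bF {v : ℝ → ℝ} {v' t : ℝ} (hv : HasDerivAt v v' t) (h0 : 0 < v t) :
    HasDerivAt (fun s => bF γ (v s)) (bdF γ (v t) * v') t := by
  have := (hv.rpow_const (p := -γ - 1) (Or.inl h0.ne')).const_mul γ
  refine this.congr_deriv ?_
  rw [bdF, show (-γ - 1 - 1 : ℝ) = -γ - 2 by ring]
  ring

lemma kF_num_pos (ha : |a| ≤ 1) {S : ℝ} (hS : |S| ≤ μ * ν / 4) :
    μ * ν / 2 ≤ 2 * a * S + μ * ν := by
  have : |a * S| ≤ μ * ν / 4 := by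
    rw [abs_mul]
    nlinarith [abs_nonneg a, abs_nonneg S]
  nlinarith [abs_le.1 this]

lemma kF_pos (ha : |a| ≤ 1) (hμν : 0 < μ * ν) {v S : ℝ} (hv : 0 < v) (hS : |S| ≤ μ * ν / 4) :
    0 < kF a μ ν v S :=
  div_pos (by linarith [kF_num_pos ha hS]) hv

lemma qF_pos (ha : |a| ≤ 1) (hμν : 0 < μ * ν) (hγ : 1 < γ) {v S : ℝ} (hv : 0 < v)
    (hS : |S| ≤ μ * ν / 4) : 0 < qF a μ γ ν v S :=
  add_pos (kF_pos ha hμν hv hS) (bF_pos hγ hv)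

lemma cF_sq {v S : ℝ} (hq : 0 < qF a μ γ ν v S) :
    cF a μ γ ν v S ^ 2 = kF a μ ν v S + bF γ v := Real.sq_sqrt hq.le

lemma cF_pos {v S : ℝ} (hq : 0 < qF a μ γ ν v S) : 0 < cF a μ γ ν v S := Real.sqrt_pos.2 hq

lemma hasDerivAt_kF {v S : ℝ → ℝ} {v' S' t : ℝ} (hv : HasDerivAt v v' t) (hS : HasDerivAt S S' t)
    (h0 : 0 < v t) : HasDerivAt (fun s => kF a μ ν (v s) (S s))
      (2 * a / v t * S' - kF a μ ν (v t) (S t) / v t * v') t := by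
  have := ((hS.const_mul (2 * a)).add_const (μ * ν)).div hv h0.ne'
  refine this.congr_deriv ?_
  rw [kF]
  field_simp

lemma hasDerivAt_cF {v S : ℝ → ℝ} {v' S' t : ℝ} (hv : HasDerivAt v v' t) (hS : HasDerivAt S S' t)
    (h0 : 0 < v t) (hq : 0 < qF a μ γ ν (v t) (S t)) :
    HasDerivAt (fun s => cF a μ γ ν (v s) (S s))
      (cvF a μ γ ν (v t) (S t) * v' + cSF a μ γ ν (v t) (S t) * S') t := by
  have := ((hasDerivAt_kF (a := a) (μ := μ) (ν := ν) hv hS h0).add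
    (hasDerivAt_bF (γ := γ) hv h0)).sqrt hq.ne'
  refine this.congr_deriv ?_
  have hc := (cF_pos hq).ne'
  rw [cvF, cSF]
  change _ / (2 * cF a μ γ ν (v t) (S t)) = _
  field_simp
  ring

variable {E : Type*} [NormedAddCommGroup E] [NormedSpace ℝ E] {n : WithTop ℕ∞}

lemma contDiffAt_kF {v S : E → ℝ} {w : E} (hv : ContDiffAt ℝ n v w) (hS : ContDiffAt ℝ n S w)
    (h0 : 0 < v w) : ContDiffAt ℝ n (fun w => kF a μ ν (v w) (S w)) w :=
  ((contDiffAt_const.mul hS).add contDiffAt_const).div hv h0.ne'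

lemma contDiffAt_bF {v : E → ℝ} {w : E} (hv : ContDiffAt ℝ n v w)
    (h0 : 0 < v w) : ContDiffAt ℝ n (fun w => bF γ (v w)) w :=
  contDiffAt_const.mul (hv.rpow_const_of_ne h0.ne')

lemma contDiffAt_bdF {v : E → ℝ} {w : E} (hv : ContDiffAt ℝ n v w)
    (h0 : 0 < v w) : ContDiffAt ℝ n (fun w => bdF γ (v w)) w :=
  contDiffAt_const.mul (hv.rpow_const_of_ne h0.ne')

lemma contDiffAt_cF {v S : E → ℝ} {w : E} (hv : ContDiffAt ℝ n v w) (hS : ContDiffAt ℝ n S w)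
    (h0 : 0 < v w) (hq : 0 < qF a μ γ ν (v w) (S w)) :
    ContDiffAt ℝ n (fun w => cF a μ γ ν (v w) (S w)) w :=
  ((contDiffAt_kF hv hS h0).add (contDiffAt_bF hv h0)).sqrt hq.ne'

lemma contDiffAt_cvF {v S : E → ℝ} {w : E} (hv : ContDiffAt ℝ n v w) (hS : ContDiffAt ℝ n S w)
    (h0 : 0 < v w) (hq : 0 < qF a μ γ ν (v w) (S w)) :
    ContDiffAt ℝ n (fun w => cvF a μ γ ν (v w) (S w)) w :=
  (((contDiffAt_kF hv hS h0).neg.div hv h0.ne').add (contDiffAt_bdF hv h0)).div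
    (contDiffAt_const.mul (contDiffAt_cF hv hS h0 hq)) (mul_pos two_pos (cF_pos hq)).ne'

lemma contDiffAt_cSF {v S : E → ℝ} {w : E} (hv : ContDiffAt ℝ n v w) (hS : ContDiffAt ℝ n S w)
    (h0 : 0 < v w) (hq : 0 < qF a μ γ ν (v w) (S w)) :
    ContDiffAt ℝ n (fun w => cSF a μ γ ν (v w) (S w)) w :=
  (contDiffAt_const.div hv h0.ne').div
    (contDiffAt_const.mul (contDiffAt_cF hv hS h0 hq)) (mul_pos two_pos (cF_pos hq)).ne'

end Scalar

section System

variable (a μ γ ν : ℝ)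

/-- `u_x` as a function of the diagonal unknowns. -/
def alF (w : Fin 6 → ℝ) : ℝ := (w 3 - w 4) / (2 * cF a μ γ ν (w 0) (w 2))

/-- `(S - p(v))_x` as a function of the diagonal unknowns. -/
def beF (w : Fin 6 → ℝ) : ℝ := (w 3 + w 4) / 2

/-- `v_x` as a function of the diagonal unknowns. -/
def VF (w : Fin 6 → ℝ) : ℝ := (beF w - w 5) / qF a μ γ ν (w 0) (w 2)

/-- `S_x` as a function of the diagonal unknowns. -/
def SiF (w : Fin 6 → ℝ) : ℝ := w 5 + kF a μ ν (w 0) (w 2) * VF a μ γ ν w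

/-- `S_t` as a function of the diagonal unknowns. -/
def StF (w : Fin 6 → ℝ) : ℝ := kF a μ ν (w 0) (w 2) * alF a μ γ ν w - ν * w 2

/-- `c_t` as a function of the diagonal unknowns. -/
def ctF (w : Fin 6 → ℝ) : ℝ :=
  cvF a μ γ ν (w 0) (w 2) * alF a μ γ ν w + cSF a μ γ ν (w 0) (w 2) * StF a μ γ ν w

/-- `c_x` as a function of the diagonal unknowns. -/
def cxF (w : Fin 6 → ℝ) : ℝ :=
  cvF a μ γ ν (w 0) (w 2) * VF a μ γ ν w + cSF a μ γ ν (w 0) (w 2) * SiF a μ γ ν w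

/-- Characteristic speeds of the diagonal system. -/
def lamF : Fin 6 → (Fin 6 → ℝ) → ℝ
  | 3 => fun w => -cF a μ γ ν (w 0) (w 2)
  | 4 => fun w => cF a μ γ ν (w 0) (w 2)
  | _ => fun _ => 0

/-- Source terms of the diagonal system. -/
def srcF : Fin 6 → (Fin 6 → ℝ) → ℝ
  | 0 => fun w => alF a μ γ ν w
  | 1 => fun w => beF w
  | 2 => fun w => StF a μ γ ν w
  | 3 => fun w => (ctF a μ γ ν w + cF a μ γ ν (w 0) (w 2) * cxF a μ γ ν w) * alF a μ γ ν w
      - ν * SiF a μ γ ν w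
  | 4 => fun w => -(ctF a μ γ ν w - cF a μ γ ν (w 0) (w 2) * cxF a μ γ ν w) * alF a μ γ ν w
      - ν * SiF a μ γ ν w
  | 5 => fun w => 2 * a / w 0 * (w 5 * alF a μ γ ν w + ν * w 2 * VF a μ γ ν w)
      - ν * SiF a μ γ ν w

/-- The rest state. -/
def restW : Fin 6 → ℝ := ![1, 0, 0, 0, 0, 0]

/-- The box in which the diagonal system is solved. -/
def boxK (μ ν B : ℝ) : Set (Fin 6 → ℝ) :=
  {w | |w 0 - 1| ≤ 1 / 2 ∧ |w 1| ≤ B ∧ |w 2| ≤ μ * ν / 4 ∧ |w 3| ≤ B ∧ |w 4| ≤ B ∧ |w 5| ≤ B}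

variable {a μ γ ν}

lemma boxK_pos {B : ℝ} {w : Fin 6 → ℝ} (h : w ∈ boxK μ ν B) : 0 < w 0 := by
  linarith [(abs_le.1 h.1).1]

lemma boxK_qF (ha : |a| ≤ 1) (hμν : 0 < μ * ν) (hγ : 1 < γ) {B : ℝ} {w : Fin 6 → ℝ}
    (h : w ∈ boxK μ ν B) : 0 < qF a μ γ ν (w 0) (w 2) :=
  qF_pos ha hμν hγ (boxK_pos h) h.2.2.1

lemma boxK_eq (B : ℝ) : boxK μ ν B =
    Set.pi univ fun i => Icc ((![1 / 2, -B, -(μ * ν / 4), -B, -B, -B] : Fin 6 → ℝ) i)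
      ((![3 / 2, B, μ * ν / 4, B, B, B] : Fin 6 → ℝ) i) := by
  ext w
  simp only [Set.mem_pi, mem_univ, true_implies, Fin.forall_fin_succ]
  simp only [boxK, mem_ofPred_eq, mem_Icc, abs_le]
  simp
  norm_num
  intros
  constructor <;> intro <;> linarith

lemma isCompact_boxK (B : ℝ) : IsCompact (boxK μ ν B) := by
  rw [boxK_eq]
  exact isCompact_univ_pi fun i => isCompact_Icc

lemma convex_boxK (B : ℝ) : Convex ℝ (boxK μ ν B) := by
  rw [boxK_eq]
  exact convex_pi fun i _ => convex_Icc _ _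

lemma contDiffAt_coord (n : WithTop ℕ∞) (i : Fin 6) (w : Fin 6 → ℝ) :
    ContDiffAt ℝ n (fun w : Fin 6 → ℝ => w i) w :=
  (contDiff_apply ℝ ℝ i).contDiffAt

/-- All the coefficient functions are smooth at `w`. -/
structure SmoothCoeffs (a μ γ ν : ℝ) (n : WithTop ℕ∞) (w : Fin 6 → ℝ) : Prop where
  k : ContDiffAt ℝ n (fun w : Fin 6 → ℝ => kF a μ ν (w 0) (w 2)) w
  c : ContDiffAt ℝ n (fun w : Fin 6 → ℝ => cF a μ γ ν (w 0) (w 2)) w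
  cv : ContDiffAt ℝ n (fun w : Fin 6 → ℝ => cvF a μ γ ν (w 0) (w 2)) w
  cS : ContDiffAt ℝ n (fun w : Fin 6 → ℝ => cSF a μ γ ν (w 0) (w 2)) w
  al : ContDiffAt ℝ n (alF a μ γ ν) w
  be : ContDiffAt ℝ n beF w
  V : ContDiffAt ℝ n (VF a μ γ ν) w
  Si : ContDiffAt ℝ n (SiF a μ γ ν) w
  St : ContDiffAt ℝ n (StF a μ γ ν) w

lemma smoothCoeffs (ha : |a| ≤ 1) (hμν : 0 < μ * ν) (hγ : 1 < γ) {B : ℝ} (n : WithTop ℕ∞)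
    {w : Fin 6 → ℝ} (h : w ∈ boxK μ ν B) : SmoothCoeffs a μ γ ν n w := by
  have h0 := boxK_pos h
  have hq := boxK_qF ha hμν hγ h
  have X := fun i => contDiffAt_coord n i w
  have hk : ContDiffAt ℝ n (fun w : Fin 6 → ℝ => kF a μ ν (w 0) (w 2)) w :=
    contDiffAt_kF (X 0) (X 2) h0
  have hc : ContDiffAt ℝ n (fun w : Fin 6 → ℝ => cF a μ γ ν (w 0) (w 2)) w :=
    contDiffAt_cF (X 0) (X 2) h0 hq
  have hal : ContDiffAt ℝ n (alF a μ γ ν) w :=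
    ((X 3).sub (X 4)).div (contDiffAt_const.mul hc) (mul_pos two_pos (cF_pos hq)).ne'
  have hbe : ContDiffAt ℝ n beF w := ((X 3).add (X 4)).div_const 2
  have hV : ContDiffAt ℝ n (VF a μ γ ν) w :=
    (hbe.sub (X 5)).div (hk.add (contDiffAt_bF (X 0) h0)) hq.ne'
  exact ⟨hk, hc, contDiffAt_cvF (X 0) (X 2) h0 hq, contDiffAt_cSF (X 0) (X 2) h0 hq, hal, hbe, hV,
    (X 5).add (hk.mul hV), (hk.mul hal).sub (contDiffAt_const.mul (X 2))⟩

lemma contDiffAt_lamF (ha : |a| ≤ 1) (hμν : 0 < μ * ν) (hγ : 1 < γ) {B : ℝ} (n : WithTop ℕ∞)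
    {w : Fin 6 → ℝ} (h : w ∈ boxK μ ν B) (i : Fin 6) : ContDiffAt ℝ n (lamF a μ γ ν i) w := by
  have H := smoothCoeffs ha hμν hγ n h
  fin_cases i
  exacts [contDiffAt_const, contDiffAt_const, contDiffAt_const, H.c.neg, H.c, contDiffAt_const]

lemma contDiffAt_srcF (ha : |a| ≤ 1) (hμν : 0 < μ * ν) (hγ : 1 < γ) {B : ℝ} (n : WithTop ℕ∞)
    {w : Fin 6 → ℝ} (h : w ∈ boxK μ ν B) (i : Fin 6) : ContDiffAt ℝ n (srcF a μ γ ν i) w := by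
  have H := smoothCoeffs ha hμν hγ n h
  have X := fun i => contDiffAt_coord n i w
  have hct : ContDiffAt ℝ n (ctF a μ γ ν) w := (H.cv.mul H.al).add (H.cS.mul H.St)
  have hcx : ContDiffAt ℝ n (cxF a μ γ ν) w := (H.cv.mul H.V).add (H.cS.mul H.Si)
  have hS : ContDiffAt ℝ n (fun w => ν * SiF a μ γ ν w) w := contDiffAt_const.mul H.Si
  fin_cases i
  · exact H.al
  · exact H.be
  · exact H.St
  · exact ((hct.add (H.c.mul hcx)).mul H.al).sub hS
  · exact ((hct.sub (H.c.mul hcx)).neg.mul H.al).sub hS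
  · exact ((contDiffAt_const.div (X 0) (boxK_pos h).ne').mul
      (((X 5).mul H.al).add ((contDiffAt_const.mul (X 2)).mul H.V))).sub hS

lemma srcF_restW (i : Fin 6) : srcF a μ γ ν i restW = 0 := by
  have h1 : alF a μ γ ν restW = 0 := by simp [alF, restW]
  have h2 : VF a μ γ ν restW = 0 := by simp [VF, beF, restW]
  have h3 : SiF a μ γ ν restW = 0 := by rw [SiF, h2]; simp [restW]
  fin_cases i <;> simp [srcF, h1, h2, h3, beF, StF] <;> simp [restW]

end System

end

section

/-- A homogeneous linear system of two ODEs with zero data has only the zero solution. -/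
lemma linear_ode2_zero {e f A B C D : ℝ → ℝ} {T : ℝ} (he : Continuous e) (hf : Continuous f)
    (hA : Continuous A) (hB : Continuous B) (hC : Continuous C) (hD : Continuous D)
    (hde : ∀ t ∈ Ioo 0 T, HasDerivAt e (A t * e t + B t * f t) t)
    (hdf : ∀ t ∈ Ioo 0 T, HasDerivAt f (C t * e t + D t * f t) t) (he0 : e 0 = 0) (hf0 : f 0 = 0) :
    ∀ t ∈ Icc 0 T, e t = 0 ∧ f t = 0 := by
  obtain ⟨M, hM⟩ := (isCompact_Icc (a := (0:ℝ)) (b := T)).exists_bound_of_continuousOn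
    (f := fun t => |A t| + |B t| + |C t| + |D t|) (by fun_prop)
  have key := gronwall_Ioo (y := fun t => e t ^ 2 + f t ^ 2) (L := 2 * M) (T := T)
    (y' := fun t => 2 * e t * (A t * e t + B t * f t) + 2 * f t * (C t * e t + D t * f t))
    (by fun_prop) (fun t ht => (((hde t ht).pow 2).add ((hdf t ht).pow 2)).congr_deriv
      (by norm_num)) (fun t ht => ?_)
  · intro t ht
    have := key t ht
    simp only [he0, hf0] at this
    norm_num at this
    constructor <;> nlinarith [sq_nonneg (e t), sq_nonneg (f t)]
  · have h1 := hM t (Ioo_subset_Icc_self ht)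
    rw [Real.norm_eq_abs] at h1
    have h1 := (le_abs_self _).trans h1
    have ha := sq_nonneg (e t)
    have hb := sq_nonneg (f t)
    have h2 : |e t * f t| ≤ (e t ^ 2 + f t ^ 2) / 2 := by
      rw [abs_le]; constructor <;> nlinarith [sq_nonneg (e t + f t), sq_nonneg (e t - f t)]
    have e1 : A t * e t ^ 2 ≤ |A t| * (e t ^ 2 + f t ^ 2) := by
      nlinarith [le_abs_self (A t), abs_nonneg (A t)]
    have e2 : D t * f t ^ 2 ≤ |D t| * (e t ^ 2 + f t ^ 2) := by
      nlinarith [le_abs_self (D t), abs_nonneg (D t)]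
    have e3 : B t * (e t * f t) ≤ |B t| * ((e t ^ 2 + f t ^ 2) / 2) := by
      refine (le_abs_self _).trans ?_
      rw [abs_mul]; gcongr
    have e4 : C t * (e t * f t) ≤ |C t| * ((e t ^ 2 + f t ^ 2) / 2) := by
      refine (le_abs_self _).trans ?_
      rw [abs_mul]; gcongr
    have e5 : (|A t| + |B t| + |C t| + |D t|) * (e t ^ 2 + f t ^ 2) ≤ M * (e t ^ 2 + f t ^ 2) := by
      gcongr
    nlinarith [mul_nonneg (abs_nonneg (B t)) (add_nonneg ha hb),
      mul_nonneg (abs_nonneg (C t)) (add_nonneg ha hb)]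

variable {a μ γ ν B T : ℝ} {W Z : ℝ → ℝ → Fin 6 → ℝ}

lemma continuous_box_comp (hW : Continuous fun p : ℝ × ℝ => W p.1 p.2)
    (hmem : ∀ t x, W t x ∈ boxK μ ν B) {g : (Fin 6 → ℝ) → ℝ}
    (hg : ∀ w ∈ boxK μ ν B, ContDiffAt ℝ 0 g w) : Continuous fun p : ℝ × ℝ => g (W p.1 p.2) :=
  continuous_iff_continuousAt.2 fun p =>
    ContinuousAt.comp (f := fun p : ℝ × ℝ => W p.1 p.2) (g := g)
      (hg _ (hmem p.1 p.2)).continuousAt hW.continuousAt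

/-- The differential constraints linking the diagonal unknowns to `v, u, S` are propagated. -/
theorem DiagSol.compat (ha : |a| ≤ 1) (hμν : 0 < μ * ν) (hγ : 1 < γ)
    (h : DiagSol (lamF a μ γ ν) (srcF a μ γ ν) (boxK μ ν B) restW T W Z)
    (h0 : ∀ x, Z 0 x 0 = VF a μ γ ν (W 0 x) ∧ Z 0 x 1 = alF a μ γ ν (W 0 x) ∧
      Z 0 x 2 = SiF a μ γ ν (W 0 x)) :
    ∀ t ∈ Icc 0 T, ∀ x, Z t x 0 = VF a μ γ ν (W t x) ∧ Z t x 1 = alF a μ γ ν (W t x) ∧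
      Z t x 2 = SiF a μ γ ν (W t x) := by
  have hv := fun t x => boxK_pos (h.mem t x)
  have hq := fun t x => boxK_qF ha hμν hγ (h.mem t x)
  have hcp := fun t x => cF_pos (hq t x)
  have hc2 := fun t x => cF_sq (hq t x)
  have sm := fun w (hw : w ∈ boxK μ ν B) => smoothCoeffs ha hμν hγ 0 hw
  have cW : ∀ i, Continuous fun p : ℝ × ℝ => W p.1 p.2 i := fun i =>
    (continuous_apply i).comp h.cont
  have cZ : ∀ i, Continuous fun p : ℝ × ℝ => Z p.1 p.2 i := fun i =>
    (continuous_apply i).comp h.contZ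
  have cc := continuous_box_comp h.cont h.mem fun w hw => (sm w hw).c
  have ck := continuous_box_comp h.cont h.mem fun w hw => (sm w hw).k
  have ccv := continuous_box_comp h.cont h.mem fun w hw => (sm w hw).cv
  have ccS := continuous_box_comp h.cont h.mem fun w hw => (sm w hw).cS
  have cal := continuous_box_comp h.cont h.mem fun w hw => (sm w hw).al
  have cbe := continuous_box_comp h.cont h.mem fun w hw => (sm w hw).be
  have cSt := continuous_box_comp h.cont h.mem fun w hw => (sm w hw).St
  have cb := continuous_box_comp h.cont h.mem (g := fun w => bF γ (w 0)) fun w hw =>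
    contDiffAt_bF (contDiffAt_coord 0 0 w) (boxK_pos hw)
  have cq : Continuous fun p : ℝ × ℝ => qF a μ γ ν (W p.1 p.2 0) (W p.1 p.2 2) := ck.add cb
  have dX : ∀ i t x, HasDerivAt (fun y => W t y i) (Z t x i) x := fun i t x =>
    (hasDerivAt_pi.1 (h.dx t x)) i
  -- space derivatives
  set cx : ℝ → ℝ → ℝ := fun t x => cvF a μ γ ν (W t x 0) (W t x 2) * Z t x 0 +
    cSF a μ γ ν (W t x 0) (W t x 2) * Z t x 2 with hcx
  set alx : ℝ → ℝ → ℝ := fun t x => (Z t x 3 - Z t x 4) / (2 * cF a μ γ ν (W t x 0) (W t x 2)) -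
    alF a μ γ ν (W t x) * cx t x / cF a μ γ ν (W t x 0) (W t x 2) with halx
  set kx : ℝ → ℝ → ℝ := fun t x => 2 * a / W t x 0 * Z t x 2 -
    kF a μ ν (W t x 0) (W t x 2) / W t x 0 * Z t x 0 with hkx
  have dcx : ∀ t x, HasDerivAt (fun y => cF a μ γ ν (W t y 0) (W t y 2)) (cx t x) x := fun t x =>
    hasDerivAt_cF (dX 0 t x) (dX 2 t x) (hv t x) (hq t x)
  have dkx : ∀ t x, HasDerivAt (fun y => kF a μ ν (W t y 0) (W t y 2)) (kx t x) x := fun t x =>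
    hasDerivAt_kF (dX 0 t x) (dX 2 t x) (hv t x)
  have dalx : ∀ t x, HasDerivAt (fun y => alF a μ γ ν (W t y)) (alx t x) x := by
    intro t x
    have h1 := ((dX 3 t x).sub (dX 4 t x)).div ((dcx t x).const_mul 2)
      (mul_pos two_pos (hcp t x)).ne'
    refine h1.congr_deriv ?_
    have := (hcp t x).ne'
    simp only [halx, alF, Pi.sub_apply]
    field_simp
  have dbex : ∀ t x, HasDerivAt (fun y => beF (W t y)) ((Z t x 3 + Z t x 4) / 2) x := fun t x =>
    ((dX 3 t x).add (dX 4 t x)).div_const 2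
  have dStx : ∀ t x, HasDerivAt (fun y => StF a μ γ ν (W t y))
      (kx t x * alF a μ γ ν (W t x) + kF a μ ν (W t x 0) (W t x 2) * alx t x - ν * Z t x 2) x :=
    fun t x => ((dkx t x).mul (dalx t x)).sub ((dX 2 t x).const_mul ν)
  have ccx : Continuous fun p : ℝ × ℝ => cx p.1 p.2 := by
    simp only [hcx]; exact (ccv.mul (cZ 0)).add (ccS.mul (cZ 2))
  have cW0 : ∀ p : ℝ × ℝ, W p.1 p.2 0 ≠ 0 := fun p => (hv _ _).ne'
  have calx : Continuous fun p : ℝ × ℝ => alx p.1 p.2 := by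
    simp only [halx]
    exact (((cZ 3).sub (cZ 4)).div (continuous_const.mul cc)
      fun p => (mul_pos two_pos (hcp _ _)).ne').sub ((cal.mul ccx).div cc fun p => (hcp _ _).ne')
  have ckx : Continuous fun p : ℝ × ℝ => kx p.1 p.2 := by
    simp only [hkx]
    exact ((continuous_const.div (cW 0) cW0).mul (cZ 2)).sub ((ck.div (cW 0) cW0).mul (cZ 0))
  -- time derivatives
  have tX : ∀ i, ∀ t ∈ Ioo 0 T, ∀ x, HasDerivAt (fun s => W s x i)
    (srcF a μ γ ν i (W t x) - lamF a μ γ ν i (W t x) * Z t x i) t := fun i t ht x => h.dt t ht x i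
  have tv : ∀ t ∈ Ioo 0 T, ∀ x, HasDerivAt (fun s => W s x 0) (alF a μ γ ν (W t x)) t :=
    fun t ht x => (tX 0 t ht x).congr_deriv (by simp [lamF, srcF])
  have tu : ∀ t ∈ Ioo 0 T, ∀ x, HasDerivAt (fun s => W s x 1) (beF (W t x)) t :=
    fun t ht x => (tX 1 t ht x).congr_deriv (by simp [lamF, srcF])
  have tS : ∀ t ∈ Ioo 0 T, ∀ x, HasDerivAt (fun s => W s x 2) (StF a μ γ ν (W t x)) t :=
    fun t ht x => (tX 2 t ht x).congr_deriv (by simp [lamF, srcF])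
  have tvx := hasDerivAt_mixed (cW 0) (cZ 0) cal calx (dX 0) dalx tv
  have tux := hasDerivAt_mixed (cW 1) (cZ 1) cbe (((cZ 3).add (cZ 4)).div_const 2) (dX 1) dbex tu
  have tSx := hasDerivAt_mixed (cW 2) (cZ 2) cSt
    (((ckx.mul cal).add (ck.mul calx)).sub (continuous_const.mul (cZ 2))) (dX 2) dStx tS
  have tc : ∀ t ∈ Ioo 0 T, ∀ x, HasDerivAt (fun s => cF a μ γ ν (W s x 0) (W s x 2))
      (ctF a μ γ ν (W t x)) t := fun t ht x =>
    hasDerivAt_cF (tv t ht x) (tS t ht x) (hv t x) (hq t x)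
  have tk : ∀ t ∈ Ioo 0 T, ∀ x, HasDerivAt (fun s => kF a μ ν (W s x 0) (W s x 2))
      (2 * a / W t x 0 * StF a μ γ ν (W t x) -
        kF a μ ν (W t x 0) (W t x 2) / W t x 0 * alF a μ γ ν (W t x)) t := fun t ht x =>
    hasDerivAt_kF (tv t ht x) (tS t ht x) (hv t x)
  have tb : ∀ t ∈ Ioo 0 T, ∀ x, HasDerivAt (fun s => bF γ (W s x 0))
      (bdF γ (W t x 0) * alF a μ γ ν (W t x)) t := fun t ht x =>
    hasDerivAt_bF (tv t ht x) (hv t x)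
  intro t ht x
  have sl : ∀ {F : ℝ → ℝ → ℝ}, (Continuous fun p : ℝ × ℝ => F p.1 p.2) →
      Continuous fun s => F s x := fun hF =>
    hF.comp (by fun_prop : Continuous fun s : ℝ => (s, x))
  -- first constraint
  have E1 : Z t x 1 = alF a μ γ ν (W t x) := by
    have hd : ∀ s ∈ Ioo 0 T, HasDerivAt (fun s => alF a μ γ ν (W s x))
        ((Z s x 3 + Z s x 4) / 2) s := by
      intro s hs
      have h1 := ((tX 3 s hs x).sub (tX 4 s hs x)).div ((tc s hs x).const_mul 2)
        (mul_pos two_pos (hcp s x)).ne'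
      refine h1.congr_deriv ?_
      have hc := (hcp s x).ne'
      have hal : W s x 3 - W s x 4 = 2 * cF a μ γ ν (W s x 0) (W s x 2) * alF a μ γ ν (W s x) := by
        rw [alF]; field_simp
      simp only [Pi.sub_apply, hal, srcF, lamF]
      field_simp
      ring
    have hz := linear_ode2_zero (T := T) (e := fun s => Z s x 1 - alF a μ γ ν (W s x))
      (f := fun _ => 0) (A := fun _ => 0) (B := fun _ => 0) (C := fun _ => 0) (D := fun _ => 0)
      (sl (F := fun s x => Z s x 1 - alF a μ γ ν (W s x)) ((cZ 1).sub cal)) continuous_const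
      continuous_const continuous_const
      continuous_const continuous_const
      (fun s hs => ((tux s hs x).sub (hd s hs)).congr_deriv (by ring))
      (fun s hs => by simpa using hasDerivAt_const s (0 : ℝ)) (by rw [(h0 x).2.1]; ring) rfl
    linarith [(hz t ht).1]
  have hdiff : ∀ s, Z s x 0 - VF a μ γ ν (W s x) =
      ((Z s x 2 + bF γ (W s x 0) * Z s x 0 - beF (W s x)) -
        (Z s x 2 - kF a μ ν (W s x 0) (W s x 2) * Z s x 0 - W s x 5)) /
        qF a μ γ ν (W s x 0) (W s x 2) := by
    intro s
    have := (hq s x).ne'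
    rw [VF, eq_div_iff this, sub_mul, div_mul_cancel₀ _ this, qF]
    ring
  have hq' : ∀ s, qF a μ γ ν (W s x 0) (W s x 2) = cF a μ γ ν (W s x 0) (W s x 2) ^ 2 := fun s =>
    (hc2 s x).symm
  set e : ℝ → ℝ := fun s => Z s x 2 + bF γ (W s x 0) * Z s x 0 - beF (W s x) with he
  set f : ℝ → ℝ := fun s => Z s x 2 - kF a μ ν (W s x 0) (W s x 2) * Z s x 0 - W s x 5 with hf
  set k : ℝ → ℝ := fun s => kF a μ ν (W s x 0) (W s x 2) with hk
  set c : ℝ → ℝ := fun s => cF a μ γ ν (W s x 0) (W s x 2) with hc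
  set q : ℝ → ℝ := fun s => qF a μ γ ν (W s x 0) (W s x 2) with hqd
  set cv : ℝ → ℝ := fun s => cvF a μ γ ν (W s x 0) (W s x 2) with hcv
  set cS : ℝ → ℝ := fun s => cSF a μ γ ν (W s x 0) (W s x 2) with hcS
  set al : ℝ → ℝ := fun s => alF a μ γ ν (W s x) with hal
  have hd : ∀ s, Z s x 0 = VF a μ γ ν (W s x) + (e s - f s) / q s := fun s => by
    linarith [hdiff s]
  have hSg : ∀ s, Z s x 2 = SiF a μ γ ν (W s x) + (f s + k s * ((e s - f s) / q s)) := fun s => by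
    rw [SiF, show f s = Z s x 2 - k s * Z s x 0 - W s x 5 from rfl]
    have := hdiff s
    change _ = (e s - f s) / q s at this
    rw [← this]
    ring
  have hcxs : ∀ s, cx s x = cxF a μ γ ν (W s x) + (cv s * ((e s - f s) / q s) +
      cS s * (f s + k s * ((e s - f s) / q s))) := fun s => by
    rw [hcx, cxF]; simp only; rw [hd s, hSg s]; ring
  have de : ∀ s ∈ Ioo 0 T, HasDerivAt e (c s * al s * (cv s * ((e s - f s) / q s) +
      cS s * (f s + k s * ((e s - f s) / q s))) - ν * (f s + k s * ((e s - f s) / q s))) s := by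
    intro s hs
    have h1 := ((tSx s hs x).add ((tb s hs x).mul (tvx s hs x))).sub
      (((tX 3 s hs x).add (tX 4 s hs x)).div_const 2)
    refine h1.congr_deriv ?_
    have hc0 := (hcp s x).ne'
    have hqx : kx s x + bdF γ (W s x 0) * Z s x 0 = 2 * c s * cx s x := by
      have := (dkx s x).add (hasDerivAt_bF (γ := γ) (dX 0 s x) (hv s x))
      refine this.unique ?_
      refine (((dcx s x).pow 2).congr_of_eventuallyEq (Eventually.of_forall fun y => ?_)).congr_deriv
        (by norm_num [hc])
      exact (hc2 s y).symm
    have hqal : q s * alx s x = c s * (Z s x 3 - Z s x 4) / 2 - c s * cx s x * al s := by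
      rw [hqd]; simp only; rw [hq' s, halx]
      simp only [hc, hal]
      field_simp
    have hqk : bF γ (W s x 0) = q s - k s := by simp [hqd, hk, qF]
    rw [hqk]
    simp only [srcF, lamF]
    have h2 := hcxs s
    have h3 := hSg s
    change _ + (bdF γ (W s x 0) * al s * Z s x 0 + _ * _) - _ = _
    change (kx s x * al s + k s * alx s x - ν * Z s x 2) + (bdF γ (W s x 0) * al s * Z s x 0 +
      (q s - k s) * alx s x) - (((ctF a μ γ ν (W s x) + c s * cxF a μ γ ν (W s x)) * al s -
      ν * SiF a μ γ ν (W s x) - (-c s) * Z s x 3) +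
      (-(ctF a μ γ ν (W s x) - c s * cxF a μ γ ν (W s x)) * al s -
      ν * SiF a μ γ ν (W s x) - c s * Z s x 4)) / 2 = _
    linear_combination hqal + al s * hqx + c s * al s * h2 - ν * h3
  have df : ∀ s ∈ Ioo 0 T, HasDerivAt f (2 * a / W s x 0 * (al s * f s +
      ν * W s x 2 * ((e s - f s) / q s)) - ν * (f s + k s * ((e s - f s) / q s))) s := by
    intro s hs
    have h1 := ((tSx s hs x).sub ((tk s hs x).mul (tvx s hs x))).sub (tX 5 s hs x)
    refine h1.congr_deriv ?_
    simp only [srcF, lamF, StF]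
    have h2 := hd s
    have h3 := hSg s
    have h4 : f s = Z s x 2 - k s * Z s x 0 - W s x 5 := rfl
    change (kx s x * al s + k s * alx s x - ν * Z s x 2) - ((2 * a / W s x 0 *
      (k s * al s - ν * W s x 2) - k s / W s x 0 * al s) * Z s x 0 + k s * alx s x) -
      (2 * a / W s x 0 * (W s x 5 * al s + ν * W s x 2 * VF a μ γ ν (W s x)) -
        ν * SiF a μ γ ν (W s x) - 0 * Z s x 5) = _
    rw [hkx]
    simp only
    change ((2 * a / W s x 0 * Z s x 2 - k s / W s x 0 * Z s x 0) * al s + k s * alx s x -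
      ν * Z s x 2) - ((2 * a / W s x 0 *
      (k s * al s - ν * W s x 2) - k s / W s x 0 * al s) * Z s x 0 + k s * alx s x) -
      (2 * a / W s x 0 * (W s x 5 * al s + ν * W s x 2 * VF a μ γ ν (W s x)) -
        ν * SiF a μ γ ν (W s x) - 0 * Z s x 5) = _
    linear_combination (2 * a / W s x 0 * ν * W s x 2) * h2 - ν * h3 - (2 * a / W s x 0 * al s) * h4
  have ke : Continuous k := sl (F := fun s x => kF a μ ν (W s x 0) (W s x 2)) ck
  have kq : Continuous q := sl (F := fun s x => qF a μ γ ν (W s x 0) (W s x 2)) cq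
  have kq0 : ∀ s, q s ≠ 0 := fun s => (hq s x).ne'
  have kcv : Continuous cv := sl (F := fun s x => cvF a μ γ ν (W s x 0) (W s x 2)) ccv
  have kcS : Continuous cS := sl (F := fun s x => cSF a μ γ ν (W s x 0) (W s x 2)) ccS
  have kc : Continuous c := sl (F := fun s x => cF a μ γ ν (W s x 0) (W s x 2)) cc
  have kal : Continuous al := sl (F := fun s x => alF a μ γ ν (W s x)) cal
  have kW : ∀ i, Continuous fun s => W s x i := fun i => sl (F := fun s x => W s x i) (cW i)
  have kZ : ∀ i, Continuous fun s => Z s x i := fun i => sl (F := fun s x => Z s x i) (cZ i)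
  have kW0 := kW 0
  have kW00 : ∀ s, W s x 0 ≠ 0 := fun s => (hv s x).ne'
  have kW2 := kW 2
  have kkq : Continuous fun s => k s / q s := ke.div kq kq0
  have ki : Continuous fun s => 1 / q s := continuous_const.div kq kq0
  have kav : Continuous fun s => 2 * a / W s x 0 := continuous_const.div kW0 kW00
  have hz := linear_ode2_zero (T := T) (e := e) (f := f)
    (A := fun s => c s * al s * (cv s * (1 / q s) + cS s * (k s / q s)) - ν * (k s / q s))
    (B := fun s => c s * al s * (-(cv s * (1 / q s)) + cS s * (1 - k s / q s))
      - ν * (1 - k s / q s))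
    (C := fun s => 2 * a / W s x 0 * (ν * W s x 2 * (1 / q s)) - ν * (k s / q s))
    (D := fun s => 2 * a / W s x 0 * (al s - ν * W s x 2 * (1 / q s)) - ν * (1 - k s / q s))
    (((kZ 2).add ((sl (F := fun s x => bF γ (W s x 0)) cb).mul (kZ 0))).sub
      (sl (F := fun s x => beF (W s x)) cbe))
    (((kZ 2).sub (ke.mul (kZ 0))).sub (kW 5))
    (((kc.mul kal).mul ((kcv.mul ki).add (kcS.mul kkq))).sub (continuous_const.mul kkq))
    (((kc.mul kal).mul ((kcv.mul ki).neg.add (kcS.mul (continuous_const.sub kkq)))).sub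
      (continuous_const.mul (continuous_const.sub kkq)))
    ((kav.mul ((continuous_const.mul kW2).mul ki)).sub (continuous_const.mul kkq))
    ((kav.mul (kal.sub ((continuous_const.mul kW2).mul ki))).sub
      (continuous_const.mul (continuous_const.sub kkq)))
    (fun s hs => (de s hs).congr_deriv (by ring)) (fun s hs => (df s hs).congr_deriv (by ring))
    ?_ ?_
  · have h3 := hd t
    have h4 := hSg t
    rw [(hz t ht).1, (hz t ht).2] at h3 h4
    exact ⟨by rw [h3]; ring, E1, by rw [h4]; ring⟩
  · have h1 : qF a μ γ ν (W 0 x 0) (W 0 x 2) * VF a μ γ ν (W 0 x) = beF (W 0 x) - W 0 x 5 := by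
      rw [VF]; exact mul_div_cancel₀ _ (hq 0 x).ne'
    simp only [he, (h0 x).1, (h0 x).2.2, SiF]
    rw [qF] at h1
    linarith
  · simp only [hf, (h0 x).1, (h0 x).2.2, SiF]
    ring

end

section

/-- The unknowns `v, u, S` together with their first two spatial derivatives. -/
structure Fields where
  (v u S vx ux Sx vxx uxx Sxx : ℝ → ℝ → ℝ)

/-- `F` is a classical, compactly supported perturbation of the rest state which solves the
relaxed system (with `ν = 1/τ`) on `[0, T]`. The fields are defined for all times. -/
structure CSol (a μ γ ν T : ℝ) (F : Fields) : Prop where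
  cv : Continuous fun p : ℝ × ℝ => F.v p.1 p.2
  cu : Continuous fun p : ℝ × ℝ => F.u p.1 p.2
  cS : Continuous fun p : ℝ × ℝ => F.S p.1 p.2
  cvx : Continuous fun p : ℝ × ℝ => F.vx p.1 p.2
  cux : Continuous fun p : ℝ × ℝ => F.ux p.1 p.2
  cSx : Continuous fun p : ℝ × ℝ => F.Sx p.1 p.2
  cvxx : Continuous fun p : ℝ × ℝ => F.vxx p.1 p.2
  cuxx : Continuous fun p : ℝ × ℝ => F.uxx p.1 p.2
  cSxx : Continuous fun p : ℝ × ℝ => F.Sxx p.1 p.2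
  dv : ∀ t x, HasDerivAt (F.v t) (F.vx t x) x
  du : ∀ t x, HasDerivAt (F.u t) (F.ux t x) x
  dS : ∀ t x, HasDerivAt (F.S t) (F.Sx t x) x
  dvx : ∀ t x, HasDerivAt (F.vx t) (F.vxx t x) x
  dux : ∀ t x, HasDerivAt (F.ux t) (F.uxx t x) x
  dSx : ∀ t x, HasDerivAt (F.Sx t) (F.Sxx t x) x
  tv : ∀ t ∈ Ioo 0 T, ∀ x, HasDerivAt (fun s => F.v s x) (F.ux t x) t
  tu : ∀ t ∈ Ioo 0 T, ∀ x,
    HasDerivAt (fun s => F.u s x) (F.Sx t x + bF γ (F.v t x) * F.vx t x) t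
  tS : ∀ t ∈ Ioo 0 T, ∀ x, HasDerivAt (fun s => F.S s x)
    (kF a μ ν (F.v t x) (F.S t x) * F.ux t x - ν * F.S t x) t
  hv : ∀ t x, |F.v t x - 1| ≤ 1 / 2
  hS : ∀ t x, |F.S t x| ≤ μ * ν / 4
  far : ∃ R, ∀ t x, R < |x| → F.v t x = 1 ∧ F.u t x = 0 ∧ F.S t x = 0

variable {a μ γ ν B T : ℝ} {W Z : ℝ → ℝ → Fin 6 → ℝ}

/-- Classical fields built from a solution of the diagonal system. -/
def diagFields (a μ γ ν T : ℝ) (W Z : ℝ → ℝ → Fin 6 → ℝ) : Fields where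
  v t x := W (clampT T t) x 0
  u t x := W (clampT T t) x 1
  S t x := W (clampT T t) x 2
  vx t x := Z (clampT T t) x 0
  ux t x := Z (clampT T t) x 1
  Sx t x := Z (clampT T t) x 2
  vxx t x := fderiv ℝ (VF a μ γ ν) (W (clampT T t) x) (Z (clampT T t) x)
  uxx t x := fderiv ℝ (alF a μ γ ν) (W (clampT T t) x) (Z (clampT T t) x)
  Sxx t x := fderiv ℝ (SiF a μ γ ν) (W (clampT T t) x) (Z (clampT T t) x)

lemma beF_eq (ha : |a| ≤ 1) (hμν : 0 < μ * ν) (hγ : 1 < γ) {w : Fin 6 → ℝ}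
    (h : w ∈ boxK μ ν B) : beF w = SiF a μ γ ν w + bF γ (w 0) * VF a μ γ ν w := by
  have h1 : qF a μ γ ν (w 0) (w 2) * VF a μ γ ν w = beF w - w 5 := by
    rw [VF]; exact mul_div_cancel₀ _ (boxK_qF ha hμν hγ h).ne'
  rw [SiF]
  rw [qF] at h1
  linarith

theorem DiagSol.cSol (ha : |a| ≤ 1) (hμν : 0 < μ * ν) (hγ : 1 < γ) (hT : 0 < T)
    (h : DiagSol (lamF a μ γ ν) (srcF a μ γ ν) (boxK μ ν B) restW T W Z)
    (h0 : ∀ x, Z 0 x 0 = VF a μ γ ν (W 0 x) ∧ Z 0 x 1 = alF a μ γ ν (W 0 x) ∧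
      Z 0 x 2 = SiF a μ γ ν (W 0 x)) : CSol a μ γ ν T (diagFields a μ γ ν T W Z) := by
  have hc := h.compat ha hμν hγ h0
  have hcl : Continuous fun p : ℝ × ℝ => (clampT T p.1, p.2) :=
    ((continuous_clampT T).comp continuous_fst).prodMk continuous_snd
  have cW : ∀ i, Continuous fun p : ℝ × ℝ => W (clampT T p.1) p.2 i := fun i =>
    ((continuous_apply i).comp h.cont).comp hcl
  have cZ : ∀ i, Continuous fun p : ℝ × ℝ => Z (clampT T p.1) p.2 i := fun i =>
    ((continuous_apply i).comp h.contZ).comp hcl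
  have dX : ∀ i t x, HasDerivAt (fun y => W t y i) (Z t x i) x := fun i t x =>
    (hasDerivAt_pi.1 (h.dx t x)) i
  have sm := fun w (hw : w ∈ boxK μ ν B) => smoothCoeffs ha hμν hγ 1 hw
  have c2 : ∀ {g : (Fin 6 → ℝ) → ℝ}, (∀ w ∈ boxK μ ν B, ContDiffAt ℝ 1 g w) →
      Continuous fun p : ℝ × ℝ => fderiv ℝ g (W (clampT T p.1) p.2) (Z (clampT T p.1) p.2) := by
    intro g hg
    refine Continuous.clm_apply (continuous_iff_continuousAt.2 fun p => ?_) (h.contZ.comp hcl)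
    exact ContinuousAt.comp (f := fun p : ℝ × ℝ => W (clampT T p.1) p.2) (g := fderiv ℝ g)
      ((hg _ (h.mem _ _)).fderiv_right (m := 0) (by norm_num)).continuousAt
      (h.cont.comp hcl).continuousAt
  have d2 : ∀ {g : (Fin 6 → ℝ) → ℝ}, (∀ w ∈ boxK μ ν B, ContDiffAt ℝ 1 g w) → ∀ t x,
      HasDerivAt (fun y => g (W t y)) (fderiv ℝ g (W t x) (Z t x)) x := fun hg t x =>
    (((hg _ (h.mem t x)).differentiableAt (by norm_num)).hasFDerivAt).comp_hasDerivAt x (h.dx t x)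
  have tt : ∀ i, lamF a μ γ ν i = (fun _ => 0) → ∀ t ∈ Ioo 0 T, ∀ x,
      HasDerivAt (fun s => W (clampT T s) x i) (srcF a μ γ ν i (W t x)) t := by
    intro i hi t ht x
    have h1 := h.dt t ht x i
    rw [hi] at h1
    simp only [zero_mul, sub_zero] at h1
    refine h1.congr_of_eventuallyEq ?_
    filter_upwards [Ioo_mem_nhds ht.1 ht.2] with s hs
    rw [clampT_of_mem (Ioo_subset_Icc_self hs)]
  have hm := fun t => clampT_mem hT.le t
  refine ⟨cW 0, cW 1, cW 2, cZ 0, cZ 1, cZ 2, c2 fun w hw => (sm w hw).V,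
    c2 fun w hw => (sm w hw).al, c2 fun w hw => (sm w hw).Si, fun t x => dX 0 _ x,
    fun t x => dX 1 _ x, fun t x => dX 2 _ x, fun t x => ?_, fun t x => ?_, fun t x => ?_,
    fun t ht x => ?_, fun t ht x => ?_, fun t ht x => ?_, fun t x => (h.mem _ x).1,
    fun t x => (h.mem _ x).2.2.1, ?_⟩
  · exact (d2 (fun w hw => (sm w hw).V) (clampT T t) x).congr_of_eventuallyEq
      (Eventually.of_forall fun y => (hc _ (hm t) y).1)
  · exact (d2 (fun w hw => (sm w hw).al) (clampT T t) x).congr_of_eventuallyEq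
      (Eventually.of_forall fun y => (hc _ (hm t) y).2.1)
  · exact (d2 (fun w hw => (sm w hw).Si) (clampT T t) x).congr_of_eventuallyEq
      (Eventually.of_forall fun y => (hc _ (hm t) y).2.2)
  · refine (tt 0 rfl t ht x).congr_deriv ?_
    simp only [diagFields, clampT_of_mem (Ioo_subset_Icc_self ht)]
    exact (hc t (Ioo_subset_Icc_self ht) x).2.1.symm
  · refine (tt 1 rfl t ht x).congr_deriv ?_
    simp only [diagFields, clampT_of_mem (Ioo_subset_Icc_self ht)]
    rw [(hc t (Ioo_subset_Icc_self ht) x).1, (hc t (Ioo_subset_Icc_self ht) x).2.2]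
    exact beF_eq ha hμν hγ (h.mem t x)
  · refine (tt 2 rfl t ht x).congr_deriv ?_
    simp only [diagFields, clampT_of_mem (Ioo_subset_Icc_self ht)]
    rw [(hc t (Ioo_subset_Icc_self ht) x).2.1]
    rfl
  · obtain ⟨R, hR⟩ := h.far
    refine ⟨R, fun t x hx => ?_⟩
    simp [diagFields, hR _ x hx, restW]

/-- Compactly supported `C²` data. -/
structure Data where
  (v u S v' u' S' v'' u'' S'' : ℝ → ℝ)

/-- The functions in `D` are the successive derivatives of `v, u, S`, and `(v, u, S)` is a
compactly supported perturbation of the rest state. -/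
structure Data.IsC2 (D : Data) : Prop where
  dv : ∀ x, HasDerivAt D.v (D.v' x) x
  du : ∀ x, HasDerivAt D.u (D.u' x) x
  dS : ∀ x, HasDerivAt D.S (D.S' x) x
  dv' : ∀ x, HasDerivAt D.v' (D.v'' x) x
  du' : ∀ x, HasDerivAt D.u' (D.u'' x) x
  dS' : ∀ x, HasDerivAt D.S' (D.S'' x) x
  cv : Continuous D.v''
  cu : Continuous D.u''
  cS : Continuous D.S''
  far : ∃ R, ∀ x, R < |x| → D.v x = 1 ∧ D.u x = 0 ∧ D.S x = 0

/-- Diagonal unknowns of given data. -/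
def Data.diag (D : Data) (a μ γ ν x : ℝ) : Fin 6 → ℝ :=
  ![D.v x, D.u x, D.S x,
    D.S' x + bF γ (D.v x) * D.v' x + cF a μ γ ν (D.v x) (D.S x) * D.u' x,
    D.S' x + bF γ (D.v x) * D.v' x - cF a μ γ ν (D.v x) (D.S x) * D.u' x,
    D.S' x - kF a μ ν (D.v x) (D.S x) * D.v' x]

lemma deriv_eq_zero_of_far {E : Type*} [NormedAddCommGroup E] [NormedSpace ℝ E] {f f' : ℝ → E}
    {R : ℝ} {c : E} (hd : ∀ x, HasDerivAt f (f' x) x)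
    (hR : ∀ x, R < |x| → f x = c) : ∀ x, R < |x| → f' x = 0 := by
  intro x hx
  refine (hd x).unique ((hasDerivAt_const x c).congr_of_eventuallyEq ?_)
  filter_upwards [(isOpen_lt continuous_const continuous_abs).mem_nhds hx] with y hy
  exact hR y hy

lemma bounded_of_far {g : ℝ → Fin 6 → ℝ} {R : ℝ} (hg : Continuous g)
    (hR : ∀ x, R < |x| → g x = 0) : ∃ M ≥ 0, ∀ x, ‖g x‖ ≤ M := by
  obtain ⟨M, hM⟩ := (isCompact_Icc (a := -R) (b := R)).exists_bound_of_continuousOn hg.continuousOn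
  refine ⟨max M 0, le_max_right _ _, fun x => ?_⟩
  by_cases h : |x| ≤ R
  · exact (hM x (abs_le.1 h)).trans (le_max_left _ _)
  · rw [hR x (not_le.1 h)]
    simp

/-- Smallness of the pointwise values of `v - 1, u, S` and their first derivatives. -/
def PtBd (μ ν B v u S vx ux Sx : ℝ) : Prop :=
  |v - 1| ≤ 1 / 4 ∧ |S| ≤ μ * ν / 8 ∧ |u| ≤ B ∧ |vx| ≤ B ∧ |ux| ≤ B ∧ |Sx| ≤ B

lemma exists_box (ha : |a| ≤ 1) (hμν : 0 < μ * ν) (hγ : 1 < γ) (hB : 0 < B) :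
    ∃ B' > 0, ∃ ρ > 0, ∀ v u S vx ux Sx, PtBd μ ν B v u S vx ux Sx → 
      ∀ w : Fin 6 → ℝ, w 0 = v → w 1 = u → w 2 = S →
      w 3 = Sx + bF γ v * vx + cF a μ γ ν v S * ux →
      w 4 = Sx + bF γ v * vx - cF a μ γ ν v S * ux → w 5 = Sx - kF a μ ν v S * vx →
      Metric.closedBall w ρ ⊆ boxK μ ν B' := by
  obtain ⟨κ, hκ, hk⟩ := exists_ctrlOn_family (isCompact_boxK (μ := μ) (ν := ν) 1) (convex_boxK 1)
    (g := ![fun w : Fin 6 → ℝ => kF a μ ν (w 0) (w 2), fun w => cF a μ γ ν (w 0) (w 2),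
      fun w => bF γ (w 0)]) (by
      intro i w hw
      have := smoothCoeffs ha hμν hγ 2 hw
      fin_cases i
      exacts [this.k, this.c, contDiffAt_bF (contDiffAt_coord 2 0 w) (boxK_pos hw)])
  refine ⟨B * (1 + 2 * κ) + 1, by positivity, min (1 / 4) (min (μ * ν / 8) 1), by positivity, ?_⟩
  rintro v u S vx ux Sx ⟨h1, h2, h3, h4, h5, h6⟩ w e0 e1 e2 e3 e4 e5 z hz
  have hbox : (![v, 0, S, 0, 0, 0] : Fin 6 → ℝ) ∈ boxK μ ν 1 := by
    simp only [boxK, mem_ofPred_eq]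
    simp
    exact ⟨by norm_num at h1 ⊢; linarith, by linarith⟩
  have k1 : |kF a μ ν v S| ≤ κ := by simpa using (hk 0).bdd _ hbox
  have k2 : |cF a μ γ ν v S| ≤ κ := by simpa using (hk 1).bdd _ hbox
  have k3 : |bF γ v| ≤ κ := by simpa using (hk 2).bdd _ hbox
  have hm : ∀ {p q : ℝ}, |p| ≤ κ → |q| ≤ B → |p * q| ≤ B * κ := fun {p q} hp hq => by
    rw [abs_mul, mul_comm B]; gcongr
  have m1 := abs_le.1 (hm k1 h4)
  have m2 := abs_le.1 (hm k2 h5)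
  have m3 := abs_le.1 (hm k3 h4)
  have hz' : ∀ i, |z i - w i| ≤ min (1 / 4) (min (μ * ν / 8) 1) := fun i => by
    rw [Metric.mem_closedBall, dist_eq_norm] at hz
    exact (norm_le_pi_norm (z - w) i).trans hz
  have za : ∀ i, |z i - w i| ≤ 1 / 4 := fun i => (hz' i).trans (min_le_left _ _)
  have zb : ∀ i, |z i - w i| ≤ μ * ν / 8 := fun i =>
    (hz' i).trans ((min_le_right _ _).trans (min_le_left _ _))
  have hBκ : 0 < B * κ := by positivity
  have z0 := abs_le.1 (za 0)
  have z1 := abs_le.1 (za 1)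
  have z2 := abs_le.1 (zb 2)
  have z3 := abs_le.1 (za 3)
  have z4 := abs_le.1 (za 4)
  have z5 := abs_le.1 (za 5)
  rw [e0] at z0
  rw [e1] at z1
  rw [e2] at z2
  rw [e3] at z3
  rw [e4] at z4
  rw [e5] at z5
  rw [abs_le] at h1 h2 h3 h4 h5 h6
  simp only [boxK, mem_ofPred_eq, abs_le]
  refine ⟨⟨?_, ?_⟩, ⟨?_, ?_⟩, ⟨?_, ?_⟩, ⟨?_, ?_⟩, ⟨?_, ?_⟩, ⟨?_, ?_⟩⟩ <;> linarith

end

section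

variable {a μ γ ν B T : ℝ}

lemma Data.IsC2.cont {D : Data} (h : D.IsC2) : Continuous D.v ∧ Continuous D.u ∧ Continuous D.S ∧
    Continuous D.v' ∧ Continuous D.u' ∧ Continuous D.S' := by
  refine ⟨?_, ?_, ?_, ?_, ?_, ?_⟩ <;> rw [continuous_iff_continuousAt] <;> intro x
  exacts [(h.dv x).continuousAt, (h.du x).continuousAt, (h.dS x).continuousAt,
    (h.dv' x).continuousAt, (h.du' x).continuousAt, (h.dS' x).continuousAt]

lemma Data.IsC2.diag (ha : |a| ≤ 1) (hμν : 0 < μ * ν) (hγ : 1 < γ) {D : Data} (h : D.IsC2)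
    (hv : ∀ x, |D.v x - 1| ≤ 1 / 2) (hS : ∀ x, |D.S x| ≤ μ * ν / 4) :
    ∃ W0' : ℝ → Fin 6 → ℝ, (∀ x, HasDerivAt (D.diag a μ γ ν) (W0' x) x) ∧ Continuous W0' ∧
      ∃ R, ∀ x, R < |x| → D.diag a μ γ ν x = restW := by
  have hv0 : ∀ x, 0 < D.v x := fun x => by linarith [(abs_le.1 (hv x)).1]
  have hq : ∀ x, 0 < qF a μ γ ν (D.v x) (D.S x) := fun x => qF_pos ha hμν hγ (hv0 x) (hS x)
  obtain ⟨cv, cu, cS, cv', cu', cS'⟩ := h.cont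
  have hmem : ∀ x, (![D.v x, 0, D.S x, 0, 0, 0] : Fin 6 → ℝ) ∈ boxK μ ν 1 := fun x => by
    simp only [boxK, mem_ofPred_eq]
    simpa using ⟨by simpa using hv x, hS x⟩
  have cW : Continuous fun x => (![D.v x, 0, D.S x, 0, 0, 0] : Fin 6 → ℝ) := by
    rw [continuous_pi_iff]
    intro i
    fin_cases i <;> simp <;> fun_prop
  have cc : ∀ {g : (Fin 6 → ℝ) → ℝ}, (∀ w ∈ boxK μ ν 1, ContDiffAt ℝ 0 g w) →
      Continuous fun x => g (![D.v x, 0, D.S x, 0, 0, 0] : Fin 6 → ℝ) := fun {g} hg =>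
    continuous_iff_continuousAt.2 fun x => ContinuousAt.comp (g := g)
      (f := fun x => (![D.v x, 0, D.S x, 0, 0, 0] : Fin 6 → ℝ))
      (hg _ (hmem x)).continuousAt cW.continuousAt
  have sm := fun w (hw : w ∈ boxK μ ν 1) => smoothCoeffs ha hμν hγ 0 hw
  have ck : Continuous fun x => kF a μ ν (D.v x) (D.S x) := by simpa using cc fun w hw => (sm w hw).k
  have ccF : Continuous fun x => cF a μ γ ν (D.v x) (D.S x) := by
    simpa using cc fun w hw => (sm w hw).c
  have ccv : Continuous fun x => cvF a μ γ ν (D.v x) (D.S x) := by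
    simpa using cc fun w hw => (sm w hw).cv
  have ccS : Continuous fun x => cSF a μ γ ν (D.v x) (D.S x) := by
    simpa using cc fun w hw => (sm w hw).cS
  have cb : Continuous fun x => bF γ (D.v x) := by
    simpa using cc (g := fun w => bF γ (w 0)) fun w hw =>
      contDiffAt_bF (contDiffAt_coord 0 0 w) (boxK_pos hw)
  have cbd : Continuous fun x => bdF γ (D.v x) := by
    simpa using cc (g := fun w => bdF γ (w 0)) fun w hw =>
      contDiffAt_bdF (contDiffAt_coord 0 0 w) (boxK_pos hw)
  have cdiv : ∀ {g : ℝ → ℝ}, Continuous g → Continuous fun x => g x / D.v x := fun hg =>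
    hg.div cv fun x => (hv0 x).ne'
  have dc := fun x => hasDerivAt_cF (h.dv x) (h.dS x) (hv0 x) (hq x)
  have dk := fun x => hasDerivAt_kF (a := a) (μ := μ) (ν := ν) (h.dv x) (h.dS x) (hv0 x)
  have db := fun x => hasDerivAt_bF (γ := γ) (h.dv x) (hv0 x)
  have hd1 := fun x => (h.dS' x).add ((db x).mul (h.dv' x))
  have hd2 := fun x => (dc x).mul (h.du' x)
  refine ⟨fun x => ![D.v' x, D.u' x, D.S' x,
    (D.S'' x + (bdF γ (D.v x) * D.v' x * D.v' x + bF γ (D.v x) * D.v'' x)) +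
      ((cvF a μ γ ν (D.v x) (D.S x) * D.v' x + cSF a μ γ ν (D.v x) (D.S x) * D.S' x) * D.u' x +
        cF a μ γ ν (D.v x) (D.S x) * D.u'' x),
    (D.S'' x + (bdF γ (D.v x) * D.v' x * D.v' x + bF γ (D.v x) * D.v'' x)) -
      ((cvF a μ γ ν (D.v x) (D.S x) * D.v' x + cSF a μ γ ν (D.v x) (D.S x) * D.S' x) * D.u' x +
        cF a μ γ ν (D.v x) (D.S x) * D.u'' x),
    D.S'' x - ((2 * a / D.v x * D.S' x - kF a μ ν (D.v x) (D.S x) / D.v x * D.v' x) * D.v' x +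
      kF a μ ν (D.v x) (D.S x) * D.v'' x)], fun x => ?_, ?_, ?_⟩
  · rw [hasDerivAt_pi]
    intro i
    fin_cases i
    · exact h.dv x
    · exact h.du x
    · exact h.dS x
    · exact (hd1 x).add (hd2 x)
    · exact (hd1 x).sub (hd2 x)
    · exact (h.dS' x).sub ((dk x).mul (h.dv' x))
  · have k1 := cdiv (continuous_const (y := 2 * a))
    have k2 := cdiv ck
    obtain ⟨-, -, -, -, -, -, kv, ku, kS, -⟩ := h
    rw [continuous_pi_iff]
    intro i
    fin_cases i
    · exact cv'
    · exact cu'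
    · exact cS'
    · exact (kS.add (((cbd.mul cv').mul cv').add (cb.mul kv))).add
        ((((ccv.mul cv').add (ccS.mul cS')).mul cu').add (ccF.mul ku))
    · exact (kS.add (((cbd.mul cv').mul cv').add (cb.mul kv))).sub
        ((((ccv.mul cv').add (ccS.mul cS')).mul cu').add (ccF.mul ku))
    · exact kS.sub ((((k1.mul cS').sub (k2.mul cv')).mul cv').add (ck.mul kv))
  · obtain ⟨R, hR⟩ := h.far
    refine ⟨R, fun x hx => ?_⟩
    have e1 := deriv_eq_zero_of_far h.dv (fun x hx => (hR x hx).1) x hx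
    have e2 := deriv_eq_zero_of_far h.du (fun x hx => (hR x hx).2.1) x hx
    have e3 := deriv_eq_zero_of_far h.dS (fun x hx => (hR x hx).2.2) x hx
    simp [Data.diag, restW, e1, e2, e3, hR x hx]

lemma Data.diag_constraints (ha : |a| ≤ 1) (hμν : 0 < μ * ν) (hγ : 1 < γ) {D : Data}
    {x : ℝ} (hv : |D.v x - 1| ≤ 1 / 2) (hS : |D.S x| ≤ μ * ν / 4) :
    D.v' x = VF a μ γ ν (D.diag a μ γ ν x) ∧ D.u' x = alF a μ γ ν (D.diag a μ γ ν x) ∧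
      D.S' x = SiF a μ γ ν (D.diag a μ γ ν x) := by
  have hq : 0 < qF a μ γ ν (D.v x) (D.S x) :=
    qF_pos ha hμν hγ (by linarith [(abs_le.1 hv).1]) hS
  have hc := (cF_pos hq).ne'
  have e0 : D.diag a μ γ ν x 0 = D.v x := rfl
  have e2 : D.diag a μ γ ν x 2 = D.S x := rfl
  have e3 : D.diag a μ γ ν x 3 =
    D.S' x + bF γ (D.v x) * D.v' x + cF a μ γ ν (D.v x) (D.S x) * D.u' x := rfl
  have e4 : D.diag a μ γ ν x 4 =
    D.S' x + bF γ (D.v x) * D.v' x - cF a μ γ ν (D.v x) (D.S x) * D.u' x := rfl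
  have e5 : D.diag a μ γ ν x 5 = D.S' x - kF a μ ν (D.v x) (D.S x) * D.v' x := rfl
  have h1 : VF a μ γ ν (D.diag a μ γ ν x) = D.v' x := by
    rw [VF, beF, e0, e2, e3, e4, e5, div_eq_iff hq.ne', qF]
    ring
  refine ⟨h1.symm, ?_, ?_⟩
  · rw [alF, e0, e2, e3, e4]
    field_simp
    ring
  · rw [SiF, h1, e0, e2, e5]
    ring

/-- Existence of classical solutions on `[0, T]` under an a priori bound. -/
theorem cSol_existence (ha : |a| ≤ 1) (hμν : 0 < μ * ν) (hγ : 1 < γ) (hB : 0 < B) (hT : 0 < T)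
    {D : Data} (hD : D.IsC2)
    (hD0 : ∀ x, PtBd μ ν B (D.v x) (D.u x) (D.S x) (D.v' x) (D.u' x) (D.S' x))
    (hap : ∀ T' ∈ Ioc 0 T, ∀ F : Fields, CSol a μ γ ν T' F → F.v 0 = D.v → F.u 0 = D.u →
      F.S 0 = D.S → ∀ t ∈ Icc 0 T', ∀ x, PtBd μ ν B (F.v t x) (F.u t x) (F.S t x)
        (F.vx t x) (F.ux t x) (F.Sx t x)) :
    ∃ F : Fields, CSol a μ γ ν T F ∧ F.v 0 = D.v ∧ F.u 0 = D.u ∧ F.S 0 = D.S := by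
  obtain ⟨B', hB', ρ, hρ, hbox⟩ := exists_box ha hμν hγ hB
  have hv : ∀ x, |D.v x - 1| ≤ 1 / 2 := fun x => (hD0 x).1.trans (by norm_num)
  have hS : ∀ x, |D.S x| ≤ μ * ν / 4 := fun x => (hD0 x).2.1.trans (by linarith)
  obtain ⟨W0', dW, cW', R, hR⟩ := hD.diag ha hμν hγ hv hS
  obtain ⟨M, hM0, hM⟩ := bounded_of_far cW' (deriv_eq_zero_of_far dW hR)
  obtain ⟨κ₁, hκ₁, hl⟩ := exists_ctrlOn_family (isCompact_boxK (μ := μ) (ν := ν) B')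
    (convex_boxK B') (g := lamF a μ γ ν) fun i w hw => contDiffAt_lamF ha hμν hγ 2 hw i
  obtain ⟨κ₂, hκ₂, hf⟩ := exists_ctrlOn_family (isCompact_boxK (μ := μ) (ν := ν) B')
    (convex_boxK B') (g := srcF a μ γ ν) fun i w hw => contDiffAt_srcF ha hμν hγ 2 hw i
  obtain ⟨κ₃, hκ₃, hcvS⟩ := exists_ctrlOn_family (isCompact_boxK (μ := μ) (ν := ν) B')
    (convex_boxK B') (g := ![fun w : Fin 6 → ℝ => cvF a μ γ ν (w 0) (w 2),
      fun w : Fin 6 → ℝ => cSF a μ γ ν (w 0) (w 2)]) fun i w hw => by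
        have := smoothCoeffs ha hμν hγ 2 hw
        fin_cases i
        exacts [this.cv, this.cS]
  set κ := max κ₁ κ₂ with hκ
  have hκ0 : 0 < κ := hκ₁.trans_le (le_max_left _ _)
  have hl := fun i => (hl i).mono (le_max_left κ₁ κ₂)
  have hf := fun i => (hf i).mono (le_max_right κ₁ κ₂)
  set K₁ := 2 * (κ₃ * B) with hK₁
  have hK₁0 : 0 ≤ K₁ := by positivity
  set M₀ := 2 * M * Real.exp (2 * (κ + K₁) * T) with hM₀
  have hMM₀ : M ≤ M₀ := by
    have : 1 ≤ Real.exp (2 * (κ + K₁) * T) := Real.one_le_exp (by positivity)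
    nlinarith
  -- constraints for solutions of the diagonal system with these data
  have hcon : ∀ {T' W Z}, DiagSol (lamF a μ γ ν) (srcF a μ γ ν) (boxK μ ν B') restW T' W Z →
      W 0 = D.diag a μ γ ν → ∀ x, Z 0 x = W0' x ∧ (Z 0 x 0 = VF a μ γ ν (W 0 x) ∧
        Z 0 x 1 = alF a μ γ ν (W 0 x) ∧ Z 0 x 2 = SiF a μ γ ν (W 0 x)) := by
    intro T' W Z h hW x
    have hx := h.dx 0 x
    have hX := hasDerivAt_pi.1 hx
    rw [hW] at hx hX ⊢
    refine ⟨hx.unique (dW x), ?_⟩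
    obtain ⟨e1, e2, e3⟩ := Data.diag_constraints ha hμν hγ (hv x) (hS x)
    rw [← e1, ← e2, ← e3]
    exact ⟨(hX 0).unique (hD.dv x), (hX 1).unique (hD.du x), (hX 2).unique (hD.dS x)⟩
  have hfin : ∀ {T' W Z}, 0 < T' →
      DiagSol (lamF a μ γ ν) (srcF a μ γ ν) (boxK μ ν B') restW T' W Z → 
      W 0 = D.diag a μ γ ν → CSol a μ γ ν T' (diagFields a μ γ ν T' W Z) ∧
        (diagFields a μ γ ν T' W Z).v 0 = D.v ∧ (diagFields a μ γ ν T' W Z).u 0 = D.u ∧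
        (diagFields a μ γ ν T' W Z).S 0 = D.S := by
    intro T' W Z hT' h hW
    refine ⟨h.cSol ha hμν hγ hT' fun x => (hcon h hW x).2, ?_, ?_, ?_⟩ <;> ext x <;>
      simp [diagFields, clampT_of_nonpos, hW, Data.diag]
  suffices hkey : ∀ T' ∈ Ioc 0 T, ∀ W Z,
      DiagSol (lamF a μ γ ν) (srcF a μ γ ν) (boxK μ ν B') restW T' W Z → W 0 = D.diag a μ γ ν →
      ∀ x, Metric.closedBall (W T' x) ρ ⊆ boxK μ ν B' ∧ ‖Z T' x‖ ≤ M₀ by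
    obtain ⟨W, Z, h, hW⟩ := diag_continuation (isCompact_boxK B') hl hf hκ0.le
      (hM0.trans hMM₀) hρ srcF_restW hT dW (fun x => (hM x).trans hMM₀) cW'
      (fun x => hbox _ _ _ _ _ _ (hD0 x) _ rfl rfl rfl rfl rfl rfl) hR hkey
    exact ⟨_, hfin hT h hW⟩
  intro T' hT' W Z h hW
  obtain ⟨hC, i1, i2, i3⟩ := hfin hT'.1 h hW
  have hb := hap T' hT' _ hC i1 i2 i3
  have hco := h.compat ha hμν hγ fun x => (hcon h hW x).2
  have hb' : ∀ t ∈ Icc 0 T', ∀ x, PtBd μ ν B (W t x 0) (W t x 1) (W t x 2)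
        (Z t x 0) (Z t x 1) (Z t x 2) := by
    intro t ht x
    have := hb t ht x
    simpa only [diagFields, clampT_of_mem ht] using this
  have hq := fun t x => boxK_qF ha hμν hγ (h.mem t x)
  intro x
  constructor
  · have hT'' : T' ∈ Icc 0 T' := ⟨hT'.1.le, le_rfl⟩
    obtain ⟨c1, c2, c3⟩ := hco T' hT'' x
    have hβ := beF_eq ha hμν hγ (h.mem T' x)
    have hc := (cF_pos (hq T' x)).ne'
    have hα : W T' x 3 - W T' x 4 =
        2 * cF a μ γ ν (W T' x 0) (W T' x 2) * alF a μ γ ν (W T' x) := by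
      rw [alF]; field_simp
    refine hbox _ _ _ _ _ _ (hb' T' hT'' x) _ rfl rfl rfl ?_ ?_ ?_
    · rw [c1, c2, c3, ← hβ, beF]; linarith
    · rw [c1, c2, c3, ← hβ, beF]; linarith
    · rw [c1, c3, SiF]; ring
  · have hg := h.lip_growth hT'.1 hl hf hκ0 hK₁0 (M₀ := M)
      (fun x => by rw [(hcon h hW x).1]; exact hM x) ?_ T' ⟨hT'.1.le, le_rfl⟩ x
    · refine hg.trans ?_
      rw [hM₀]
      gcongr
      exact hT'.2
    · intro t ht x i
      have hdX : ∀ i, HasDerivAt (fun y => W t y i) (Z t x i) x := fun i =>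
        (hasDerivAt_pi.1 (h.dx t x)) i
      have h1 : HasDerivAt (fun y => lamF a μ γ ν i (W t y))
          (fderiv ℝ (lamF a μ γ ν i) (W t x) (Z t x)) x :=
        ((hl i).hasDeriv _ (h.mem t x)).comp_hasDerivAt x (h.dx t x)
      have h2 := hasDerivAt_cF (hdX 0) (hdX 2) (boxK_pos (h.mem t x)) (hq t x)
      obtain ⟨-, -, -, b1, -, b2⟩ := hb' t ht x
      have k1 := (hcvS 0).bdd _ (h.mem t x)
      have k2 := (hcvS 1).bdd _ (h.mem t x)
      change |cvF a μ γ ν (W t x 0) (W t x 2)| ≤ κ₃ at k1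
      change |cSF a μ γ ν (W t x 0) (W t x 2)| ≤ κ₃ at k2
      have hcx : |cvF a μ γ ν (W t x 0) (W t x 2) * Z t x 0 +
          cSF a μ γ ν (W t x 0) (W t x 2) * Z t x 2| ≤ K₁ := by
        refine (abs_add_le _ _).trans ?_
        rw [abs_mul, abs_mul, hK₁, two_mul]
        gcongr
      fin_cases i
      · rw [h1.unique (hasDerivAt_const x _)]; simpa using hK₁0
      · rw [h1.unique (hasDerivAt_const x _)]; simpa using hK₁0
      · rw [h1.unique (hasDerivAt_const x _)]; simpa using hK₁0
      · rw [h1.unique h2.neg, abs_neg]; exact hcx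
      · rw [h1.unique h2]; exact hcx
      · rw [h1.unique (hasDerivAt_const x _)]; simpa using hK₁0

end

section

lemma integral_eq_interval_of_far {f : ℝ → ℝ} {R : ℝ} (h : ∀ x, R < |x| → f x = 0) :
    ∫ x, f x = ∫ x in -(|R| + 1)..(|R| + 1), f x := by
  refine (integral_eq_integral_of_support_subset fun x hx => ?_).symm
  have h1 : |x| ≤ R := not_lt.1 fun h2 => hx (h x h2)
  have h2 := abs_le.1 (h1.trans (le_abs_self R))
  exact ⟨by linarith, by linarith⟩

lemma integrable_of_far {f : ℝ → ℝ} {R : ℝ} (hf : Continuous f) (h : ∀ x, R < |x| → f x = 0) :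
    Integrable f := by
  refine hf.integrable_of_hasCompactSupport ?_
  refine HasCompactSupport.intro (isCompact_Icc (a := -R) (b := R)) fun x hx => h x ?_
  exact not_le.1 fun h1 => hx (abs_le.1 h1)

lemma continuous_integral_far {X : Type*} [TopologicalSpace X] {f : X → ℝ → ℝ} {R : ℝ}
    (hf : Continuous fun p : X × ℝ => f p.1 p.2) (h : ∀ p x, R < |x| → f p x = 0) :
    Continuous fun p => ∫ x, f p x := by
  have : (fun p => ∫ x, f p x) = fun p => ∫ x in -(|R| + 1)..(|R| + 1), f p x :=
    funext fun p => integral_eq_interval_of_far (h p)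
  rw [this]
  exact continuous_parametric_intervalIntegral_of_continuous' hf _ _

lemma integral_deriv_far {f f' : ℝ → ℝ} {R : ℝ} (hd : ∀ x, HasDerivAt f (f' x) x)
    (hf' : Continuous f') (h : ∀ x, R < |x| → f x = 0) : ∫ x, f' x = 0 :=
  integral_eq_zero_of_hasDerivAt_of_integrable hd
    (integrable_of_far hf' (deriv_eq_zero_of_far hd h))
    (integrable_of_far (continuous_iff_continuousAt.2 fun x => (hd x).continuousAt) h)

lemma hasDerivAt_integral_far {f ft : ℝ → ℝ → ℝ} {R T : ℝ}
    (hf : Continuous fun p : ℝ × ℝ => f p.1 p.2) (hft : Continuous fun p : ℝ × ℝ => ft p.1 p.2)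
    (hR : ∀ t x, R < |x| → f t x = 0) (hR' : ∀ t x, R < |x| → ft t x = 0)
    (hd : ∀ t ∈ Ioo 0 T, ∀ x, HasDerivAt (fun s => f s x) (ft t x) t) :
    ∀ t ∈ Ioo 0 T, HasDerivAt (fun s => ∫ x, f s x) (∫ x, ft t x) t := by
  intro t ht
  obtain ⟨C, hC⟩ := ((isCompact_Icc (a := 0) (b := T)).prod
    (isCompact_Icc (a := -R) (b := R))).exists_bound_of_continuousOn hft.continuousOn
  have h1 : ∀ s, Continuous (f s) := fun s => hf.comp (by fun_prop : Continuous fun x => (s, x))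
  have h2 : ∀ s, Continuous (ft s) := fun s => hft.comp (by fun_prop : Continuous fun x => (s, x))
  refine (hasDerivAt_integral_of_dominated_loc_of_deriv_le (F := f) (F' := ft)
    (bound := (Icc (-R) R).indicator fun _ => C) (Ioo_mem_nhds ht.1 ht.2)
    (Eventually.of_forall fun s => (h1 s).aestronglyMeasurable)
    (integrable_of_far (h1 t) (hR t)) (h2 t).aestronglyMeasurable
    (Eventually.of_forall fun x s hs => ?_) ?_
    (Eventually.of_forall fun x s hs => hd s hs x)).2
  · by_cases hx : x ∈ Icc (-R) R
    · rw [indicator_of_mem hx]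
      exact hC (s, x) ⟨Ioo_subset_Icc_self hs, hx⟩
    · rw [indicator_of_notMem hx, hR' s x (not_le.1 fun h => hx (abs_le.1 h)), norm_zero]
  · exact (integrable_indicator_iff measurableSet_Icc).2 (by simp)

/-- A balance law `e_t = F_x + r` with compact support, integrated over a strip. -/
lemma balance {e F Fx r : ℝ → ℝ → ℝ} {R T : ℝ}
    (he : Continuous fun p : ℝ × ℝ => e p.1 p.2) (hFx : Continuous fun p : ℝ × ℝ => Fx p.1 p.2)
    (hr : Continuous fun p : ℝ × ℝ => r p.1 p.2)
    (heR : ∀ t x, R < |x| → e t x = 0) (hFR : ∀ t x, R < |x| → F t x = 0)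
    (hrR : ∀ t x, R < |x| → r t x = 0) (hF : ∀ t x, HasDerivAt (F t) (Fx t x) x)
    (hd : ∀ t ∈ Ioo 0 T, ∀ x, HasDerivAt (fun s => e s x) (Fx t x + r t x) t) {s t : ℝ}
    (hs : 0 ≤ s) (hst : s ≤ t) (ht : t ≤ T) :
    (∫ x, e t x) - ∫ x, e s x = ∫ q in s..t, ∫ x, r q x := by
  have hFxR : ∀ t x, R < |x| → Fx t x = 0 := fun t => deriv_eq_zero_of_far (hF t) (hFR t)
  have h1 := hasDerivAt_integral_far he (hFx.add hr) heR
    (fun t x hx => by simp [hFxR t x hx, hrR t x hx]) hd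
  refine sub_eq_integral_of_Ioo (continuous_integral_far he heR) (continuous_integral_far hr hrR)
    (fun q hq => (h1 q hq).congr_deriv ?_) hs hst ht
  have c1 : Continuous (Fx q) := hFx.comp (by fun_prop : Continuous fun x => (q, x))
  have c2 : Continuous (r q) := hr.comp (by fun_prop : Continuous fun x => (q, x))
  rw [integral_add (integrable_of_far c1 (hFxR q)) (integrable_of_far c2 (hrR q)),
    integral_deriv_far (hF q) c1 (hFR q), zero_add]

/-- Averaged derivative: equals the difference quotient for `h ≠ 0` and `fx` for `h = 0`. -/
def avg (fx : ℝ → ℝ → ℝ) (h t x : ℝ) : ℝ := ∫ θ in (0 : ℝ)..1, fx t (x + θ * h)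

lemma avg_zero (fx : ℝ → ℝ → ℝ) (t x : ℝ) : avg fx 0 t x = fx t x := by simp [avg]

lemma continuous_avg {fx : ℝ → ℝ → ℝ} (hf : Continuous fun p : ℝ × ℝ => fx p.1 p.2) :
    Continuous fun p : ℝ × ℝ × ℝ => avg fx p.1 p.2.1 p.2.2 := by
  unfold avg
  refine continuous_parametric_intervalIntegral_of_continuous' 
    (f := fun (p : ℝ × ℝ × ℝ) θ => fx p.2.1 (p.2.2 + θ * p.1)) ?_ _ _
  exact hf.comp (by fun_prop :
    Continuous fun p : (ℝ × ℝ × ℝ) × ℝ => (p.1.2.1, p.1.2.2 + p.2 * p.1.1))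

lemma avg_eq {f fx : ℝ → ℝ → ℝ} (hf : Continuous fun p : ℝ × ℝ => fx p.1 p.2)
    (hd : ∀ t x, HasDerivAt (f t) (fx t x) x) {h : ℝ} (hh : h ≠ 0) (t x : ℝ) :
    avg fx h t x = (f t (x + h) - f t x) / h := by
  rw [eq_div_iff hh, avg, ← intervalIntegral.integral_mul_const]
  have h1 : ∀ θ ∈ uIcc (0 : ℝ) 1,
      HasDerivAt (fun θ => f t (x + θ * h)) (fx t (x + θ * h) * h) θ := by
    intro θ _
    have h2 : HasDerivAt (fun θ : ℝ => x + θ * h) h θ := by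
      simpa using ((hasDerivAt_id θ).mul_const h).const_add x
    exact (hd t (x + θ * h)).comp θ h2
  rw [integral_eq_sub_of_hasDerivAt h1]
  · simp
  · refine Continuous.intervalIntegrable ?_ _ _
    exact (hf.comp (by fun_prop : Continuous fun θ : ℝ => (t, x + θ * h))).mul continuous_const

lemma avg_far {fx : ℝ → ℝ → ℝ} {R : ℝ} (hR : ∀ t x, R < |x| → fx t x = 0) {h : ℝ} (hh : |h| ≤ 1)
    (t x : ℝ) (hx : R + 1 < |x|) : avg fx h t x = 0 := by
  have : ∀ θ ∈ uIcc (0 : ℝ) 1, fx t (x + θ * h) = 0 := by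
    intro θ hθ
    rw [uIcc_of_le zero_le_one] at hθ
    refine hR _ _ ?_
    have h1 : |θ * h| ≤ 1 := by
      rw [abs_mul, abs_of_nonneg hθ.1]
      nlinarith [hθ.1, hθ.2, abs_nonneg h]
    have h2 := abs_sub_abs_le_abs_sub x (-(θ * h))
    rw [abs_neg, sub_neg_eq_add] at h2
    linarith
  rw [avg, integral_congr this]
  simp

end

section

/-- Unknowns, coefficients and sources of a linear relaxation system
`V_t = A_x`, `A_t = G_x + b V_x + g₁`, `τ G_t = m A_x - G + g₂`, with `n = 1 / m`. -/
structure LinFields where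
  (V A G Vx Ax Gx b bt bx m n nt g₁ g₂ : ℝ → ℝ → ℝ)

/-- `L` solves the linear relaxation system for times in `(0, T)`. -/
structure LinSol (τ T : ℝ) (L : LinFields) : Prop where
  cV : Continuous fun p : ℝ × ℝ => L.V p.1 p.2
  cA : Continuous fun p : ℝ × ℝ => L.A p.1 p.2
  cG : Continuous fun p : ℝ × ℝ => L.G p.1 p.2
  cVx : Continuous fun p : ℝ × ℝ => L.Vx p.1 p.2
  cAx : Continuous fun p : ℝ × ℝ => L.Ax p.1 p.2
  cGx : Continuous fun p : ℝ × ℝ => L.Gx p.1 p.2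
  cb : Continuous fun p : ℝ × ℝ => L.b p.1 p.2
  cbt : Continuous fun p : ℝ × ℝ => L.bt p.1 p.2
  cbx : Continuous fun p : ℝ × ℝ => L.bx p.1 p.2
  cm : Continuous fun p : ℝ × ℝ => L.m p.1 p.2
  cn : Continuous fun p : ℝ × ℝ => L.n p.1 p.2
  cnt : Continuous fun p : ℝ × ℝ => L.nt p.1 p.2
  cg₁ : Continuous fun p : ℝ × ℝ => L.g₁ p.1 p.2
  cg₂ : Continuous fun p : ℝ × ℝ => L.g₂ p.1 p.2
  dV : ∀ t x, HasDerivAt (L.V t) (L.Vx t x) x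
  dA : ∀ t x, HasDerivAt (L.A t) (L.Ax t x) x
  dG : ∀ t x, HasDerivAt (L.G t) (L.Gx t x) x
  db : ∀ t x, HasDerivAt (L.b t) (L.bx t x) x
  tV : ∀ t ∈ Ioo 0 T, ∀ x, HasDerivAt (fun s => L.V s x) (L.Ax t x) t
  tA : ∀ t ∈ Ioo 0 T, ∀ x,
    HasDerivAt (fun s => L.A s x) (L.Gx t x + L.b t x * L.Vx t x + L.g₁ t x) t
  tG : ∀ t ∈ Ioo 0 T, ∀ x,
    HasDerivAt (fun s => L.G s x) (τ⁻¹ * (L.m t x * L.Ax t x - L.G t x + L.g₂ t x)) t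
  tb : ∀ t ∈ Ioo 0 T, ∀ x, HasDerivAt (fun s => L.b s x) (L.bt t x) t
  tn : ∀ t ∈ Ioo 0 T, ∀ x, HasDerivAt (fun s => L.n s x) (L.nt t x) t
  nm : ∀ t x, L.n t x * L.m t x = 1

/-- Energy density of a linear relaxation system. -/
def LinFields.ed (L : LinFields) (τ t x : ℝ) : ℝ :=
  1 / 2 * (L.b t x * L.V t x ^ 2 + L.A t x ^ 2 + τ * (L.n t x * L.G t x ^ 2))

/-- Production of energy. -/
def LinFields.pr (L : LinFields) (τ t x : ℝ) : ℝ :=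
  1 / 2 * (L.bt t x * L.V t x ^ 2) - L.bx t x * L.V t x * L.A t x + L.A t x * L.g₁ t x
    + L.n t x * L.G t x * L.g₂ t x + 1 / 2 * (τ * (L.nt t x * L.G t x ^ 2))
    - L.n t x * L.G t x ^ 2

variable {τ T : ℝ} {L : LinFields}

lemma LinSol.ced (h : LinSol τ T L) : Continuous fun p : ℝ × ℝ => L.ed τ p.1 p.2 := by
  obtain ⟨cV, cA, cG, cVx, cAx, cGx, cb, cbt, cbx, cm, cn, cnt, cg₁, cg₂, -⟩ := h
  unfold LinFields.ed
  fun_prop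

lemma LinSol.cpr (h : LinSol τ T L) : Continuous fun p : ℝ × ℝ => L.pr τ p.1 p.2 := by
  obtain ⟨cV, cA, cG, cVx, cAx, cGx, cb, cbt, cbx, cm, cn, cnt, cg₁, cg₂, -⟩ := h
  unfold LinFields.pr
  fun_prop

/-- Weighted energy identity. -/
lemma LinSol.energy (h : LinSol τ T L) (hτ : τ ≠ 0) {φ φt φx : ℝ → ℝ → ℝ} {R : ℝ}
    (cφ : Continuous fun p : ℝ × ℝ => φ p.1 p.2) (cφt : Continuous fun p : ℝ × ℝ => φt p.1 p.2)
    (cφx : Continuous fun p : ℝ × ℝ => φx p.1 p.2) (dφ : ∀ t x, HasDerivAt (φ t) (φx t x) x)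
    (tφ : ∀ t ∈ Ioo 0 T, ∀ x, HasDerivAt (fun s => φ s x) (φt t x) t)
    (hR : ∀ t x, R < |x| → (φ t x = 0 ∧ φt t x = 0 ∧ φx t x = 0) ∨
      (L.V t x = 0 ∧ L.A t x = 0 ∧ L.G t x = 0)) {s t : ℝ}
    (hs : 0 ≤ s) (hst : s ≤ t) (ht : t ≤ T) :
    (∫ x, φ t x * L.ed τ t x) - ∫ x, φ s x * L.ed τ s x = ∫ q in s..t, ∫ x,
      (φ q x * L.pr τ q x + φt q x * L.ed τ q x
        - φx q x * (L.A q x * (L.b q x * L.V q x + L.G q x))) := by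
  have hed := h.ced
  have hpr := h.cpr
  have h' := h
  obtain ⟨cV, cA, cG, cVx, cAx, cGx, cb, cbt, cbx, cm, cn, cnt, cg₁, cg₂, -⟩ := h'
  refine balance (e := fun t x => φ t x * L.ed τ t x)
    (r := fun t x => φ t x * L.pr τ t x + φt t x * L.ed τ t x
      - φx t x * (L.A t x * (L.b t x * L.V t x + L.G t x)))
    (F := fun t x => φ t x * (L.A t x * (L.b t x * L.V t x + L.G t x)))
    (Fx := fun t x => φx t x * (L.A t x * (L.b t x * L.V t x + L.G t x))
      + φ t x * (L.Ax t x * (L.b t x * L.V t x + L.G t x)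
        + L.A t x * (L.bx t x * L.V t x + L.b t x * L.Vx t x + L.Gx t x))) (R := R) (T := T)
    (by fun_prop) (by fun_prop) (by fun_prop) ?_ ?_ ?_ ?_ ?_ hs hst ht
  · rintro t x hx
    rcases hR t x hx with ⟨h1, h2, h3⟩ | ⟨h1, h2, h3⟩ <;> simp [h1, h2, h3, LinFields.ed]
  · rintro t x hx
    rcases hR t x hx with ⟨h1, h2, h3⟩ | ⟨h1, h2, h3⟩ <;> simp [h1, h2, h3]
  · rintro t x hx
    rcases hR t x hx with ⟨h1, h2, h3⟩ | ⟨h1, h2, h3⟩ <;>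
      simp [h1, h2, h3, LinFields.ed, LinFields.pr]
  · intro t x
    exact ((dφ t x).mul ((h.dA t x).mul (((h.db t x).mul (h.dV t x)).add (h.dG t x)))).congr_deriv
      (by simp only [Pi.mul_apply, Pi.add_apply])
  · intro t ht x
    have e1 := (((h.tb t ht x).mul ((h.tV t ht x).pow 2)).add ((h.tA t ht x).pow 2)).add
      (((h.tn t ht x).mul ((h.tG t ht x).pow 2)).const_mul τ)
    refine ((tφ t ht x).mul (e1.const_mul (1 / 2))).congr_deriv ?_
    simp only [Pi.mul_apply, Pi.add_apply, Pi.pow_apply, LinFields.ed, LinFields.pr]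
    have hn := h.nm t x
    have e2 : ∀ z : ℝ, τ * (τ⁻¹ * z) = z := fun z => by field_simp
    have e3 : τ * (L.n t x * (2 * L.G t x * (τ⁻¹ *
        (L.m t x * L.Ax t x - L.G t x + L.g₂ t x)))) = 2 * L.G t x * L.Ax t x
          - 2 * L.n t x * L.G t x ^ 2 + 2 * L.n t x * L.G t x * L.g₂ t x := by
      rw [show τ * (L.n t x * (2 * L.G t x * (τ⁻¹ * (L.m t x * L.Ax t x - L.G t x + L.g₂ t x))))
        = 2 * L.G t x * L.n t x * (τ * (τ⁻¹ * (L.m t x * L.Ax t x - L.G t x + L.g₂ t x))) by ring,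
        e2]
      linear_combination 2 * L.G t x * L.Ax t x * hn
    push_cast
    norm_num
    linear_combination (1 / 2 * φ t x) * e3

/-- Energy identity for compactly supported solutions. -/
lemma LinSol.energy_one (h : LinSol τ T L) (hτ : τ ≠ 0) {R : ℝ}
    (hR : ∀ t x, R < |x| → L.V t x = 0 ∧ L.A t x = 0 ∧ L.G t x = 0) {s t : ℝ}
    (hs : 0 ≤ s) (hst : s ≤ t) (ht : t ≤ T) :
    (∫ x, L.ed τ t x) - ∫ x, L.ed τ s x = ∫ q in s..t, ∫ x, L.pr τ q x := by
  have := h.energy hτ (φ := fun _ _ => 1) (φt := fun _ _ => 0) (φx := fun _ _ => 0)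
    continuous_const continuous_const continuous_const (fun t x => hasDerivAt_const x 1)
    (fun t _ x => hasDerivAt_const t 1) (fun t x hx => Or.inr (hR t x hx)) hs hst ht
  simpa using this

end

section

variable {τ T : ℝ} {L : LinFields}

/-- Difference quotients of a linear relaxation system. -/
def LinFields.dq (L : LinFields) (g₁x g₂x mx : ℝ → ℝ → ℝ) (h : ℝ) : LinFields where
  V := avg L.Vx h
  A := avg L.Ax h
  G := avg L.Gx h
  Vx t x := (L.Vx t (x + h) - L.Vx t x) / h
  Ax t x := (L.Ax t (x + h) - L.Ax t x) / h
  Gx t x := (L.Gx t (x + h) - L.Gx t x) / h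
  b := L.b
  bt := L.bt
  bx := L.bx
  m := L.m
  n := L.n
  nt := L.nt
  g₁ t x := avg L.bx h t x * L.Vx t (x + h) + avg g₁x h t x
  g₂ t x := avg mx h t x * L.Ax t (x + h) + avg g₂x h t x

lemma hasDerivAt_quot {f f' : ℝ → ℝ} (hd : ∀ x, HasDerivAt f (f' x) x) (h x : ℝ) :
    HasDerivAt (fun x => (f (x + h) - f x) / h) ((f' (x + h) - f' x) / h) x := by
  have h1 : HasDerivAt (fun x => f (x + h)) (f' (x + h)) x :=
    HasDerivAt.comp_add_const x h (hd (x + h))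
  exact (h1.sub (hd x)).div_const h

lemma LinSol.dq (hL : LinSol τ T L) {g₁x g₂x mx : ℝ → ℝ → ℝ}
    (cg₁x : Continuous fun p : ℝ × ℝ => g₁x p.1 p.2)
    (cg₂x : Continuous fun p : ℝ × ℝ => g₂x p.1 p.2)
    (cmx : Continuous fun p : ℝ × ℝ => mx p.1 p.2)
    (dg₁ : ∀ t x, HasDerivAt (L.g₁ t) (g₁x t x) x) (dg₂ : ∀ t x, HasDerivAt (L.g₂ t) (g₂x t x) x)
    (dm : ∀ t x, HasDerivAt (L.m t) (mx t x) x) {h : ℝ} (hh : h ≠ 0) :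
    LinSol τ T (L.dq g₁x g₂x mx h) := by
  have hL' := hL
  obtain ⟨cV, cA, cG, cVx, cAx, cGx, cb, cbt, cbx, cm, cn, cnt, cg₁, cg₂, dV, dA, dG, db, tV, tA,
    tG, tb, tn, nm⟩ := hL'
  have sh : ∀ {f : ℝ → ℝ → ℝ}, (Continuous fun p : ℝ × ℝ => f p.1 p.2) →
      Continuous fun p : ℝ × ℝ => f p.1 (p.2 + h) := fun hf =>
    hf.comp (by fun_prop : Continuous fun p : ℝ × ℝ => (p.1, p.2 + h))
  have av : ∀ {f : ℝ → ℝ → ℝ}, (Continuous fun p : ℝ × ℝ => f p.1 p.2) →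
      Continuous fun p : ℝ × ℝ => avg f h p.1 p.2 := fun hf =>
    (continuous_avg hf).comp (by fun_prop : Continuous fun p : ℝ × ℝ => (h, p.1, p.2))
  have eV : avg L.Vx h = fun t x => (L.V t (x + h) - L.V t x) / h :=
    funext fun t => funext fun x => avg_eq cVx dV hh t x
  have eA : avg L.Ax h = fun t x => (L.A t (x + h) - L.A t x) / h :=
    funext fun t => funext fun x => avg_eq cAx dA hh t x
  have eG : avg L.Gx h = fun t x => (L.G t (x + h) - L.G t x) / h :=
    funext fun t => funext fun x => avg_eq cGx dG hh t x
  refine ⟨av cVx, av cAx, av cGx, ((sh cVx).sub cVx).div_const h, ((sh cAx).sub cAx).div_const h,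
    ((sh cGx).sub cGx).div_const h, cb, cbt, cbx, cm, cn, cnt, ((av cbx).mul (sh cVx)).add
    (av cg₁x), ((av cmx).mul (sh cAx)).add (av cg₂x), fun t x => ?_, fun t x => ?_, fun t x => ?_,
    db, fun t ht x => ?_, fun t ht x => ?_, fun t ht x => ?_, tb, tn, nm⟩
  · simp only [LinFields.dq, eV]
    exact hasDerivAt_quot (dV t) h x
  · simp only [LinFields.dq, eA]
    exact hasDerivAt_quot (dA t) h x
  · simp only [LinFields.dq, eG]
    exact hasDerivAt_quot (dG t) h x
  · simp only [LinFields.dq, eV]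
    exact ((tV t ht (x + h)).sub (tV t ht x)).div_const h
  · simp only [LinFields.dq, eA, avg_eq cbx db hh, avg_eq cg₁x dg₁ hh]
    refine (((tA t ht (x + h)).sub (tA t ht x)).div_const h).congr_deriv ?_
    ring
  · simp only [LinFields.dq, eG, avg_eq cmx dm hh, avg_eq cg₂x dg₂ hh]
    refine (((tG t ht (x + h)).sub (tG t ht x)).div_const h).congr_deriv ?_
    ring

lemma exists_continuous_truncation : ∃ κ : ℝ → ℝ, Continuous κ ∧ (∀ h, |κ h| ≤ 1) ∧ κ 0 = 0 ∧
    ∀ h, h ≠ 0 → κ h ≠ 0 := by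
  set κ : ℝ → ℝ := fun h => max (-1) (min h 1) with hκ
  have cκ : Continuous κ := continuous_const.max (continuous_id.min continuous_const)
  have κ1 : ∀ h, |κ h| ≤ 1 := fun h =>
    abs_le.2 ⟨le_max_left _ _, max_le (by norm_num) (min_le_right _ _)⟩
  have κ0 : κ 0 = 0 := by norm_num [hκ]
  have κne : ∀ h, h ≠ 0 → κ h ≠ 0 := by
    intro h hh h0
    simp only [hκ] at h0
    rcases lt_or_gt_of_ne hh with h1 | h1
    · rw [min_eq_left (by linarith)] at h0
      rcases max_choice (-1) h with h2 | h2 <;> rw [h2] at h0 <;> linarith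
    · have h3 : 0 < min h 1 := lt_min h1 one_pos
      rw [max_eq_right (by linarith)] at h0
      linarith
  exact ⟨κ, cκ, κ1, κ0, κne⟩

/-- Energy density of the `x`-derivatives. -/
def LinFields.edx (L : LinFields) (τ t x : ℝ) : ℝ :=
  1 / 2 * (L.b t x * L.Vx t x ^ 2 + L.Ax t x ^ 2 + τ * (L.n t x * L.Gx t x ^ 2))

/-- Energy production of the `x`-derivatives. -/
def LinFields.prx (L : LinFields) (g₁x g₂x mx : ℝ → ℝ → ℝ) (τ t x : ℝ) : ℝ :=
  1 / 2 * (L.bt t x * L.Vx t x ^ 2) + L.Ax t x * g₁x t x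
    + L.n t x * L.Gx t x * (g₂x t x + mx t x * L.Ax t x)
    + 1 / 2 * (τ * (L.nt t x * L.Gx t x ^ 2)) - L.n t x * L.Gx t x ^ 2

/-- Energy identity for the `x`-derivatives. -/
lemma LinSol.energy_deriv (hL : LinSol τ T L) (hτ : τ ≠ 0) {g₁x g₂x mx : ℝ → ℝ → ℝ}
    (cg₁x : Continuous fun p : ℝ × ℝ => g₁x p.1 p.2)
    (cg₂x : Continuous fun p : ℝ × ℝ => g₂x p.1 p.2)
    (cmx : Continuous fun p : ℝ × ℝ => mx p.1 p.2)
    (dg₁ : ∀ t x, HasDerivAt (L.g₁ t) (g₁x t x) x) (dg₂ : ∀ t x, HasDerivAt (L.g₂ t) (g₂x t x) x)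
    (dm : ∀ t x, HasDerivAt (L.m t) (mx t x) x) {R : ℝ}
    (hR : ∀ t x, R < |x| → L.V t x = 0 ∧ L.A t x = 0 ∧ L.G t x = 0) {s t : ℝ}
    (hs : 0 ≤ s) (hst : s ≤ t) (ht : t ≤ T) :
    (∫ x, L.edx τ t x) - ∫ x, L.edx τ s x = ∫ q in s..t, ∫ x, L.prx g₁x g₂x mx τ q x := by
  obtain ⟨cV, cA, cG, cVx, cAx, cGx, cb, cbt, cbx, cm, cn, cnt, cg₁, cg₂, dV, dA, dG, -⟩ := id hL
  have fV : ∀ t x, R < |x| → L.Vx t x = 0 := fun t =>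
    deriv_eq_zero_of_far (dV t) fun x hx => (hR t x hx).1
  have fA : ∀ t x, R < |x| → L.Ax t x = 0 := fun t =>
    deriv_eq_zero_of_far (dA t) fun x hx => (hR t x hx).2.1
  have fG : ∀ t x, R < |x| → L.Gx t x = 0 := fun t =>
    deriv_eq_zero_of_far (dG t) fun x hx => (hR t x hx).2.2
  obtain ⟨κ, cκ, κ1, κ0, κne⟩ := exists_continuous_truncation
  set LL : ℝ → LinFields := fun h => L.dq g₁x g₂x mx (κ h) with hLL
  have av : ∀ {f : ℝ → ℝ → ℝ}, (Continuous fun p : ℝ × ℝ => f p.1 p.2) →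
      Continuous fun p : (ℝ × ℝ) × ℝ => avg f (κ p.1.1) p.1.2 p.2 := fun hf =>
    (continuous_avg hf).comp
      (by fun_prop : Continuous fun p : (ℝ × ℝ) × ℝ => (κ p.1.1, p.1.2, p.2))
  have cE : Continuous fun p : (ℝ × ℝ) × ℝ => (LL p.1.1).ed τ p.1.2 p.2 := by
    have h1 := av cVx
    have h2 := av cAx
    have h3 := av cGx
    simp only [hLL, LinFields.dq, LinFields.ed]
    fun_prop
  have cP : Continuous fun p : (ℝ × ℝ) × ℝ => (LL p.1.1).pr τ p.1.2 p.2 := by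
    have h1 := av cVx
    have h2 := av cAx
    have h3 := av cGx
    have h4 := av cmx
    have h5 := av cg₁x
    have h6 := av cg₂x
    have h7 := av cbx
    simp only [hLL, LinFields.dq, LinFields.pr]
    fun_prop
  have fa : ∀ h t x, R + 1 < |x| → (LL h).V t x = 0 ∧ (LL h).A t x = 0 ∧ (LL h).G t x = 0 :=
    fun h t x hx => ⟨avg_far fV (κ1 h) t x hx, avg_far fA (κ1 h) t x hx, avg_far fG (κ1 h) t x hx⟩
  have fE : ∀ (p : ℝ × ℝ) x, R + 1 < |x| → (LL p.1).ed τ p.2 x = 0 := by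
    intro p x hx
    obtain ⟨h1, h2, h3⟩ := fa p.1 p.2 x hx
    simp [LinFields.ed, h1, h2, h3]
  have fP : ∀ (p : ℝ × ℝ) x, R + 1 < |x| → (LL p.1).pr τ p.2 x = 0 := by
    intro p x hx
    obtain ⟨h1, h2, h3⟩ := fa p.1 p.2 x hx
    simp [LinFields.pr, h1, h2, h3]
  have kE := continuous_integral_far cE fE
  have kP := continuous_integral_far cP fP
  have kl : Continuous fun h => (∫ x, (LL h).ed τ t x) - ∫ x, (LL h).ed τ s x :=
    (kE.comp (by fun_prop : Continuous fun h : ℝ => (h, t))).sub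
      (kE.comp (by fun_prop : Continuous fun h : ℝ => (h, s)))
  have kr : Continuous fun h => ∫ q in s..t, ∫ x, (LL h).pr τ q x :=
    continuous_parametric_intervalIntegral_of_continuous' kP _ _
  have key := Continuous.ext_on (dense_compl_singleton (0 : ℝ)) kl kr fun h hh =>
    (hL.dq cg₁x cg₂x cmx dg₁ dg₂ dm (κne h hh)).energy_one hτ (fa h) hs hst ht
  have k0 := congrFun key 0
  have e1 : ∀ q x, (LL 0).ed τ q x = L.edx τ q x := by
    intro q x
    simp only [hLL, LinFields.dq, LinFields.ed, LinFields.edx, κ0, avg_zero]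
  have e2 : ∀ q x, (LL 0).pr τ q x = L.prx g₁x g₂x mx τ q x := by
    intro q x
    simp only [hLL, LinFields.dq, LinFields.pr, LinFields.prx, κ0, avg_zero, add_zero]
    ring
  simpa only [e1, e2] using k0

/-- The cross identity `d/dt ∫ f g_x = ∫ (f_t g_x - f_x g_t)`. -/
lemma cross_identity {f fx g gx p r : ℝ → ℝ → ℝ} {R : ℝ}
    (cf : Continuous fun p : ℝ × ℝ => f p.1 p.2) (cfx : Continuous fun p : ℝ × ℝ => fx p.1 p.2)
    (cg : Continuous fun p : ℝ × ℝ => g p.1 p.2) (cgx : Continuous fun p : ℝ × ℝ => gx p.1 p.2)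
    (cp : Continuous fun q : ℝ × ℝ => p q.1 q.2) (cr : Continuous fun p : ℝ × ℝ => r p.1 p.2)
    (df : ∀ t x, HasDerivAt (f t) (fx t x) x) (dg : ∀ t x, HasDerivAt (g t) (gx t x) x)
    (tf : ∀ t ∈ Ioo 0 T, ∀ x, HasDerivAt (fun s => f s x) (p t x) t)
    (tg : ∀ t ∈ Ioo 0 T, ∀ x, HasDerivAt (fun s => g s x) (r t x) t)
    (hf : ∀ t x, R < |x| → f t x = 0) (hp : ∀ t x, R < |x| → p t x = 0) {s t : ℝ}
    (hs : 0 ≤ s) (hst : s ≤ t) (ht : t ≤ T) :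
    (∫ x, f t x * gx t x) - ∫ x, f s x * gx s x
      = ∫ q in s..t, ∫ x, (p q x * gx q x - fx q x * r q x) := by
  have hfx : ∀ t x, R < |x| → fx t x = 0 := fun t => deriv_eq_zero_of_far (df t) (hf t)
  obtain ⟨κ, cκ, κ1, κ0, κne⟩ := exists_continuous_truncation
  have cgx' := (continuous_avg cgx).comp
      (by fun_prop : Continuous fun p : (ℝ × ℝ) × ℝ => (κ p.1.1, p.1.2, p.2))
  have cfx' := (continuous_avg cfx).comp
      (by fun_prop : Continuous fun p : (ℝ × ℝ) × ℝ => (-κ p.1.1, p.1.2, p.2))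
  have c1 : Continuous fun p : (ℝ × ℝ) × ℝ => f p.1.2 p.2 * avg gx (κ p.1.1) p.1.2 p.2 :=
    (cf.comp (by fun_prop : Continuous fun p : (ℝ × ℝ) × ℝ => (p.1.2, p.2))).mul cgx'
  have c2 : Continuous fun q : (ℝ × ℝ) × ℝ => p q.1.2 q.2 * avg gx (κ q.1.1) q.1.2 q.2
      - avg fx (-κ q.1.1) q.1.2 q.2 * r q.1.2 q.2 :=
    ((cp.comp (by fun_prop : Continuous fun p : (ℝ × ℝ) × ℝ => (p.1.2, p.2))).mul cgx').sub
      (cfx'.mul (cr.comp (by fun_prop : Continuous fun p : (ℝ × ℝ) × ℝ => (p.1.2, p.2))))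
  have k1 := continuous_integral_far (f := fun q : ℝ × ℝ => fun x =>
    f q.2 x * avg gx (κ q.1) q.2 x) c1 (R := R) fun q x hx => by simp [hf _ x hx]
  have k2 := continuous_integral_far (f := fun q : ℝ × ℝ => fun x =>
    p q.2 x * avg gx (κ q.1) q.2 x - avg fx (-κ q.1) q.2 x * r q.2 x) c2 (R := R + 1)
    fun q x hx => by
      simp [hp _ x (by linarith), avg_far hfx (h := -κ q.1) (by rw [abs_neg]; exact κ1 _) _ x hx]
  have kl : Continuous fun h => (∫ x, f t x * avg gx (κ h) t x) - ∫ x, f s x * avg gx (κ h) s x :=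
    (k1.comp (by fun_prop : Continuous fun h : ℝ => (h, t))).sub
      (k1.comp (by fun_prop : Continuous fun h : ℝ => (h, s)))
  have kr : Continuous fun h => ∫ q in s..t, ∫ x,
      (p q x * avg gx (κ h) q x - avg fx (-κ h) q x * r q x) :=
    continuous_parametric_intervalIntegral_of_continuous' k2 _ _
  have key := Continuous.ext_on (dense_compl_singleton (0 : ℝ)) kl kr fun h hh => ?_
  · have k0 := congrFun key 0
    simpa only [κ0, avg_zero, neg_zero] using k0
  · have hk := κne h hh
    have cr' : Continuous fun q : ℝ × ℝ => r q.1 (q.2 + κ h) :=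
      cr.comp (by fun_prop : Continuous fun q : ℝ × ℝ => (q.1, q.2 + κ h))
    have cg' : Continuous fun q : ℝ × ℝ => g q.1 (q.2 + κ h) :=
      cg.comp (by fun_prop : Continuous fun q : ℝ × ℝ => (q.1, q.2 + κ h))
    have fh : ∀ t, Continuous (f t) := fun t => cf.comp (by fun_prop : Continuous fun x => (t, x))
    have rh : ∀ t, Continuous (r t) := fun t => cr.comp (by fun_prop : Continuous fun x => (t, x))
    have ph : ∀ t, Continuous (p t) := fun t => cp.comp (by fun_prop : Continuous fun x => (t, x))
    have gh : ∀ t, Continuous (g t) := fun t => cg.comp (by fun_prop : Continuous fun x => (t, x))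
    have hd := hasDerivAt_integral_far (T := T) (R := R)
      (f := fun t x => f t x * ((g t (x + κ h) - g t x) / κ h))
      (ft := fun t x => p t x * ((g t (x + κ h) - g t x) / κ h)
        + f t x * ((r t (x + κ h) - r t x) / κ h)) (by fun_prop) (by fun_prop)
      (fun t x hx => by simp [hf t x hx]) (fun t x hx => by simp [hf t x hx, hp t x hx])
      fun t ht x => (tf t ht x).mul (((tg t ht (x + κ h)).sub (tg t ht x)).div_const _)
    have e1 : ∀ t x, avg gx (κ h) t x = (g t (x + κ h) - g t x) / κ h := avg_eq cgx dg hk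
    have e2 : ∀ t x, avg fx (-κ h) t x = (f t x - f t (x - κ h)) / κ h := fun t x => by
      rw [avg_eq cfx df (neg_ne_zero.2 hk), div_neg, ← neg_div]
      congr 1
      ring_nf
    refine sub_eq_integral_of_Ioo (k1.comp (by fun_prop : Continuous fun q : ℝ => (h, q)))
      (k2.comp (by fun_prop : Continuous fun q : ℝ => (h, q))) (fun q hq => ?_) hs hst ht
    have hd' := hd q hq
    simp only [Function.comp_def, e1, e2]
    refine hd'.congr_deriv ?_
    have i1 : Integrable fun x => p q x * ((g q (x + κ h) - g q x) / κ h) :=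
      integrable_of_far (by have := gh q; have := ph q; fun_prop) (R := R)
        fun x hx => by simp [hp q x hx]
    have j1 : Integrable fun x => f q x * r q x := integrable_of_far (R := R)
      ((fh q).mul (rh q)) fun x hx => by simp [hf q x hx]
    have j2 : Integrable fun x => f q x * r q (x + κ h) := integrable_of_far (R := R)
      (by have := fh q; have := rh q; fun_prop) fun x hx => by simp [hf q x hx]
    have j3 : Integrable fun x => f q (x - κ h) * r q x := by
      have := j2.comp_sub_right (κ h)
      simpa using this
    have e3 : ∫ x, f q (x - κ h) * r q x = ∫ x, f q x * r q (x + κ h) := by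
      rw [← integral_sub_right_eq_self (fun x => f q x * r q (x + κ h)) (κ h)]
      simp
    have i2 : Integrable fun x => f q x * ((r q (x + κ h) - r q x) / κ h) := by
      refine ((j2.sub j1).div_const (κ h)).congr (Eventually.of_forall fun x => ?_)
      simp only [Pi.sub_apply]
      ring
    have i3 : Integrable fun x => (f q x - f q (x - κ h)) / κ h * r q x := by
      refine ((j1.sub j3).div_const (κ h)).congr (Eventually.of_forall fun x => ?_)
      simp only [Pi.sub_apply]
      ring
    rw [integral_add i1 i2, integral_sub i1 i3, sub_eq_add_neg, ← MeasureTheory.integral_neg]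
    congr 1
    have a1 : ∫ x, f q x * ((r q (x + κ h) - r q x) / κ h)
        = ((∫ x, f q x * r q (x + κ h)) - ∫ x, f q x * r q x) / κ h := by
      rw [← integral_sub j2 j1, ← MeasureTheory.integral_div]
      exact integral_congr_ae (Eventually.of_forall fun x => by ring)
    have a2 : ∫ x, -((f q x - f q (x - κ h)) / κ h * r q x)
        = ((∫ x, f q (x - κ h) * r q x) - ∫ x, f q x * r q x) / κ h := by
      rw [← integral_sub j3 j1, ← MeasureTheory.integral_div]
      exact integral_congr_ae (Eventually.of_forall fun x => by ring)
    rw [a1, a2, e3]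

end

section

/-- The negative third derivative of the pressure `p(v) = v^(-γ)`. -/
def bddF (γ v : ℝ) : ℝ := γ * (γ + 1) * (γ + 2) * v ^ (-γ - 3)

lemma hasDerivAt_bdF {γ : ℝ} {v : ℝ → ℝ} {v' t : ℝ} (hv : HasDerivAt v v' t) (h0 : 0 < v t) :
    HasDerivAt (fun s => bdF γ (v s)) (bddF γ (v t) * v') t := by
  have := (hv.rpow_const (p := -γ - 2) (Or.inl h0.ne')).const_mul (-(γ * (γ + 1)))
  refine this.congr_deriv ?_
  rw [bddF, show (-γ - 2 - 1 : ℝ) = -γ - 3 by ring]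
  ring

namespace Fields

variable (F : Fields) (a μ γ τ : ℝ)

/-- The sum `μ + 2 * a * τ * S`. -/
def P (t x : ℝ) : ℝ := 2 * a * τ * F.S t x + μ

/-- The coefficient `m = (μ + 2 * a * τ * S) / v` in `τ S_t = m u_x - S`. -/
def m (t x : ℝ) : ℝ := F.P a μ τ t x / F.v t x

/-- Its reciprocal. -/
def n (t x : ℝ) : ℝ := F.v t x / F.P a μ τ t x

/-- The time derivative of `n`. -/
def nt (t x : ℝ) : ℝ := F.ux t x / F.P a μ τ t x
  - 2 * a * F.v t x * (F.m a μ τ t x * F.ux t x - F.S t x) / F.P a μ τ t x ^ 2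

/-- The `x`-derivative of `m`. -/
def mx (t x : ℝ) : ℝ := (2 * a * τ * F.Sx t x - F.m a μ τ t x * F.vx t x) / F.v t x

/-- The second `x`-derivative of `m`. -/
def mxx (t x : ℝ) : ℝ :=
  (2 * a * τ * F.Sxx t x - F.m a μ τ t x * F.vxx t x - 2 * F.mx a μ τ t x * F.vx t x) / F.v t x

/-- The source in the differentiated momentum equation. -/
def g₁ (t x : ℝ) : ℝ := bdF γ (F.v t x) * F.vx t x ^ 2

/-- The `x`-derivative of `g₁`. -/
def g₁x (t x : ℝ) : ℝ :=
  bddF γ (F.v t x) * F.vx t x ^ 3 + 2 * bdF γ (F.v t x) * F.vx t x * F.vxx t x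

/-- The source in the differentiated constitutive law. -/
def g₂ (t x : ℝ) : ℝ := F.mx a μ τ t x * F.ux t x

/-- The `x`-derivative of `g₂`. -/
def g₂x (t x : ℝ) : ℝ := F.mxx a μ τ t x * F.ux t x + F.mx a μ τ t x * F.uxx t x

/-- The linear system satisfied by the first spatial derivatives. -/
def lin : LinFields where
  V := F.vx
  A := F.ux
  G := F.Sx
  Vx := F.vxx
  Ax := F.uxx
  Gx := F.Sxx
  b t x := bF γ (F.v t x)
  bt t x := bdF γ (F.v t x) * F.ux t x
  bx t x := bdF γ (F.v t x) * F.vx t x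
  m := F.m a μ τ
  n := F.n a μ τ
  nt := F.nt a μ τ
  g₁ := F.g₁ γ
  g₂ := F.g₂ a μ τ

end Fields

section

variable {a μ γ τ T : ℝ} {F : Fields}

lemma CSol.v_mem (h : CSol a μ γ τ⁻¹ T F) (t x : ℝ) : F.v t x ∈ Icc (1 / 2 : ℝ) (3 / 2) := by
  have := abs_le.1 (h.hv t x)
  constructor <;> linarith

lemma CSol.v_pos (h : CSol a μ γ τ⁻¹ T F) (t x : ℝ) : 0 < F.v t x := by
  linarith [(h.v_mem t x).1]

lemma CSol.P_mem (ha : |a| ≤ 1) (hτ : 0 < τ) (h : CSol a μ γ τ⁻¹ T F) (t x : ℝ) :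
    F.P a μ τ t x ∈ Icc (μ / 2) (3 * μ / 2) := by
  have h1 : |2 * a * τ * F.S t x| ≤ μ / 2 := by
    rw [abs_mul, abs_mul, abs_mul, abs_two, abs_of_pos hτ]
    calc 2 * |a| * τ * |F.S t x| ≤ 2 * 1 * τ * (μ * τ⁻¹ / 4) := by
          gcongr
          exact h.hS t x
      _ = μ / 2 := by field_simp; ring
  have h2 := abs_le.1 h1
  rw [Fields.P]
  constructor <;> linarith

lemma CSol.P_pos (ha : |a| ≤ 1) (hμ : 0 < μ) (hτ : 0 < τ) (h : CSol a μ γ τ⁻¹ T F) (t x : ℝ) :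
    0 < F.P a μ τ t x := by linarith [(h.P_mem ha hτ t x).1]

lemma continuous_rpow_of_pos {X : Type*} [TopologicalSpace X] {f : X → ℝ} (hf : Continuous f)
    (h : ∀ x, 0 < f x) (p : ℝ) : Continuous fun x => f x ^ p :=
  hf.rpow_const fun x => Or.inl (h x).ne'

lemma CSol.cb (h : CSol a μ γ τ⁻¹ T F) : Continuous fun p : ℝ × ℝ => bF γ (F.v p.1 p.2) :=
  (continuous_rpow_of_pos h.cv (fun p => h.v_pos p.1 p.2) _).const_mul _

lemma CSol.cbd (h : CSol a μ γ τ⁻¹ T F) : Continuous fun p : ℝ × ℝ => bdF γ (F.v p.1 p.2) :=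
  (continuous_rpow_of_pos h.cv (fun p => h.v_pos p.1 p.2) _).const_mul _

lemma CSol.cbdd (h : CSol a μ γ τ⁻¹ T F) : Continuous fun p : ℝ × ℝ => bddF γ (F.v p.1 p.2) :=
  (continuous_rpow_of_pos h.cv (fun p => h.v_pos p.1 p.2) _).const_mul _

lemma CSol.cP (h : CSol a μ γ τ⁻¹ T F) : Continuous fun p : ℝ × ℝ => F.P a μ τ p.1 p.2 := by
  have := h.cS
  unfold Fields.P
  fun_prop

lemma CSol.cm (h : CSol a μ γ τ⁻¹ T F) : Continuous fun p : ℝ × ℝ => F.m a μ τ p.1 p.2 :=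
  h.cP.div h.cv fun p => (h.v_pos p.1 p.2).ne'

lemma CSol.cn (ha : |a| ≤ 1) (hμ : 0 < μ) (hτ : 0 < τ) (h : CSol a μ γ τ⁻¹ T F) :
    Continuous fun p : ℝ × ℝ => F.n a μ τ p.1 p.2 :=
  h.cv.div h.cP fun p => (h.P_pos ha hμ hτ p.1 p.2).ne'

lemma CSol.cmx (h : CSol a μ γ τ⁻¹ T F) : Continuous fun p : ℝ × ℝ => F.mx a μ τ p.1 p.2 :=
  (((h.cSx.const_mul _)).sub (h.cm.mul h.cvx)).div h.cv fun p => (h.v_pos p.1 p.2).ne'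

lemma CSol.cmxx (h : CSol a μ γ τ⁻¹ T F) : Continuous fun p : ℝ × ℝ => F.mxx a μ τ p.1 p.2 :=
  (((h.cSxx.const_mul _).sub (h.cm.mul h.cvxx)).sub ((h.cmx.const_mul 2).mul h.cvx)).div h.cv
    fun p => (h.v_pos p.1 p.2).ne'

lemma CSol.cg₁x (h : CSol a μ γ τ⁻¹ T F) : Continuous fun p : ℝ × ℝ => F.g₁x γ p.1 p.2 := by
  have h1 := h.cbd
  have h2 := h.cbdd
  have h3 := h.cvx
  have h4 := h.cvxx
  unfold Fields.g₁x
  fun_prop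

lemma CSol.cg₂x (h : CSol a μ γ τ⁻¹ T F) : Continuous fun p : ℝ × ℝ => F.g₂x a μ τ p.1 p.2 :=
  (h.cmxx.mul h.cux).add (h.cmx.mul h.cuxx)

lemma CSol.dm (h : CSol a μ γ τ⁻¹ T F) (t x : ℝ) :
    HasDerivAt (F.m a μ τ t) (F.mx a μ τ t x) x := by
  have h0 := (h.v_pos t x).ne'
  have h1 : HasDerivAt (F.P a μ τ t) (2 * a * τ * F.Sx t x) x :=
    ((h.dS t x).const_mul (2 * a * τ)).add_const μ
  refine (h1.div (h.dv t x) h0).congr_deriv ?_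
  rw [Fields.mx, Fields.m]
  field_simp

lemma CSol.dmx (h : CSol a μ γ τ⁻¹ T F) (t x : ℝ) :
    HasDerivAt (F.mx a μ τ t) (F.mxx a μ τ t x) x := by
  have h0 := (h.v_pos t x).ne'
  refine ((((h.dSx t x).const_mul (2 * a * τ)).sub ((h.dm t x).mul (h.dvx t x))).div (h.dv t x)
    h0).congr_deriv ?_
  simp only [Pi.sub_apply, Pi.mul_apply]
  rw [Fields.mxx, Fields.mx]
  field_simp
  ring

lemma CSol.dg₁ (h : CSol a μ γ τ⁻¹ T F) (t x : ℝ) :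
    HasDerivAt (F.g₁ γ t) (F.g₁x γ t x) x := by
  refine ((hasDerivAt_bdF (γ := γ) (h.dv t x) (h.v_pos t x)).mul
    ((h.dvx t x).pow 2)).congr_deriv ?_
  simp only [Pi.pow_apply]
  rw [Fields.g₁x]
  ring

lemma CSol.dg₂ (h : CSol a μ γ τ⁻¹ T F) (t x : ℝ) :
    HasDerivAt (F.g₂ a μ τ t) (F.g₂x a μ τ t x) x := (h.dmx t x).mul (h.dux t x)

lemma CSol.tS' (hτ : 0 < τ) (h : CSol a μ γ τ⁻¹ T F) : ∀ t ∈ Ioo 0 T, ∀ x,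
    HasDerivAt (fun s => F.S s x) (τ⁻¹ * (F.m a μ τ t x * F.ux t x - F.S t x)) t := by
  intro t ht x
  have h0 := (h.v_pos t x).ne'
  refine (h.tS t ht x).congr_deriv ?_
  rw [kF, Fields.m, Fields.P]
  field_simp

lemma CSol.lin (ha : |a| ≤ 1) (hμ : 0 < μ) (hτ : 0 < τ) (h : CSol a μ γ τ⁻¹ T F) :
    LinSol τ T (F.lin a μ γ τ) := by
  have hP := h.P_pos ha hμ hτ
  have hv := h.v_pos
  have c1 := h.cbd
  have c2 := h.cvx
  have c3 := h.cux
  have c4 := h.cb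
  have c5 := h.cSx
  have c6 := h.cm
  have c7 := h.cS
  have c8 := h.cSxx
  have c9 := h.cvxx
  have c10 := h.cmx
  have c11 := h.cuxx
  have ctS : Continuous fun p : ℝ × ℝ =>
      τ⁻¹ * (F.m a μ τ p.1 p.2 * F.ux p.1 p.2 - F.S p.1 p.2) := by fun_prop
  refine ⟨h.cvx, h.cux, h.cSx, h.cvxx, h.cuxx, h.cSxx, h.cb, h.cbd.mul h.cux, h.cbd.mul h.cvx,
    h.cm, h.cn ha hμ hτ, ?_, h.cbd.mul (h.cvx.pow 2), h.cmx.mul h.cux, h.dvx, h.dux, h.dSx,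
    fun t x => hasDerivAt_bF (h.dv t x) (hv t x),
    hasDerivAt_mixed h.cv h.cvx h.cux h.cuxx h.dv h.dux h.tv, ?_, ?_,
    fun t ht x => hasDerivAt_bF (h.tv t ht x) (hv t x), ?_, ?_⟩
  · refine (h.cux.div h.cP fun p => (hP p.1 p.2).ne').sub (Continuous.div ?_ (h.cP.pow 2)
      fun p => (pow_pos (hP p.1 p.2) 2).ne')
    have := h.cv
    fun_prop
  · have := hasDerivAt_mixed (A := fun t x => F.Sx t x + bF γ (F.v t x) * F.vx t x)
      (Ax := fun t x => F.Sxx t x + (bdF γ (F.v t x) * F.vx t x * F.vx t x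
        + bF γ (F.v t x) * F.vxx t x)) h.cu h.cux (by fun_prop) (by fun_prop) h.du
      (fun t x => (h.dSx t x).add ((hasDerivAt_bF (h.dv t x) (hv t x)).mul (h.dvx t x))) h.tu
    intro t ht x
    refine (this t ht x).congr_deriv ?_
    simp only [Fields.lin, Fields.g₁]
    ring
  · have := hasDerivAt_mixed (A := fun t x => τ⁻¹ * (F.m a μ τ t x * F.ux t x - F.S t x))
      (Ax := fun t x => τ⁻¹ * (F.mx a μ τ t x * F.ux t x + F.m a μ τ t x * F.uxx t x - F.Sx t x))
      h.cS h.cSx (by fun_prop) (by fun_prop) h.dS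
      (fun t x => (((h.dm t x).mul (h.dux t x)).sub (h.dS t x)).const_mul _) (h.tS' hτ)
    intro t ht x
    refine (this t ht x).congr_deriv ?_
    simp only [Fields.lin, Fields.g₂]
    ring
  · intro t ht x
    have h1 : HasDerivAt (fun s => F.P a μ τ s x)
        (2 * a * (F.m a μ τ t x * F.ux t x - F.S t x)) t := by
      refine (((h.tS' hτ t ht x).const_mul (2 * a * τ)).add_const μ).congr_deriv ?_
      field_simp
    refine ((h.tv t ht x).div h1 (hP t x).ne').congr_deriv ?_
    have := (hP t x).ne'
    simp only [Fields.lin, Fields.nt]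
    field_simp
  · intro t x
    have h1 := (hP t x).ne'
    have h2 := (hv t x).ne'
    simp only [Fields.lin, Fields.n, Fields.m]
    field_simp

end

end

section

/-- Continuous functions of `(t, x)` supported in `|x| ≤ R`. -/
structure CF (R : ℝ) (f : ℝ → ℝ → ℝ) : Prop where
  cont : Continuous fun p : ℝ × ℝ => f p.1 p.2
  far : ∀ t x, R < |x| → f t x = 0

lemma CF.slice {R : ℝ} {f : ℝ → ℝ → ℝ} (h : CF R f) (t : ℝ) : Integrable (f t) :=
  integrable_of_far (h.cont.comp (by fun_prop : Continuous fun x => (t, x))) (h.far t)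

lemma CF.cint {R : ℝ} {f : ℝ → ℝ → ℝ} (h : CF R f) : Continuous fun t => ∫ x, f t x :=
  continuous_integral_far h.cont h.far

lemma CF.add {R : ℝ} {f g : ℝ → ℝ → ℝ} (hf : CF R f) (hg : CF R g) :
    CF R fun t x => f t x + g t x :=
  ⟨hf.cont.add hg.cont, fun t x hx => by simp [hf.far t x hx, hg.far t x hx]⟩

lemma CF.const_mul {R : ℝ} {f : ℝ → ℝ → ℝ} (hf : CF R f) (c : ℝ) : CF R fun t x => c * f t x :=
  ⟨hf.cont.const_mul c, fun t x hx => by simp [hf.far t x hx]⟩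

/-- `d/dt ∫ e = ∫ r` in integrated form. -/
structure Bal (R T : ℝ) (e r : ℝ → ℝ → ℝ) : Prop where
  ce : CF R e
  cr : CF R r
  eq : ∀ {s t : ℝ}, 0 ≤ s → s ≤ t → t ≤ T →
    (∫ x, e t x) - ∫ x, e s x = ∫ q in s..t, ∫ x, r q x

lemma Bal.add {R T : ℝ} {e e' r r' : ℝ → ℝ → ℝ} (h : Bal R T e r) (h' : Bal R T e' r') :
    Bal R T (fun t x => e t x + e' t x) (fun t x => r t x + r' t x) := by
  refine ⟨h.ce.add h'.ce, h.cr.add h'.cr, fun {s t} hs hst ht => ?_⟩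
  have e1 : ∀ t, ∫ x, (r t x + r' t x) = (∫ x, r t x) + ∫ x, r' t x := fun t =>
    MeasureTheory.integral_add (h.cr.slice t) (h'.cr.slice t)
  simp only [e1]
  rw [MeasureTheory.integral_add (h.ce.slice t) (h'.ce.slice t),
    MeasureTheory.integral_add (h.ce.slice s) (h'.ce.slice s), intervalIntegral.integral_add
      (h.cr.cint.intervalIntegrable _ _) (h'.cr.cint.intervalIntegrable _ _),
    ← h.eq hs hst ht, ← h'.eq hs hst ht]
  ring

lemma Bal.const_mul {R T : ℝ} {e r : ℝ → ℝ → ℝ} (h : Bal R T e r) (c : ℝ) :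
    Bal R T (fun t x => c * e t x) (fun t x => c * r t x) := by
  refine ⟨h.ce.const_mul c, h.cr.const_mul c, fun {s t} hs hst ht => ?_⟩
  simp only [MeasureTheory.integral_const_mul, intervalIntegral.integral_const_mul]
  rw [← h.eq hs hst ht]
  ring

/-- Potential energy of the pressure. -/
def PhiF (γ v : ℝ) : ℝ := v ^ (1 - γ) / (γ - 1) - 1 / (γ - 1) + (v - 1)

lemma hasDerivAt_PhiF {γ : ℝ} (hγ : 1 < γ) {v : ℝ → ℝ} {v' t : ℝ} (hv : HasDerivAt v v' t)
    (h0 : 0 < v t) : HasDerivAt (fun s => PhiF γ (v s)) ((1 - v t ^ (-γ)) * v') t := by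
  have h1 := (((hv.rpow_const (p := 1 - γ) (Or.inl h0.ne')).div_const (γ - 1)).sub_const
    (1 / (γ - 1))).add (hv.sub_const 1)
  refine h1.congr_deriv ?_
  have : γ - 1 ≠ 0 := by linarith
  rw [show (1 - γ - 1 : ℝ) = -γ by ring]
  field_simp
  ring

lemma PhiF_one {γ : ℝ} : PhiF γ 1 = 0 := by simp [PhiF]

lemma hasDerivAt_pressure {γ : ℝ} {v : ℝ → ℝ} {v' t : ℝ} (hv : HasDerivAt v v' t)
    (h0 : 0 < v t) : HasDerivAt (fun s => v s ^ (-γ)) (-bF γ (v t) * v') t := by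
  refine (hv.rpow_const (p := -γ) (Or.inl h0.ne')).congr_deriv ?_
  rw [bF]
  ring

namespace Fields

variable (F : Fields) (a μ γ τ : ℝ)

/-- Energy density of order zero. -/
def ed₀ (t x : ℝ) : ℝ :=
  PhiF γ (F.v t x) + 1 / 2 * F.u t x ^ 2 + 1 / 2 * (τ * (F.n a μ τ t x * F.S t x ^ 2))

/-- Energy production of order zero. -/
def pr₀ (t x : ℝ) : ℝ :=
  1 / 2 * (τ * (F.nt a μ τ t x * F.S t x ^ 2)) - F.n a μ τ t x * F.S t x ^ 2

/-- Density of the Lyapunov functional. -/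
def lyd (δ₁ δ₂ t x : ℝ) : ℝ :=
  F.ed₀ a μ γ τ t x + (F.lin a μ γ τ).ed τ t x + (F.lin a μ γ τ).edx τ t x
    + -δ₂ * (τ * F.S t x * F.ux t x + τ * F.Sx t x * F.uxx t x)
    + -δ₁ * (F.u t x * F.vx t x + F.ux t x * F.vxx t x)

/-- Production of the Lyapunov functional. -/
def lyp (δ₁ δ₂ t x : ℝ) : ℝ :=
  F.pr₀ a μ τ t x + (F.lin a μ γ τ).pr τ t x
    + (F.lin a μ γ τ).prx (F.g₁x γ) (F.g₂x a μ τ) (F.mx a μ τ) τ t x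
    + -δ₂ * (((F.m a μ τ t x * F.ux t x - F.S t x) * F.ux t x
        - τ * F.Sx t x * (F.Sx t x + bF γ (F.v t x) * F.vx t x))
      + ((F.mx a μ τ t x * F.ux t x + F.m a μ τ t x * F.uxx t x - F.Sx t x) * F.uxx t x
        - τ * F.Sxx t x * (F.Sxx t x + bF γ (F.v t x) * F.vxx t x + F.g₁ γ t x)))
    + -δ₁ * (((F.Sx t x + bF γ (F.v t x) * F.vx t x) * F.vx t x - F.ux t x * F.ux t x)
      + ((F.Sxx t x + bF γ (F.v t x) * F.vxx t x + F.g₁ γ t x) * F.vxx t x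
        - F.uxx t x * F.uxx t x))

end Fields

variable {a μ γ τ T : ℝ} {F : Fields}

lemma CSol.far_all (h : CSol a μ γ τ⁻¹ T F) : ∃ R, ∀ t x, R < |x| → F.v t x = 1 ∧ F.u t x = 0 ∧
    F.S t x = 0 ∧ F.vx t x = 0 ∧ F.ux t x = 0 ∧ F.Sx t x = 0 ∧ F.vxx t x = 0 ∧ F.uxx t x = 0 ∧
    F.Sxx t x = 0 := by
  obtain ⟨R, hR⟩ := h.far
  have e1 := fun t => deriv_eq_zero_of_far (h.dv t) fun x hx => (hR t x hx).1
  have e2 := fun t => deriv_eq_zero_of_far (h.du t) fun x hx => (hR t x hx).2.1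
  have e3 := fun t => deriv_eq_zero_of_far (h.dS t) fun x hx => (hR t x hx).2.2
  have e4 := fun t => deriv_eq_zero_of_far (h.dvx t) (e1 t)
  have e5 := fun t => deriv_eq_zero_of_far (h.dux t) (e2 t)
  have e6 := fun t => deriv_eq_zero_of_far (h.dSx t) (e3 t)
  exact ⟨R, fun t x hx => ⟨(hR t x hx).1, (hR t x hx).2.1, (hR t x hx).2.2, e1 t x hx, e2 t x hx,
    e3 t x hx, e4 t x hx, e5 t x hx, e6 t x hx⟩⟩

/-- The Lyapunov functional satisfies its production identity. -/
lemma CSol.lyapunov (ha : |a| ≤ 1) (hμ : 0 < μ) (hγ : 1 < γ) (hτ : 0 < τ)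
    (h : CSol a μ γ τ⁻¹ T F) (δ₁ δ₂ : ℝ) :
    ∃ R, Bal R T (F.lyd a μ γ τ δ₁ δ₂) (F.lyp a μ γ τ δ₁ δ₂) := by
  obtain ⟨R, hR⟩ := h.far_all
  have hl := h.lin ha hμ hτ
  have hv := h.v_pos
  have c1 := h.cbd
  have c2 := h.cvx
  have c3 := h.cux
  have c4 := h.cb
  have c5 := h.cSx
  have c6 := h.cm
  have c7 := h.cS
  have c8 := h.cSxx
  have c9 := h.cvxx
  have c10 := h.cmx
  have c11 := h.cuxx
  have c12 := h.cv
  have c13 := h.cu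
  have c14 := h.cn ha hμ hτ
  have c15 := h.cg₁x
  have c16 := h.cg₂x
  have c17 : Continuous fun p : ℝ × ℝ => F.nt a μ τ p.1 p.2 := hl.cnt
  have c18 : Continuous fun p : ℝ × ℝ => F.g₁ γ p.1 p.2 := hl.cg₁
  have c19 : Continuous fun p : ℝ × ℝ => F.g₂ a μ τ p.1 p.2 := hl.cg₂
  have c20 : Continuous fun p : ℝ × ℝ => PhiF γ (F.v p.1 p.2) := by
    have := continuous_rpow_of_pos c12 (fun p => hv p.1 p.2) (1 - γ)
    unfold PhiF
    fun_prop
  have c21 := continuous_rpow_of_pos c12 (fun p => hv p.1 p.2) (-γ)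
  have ut := fun t ht x => hl.tA t ht x
  have St := fun t ht x => hl.tG t ht x
  have B0 : Bal R T (F.ed₀ a μ γ τ) (F.pr₀ a μ τ) := by
    refine ⟨⟨by unfold Fields.ed₀; fun_prop, fun t x hx => ?_⟩,
      ⟨by unfold Fields.pr₀; fun_prop, fun t x hx => ?_⟩, fun {s t} hs hst ht => ?_⟩
    · obtain ⟨h1, h2, h3, -⟩ := hR t x hx
      simp [Fields.ed₀, h1, h2, h3, PhiF_one]
    · obtain ⟨h1, h2, h3, -⟩ := hR t x hx
      simp [Fields.pr₀, h3]
    · refine balance (R := R) (T := T)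
        (F := fun t x => (1 - F.v t x ^ (-γ)) * F.u t x + F.u t x * F.S t x)
        (Fx := fun t x => bF γ (F.v t x) * F.vx t x * F.u t x + (1 - F.v t x ^ (-γ)) * F.ux t x
          + (F.ux t x * F.S t x + F.u t x * F.Sx t x))
        (by unfold Fields.ed₀; fun_prop) (by fun_prop) (by unfold Fields.pr₀; fun_prop) ?_ ?_ ?_
        ?_ ?_ hs hst ht
      · intro t x hx
        obtain ⟨h1, h2, h3, -⟩ := hR t x hx
        simp [Fields.ed₀, h1, h2, h3, PhiF_one]
      · intro t x hx
        obtain ⟨h1, h2, h3, -⟩ := hR t x hx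
        simp [h2]
      · intro t x hx
        obtain ⟨h1, h2, h3, -⟩ := hR t x hx
        simp [Fields.pr₀, h3]
      · intro t x
        refine ((((hasDerivAt_pressure (h.dv t x) (hv t x)).const_sub 1).mul (h.du t x)).add
          ((h.du t x).mul (h.dS t x))).congr_deriv ?_
        ring
      · intro t ht x
        refine (((hasDerivAt_PhiF hγ (h.tv t ht x) (hv t x)).add
          (((h.tu t ht x).pow 2).const_mul (1 / 2))).add
          ((((hl.tn t ht x).mul ((h.tS' hτ t ht x).pow 2)).const_mul τ).const_mul
            (1 / 2))).congr_deriv ?_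
        have hn : F.n a μ τ t x * F.m a μ τ t x = 1 := hl.nm t x
        simp only [Pi.pow_apply, Fields.lin, Fields.pr₀]
        have e2 : ∀ z : ℝ, τ * (τ⁻¹ * z) = z := fun z => by field_simp
        have e3 : τ * (F.n a μ τ t x * (2 * F.S t x * (τ⁻¹ *
            (F.m a μ τ t x * F.ux t x - F.S t x)))) = 2 * F.S t x * F.ux t x
              - 2 * F.n a μ τ t x * F.S t x ^ 2 := by
          rw [show τ * (F.n a μ τ t x * (2 * F.S t x * (τ⁻¹ *
            (F.m a μ τ t x * F.ux t x - F.S t x)))) = 2 * F.S t x * F.n a μ τ t x *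
            (τ * (τ⁻¹ * (F.m a μ τ t x * F.ux t x - F.S t x))) by ring, e2]
          linear_combination 2 * F.S t x * F.ux t x * hn
        push_cast
        norm_num
        linear_combination (1 / 2) * e3
  have B1 : Bal R T ((F.lin a μ γ τ).ed τ) ((F.lin a μ γ τ).pr τ) := by
    refine ⟨⟨hl.ced, fun t x hx => ?_⟩, ⟨hl.cpr, fun t x hx => ?_⟩, fun {s t} hs hst ht =>
      hl.energy_one hτ.ne' (R := R) (fun t x hx => ?_) hs hst ht⟩ <;>
    obtain ⟨h1, h2, h3, h4, h5, h6, -⟩ := hR t x hx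
    · simp [LinFields.ed, Fields.lin, h4, h5, h6]
    · simp [LinFields.pr, Fields.lin, h4, h5, h6]
    · exact ⟨h4, h5, h6⟩
  have B2 : Bal R T ((F.lin a μ γ τ).edx τ)
      ((F.lin a μ γ τ).prx (F.g₁x γ) (F.g₂x a μ τ) (F.mx a μ τ) τ) := by
    refine ⟨⟨?_, fun t x hx => ?_⟩, ⟨?_, fun t x hx => ?_⟩, fun {s t} hs hst ht =>
      hl.energy_deriv (R := R) hτ.ne' h.cg₁x h.cg₂x h.cmx h.dg₁ h.dg₂ h.dm
        (fun t x hx => ?_) hs hst ht⟩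
    · simp only [LinFields.edx, Fields.lin]
      fun_prop
    · obtain ⟨h1, h2, h3, h4, h5, h6, h7, h8, h9⟩ := hR t x hx
      simp [LinFields.edx, Fields.lin, h7, h8, h9]
    · simp only [LinFields.prx, Fields.lin]
      fun_prop
    · obtain ⟨h1, h2, h3, h4, h5, h6, h7, h8, h9⟩ := hR t x hx
      simp [LinFields.prx, Fields.lin, h7, h8, h9]
    · obtain ⟨h1, h2, h3, h4, h5, h6, -⟩ := hR t x hx
      exact ⟨h4, h5, h6⟩
  have X : ∀ {f fx g gx p r : ℝ → ℝ → ℝ}, CF R f → CF R fx → CF R g → CF R gx → CF R p → CF R r →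
      (∀ t x, HasDerivAt (f t) (fx t x) x) → (∀ t x, HasDerivAt (g t) (gx t x) x) →
      (∀ t ∈ Ioo 0 T, ∀ x, HasDerivAt (fun s => f s x) (p t x) t) →
      (∀ t ∈ Ioo 0 T, ∀ x, HasDerivAt (fun s => g s x) (r t x) t) →
      Bal R T (fun t x => f t x * gx t x) (fun t x => p t x * gx t x - fx t x * r t x) := by
    intro f fx g gx p r hf hfx hg hgx hp hr df dg tf tg
    exact ⟨⟨hf.cont.mul hgx.cont, fun t x hx => by simp [hf.far t x hx]⟩,
      ⟨(hp.cont.mul hgx.cont).sub (hfx.cont.mul hr.cont), fun t x hx => by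
        simp [hp.far t x hx, hfx.far t x hx]⟩, fun hs hst ht => cross_identity hf.cont hfx.cont
        hg.cont hgx.cont hp.cont hr.cont df dg tf tg hf.far hp.far hs hst ht⟩
  have fu : CF R F.u := ⟨c13, fun t x hx => (hR t x hx).2.1⟩
  have fS : CF R F.S := ⟨c7, fun t x hx => (hR t x hx).2.2.1⟩
  have fvx : CF R F.vx := ⟨c2, fun t x hx => (hR t x hx).2.2.2.1⟩
  have fux : CF R F.ux := ⟨c3, fun t x hx => (hR t x hx).2.2.2.2.1⟩
  have fSx : CF R F.Sx := ⟨c5, fun t x hx => (hR t x hx).2.2.2.2.2.1⟩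
  have fvxx : CF R F.vxx := ⟨c9, fun t x hx => (hR t x hx).2.2.2.2.2.2.1⟩
  have fuxx : CF R F.uxx := ⟨c11, fun t x hx => (hR t x hx).2.2.2.2.2.2.2.1⟩
  have fSxx : CF R F.Sxx := ⟨c8, fun t x hx => (hR t x hx).2.2.2.2.2.2.2.2⟩
  have fw : CF R fun t x => F.v t x - 1 :=
    ⟨c12.sub continuous_const, fun t x hx => by simp [(hR t x hx).1]⟩
  have fut : CF R fun t x => F.Sx t x + bF γ (F.v t x) * F.vx t x :=
    ⟨by fun_prop, fun t x hx => by simp [fSx.far t x hx, fvx.far t x hx]⟩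
  have fuxt : CF R fun t x => F.Sxx t x + bF γ (F.v t x) * F.vxx t x + F.g₁ γ t x :=
    ⟨by fun_prop, fun t x hx => by
      simp [fSxx.far t x hx, fvxx.far t x hx, Fields.g₁, fvx.far t x hx]⟩
  have fSt : CF R fun t x => F.m a μ τ t x * F.ux t x - F.S t x :=
    ⟨by fun_prop, fun t x hx => by simp [fux.far t x hx, fS.far t x hx]⟩
  have fSxt : CF R fun t x =>
      F.mx a μ τ t x * F.ux t x + F.m a μ τ t x * F.uxx t x - F.Sx t x :=
    ⟨by fun_prop, fun t x hx => by simp [fux.far t x hx, fuxx.far t x hx, fSx.far t x hx]⟩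
  have tSτ : ∀ t ∈ Ioo 0 T, ∀ x, HasDerivAt (fun s => τ * F.S s x)
      (F.m a μ τ t x * F.ux t x - F.S t x) t := fun t ht x =>
    ((h.tS' hτ t ht x).const_mul τ).congr_deriv (by field_simp)
  have tSxτ : ∀ t ∈ Ioo 0 T, ∀ x, HasDerivAt (fun s => τ * F.Sx s x)
      (F.mx a μ τ t x * F.ux t x + F.m a μ τ t x * F.uxx t x - F.Sx t x) t := fun t ht x =>
    ((St t ht x).const_mul τ).congr_deriv (by
      simp only [Fields.lin, Fields.g₂]
      field_simp
      ring)
  have tux : ∀ t ∈ Ioo 0 T, ∀ x, HasDerivAt (fun s => F.ux s x)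
      (F.Sxx t x + bF γ (F.v t x) * F.vxx t x + F.g₁ γ t x) t := ut
  have X1 := X (fS.const_mul τ) (fSx.const_mul τ) fu fux fSt fut
    (fun t x => (h.dS t x).const_mul τ) h.du tSτ h.tu
  have X2 := X (fSx.const_mul τ) (fSxx.const_mul τ) fux fuxx fSxt fuxt
    (fun t x => (h.dSx t x).const_mul τ) h.dux tSxτ tux
  have X3 := X fu fux fw fvx fut fux h.du (fun t x => (h.dv t x).sub_const 1) h.tu
    (fun t ht x => (h.tv t ht x).sub_const 1)
  have X4 := X fux fuxx fvx fvxx fuxt fuxx h.dux h.dvx tux hl.tV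
  exact ⟨R, (((B0.add B1).add B2).add ((X1.add X2).const_mul (-δ₂))).add
    ((X3.add X4).const_mul (-δ₁))⟩

end

section

lemma nonneg_of_second_deriv {f f' f'' : ℝ → ℝ} {l r c : ℝ} (hc : c ∈ Ioo l r)
    (h1 : ∀ x ∈ Icc l r, HasDerivAt f (f' x) x) (h2 : ∀ x ∈ Icc l r, HasDerivAt f' (f'' x) x)
    (hpos : ∀ x ∈ Icc l r, 0 ≤ f'' x) (f0 : f c = 0) (f'0 : f' c = 0) : ∀ x ∈ Icc l r, 0 ≤ f x := by
  have hm : MonotoneOn f' (Icc l r) := monotoneOn_of_deriv_nonneg (convex_Icc l r)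
    (fun x hx => (h2 x hx).continuousAt.continuousWithinAt)
    (fun x hx => (h2 x (interior_subset hx)).differentiableAt.differentiableWithinAt)
    fun x hx => by rw [(h2 x (interior_subset hx)).deriv]; exact hpos x (interior_subset hx)
  intro x hx
  rcases le_total c x with h | h
  · have hs : Icc c r ⊆ Icc l r := Icc_subset_Icc hc.1.le le_rfl
    have := monotoneOn_of_deriv_nonneg (convex_Icc c r)
      (fun x hx => (h1 x (hs hx)).continuousAt.continuousWithinAt)
      (fun x hx => (h1 x (hs (interior_subset hx))).differentiableAt.differentiableWithinAt)
      (fun x hx => by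
        rw [(h1 x (hs (interior_subset hx))).deriv, ← f'0]
        exact hm ⟨hc.1.le, hc.2.le⟩ (hs (interior_subset hx)) (interior_subset hx).1)
    rw [← f0]
    exact this ⟨le_rfl, hc.2.le⟩ ⟨h, hx.2⟩ h
  · have hs : Icc l c ⊆ Icc l r := Icc_subset_Icc le_rfl hc.2.le
    have := antitoneOn_of_deriv_nonpos (convex_Icc l c)
      (fun x hx => (h1 x (hs hx)).continuousAt.continuousWithinAt)
      (fun x hx => (h1 x (hs (interior_subset hx))).differentiableAt.differentiableWithinAt)
      (fun x hx => by
        rw [(h1 x (hs (interior_subset hx))).deriv, ← f'0]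
        exact hm (hs (interior_subset hx)) ⟨hc.1.le, hc.2.le⟩ (interior_subset hx).2)
    rw [← f0]
    exact this ⟨hx.1, h⟩ ⟨hc.1.le, le_rfl⟩ h

/-- Uniform bounds for the coefficients near the rest state. -/
structure CoefBd (γ μ K : ℝ) : Prop where
  one_le : 1 ≤ K
  b_ge : ∀ v ∈ Icc (1 / 2 : ℝ) (3 / 2), 1 / K ≤ bF γ v
  b_le : ∀ v ∈ Icc (1 / 2 : ℝ) (3 / 2), bF γ v ≤ K
  bd : ∀ v ∈ Icc (1 / 2 : ℝ) (3 / 2), |bdF γ v| ≤ K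
  bdd : ∀ v ∈ Icc (1 / 2 : ℝ) (3 / 2), |bddF γ v| ≤ K
  phi_ge : ∀ v ∈ Icc (1 / 2 : ℝ) (3 / 2), 1 / (2 * K) * (v - 1) ^ 2 ≤ PhiF γ v
  phi_le : ∀ v ∈ Icc (1 / 2 : ℝ) (3 / 2), PhiF γ v ≤ K * (v - 1) ^ 2
  mu_le : 3 * μ ≤ K
  mu_ge : 3 / μ ≤ K

lemma exists_coefBd {γ μ : ℝ} (hγ : 1 < γ) (hμ : 0 < μ) : ∃ K, CoefBd γ μ K := by
  have hp : ∀ v ∈ Icc (1 / 2 : ℝ) (3 / 2), 0 < v := fun v hv => by linarith [hv.1]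
  have hr : ∀ p : ℝ, ContinuousOn (fun v : ℝ => v ^ p) (Icc (1 / 2 : ℝ) (3 / 2)) := fun p =>
    continuousOn_id.rpow_const fun v hv => Or.inl (hp v hv).ne'
  obtain ⟨K1, h1⟩ := isCompact_Icc.exists_bound_of_continuousOn (f := bF γ)
    ((hr (-γ - 1)).const_mul γ |> fun h => h)
  obtain ⟨K2, h2⟩ := isCompact_Icc.exists_bound_of_continuousOn (f := bdF γ)
    ((hr (-γ - 2)).const_mul (-(γ * (γ + 1))))
  obtain ⟨K3, h3⟩ := isCompact_Icc.exists_bound_of_continuousOn (f := bddF γ)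
    ((hr (-γ - 3)).const_mul (γ * (γ + 1) * (γ + 2)))
  obtain ⟨K4, h4⟩ := isCompact_Icc.exists_bound_of_continuousOn (f := fun v => (bF γ v)⁻¹)
    (((hr (-γ - 1)).const_mul γ).inv₀ fun v hv => (bF_pos hγ (hp v hv)).ne')
  have hb : ∀ v ∈ Icc (1 / 2 : ℝ) (3 / 2), 0 < bF γ v := fun v hv => bF_pos hγ (hp v hv)
  have m1 : (1 : ℝ) ∈ Icc (1 / 2 : ℝ) (3 / 2) := ⟨by norm_num, by norm_num⟩
  have p1 : 0 ≤ K1 := (norm_nonneg _).trans (h1 1 m1)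
  have p2 : 0 ≤ K2 := (norm_nonneg _).trans (h2 1 m1)
  have p3 : 0 ≤ K3 := (norm_nonneg _).trans (h3 1 m1)
  have p4 : 0 ≤ K4 := (norm_nonneg _).trans (h4 1 m1)
  have p5 : 0 < 3 / μ := by positivity
  set K := 1 + K1 + K2 + K3 + K4 + 3 * μ + 3 / μ with hK
  have K1le : 1 ≤ K := by linarith
  have bge : ∀ v ∈ Icc (1 / 2 : ℝ) (3 / 2), 1 / K ≤ bF γ v := fun v hv => by
    have h5 := h4 v hv
    rw [Real.norm_of_nonneg (inv_nonneg.2 (hb v hv).le)] at h5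
    have h6 : (bF γ v)⁻¹ ≤ K := by linarith
    rw [one_div]
    exact inv_le_of_inv_le₀ (hb v hv) h6
  have ble : ∀ v ∈ Icc (1 / 2 : ℝ) (3 / 2), bF γ v ≤ K := fun v hv => by
    have h5 := (le_abs_self _).trans (h1 v hv)
    linarith
  have hphi : ∀ v ∈ Icc (1 / 2 : ℝ) (3 / 2), HasDerivAt (PhiF γ) (1 - v ^ (-γ)) v := fun v hv =>
    (hasDerivAt_PhiF hγ (hasDerivAt_id v) (hp v hv)).congr_deriv (by simp)
  have hpr : ∀ v ∈ Icc (1 / 2 : ℝ) (3 / 2),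
      HasDerivAt (fun v : ℝ => 1 - v ^ (-γ)) (bF γ v) v := fun v hv =>
    ((hasDerivAt_pressure (hasDerivAt_id v) (hp v hv)).const_sub 1).congr_deriv (by simp)
  have hsq : ∀ c v : ℝ, HasDerivAt (fun v : ℝ => c * (v - 1) ^ 2) (2 * c * (v - 1)) v := fun c v =>
    ((((hasDerivAt_id v).sub_const 1).pow 2).const_mul c).congr_deriv (by simp; ring)
  have hli : ∀ c v : ℝ, HasDerivAt (fun v : ℝ => 2 * c * (v - 1)) (2 * c) v := fun c v =>
    (((hasDerivAt_id v).sub_const 1).const_mul (2 * c)).congr_deriv (by simp)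
  have hc : (1 : ℝ) ∈ Ioo (1 / 2 : ℝ) (3 / 2) := ⟨by norm_num, by norm_num⟩
  refine ⟨K, K1le, bge, ble, fun v hv => (h2 v hv).trans (by linarith),
    fun v hv => (h3 v hv).trans (by linarith), fun v hv => ?_, fun v hv => ?_, by linarith,
    by linarith⟩
  · have := nonneg_of_second_deriv hc
      (fun v hv => (hphi v hv).sub (hsq (1 / (2 * K)) v))
      (fun v hv => (hpr v hv).sub (hli (1 / (2 * K)) v))
      (fun v hv => by
        have := bge v hv
        have h6 : 2 * (1 / (2 * K)) = 1 / K := by field_simp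
        linarith) (by simp [PhiF_one]) (by simp) v hv
    simp only [Pi.sub_apply] at this
    linarith
  · have := nonneg_of_second_deriv hc
      (fun v hv => (hsq K v).sub (hphi v hv))
      (fun v hv => (hli K v).sub (hpr v hv))
      (fun v hv => by
        have := ble v hv
        linarith) (by simp [PhiF_one]) (by simp) v hv
    simp only [Pi.sub_apply] at this
    linarith

/-- The dissipative quadratic form at one order of differentiation. -/
lemma quad_form_le {K m b τ δ₁ δ₂ S Sx ux vx : ℝ} (hK : 1 ≤ K) (hm : 1 / K ≤ m) (hb : 1 / K ≤ b)
    (hb' : b ≤ K) (hτ : 0 < τ) (hτ1 : τ ≤ 1) (h2 : δ₂ = 1 / (24 * K ^ 5))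
    (h1 : δ₁ = δ₂ / (4 * K)) :
    -δ₂ * ((m * ux - S) * ux - τ * Sx * (Sx + b * vx))
      + -δ₁ * ((Sx + b * vx) * vx - ux * ux)
      ≤ -(δ₁ / (2 * K)) * (ux ^ 2 + vx ^ 2) + 1 / (4 * K) * (S ^ 2 + Sx ^ 2) := by
  have K0 : 0 < K := by linarith
  have d2 : 0 < δ₂ := by rw [h2]; positivity
  have d1 : 0 < δ₁ := by rw [h1]; positivity
  have e1 : δ₂ * (S * ux) ≤ δ₂ * (ux ^ 2 / (4 * K) + K * S ^ 2) := by
    gcongr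
    have : ux ^ 2 / (4 * K) + K * S ^ 2 - S * ux = (ux / (2 * K) - S) ^ 2 * K := by
      field_simp; ring
    nlinarith [mul_nonneg (sq_nonneg (ux / (2 * K) - S)) K0.le]
  have e2 : δ₂ * (m * ux ^ 2) ≥ δ₂ * (1 / K * ux ^ 2) := by gcongr
  have e3 : δ₁ * (b * vx ^ 2) ≥ δ₁ * (1 / K * vx ^ 2) := by gcongr
  have e4 : τ * Sx ^ 2 ≤ Sx ^ 2 := by nlinarith [sq_nonneg Sx]
  have hb0 : 0 < b := lt_of_lt_of_le (by positivity) hb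
  have e5 : δ₂ * (τ * b * (Sx * vx)) ≤ δ₁ / (4 * K) * vx ^ 2 + 4 * K ^ 4 * δ₂ * Sx ^ 2 := by
    have s1 : τ * b ≤ K := by nlinarith
    have s2 : τ * b * (Sx * vx) ≤ K * |Sx * vx| := by
      calc τ * b * (Sx * vx) ≤ τ * b * |Sx * vx| := by gcongr; exact le_abs_self _
        _ ≤ K * |Sx * vx| := by gcongr
    have s3 : K * |Sx * vx| ≤ vx ^ 2 / (16 * K ^ 2) + 4 * K ^ 4 * Sx ^ 2 := by
      rw [abs_mul]
      have : vx ^ 2 / (16 * K ^ 2) + 4 * K ^ 4 * Sx ^ 2 - K * (|Sx| * |vx|)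
          = (|vx| / (4 * K) - 2 * K ^ 2 * |Sx|) ^ 2 := by
        rw [← sq_abs vx, ← sq_abs Sx]; field_simp; ring
      nlinarith [sq_nonneg (|vx| / (4 * K) - 2 * K ^ 2 * |Sx|)]
    have s4 := mul_le_mul_of_nonneg_left (s2.trans s3) d2.le
    refine s4.trans (le_of_eq ?_)
    rw [h1]; field_simp; ring
  have e6 : δ₁ * (-(Sx * vx)) ≤ δ₁ / (4 * K) * vx ^ 2 + δ₁ * K * Sx ^ 2 := by
    have : vx ^ 2 / (4 * K) + K * Sx ^ 2 + Sx * vx = (vx / (2 * K) + Sx) ^ 2 * K := by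
      field_simp; ring
    have h := mul_nonneg (sq_nonneg (vx / (2 * K) + Sx)) K0.le
    rw [← this] at h
    have := mul_nonneg d1.le h
    have h3 : δ₁ / (4 * K) * vx ^ 2 = δ₁ * (vx ^ 2 / (4 * K)) := by ring
    rw [h3]
    linarith
  have f1 : δ₂ * K ≤ 1 / (4 * K) := by
    rw [h2, div_mul_eq_mul_div, div_le_div_iff₀ (by positivity) (by positivity)]
    have : K ^ 2 ≤ K ^ 5 := pow_le_pow_right₀ hK (by norm_num)
    nlinarith
  have f2 : δ₂ + 4 * K ^ 4 * δ₂ + δ₁ * K ≤ 1 / (4 * K) := by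
    have g1 : δ₁ * K = δ₂ / 4 := by rw [h1]; field_simp
    have g2 : 1 ≤ K ^ 4 := one_le_pow₀ hK
    have g3 : δ₂ * (6 * K ^ 4) = 1 / (4 * K) := by rw [h2]; field_simp; norm_num
    nlinarith
  have f3 := mul_le_mul_of_nonneg_right f1 (sq_nonneg S)
  have f4 := mul_le_mul_of_nonneg_right f2 (sq_nonneg Sx)
  have f5 : δ₁ * ux ^ 2 = δ₂ * (ux ^ 2 / (4 * K)) := by rw [h1]; ring
  have f6 : δ₁ / (2 * K) * ux ^ 2 ≤ δ₂ * (1 / K * ux ^ 2) - 2 * (δ₂ * (ux ^ 2 / (4 * K))) := by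
    have : δ₁ / (2 * K) ≤ δ₂ / (2 * K) := by
      gcongr
      rw [h1]
      exact div_le_self d2.le (by linarith)
    have h7 := mul_le_mul_of_nonneg_right this (sq_nonneg ux)
    refine h7.trans (le_of_eq ?_)
    field_simp; ring
  have f7 : δ₁ / (2 * K) * vx ^ 2 = δ₁ * (1 / K * vx ^ 2) - 2 * (δ₁ / (4 * K) * vx ^ 2) := by
    field_simp; ring
  have f8 := mul_le_mul_of_nonneg_left e4 d2.le
  linarith

end

section

lemma abs_mul_le_mul {x y A B : ℝ} (hx : |x| ≤ A) (hy : |y| ≤ B) : |x * y| ≤ A * B := by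
  rw [abs_mul]
  exact mul_le_mul hx hy (abs_nonneg _) ((abs_nonneg _).trans hx)

namespace Fields

variable (F : Fields) (τ : ℝ)

/-- Density of the squared norms in the energy. -/
def Yd (t x : ℝ) : ℝ := (F.v t x - 1) ^ 2 + F.vx t x ^ 2 + F.vxx t x ^ 2
  + (F.u t x ^ 2 + F.ux t x ^ 2 + F.uxx t x ^ 2)
  + τ * (F.S t x ^ 2 + F.Sx t x ^ 2 + F.Sxx t x ^ 2)

/-- Density of the squared norms in the dissipation. -/
def dens (t x : ℝ) : ℝ := F.vx t x ^ 2 + F.vxx t x ^ 2 + (F.ux t x ^ 2 + F.uxx t x ^ 2)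
  + (F.S t x ^ 2 + F.Sx t x ^ 2 + F.Sxx t x ^ 2)

end Fields

variable {a μ γ τ T K : ℝ} {F : Fields}

lemma CoefBd.m_mem (hK : CoefBd γ μ K) (ha : |a| ≤ 1) (hμ : 0 < μ) (hτ : 0 < τ)
    (h : CSol a μ γ τ⁻¹ T F) (t x : ℝ) : F.m a μ τ t x ∈ Icc (1 / K) K := by
  have hP := h.P_mem ha hτ t x
  have hv := h.v_mem t x
  have hv0 := h.v_pos t x
  have K0 : 0 < K := by linarith [hK.one_le]
  rw [Fields.m]
  constructor
  · rw [le_div_iff₀ hv0]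
    have h1 : 1 / K ≤ μ / 3 := by
      have := hK.mu_ge
      rw [div_le_iff₀ hμ] at this
      rw [div_le_div_iff₀ K0 (by norm_num)]
      linarith
    calc 1 / K * F.v t x ≤ μ / 3 * (3 / 2) := by gcongr; exact hv.2
      _ ≤ _ := by linarith [hP.1]
  · rw [div_le_iff₀ hv0]
    have := hK.mu_le
    nlinarith [hP.2, hv.1]

lemma CoefBd.n_mem (hK : CoefBd γ μ K) (ha : |a| ≤ 1) (hμ : 0 < μ) (hτ : 0 < τ)
    (h : CSol a μ γ τ⁻¹ T F) (t x : ℝ) : F.n a μ τ t x ∈ Icc (1 / K) K := by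
  have hm := hK.m_mem ha hμ hτ h t x
  have hnm : F.n a μ τ t x * F.m a μ τ t x = 1 := (h.lin ha hμ hτ).nm t x
  have K0 : 0 < K := by linarith [hK.one_le]
  have m0 : 0 < F.m a μ τ t x := lt_of_lt_of_le (by positivity) hm.1
  have : F.n a μ τ t x = 1 / F.m a μ τ t x := by rw [eq_div_iff m0.ne']; exact hnm
  rw [this]
  constructor
  · exact one_div_le_one_div_of_le m0 hm.2
  · rw [div_le_iff₀ m0]
    have := hm.1
    rw [div_le_iff₀ K0] at this
    linarith

lemma two_mul_abs_le (x y : ℝ) : |x * y| ≤ 1 / 2 * (x ^ 2 + y ^ 2) := by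
  rw [abs_mul, ← sq_abs x, ← sq_abs y]
  nlinarith [sq_nonneg (|x| - |y|)]

lemma delta_bounds {δ₁ δ₂ : ℝ} (hK : 1 ≤ K) (h2 : δ₂ = 1 / (24 * K ^ 5))
    (h1 : δ₁ = δ₂ / (4 * K)) : 0 < δ₁ ∧ 0 < δ₂ ∧ δ₁ ≤ 1 / 24 ∧ δ₂ ≤ 1 / 24 ∧
      δ₁ + δ₂ ≤ 1 / (12 * K) := by
  have K0 : 0 < K := by linarith
  have d2 : 0 < δ₂ := by rw [h2]; positivity
  have d1 : 0 < δ₁ := by rw [h1]; positivity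
  have h12 : δ₁ ≤ δ₂ := by rw [h1]; exact div_le_self d2.le (by linarith)
  have h24 : δ₂ ≤ 1 / (24 * K) := by
    rw [h2]
    have : K ^ 1 ≤ K ^ 5 := pow_le_pow_right₀ hK (by norm_num)
    rw [pow_one] at this
    gcongr
  have h25 : 1 / (24 * K) ≤ 1 / 24 := by gcongr; linarith
  refine ⟨d1, d2, by linarith, by linarith, ?_⟩
  have : 1 / (12 * K) = 2 * (1 / (24 * K)) := by field_simp; norm_num
  linarith

/-- The Lyapunov density is equivalent to the energy density. -/
lemma CSol.lyd_mem {δ₁ δ₂ : ℝ} (hK : CoefBd γ μ K) (ha : |a| ≤ 1) (hμ : 0 < μ) (hτ : 0 < τ)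
    (hτ1 : τ ≤ 1) (h : CSol a μ γ τ⁻¹ T F) (h2 : δ₂ = 1 / (24 * K ^ 5)) (h1 : δ₁ = δ₂ / (4 * K))
    (t x : ℝ) : F.lyd a μ γ τ δ₁ δ₂ t x ∈ Icc (1 / (4 * K) * F.Yd τ t x) (2 * K * F.Yd τ t x) := by
  obtain ⟨d1, d2, -, -, d5⟩ := delta_bounds hK.one_le h2 h1
  have K1 := hK.one_le
  have K0 : 0 < K := by linarith
  have hn := hK.n_mem ha hμ hτ h t x
  have hv := h.v_mem t x
  have hbg := hK.b_ge _ hv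
  have hbl := hK.b_le _ hv
  have hpg := hK.phi_ge _ hv
  have hpl := hK.phi_le _ hv
  simp only [Fields.lyd, Fields.ed₀, LinFields.ed, LinFields.edx, Fields.lin, Fields.Yd]
  generalize bF γ (F.v t x) = b at *
  generalize F.n a μ τ t x = n at *
  generalize PhiF γ (F.v t x) = Ph at *
  generalize F.v t x - 1 = w at *
  generalize F.u t x = u, F.S t x = S, F.vx t x = vx, F.ux t x = ux, F.Sx t x = Sx,
    F.vxx t x = vxx, F.uxx t x = uxx, F.Sxx t x = Sxx at *
  clear hv h hK
  have q : ∀ {c z : ℝ}, 1 / K ≤ c → c ≤ K → 1 / K * z ^ 2 ≤ c * z ^ 2 ∧ c * z ^ 2 ≤ K * z ^ 2 :=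
    fun {c z} ha hb => ⟨mul_le_mul_of_nonneg_right ha (sq_nonneg z),
      mul_le_mul_of_nonneg_right hb (sq_nonneg z)⟩
  have K2 : 1 / K ≤ 1 := by rw [div_le_one K0]; exact K1
  have q1 := q (z := vx) hbg hbl
  have q2 := q (z := vxx) hbg hbl
  have q3 := q (z := S) hn.1 hn.2
  have q4 := q (z := Sx) hn.1 hn.2
  have q5 := q (z := Sxx) hn.1 hn.2
  have q6 := q (c := 1) (z := u) K2 K1
  have q7 := q (c := 1) (z := ux) K2 K1
  have q8 := q (c := 1) (z := uxx) K2 K1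
  have m3a := mul_le_mul_of_nonneg_left q3.1 hτ.le
  have m3b := mul_le_mul_of_nonneg_left q3.2 hτ.le
  have m4a := mul_le_mul_of_nonneg_left q4.1 hτ.le
  have m4b := mul_le_mul_of_nonneg_left q4.2 hτ.le
  have m5a := mul_le_mul_of_nonneg_left q5.1 hτ.le
  have m5b := mul_le_mul_of_nonneg_left q5.2 hτ.le
  have c0 : ∀ y z : ℝ, |τ * y * z| ≤ 1 / 2 * (τ * y ^ 2 + z ^ 2) := by
    intro y z
    rw [mul_assoc, abs_mul, abs_of_pos hτ]
    have e1 := mul_le_mul_of_nonneg_left (two_mul_abs_le y z) hτ.le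
    nlinarith [mul_le_mul_of_nonneg_right hτ1 (sq_nonneg z)]
  have c1 := abs_le.1 (c0 S ux)
  have c2 := abs_le.1 (c0 Sx uxx)
  have c3 := abs_le.1 (two_mul_abs_le u vx)
  have c4 := abs_le.1 (two_mul_abs_le ux vxx)
  obtain ⟨Y, hY⟩ : ∃ Y, Y = w ^ 2 + vx ^ 2 + vxx ^ 2 + (u ^ 2 + ux ^ 2 + uxx ^ 2)
      + τ * (S ^ 2 + Sx ^ 2 + Sxx ^ 2) := ⟨_, rfl⟩
  rw [← hY]
  have Y0 : 0 ≤ Y := by rw [hY]; positivity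
  have pS : 0 ≤ τ * S ^ 2 := by positivity
  have pSx : 0 ≤ τ * Sx ^ 2 := by positivity
  have pSxx : 0 ≤ τ * Sxx ^ 2 := by positivity
  have hY' : Y = w ^ 2 + vx ^ 2 + vxx ^ 2 + (u ^ 2 + ux ^ 2 + uxx ^ 2)
      + (τ * S ^ 2 + τ * Sx ^ 2 + τ * Sxx ^ 2) := by rw [hY]; ring
  have x2 : |τ * S * ux + τ * Sx * uxx| ≤ Y := by
    rw [abs_le, hY']; constructor <;>
    linarith only [sq_nonneg w, sq_nonneg vx, sq_nonneg vxx, sq_nonneg u, sq_nonneg ux,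
      sq_nonneg uxx, pS, pSx, pSxx, c1.1, c1.2, c2.1, c2.2, c3.1, c3.2, c4.1, c4.2]
  have x1 : |u * vx + ux * vxx| ≤ Y := by
    rw [abs_le, hY']; constructor <;>
    linarith only [sq_nonneg w, sq_nonneg vx, sq_nonneg vxx, sq_nonneg u, sq_nonneg ux,
      sq_nonneg uxx, pS, pSx, pSxx, c1.1, c1.2, c2.1, c2.2, c3.1, c3.2, c4.1, c4.2]
  have z2 := abs_le.1 (abs_mul_le_mul (abs_of_pos d2).le x2)
  have z1 := abs_le.1 (abs_mul_le_mul (abs_of_pos d1).le x1)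
  have z3 := mul_le_mul_of_nonneg_right d5 Y0
  have e1 : 1 / (4 * K) * Y = 1 / (2 * K) * Y - 3 * (1 / (12 * K) * Y) := by field_simp; ring
  have e2 : 1 / (2 * K) * Y = 1 / (2 * K) * w ^ 2 + 1 / 2 * (1 / K * u ^ 2 + 1 / K * ux ^ 2
      + 1 / K * uxx ^ 2 + 1 / K * vx ^ 2 + 1 / K * vxx ^ 2 + τ * (1 / K * S ^ 2)
      + τ * (1 / K * Sx ^ 2) + τ * (1 / K * Sxx ^ 2)) := by rw [hY]; field_simp; ring
  have e3 : 1 / (12 * K) * Y ≤ K * Y := by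
    gcongr
    rw [div_le_iff₀ (by positivity)]
    nlinarith only [K1]
  have e4 : 0 ≤ 1 / (12 * K) * Y := by positivity
  have e5 : K * Y = K * w ^ 2 + (K * u ^ 2 + K * ux ^ 2
      + K * uxx ^ 2 + K * vx ^ 2 + K * vxx ^ 2 + τ * (K * S ^ 2)
      + τ * (K * Sx ^ 2) + τ * (K * Sxx ^ 2)) := by rw [hY]; ring
  have r0 : ∀ {z : ℝ}, 0 ≤ K * z ^ 2 := by intro z; positivity
  have r1 : ∀ {z : ℝ}, 0 ≤ τ * (K * z ^ 2) := by intro z; positivity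
  constructor
  · linarith only [hpg, e4, e1, e2, z3, m3a, m4a, m5a, q1.1, q2.1, q6.1, q7.1, q8.1,
      z1.2, z2.2]
  · linarith only [hpl, e3, e4, e5, z3, m3b, m4b, m5b, q1.2, q2.2, q6.2, q7.2, q8.2,
      z1.1, z2.1, @r0 u, @r0 ux, @r0 uxx, @r0 vx, @r0 vxx,
      @r1 S, @r1 Sx, @r1 Sxx]

end

section

lemma production_error_le {K ε N τ n nt bt bx mx g₁ g₂ g₁x g₂x δ₁ δ₂ S Sx Sxx ux uxx vx vxx : ℝ}
    (hK : 1 ≤ K) (hε : 0 ≤ ε) (hn : |n| ≤ K) (hnt : |τ * nt| ≤ 7 * K ^ 3 * ε)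
    (hbt : |bt| ≤ K * ε) (hbx : |bx| ≤ K * ε) (hmx : |mx| ≤ 6 * K * ε) (hg₁ : |g₁| ≤ K * ε * N)
    (hg₂ : |g₂| ≤ 6 * K * ε * N) (hg₁x : |g₁x| ≤ 3 * K * ε * N) (hg₂x : |g₂x| ≤ 36 * K * ε * N)
    (hδ₁ : |δ₁| ≤ 1) (hδ₂ : |δ₂| ≤ 1) (hS : |S| ≤ N) (hSx : |Sx| ≤ N) (hSxx : |Sxx| ≤ N)
    (hSxx' : |τ * Sxx| ≤ N) (hux : |ux| ≤ N) (huxx : |uxx| ≤ N) (hvx : |vx| ≤ N)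
    (hvxx : |vxx| ≤ N) :
    1 / 2 * (τ * nt * (S * S)) + 1 / 2 * (bt * (vx * vx)) - bx * (vx * ux) + ux * g₁
      + n * (Sx * g₂) + 1 / 2 * (τ * nt * (Sx * Sx)) + 1 / 2 * (bt * (vxx * vxx)) + uxx * g₁x
      + n * (Sxx * g₂x) + n * (Sxx * (mx * uxx)) + 1 / 2 * (τ * nt * (Sxx * Sxx))
      - δ₂ * (mx * (ux * uxx)) + δ₂ * (τ * Sxx * g₁) - δ₁ * (g₁ * vxx)
      ≤ 80 * K ^ 3 * ε * N ^ 2 := by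
  have t1 := abs_le.1 (abs_mul_le_mul hnt (abs_mul_le_mul hS hS))
  have t2 := abs_le.1 (abs_mul_le_mul hbt (abs_mul_le_mul hvx hvx))
  have t3 := abs_le.1 (abs_mul_le_mul hbx (abs_mul_le_mul hvx hux))
  have t4 := abs_le.1 (abs_mul_le_mul hux hg₁)
  have t5 := abs_le.1 (abs_mul_le_mul hn (abs_mul_le_mul hSx hg₂))
  have t6 := abs_le.1 (abs_mul_le_mul hnt (abs_mul_le_mul hSx hSx))
  have t7 := abs_le.1 (abs_mul_le_mul hbt (abs_mul_le_mul hvxx hvxx))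
  have t8 := abs_le.1 (abs_mul_le_mul huxx hg₁x)
  have t9 := abs_le.1 (abs_mul_le_mul hn (abs_mul_le_mul hSxx hg₂x))
  have t10 := abs_le.1 (abs_mul_le_mul hn (abs_mul_le_mul hSxx (abs_mul_le_mul hmx huxx)))
  have t11 := abs_le.1 (abs_mul_le_mul hnt (abs_mul_le_mul hSxx hSxx))
  have t12 := abs_le.1 (abs_mul_le_mul hδ₂ (abs_mul_le_mul hmx (abs_mul_le_mul hux huxx)))
  have t13 := abs_le.1 (abs_mul_le_mul hδ₂ (abs_mul_le_mul hSxx' hg₁))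
  have t14 := abs_le.1 (abs_mul_le_mul hδ₁ (abs_mul_le_mul hg₁ hvxx))
  have z : 0 ≤ ε * N ^ 2 := by positivity
  have k1 : K * (ε * N ^ 2) ≤ K ^ 3 * (ε * N ^ 2) := by
    gcongr
    exact le_self_pow₀ hK (by norm_num)
  have k2 : K ^ 2 * (ε * N ^ 2) ≤ K ^ 3 * (ε * N ^ 2) := by
    gcongr
    norm_num
  have k0 : 0 ≤ K ^ 3 * (ε * N ^ 2) := by positivity
  linarith only [t1.2, t2.2, t3.1, t4.2, t5.2, t6.2, t7.2, t8.2, t9.2, t10.2, t11.2, t12.1, t13.2,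
    t14.1, k1, k2, k0]

/-- Pointwise smallness of the first derivatives. -/
structure SmallAt (F : Fields) (τ ε t x : ℝ) : Prop where
  vx : |F.vx t x| ≤ ε
  ux : |F.ux t x| ≤ ε
  S : |τ * F.S t x| ≤ ε
  Sx : |τ * F.Sx t x| ≤ ε

variable {a μ γ τ T K : ℝ} {F : Fields}

/-- Dissipation inequality for the Lyapunov functional. -/
lemma CSol.lyp_le {δ₁ δ₂ ε t x : ℝ} (hK : CoefBd γ μ K) (ha : |a| ≤ 1) (hμ : 0 < μ) (hτ : 0 < τ)
    (hτ1 : τ ≤ 1) (h : CSol a μ γ τ⁻¹ T F) (h2 : δ₂ = 1 / (24 * K ^ 5)) (h1 : δ₁ = δ₂ / (4 * K))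
    (hε : 0 ≤ ε) (hε1 : ε ≤ 1) (hs : SmallAt F τ ε t x) :
    F.lyp a μ γ τ δ₁ δ₂ t x ≤ (-(δ₁ / (2 * K)) + 560 * K ^ 3 * ε) * F.dens t x := by
  obtain ⟨d1, d2, d3, d4, d5⟩ := delta_bounds hK.one_le h2 h1
  have K1 := hK.one_le
  have K0 : 0 < K := by linarith
  have hn := hK.n_mem ha hμ hτ h t x
  have hm := hK.m_mem ha hμ hτ h t x
  have hv := h.v_mem t x
  have hP := h.P_mem ha hτ t x
  have P0 := h.P_pos ha hμ hτ t x
  obtain ⟨N, hN⟩ : ∃ N, N = |F.vx t x| + |F.vxx t x| + |F.ux t x| + |F.uxx t x| + |F.S t x|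
    + |F.Sx t x| + |F.Sxx t x| := ⟨_, rfl⟩
  have a1 := abs_nonneg (F.vx t x)
  have a2 := abs_nonneg (F.vxx t x)
  have a3 := abs_nonneg (F.ux t x)
  have a4 := abs_nonneg (F.uxx t x)
  have a5 := abs_nonneg (F.S t x)
  have a6 := abs_nonneg (F.Sx t x)
  have a7 := abs_nonneg (F.Sxx t x)
  have N0 : 0 ≤ N := by rw [hN]; positivity
  have b1 : |F.vx t x| ≤ N := by linarith
  have b2 : |F.vxx t x| ≤ N := by linarith
  have b3 : |F.ux t x| ≤ N := by linarith
  have b4 : |F.uxx t x| ≤ N := by linarith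
  have b5 : |F.S t x| ≤ N := by linarith
  have b6 : |F.Sx t x| ≤ N := by linarith
  have b7 : |F.Sxx t x| ≤ N := by linarith
  have tb : |τ| ≤ 1 := by rwa [abs_of_pos hτ]
  have b8 : |τ * F.Sxx t x| ≤ N := (abs_mul_le_mul tb b7).trans_eq (one_mul _)
  have b9 : |τ * F.Sx t x| ≤ N := (abs_mul_le_mul tb b6).trans_eq (one_mul _)
  have hNN : N ^ 2 ≤ 7 * F.dens t x := by
    rw [Fields.dens, ← sq_abs (F.vx t x), ← sq_abs (F.vxx t x), ← sq_abs (F.ux t x),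
      ← sq_abs (F.uxx t x), ← sq_abs (F.S t x), ← sq_abs (F.Sx t x), ← sq_abs (F.Sxx t x), hN]
    have := sq_sum_le_card_mul_sum_sq (s := Finset.univ) (f :=
      ![|F.vx t x|, |F.vxx t x|, |F.ux t x|, |F.uxx t x|, |F.S t x|, |F.Sx t x|, |F.Sxx t x|])
    simp only [Fin.sum_univ_succ, Finset.card_univ, Fintype.card_fin, Matrix.cons_val_zero,
      Matrix.cons_val_succ, Finset.univ_eq_empty, Finset.sum_empty, Matrix.cons_val_fin_one] at this
    push_cast at this
    ring_nf at this ⊢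
    linarith only [this]
  have va : |F.v t x| ≤ 3 / 2 := abs_le.2 ⟨by linarith [hv.1], hv.2⟩
  have vi : |(F.v t x)⁻¹| ≤ 2 := by
    rw [abs_inv, abs_of_pos (h.v_pos t x), inv_le_comm₀ (h.v_pos t x) (by norm_num)]
    linarith [hv.1]
  have Pi : |(F.P a μ τ t x)⁻¹| ≤ K := by
    rw [abs_inv, abs_of_pos P0]
    refine le_trans ?_ hK.mu_ge
    rw [inv_le_comm₀ P0 (by positivity), inv_div]
    linarith [hP.1]
  have ma : |F.m a μ τ t x| ≤ K := by
    rw [abs_of_nonneg (le_trans (by positivity) hm.1)]; exact hm.2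
  have na : |F.n a μ τ t x| ≤ K := by
    rw [abs_of_nonneg (le_trans (by positivity) hn.1)]; exact hn.2
  have a2 : |2 * a| ≤ 2 := by rw [abs_mul, abs_two]; linarith
  have hbd := hK.bd _ hv
  have hbdd := hK.bdd _ hv
  have hnt : |τ * F.nt a μ τ t x| ≤ 7 * K ^ 3 * ε := by
    have e : τ * F.nt a μ τ t x = τ * (F.ux t x * (F.P a μ τ t x)⁻¹)
      - 2 * a * (F.v t x * ((τ * (F.m a μ τ t x * F.ux t x) - τ * F.S t x) *
        ((F.P a μ τ t x)⁻¹ * (F.P a μ τ t x)⁻¹))) := by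
      rw [Fields.nt]; field_simp
    have f1 := abs_mul_le_mul tb (abs_mul_le_mul hs.ux Pi)
    have f2 := abs_mul_le_mul tb (abs_mul_le_mul ma hs.ux)
    have f3 := (abs_sub _ _).trans (add_le_add f2 hs.S)
    have f4 := abs_mul_le_mul a2 (abs_mul_le_mul va (abs_mul_le_mul f3 (abs_mul_le_mul Pi Pi)))
    rw [e]
    refine ((abs_sub _ _).trans (add_le_add f1 f4)).trans ?_
    have k1 : K * ε ≤ K ^ 3 * ε := by
      gcongr
      exact le_self_pow₀ K1 (by norm_num)
    have k2 : K ^ 2 * ε ≤ K ^ 3 * ε := by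
      gcongr
      · norm_num
    linarith only [k1, k2]
  have mxe : F.mx a μ τ t x = (2 * a * (τ * F.Sx t x) - F.m a μ τ t x * F.vx t x) * (F.v t x)⁻¹ := by
    rw [Fields.mx, div_eq_mul_inv]; ring
  have hmx : |F.mx a μ τ t x| ≤ 6 * K * ε := by
    rw [mxe]
    refine (abs_mul_le_mul ((abs_sub _ _).trans (add_le_add (abs_mul_le_mul a2 hs.Sx)
      (abs_mul_le_mul ma hs.vx))) vi).trans ?_
    linarith [mul_le_mul_of_nonneg_right K1 hε]
  have hmxN : |F.mx a μ τ t x| ≤ 6 * K * N := by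
    rw [mxe]
    refine (abs_mul_le_mul ((abs_sub _ _).trans (add_le_add (abs_mul_le_mul a2 b9)
      (abs_mul_le_mul ma b1))) vi).trans ?_
    linarith [mul_le_mul_of_nonneg_right K1 N0]
  have hmxx : |F.mxx a μ τ t x| ≤ 30 * K * N := by
    have e : F.mxx a μ τ t x = (2 * a * (τ * F.Sxx t x) - F.m a μ τ t x * F.vxx t x
        - 2 * (F.mx a μ τ t x * F.vx t x)) * (F.v t x)⁻¹ := by
      rw [Fields.mxx, div_eq_mul_inv]; ring
    rw [e]
    have e1 := abs_mul_le_mul hmxN (hs.vx.trans hε1)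
    refine (abs_mul_le_mul ((abs_sub _ _).trans (add_le_add ((abs_sub _ _).trans (add_le_add
      (abs_mul_le_mul a2 b8) (abs_mul_le_mul ma b2))) (abs_mul_le_mul abs_two.le e1))) vi).trans ?_
    linarith [mul_le_mul_of_nonneg_right K1 N0]
  have hg₁ : |F.g₁ γ t x| ≤ K * ε * N := by
    rw [Fields.g₁, pow_two]
    exact (abs_mul_le_mul hbd (abs_mul_le_mul hs.vx b1)).trans_eq (by ring)
  have hg₂ : |F.g₂ a μ τ t x| ≤ 6 * K * ε * N := abs_mul_le_mul hmx b3
  have hg₁x : |F.g₁x γ t x| ≤ 3 * K * ε * N := by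
    have e : F.g₁x γ t x = bddF γ (F.v t x) * (F.vx t x * (F.vx t x * F.vx t x))
      + 2 * (bdF γ (F.v t x) * (F.vx t x * F.vxx t x)) := by rw [Fields.g₁x]; ring
    rw [e]
    refine ((abs_add_le _ _).trans (add_le_add (abs_mul_le_mul hbdd (abs_mul_le_mul hs.vx
      (abs_mul_le_mul (hs.vx.trans hε1) b1))) (abs_mul_le_mul abs_two.le (abs_mul_le_mul hbd
      (abs_mul_le_mul hs.vx b2))))).trans (le_of_eq (by ring))
  have hg₂x : |F.g₂x a μ τ t x| ≤ 36 * K * ε * N := by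
    rw [Fields.g₂x]
    exact ((abs_add_le _ _).trans (add_le_add (abs_mul_le_mul hmxx hs.ux)
      (abs_mul_le_mul hmx b4))).trans (le_of_eq (by ring))
  have key := production_error_le K1 hε na hnt (abs_mul_le_mul hbd hs.ux)
    (abs_mul_le_mul hbd hs.vx) hmx hg₁ hg₂ hg₁x hg₂x (δ₁ := δ₁) (δ₂ := δ₂)
    (by rw [abs_of_pos d1]; linarith) (by rw [abs_of_pos d2]; linarith) b5 b6 b7 b8 b3 b4 b1 b2
  have Q1 := quad_form_le (S := F.S t x) (Sx := F.Sx t x) (ux := F.ux t x) (vx := F.vx t x)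
    K1 hm.1 (hK.b_ge _ hv) (hK.b_le _ hv) hτ hτ1 h2 h1
  have Q2 := quad_form_le (S := F.Sx t x) (Sx := F.Sxx t x) (ux := F.uxx t x) (vx := F.vxx t x)
    K1 hm.1 (hK.b_ge _ hv) (hK.b_le _ hv) hτ hτ1 h2 h1
  have n1 := mul_le_mul_of_nonneg_right hn.1 (sq_nonneg (F.S t x))
  have n2 := mul_le_mul_of_nonneg_right hn.1 (sq_nonneg (F.Sx t x))
  have n3 := mul_le_mul_of_nonneg_right hn.1 (sq_nonneg (F.Sxx t x))
  have hc : δ₁ / (2 * K) ≤ 1 / (2 * K) := by gcongr; linarith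
  have s0 : 0 ≤ F.S t x ^ 2 + F.Sx t x ^ 2 + F.Sxx t x ^ 2 := by positivity
  have hc' := mul_le_mul_of_nonneg_right hc s0
  have hq : 1 / (2 * K) = 2 * (1 / (4 * K)) := by field_simp; norm_num
  have hq' : 1 / K = 4 * (1 / (4 * K)) := by field_simp
  rw [hq] at hc'
  rw [hq'] at n1 n2 n3
  have i0 : 0 ≤ 1 / (4 * K) := by positivity
  have i1 := mul_nonneg i0 (sq_nonneg (F.S t x))
  have i3 := mul_nonneg i0 (sq_nonneg (F.Sxx t x))
  have hNN' := mul_le_mul_of_nonneg_left hNN (by positivity : 0 ≤ 80 * K ^ 3 * ε)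
  simp only [Fields.lyp, Fields.pr₀, LinFields.pr, LinFields.prx, Fields.lin, Fields.dens] at *
  linarith only [key, Q1, Q2, n1, n2, n3, hc', i1, i3, hNN']

end

section

lemma sq_le_integral_of_far {f f' : ℝ → ℝ} {R : ℝ} (hf : ∀ x, HasDerivAt f (f' x) x)
    (hf' : Continuous f') (h : ∀ x, R < |x| → f x = 0) (x : ℝ) :
    f x ^ 2 ≤ ∫ y, (f y ^ 2 + f' y ^ 2) := by
  have cf : Continuous f := continuous_iff_continuousAt.2 fun x => (hf x).continuousAt
  have h' := deriv_eq_zero_of_far hf h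
  have hi : Integrable fun y => f y ^ 2 + f' y ^ 2 :=
    integrable_of_far (R := R) (by fun_prop) fun x hx => by simp [h x hx, h' x hx]
  have hl : min x (-|R| - 1) ≤ x := min_le_left _ _
  set l := min x (-|R| - 1)
  have fl : f l = 0 := h l (by
    have : l ≤ -|R| - 1 := min_le_right _ _
    have h2 := neg_le_abs l
    have h3 := le_abs_self R
    linarith)
  have e : ∫ y in l..x, 2 * f y * f' y = f x ^ 2 - f l ^ 2 :=
    integral_eq_sub_of_hasDerivAt (fun y _ => ((hf y).pow 2).congr_deriv (by simp))
      (Continuous.intervalIntegrable (by fun_prop) _ _)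
  have e2 : ∫ y in l..x, 2 * f y * f' y ≤ ∫ y in l..x, (f y ^ 2 + f' y ^ 2) :=
    integral_mono_on hl (Continuous.intervalIntegrable (by fun_prop) _ _)
      (Continuous.intervalIntegrable (by fun_prop) _ _) fun y _ => by
        nlinarith [sq_nonneg (f y - f' y)]
  rw [fl] at e
  rw [intervalIntegral.integral_of_le hl] at e2
  have := setIntegral_le_integral (s := Ioc l x) hi (Eventually.of_forall fun y => by positivity)
  rw [← intervalIntegral.integral_of_le hl] at e2
  rw [← intervalIntegral.integral_of_le hl] at this
  linarith

variable {a μ γ τ T K : ℝ} {F : Fields}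

lemma Fields.Yd_nonneg (hτ : 0 < τ) (t x : ℝ) : 0 ≤ F.Yd τ t x := by
  rw [Fields.Yd]; positivity

lemma Fields.dens_nonneg (t x : ℝ) : 0 ≤ F.dens t x := by
  rw [Fields.dens]; positivity

lemma CSol.cfYd (h : CSol a μ γ τ⁻¹ T F) : ∃ R, CF R (F.Yd τ) ∧ CF R F.dens := by
  obtain ⟨R, hR⟩ := h.far_all
  obtain ⟨c1, c2, c3, c4, c5, c6, c7, c8, c9, -⟩ := id h
  refine ⟨R, ⟨by unfold Fields.Yd; fun_prop, fun t x hx => ?_⟩,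
    ⟨by unfold Fields.dens; fun_prop, fun t x hx => ?_⟩⟩ <;>
  obtain ⟨e1, e2, e3, e4, e5, e6, e7, e8, e9⟩ := hR t x hx
  · simp [Fields.Yd, e1, e2, e3, e4, e5, e6, e7, e8, e9]
  · simp [Fields.dens, e3, e4, e5, e6, e7, e8, e9]

/-- Density of the squared norms of the data. -/
def Data.yd (D : Data) (τ x : ℝ) : ℝ := (D.v x - 1) ^ 2 + D.v' x ^ 2 + D.v'' x ^ 2
  + (D.u x ^ 2 + D.u' x ^ 2 + D.u'' x ^ 2)
  + τ * (D.S x ^ 2 + D.S' x ^ 2 + D.S'' x ^ 2)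

/-- The fields at time `t`. -/
def Fields.slice (F : Fields) (t : ℝ) : Data :=
  ⟨F.v t, F.u t, F.S t, F.vx t, F.ux t, F.Sx t, F.vxx t, F.uxx t, F.Sxx t⟩

lemma CSol.slice (h : CSol a μ γ τ⁻¹ T F) (t : ℝ) : (F.slice t).IsC2 := by
  have sl : Continuous fun x : ℝ => (t, x) := by fun_prop
  obtain ⟨R, hR⟩ := h.far
  exact ⟨h.dv t, h.du t, h.dS t, h.dvx t, h.dux t, h.dSx t, h.cvxx.comp sl, h.cuxx.comp sl,
    h.cSxx.comp sl, R, hR t⟩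

lemma continuous_of_hasDerivAt {f f' : ℝ → ℝ} (hf : ∀ x, HasDerivAt f (f' x) x) : Continuous f :=
  continuous_iff_continuousAt.2 fun x => (hf x).continuousAt

lemma Data.IsC2.far_all {D : Data} (h : D.IsC2) : ∃ R, ∀ x, R < |x| → D.v x = 1 ∧ D.u x = 0 ∧
    D.S x = 0 ∧ D.v' x = 0 ∧ D.u' x = 0 ∧ D.S' x = 0 ∧ D.v'' x = 0 ∧ D.u'' x = 0 ∧
    D.S'' x = 0 := by
  obtain ⟨R, hR⟩ := h.far
  have e1 := deriv_eq_zero_of_far h.dv fun x hx => (hR x hx).1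
  have e2 := deriv_eq_zero_of_far h.du fun x hx => (hR x hx).2.1
  have e3 := deriv_eq_zero_of_far h.dS fun x hx => (hR x hx).2.2
  have e4 := deriv_eq_zero_of_far h.dv' e1
  have e5 := deriv_eq_zero_of_far h.du' e2
  have e6 := deriv_eq_zero_of_far h.dS' e3
  exact ⟨R, fun x hx => ⟨(hR x hx).1, (hR x hx).2.1, (hR x hx).2.2, e1 x hx, e2 x hx,
    e3 x hx, e4 x hx, e5 x hx, e6 x hx⟩⟩

lemma Data.IsC2.integrable_yd {D : Data} (h : D.IsC2) : Integrable (D.yd τ) := by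
  obtain ⟨R, hR⟩ := h.far_all
  have c1 := continuous_of_hasDerivAt h.dv
  have c2 := continuous_of_hasDerivAt h.dv'
  have c3 := h.cv
  have c4 := continuous_of_hasDerivAt h.du
  have c5 := continuous_of_hasDerivAt h.du'
  have c6 := h.cu
  have c7 := continuous_of_hasDerivAt h.dS
  have c8 := continuous_of_hasDerivAt h.dS'
  have c9 := h.cS
  refine integrable_of_far (R := R) (by unfold Data.yd; fun_prop) fun x hx => ?_
  obtain ⟨e1, e2, e3, e4, e5, e6, e7, e8, e9⟩ := hR x hx
  simp [Data.yd, e1, e2, e3, e4, e5, e6, e7, e8, e9]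

/-- Sobolev bounds by the energy. -/
lemma Data.IsC2.sobolev {D : Data} (hτ : 0 < τ) (h : D.IsC2) (x : ℝ) :
    (D.v x - 1) ^ 2 ≤ ∫ y, D.yd τ y ∧ D.v' x ^ 2 ≤ ∫ y, D.yd τ y ∧
    D.u x ^ 2 ≤ ∫ y, D.yd τ y ∧ D.u' x ^ 2 ≤ ∫ y, D.yd τ y ∧
    τ * D.S x ^ 2 ≤ ∫ y, D.yd τ y ∧ τ * D.S' x ^ 2 ≤ ∫ y, D.yd τ y := by
  obtain ⟨R, hR⟩ := h.far_all
  have key : ∀ {f f' : ℝ → ℝ} (c : ℝ), 0 ≤ c → (∀ x, HasDerivAt f (f' x) x) → Continuous f' →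
      (∀ x, R < |x| → f x = 0) → (∀ x, c * (f x ^ 2 + f' x ^ 2) ≤ D.yd τ x) → ∀ x,
      c * f x ^ 2 ≤ ∫ y, D.yd τ y := by
    intro f f' c hc hf hf' hfar hle x
    have cf := continuous_of_hasDerivAt hf
    have h' := deriv_eq_zero_of_far hf hfar
    have hi : Integrable fun y => f y ^ 2 + f' y ^ 2 :=
      integrable_of_far (R := R) (by fun_prop) fun x hx => by simp [hfar x hx, h' x hx]
    refine (mul_le_mul_of_nonneg_left (sq_le_integral_of_far hf hf' hfar x) hc).trans ?_
    rw [← MeasureTheory.integral_const_mul]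
    exact integral_mono (hi.const_mul c) h.integrable_yd hle
  have pos : ∀ x, 0 ≤ (D.v x - 1) ^ 2 ∧ 0 ≤ D.v' x ^ 2 ∧ 0 ≤ D.v'' x ^ 2 ∧ 0 ≤ D.u x ^ 2 ∧
      0 ≤ D.u' x ^ 2 ∧ 0 ≤ D.u'' x ^ 2 ∧ 0 ≤ τ * D.S x ^ 2 ∧ 0 ≤ τ * D.S' x ^ 2 ∧
      0 ≤ τ * D.S'' x ^ 2 := fun x => by refine ⟨?_, ?_, ?_, ?_, ?_, ?_, ?_, ?_, ?_⟩ <;> positivity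
  have k1 := key (f := fun x => D.v x - 1) 1 zero_le_one (fun x => (h.dv x).sub_const 1)
    (continuous_of_hasDerivAt h.dv') (fun x hx => by simp [(hR x hx).1]) fun x => by
      obtain ⟨p1, p2, p3, p4, p5, p6, p7, p8, p9⟩ := pos x
      rw [Data.yd]; linarith
  have k2 := key 1 zero_le_one h.dv' h.cv (fun x hx => (hR x hx).2.2.2.1) fun x => by
      obtain ⟨p1, p2, p3, p4, p5, p6, p7, p8, p9⟩ := pos x
      rw [Data.yd]; linarith
  have k3 := key 1 zero_le_one h.du (continuous_of_hasDerivAt h.du') (fun x hx => (hR x hx).2.1)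
    fun x => by
      obtain ⟨p1, p2, p3, p4, p5, p6, p7, p8, p9⟩ := pos x
      rw [Data.yd]; linarith
  have k4 := key 1 zero_le_one h.du' h.cu (fun x hx => (hR x hx).2.2.2.2.1) fun x => by
      obtain ⟨p1, p2, p3, p4, p5, p6, p7, p8, p9⟩ := pos x
      rw [Data.yd]; linarith
  have k5 := key τ hτ.le h.dS (continuous_of_hasDerivAt h.dS') (fun x hx => (hR x hx).2.2.1)
    fun x => by
      obtain ⟨p1, p2, p3, p4, p5, p6, p7, p8, p9⟩ := pos x
      rw [Data.yd]; linarith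
  have k6 := key τ hτ.le h.dS' h.cS (fun x hx => (hR x hx).2.2.2.2.2.1) fun x => by
      obtain ⟨p1, p2, p3, p4, p5, p6, p7, p8, p9⟩ := pos x
      rw [Data.yd]; linarith
  simp only [one_mul] at k1 k2 k3 k4
  exact ⟨k1 x, k2 x, k3 x, k4 x, k5 x, k6 x⟩

/-- Data of small energy are pointwise small. -/
lemma Data.IsC2.ptBd {D : Data} {η : ℝ} (hμ : 0 < μ) (hτ : 0 < τ) (hτ1 : τ ≤ 1) (h : D.IsC2)
    (hη : ∫ y, D.yd τ y ≤ η) (h1 : η ≤ 1 / 16) (h2 : η ≤ μ ^ 2 / 64) (x : ℝ) :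
    PtBd μ τ⁻¹ τ⁻¹ (D.v x) (D.u x) (D.S x) (D.v' x) (D.u' x) (D.S' x) := by
  obtain ⟨s1, s2, s3, s4, s5, s6⟩ := h.sobolev hτ x
  have t1 : 1 ≤ τ⁻¹ := (one_le_inv₀ hτ).2 hτ1
  have t2 : 1 ≤ (τ⁻¹) ^ 2 := one_le_pow₀ t1
  have e : ∀ {z C : ℝ}, 0 ≤ C → τ * z ^ 2 ≤ C ^ 2 → |z| ≤ C * τ⁻¹ := fun {z C} hC hz => by
    rw [← div_eq_mul_inv, le_div_iff₀ hτ]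
    have e1 : |z| * τ = |z * τ| := by rw [abs_mul, abs_of_pos hτ]
    rw [e1]
    refine abs_le_of_sq_le_sq ?_ hC
    nlinarith [mul_nonneg hτ.le (sq_nonneg z)]
  refine ⟨abs_le_of_sq_le_sq (by linarith) (by norm_num), ?_,
    abs_le_of_sq_le_sq (by linarith) (by linarith), abs_le_of_sq_le_sq (by linarith) (by linarith),
    abs_le_of_sq_le_sq (by linarith) (by linarith), ?_⟩
  · refine (e (C := μ / 8) (by positivity) (by linarith)).trans (le_of_eq (by ring))
  · exact (e (C := 1) (by positivity) (by linarith)).trans_eq (one_mul _)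

lemma CSol.smallAt {ε : ℝ} (hτ : 0 < τ) (hτ1 : τ ≤ 1) (h : CSol a μ γ τ⁻¹ T F) (hε : 0 ≤ ε) {t : ℝ}
    (hY : ∫ y, F.Yd τ t y ≤ ε ^ 2) (x : ℝ) : SmallAt F τ ε t x := by
  obtain ⟨-, h2, -, h4, h5, h6⟩ := (h.slice t).sobolev hτ x
  have e : ∀ z : ℝ, τ * z ^ 2 ≤ ε ^ 2 → |τ * z| ≤ ε := fun z hz => by
    refine abs_le_of_sq_le_sq ?_ hε
    nlinarith [mul_nonneg hτ.le (sq_nonneg z)]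
  exact ⟨abs_le_of_sq_le_sq (h2.trans hY) hε, abs_le_of_sq_le_sq (h4.trans hY) hε,
    e _ (h5.trans hY), e _ (h6.trans hY)⟩

/-- Uniform a priori estimate. -/
theorem apriori (ha : |a| ≤ 1) (hμ : 0 < μ) (hγ : 1 < γ) : ∃ δ > 0, ∃ C ≥ 1, ∀ τ : ℝ, 0 < τ →
    τ ≤ 1 → ∀ T F, CSol a μ γ τ⁻¹ T F → ∫ x, F.Yd τ 0 x ≤ δ → ∀ t ∈ Icc 0 T,
    (∫ x, F.Yd τ t x) ≤ C * ∫ x, F.Yd τ 0 x ∧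
    (∫ q in (0 : ℝ)..t, ∫ x, F.dens q x) ≤ C * ∫ x, F.Yd τ 0 x := by
  obtain ⟨K, hK⟩ := exists_coefBd hγ hμ
  have K1 := hK.one_le
  have K0 : 0 < K := by linarith
  obtain ⟨δ₂, h2⟩ : ∃ d, d = 1 / (24 * K ^ 5) := ⟨_, rfl⟩
  obtain ⟨δ₁, h1⟩ : ∃ d, d = δ₂ / (4 * K) := ⟨_, rfl⟩
  obtain ⟨d1, d2, d3, d4, d5⟩ := delta_bounds K1 h2 h1
  obtain ⟨c, hc⟩ : ∃ c, c = δ₁ / (2 * K) := ⟨_, rfl⟩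
  have c0 : 0 < c := by rw [hc]; positivity
  have c1 : c ≤ 1 := by rw [hc, div_le_one (by positivity)]; linarith
  obtain ⟨ε, hε⟩ : ∃ ε, ε = c / (1120 * K ^ 3) := ⟨_, rfl⟩
  have ε0 : 0 < ε := by rw [hε]; positivity
  have K3 : 1 ≤ K ^ 3 := one_le_pow₀ K1
  have ε1 : ε ≤ 1 := by rw [hε, div_le_one (by positivity)]; linarith
  have hcε : 560 * K ^ 3 * ε = c / 2 := by rw [hε]; field_simp; norm_num
  refine ⟨ε ^ 2 / (16 * K ^ 2), by positivity, 8 * K ^ 2 + 4 * K / c, ?_, ?_⟩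
  · have : 0 ≤ 4 * K / c := by positivity
    nlinarith
  intro τ hτ hτ1 T F h hY0
  obtain ⟨R, hB⟩ := h.lyapunov ha hμ hγ hτ δ₁ δ₂
  obtain ⟨R', hY, hD⟩ := h.cfYd
  have hLY : ∀ t, (∫ x, F.lyd a μ γ τ δ₁ δ₂ t x) ∈
      Icc (1 / (4 * K) * ∫ x, F.Yd τ t x) (2 * K * ∫ x, F.Yd τ t x) := fun t => by
    rw [← MeasureTheory.integral_const_mul, ← MeasureTheory.integral_const_mul]
    exact ⟨integral_mono ((hY.slice t).const_mul _) (hB.ce.slice t) fun x =>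
      (h.lyd_mem hK ha hμ hτ hτ1 h2 h1 t x).1, integral_mono (hB.ce.slice t)
      ((hY.slice t).const_mul _) fun x => (h.lyd_mem hK ha hμ hτ hτ1 h2 h1 t x).2⟩
  have hY0' : 0 ≤ ∫ x, F.Yd τ 0 x := integral_nonneg fun x => Fields.Yd_nonneg hτ 0 x
  have hDn : ∀ t, 0 ≤ ∫ x, F.dens t x := fun t => integral_nonneg fun x => Fields.dens_nonneg t x
  have hprod : ∀ q, ∫ x, F.Yd τ q x ≤ ε ^ 2 →
      ∫ x, F.lyp a μ γ τ δ₁ δ₂ q x ≤ -(c / 2) * ∫ x, F.dens q x := fun q hq => by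
    rw [← MeasureTheory.integral_const_mul]
    refine integral_mono (hB.cr.slice q) ((hD.slice q).const_mul _) fun x => ?_
    have := h.lyp_le hK ha hμ hτ hτ1 h2 h1 ε0.le ε1 (h.smallAt hτ hτ1 ε0.le hq x)
    rw [← hc, hcε] at this
    refine this.trans (le_of_eq (by ring))
  have main : ∀ t ∈ Icc 0 T, (∀ q ∈ Ioo 0 t, ∫ x, F.Yd τ q x ≤ ε ^ 2) →
      (c / 2) * (∫ q in (0 : ℝ)..t, ∫ x, F.dens q x) + 1 / (4 * K) * (∫ x, F.Yd τ t x) ≤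
        2 * K * ∫ x, F.Yd τ 0 x := fun t ht hq => by
    have e := hB.eq le_rfl ht.1 ht.2
    have e2 : ∫ q in (0 : ℝ)..t, ∫ x, F.lyp a μ γ τ δ₁ δ₂ q x ≤
        ∫ q in (0 : ℝ)..t, -(c / 2) * ∫ x, F.dens q x :=
      integral_mono_on_of_le_Ioo ht.1 (hB.cr.cint.intervalIntegrable _ _)
        ((hD.cint.const_mul _).intervalIntegrable _ _) fun q hq' => hprod q (hq q hq')
    rw [intervalIntegral.integral_const_mul] at e2
    linarith [(hLY 0).2, (hLY t).1]
  have small : ∀ t ∈ Icc 0 T, ∫ x, F.Yd τ t x ≤ ε ^ 2 := by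
    by_contra! hcon
    obtain ⟨t₁, ht₁, h₁⟩ := hcon
    have hcl : IsClosed (Icc 0 T ∩ {t | ε ^ 2 ≤ ∫ x, F.Yd τ t x}) :=
      isClosed_Icc.inter (isClosed_le continuous_const hY.cint)
    obtain ⟨t, ⟨ht, hte⟩, hmin⟩ := (isCompact_Icc.inter_right
      (isClosed_le continuous_const hY.cint)).exists_isLeast ⟨t₁, ht₁, h₁.le⟩
    have := main t ht fun q hq => by
      by_contra! hgt
      exact absurd (hmin ⟨⟨hq.1.le, hq.2.le.trans ht.2⟩, hgt.le⟩) (not_le.2 hq.2)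
    have i0 : 0 ≤ ∫ q in (0 : ℝ)..t, ∫ x, F.dens q x :=
      intervalIntegral.integral_nonneg ht.1 fun q _ => hDn q
    have i1 := mul_nonneg (by positivity : 0 ≤ c / 2) i0
    have i2 : 1 / (4 * K) * ε ^ 2 ≤ 2 * K * (ε ^ 2 / (16 * K ^ 2)) := by
      calc 1 / (4 * K) * ε ^ 2 ≤ 1 / (4 * K) * ∫ x, F.Yd τ t x := by gcongr; exact hte
        _ ≤ 2 * K * ∫ x, F.Yd τ 0 x := by linarith
        _ ≤ _ := by gcongr
    have i3 : 2 * K * (ε ^ 2 / (16 * K ^ 2)) = 1 / 2 * (1 / (4 * K) * ε ^ 2) := by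
      field_simp; norm_num
    have i4 : 0 < 1 / (4 * K) * ε ^ 2 := by positivity
    linarith
  intro t ht
  have hm := main t ht fun q hq => small q ⟨hq.1.le, hq.2.le.trans ht.2⟩
  have i0 : 0 ≤ ∫ q in (0 : ℝ)..t, ∫ x, F.dens q x :=
    intervalIntegral.integral_nonneg ht.1 fun q _ => hDn q
  have i1 := mul_nonneg (by positivity : 0 ≤ c / 2) i0
  have i2 : 0 ≤ ∫ x, F.Yd τ t x := integral_nonneg fun x => Fields.Yd_nonneg hτ t x
  have i3 : 0 ≤ 1 / (4 * K) * ∫ x, F.Yd τ t x := by positivity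
  have i4 : 0 ≤ 4 * K / c := by positivity
  constructor
  · have : (∫ x, F.Yd τ t x) = 4 * K * (1 / (4 * K) * ∫ x, F.Yd τ t x) := by field_simp
    rw [this]
    calc _ ≤ 4 * K * (2 * K * ∫ x, F.Yd τ 0 x) :=
          mul_le_mul_of_nonneg_left (by linarith) (by positivity)
      _ = 8 * K ^ 2 * ∫ x, F.Yd τ 0 x := by ring
      _ ≤ _ := by gcongr; exact le_add_of_nonneg_right i4
  · have : (∫ q in (0 : ℝ)..t, ∫ x, F.dens q x) =
        2 / c * (c / 2 * ∫ q in (0 : ℝ)..t, ∫ x, F.dens q x) := by field_simp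
    rw [this]
    calc _ ≤ 2 / c * (2 * K * ∫ x, F.Yd τ 0 x) :=
          mul_le_mul_of_nonneg_left (by linarith) (by positivity)
      _ = 4 * K / c * ∫ x, F.Yd τ 0 x := by ring
      _ ≤ _ := by gcongr; exact le_add_of_nonneg_left (by positivity)

/-- Global existence for small compactly supported data. -/
theorem compact_existence (ha : |a| ≤ 1) (hμ : 0 < μ) (hγ : 1 < γ) : ∃ δ > 0, ∃ C ≥ 1, ∀ τ : ℝ,
    0 < τ → τ ≤ 1 → ∀ D : Data, D.IsC2 → ∫ x, D.yd τ x ≤ δ → ∀ T > 0, ∃ F : Fields,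
    CSol a μ γ τ⁻¹ T F ∧ F.slice 0 = D ∧ ∀ t ∈ Icc 0 T,
    (∫ x, F.Yd τ t x) ≤ C * ∫ x, D.yd τ x ∧
    (∫ q in (0 : ℝ)..t, ∫ x, F.dens q x) ≤ C * ∫ x, D.yd τ x := by
  obtain ⟨δ, hδ, C, hC, hap⟩ := apriori ha hμ hγ
  obtain ⟨η, hη⟩ : ∃ η, η = min (1 / 16) (μ ^ 2 / 64) := ⟨_, rfl⟩
  have η0 : 0 < η := by rw [hη]; positivity
  have η1 : η ≤ 1 / 16 := hη ▸ min_le_left _ _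
  have η2 : η ≤ μ ^ 2 / 64 := hη ▸ min_le_right _ _
  have C0 : 0 < C := by linarith
  refine ⟨min δ (η / C), by positivity, C, hC, fun τ hτ hτ1 D hD hY T hT => ?_⟩
  have hY1 : C * ∫ x, D.yd τ x ≤ η := by
    have := hY.trans (min_le_right _ _)
    rw [le_div_iff₀ C0] at this
    linarith
  have hY0 : 0 ≤ ∫ x, D.yd τ x := integral_nonneg fun x => by
    show 0 ≤ D.yd τ x
    rw [Data.yd]; positivity
  have hsl : ∀ T F, CSol a μ γ τ⁻¹ T F → F.v 0 = D.v → F.u 0 = D.u → F.S 0 = D.S →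
      F.slice 0 = D := by
    intro T F hF hv hu hS
    have e1 : F.vx 0 = D.v' := funext fun x => (hv ▸ hF.dv 0 x).unique (hD.dv x)
    have e2 : F.ux 0 = D.u' := funext fun x => (hu ▸ hF.du 0 x).unique (hD.du x)
    have e3 : F.Sx 0 = D.S' := funext fun x => (hS ▸ hF.dS 0 x).unique (hD.dS x)
    have e4 : F.vxx 0 = D.v'' := funext fun x => (e1 ▸ hF.dvx 0 x).unique (hD.dv' x)
    have e5 : F.uxx 0 = D.u'' := funext fun x => (e2 ▸ hF.dux 0 x).unique (hD.du' x)
    have e6 : F.Sxx 0 = D.S'' := funext fun x => (e3 ▸ hF.dSx 0 x).unique (hD.dS' x)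
    rw [Fields.slice, hv, hu, hS, e1, e2, e3, e4, e5, e6]
  have hest : ∀ T F, CSol a μ γ τ⁻¹ T F → F.v 0 = D.v → F.u 0 = D.u → F.S 0 = D.S →
      ∀ t ∈ Icc 0 T, (∫ x, F.Yd τ t x) ≤ C * (∫ x, D.yd τ x) ∧
      (∫ q in (0 : ℝ)..t, ∫ x, F.dens q x) ≤ C * ∫ x, D.yd τ x := by
    intro T F hF hv hu hS
    have e : F.Yd τ 0 = D.yd τ := by rw [← hsl T F hF hv hu hS]; rfl
    have := hap τ hτ hτ1 T F hF
    rw [e] at this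
    exact this (hY.trans (min_le_left _ _))
  obtain ⟨F, hF, hv, hu, hS⟩ := cSol_existence ha (by positivity : 0 < μ * τ⁻¹) hγ
    (inv_pos.2 hτ) hT hD (hD.ptBd hμ hτ hτ1 (le_trans (by nlinarith) hY1) η1 η2)
    fun T' _ F hF hv hu hS t ht x => (hF.slice t).ptBd hμ hτ hτ1
      (((hest T' F hF hv hu hS t ht).1).trans hY1) η1 η2 x
  exact ⟨F, hF, hsl T F hF hv hu hS, hest T F hF hv hu hS⟩

end

section

lemma hasDerivAt_max_zero_sq (z : ℝ) : HasDerivAt (fun z : ℝ => (max 0 z) ^ 2) (2 * max 0 z) z := by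
  have key : ∀ y : ℝ, y ≠ 0 → HasDerivAt (fun z : ℝ => (max 0 z) ^ 2) (2 * max 0 y) y := by
    intro y hy
    rcases lt_or_gt_of_ne hy with h | h
    · rw [max_eq_left h.le, mul_zero]
      refine (hasDerivAt_const y (0 : ℝ)).congr_of_eventuallyEq ?_
      filter_upwards [Iio_mem_nhds h] with x hx
      rw [max_eq_left (le_of_lt hx)]
      norm_num
    · rw [max_eq_right h.le]
      refine ((hasDerivAt_id y).pow 2).congr_of_eventuallyEq ?_ |>.congr_deriv (by simp)
      filter_upwards [Ioi_mem_nhds h] with x hx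
      rw [max_eq_right (le_of_lt hx)]
      rfl
  by_cases hz : z = 0
  · subst hz
    exact hasDerivAt_of_punctured (g := fun z : ℝ => (max 0 z) ^ 2) (G := fun z => 2 * max 0 z)
      (a := -1) (b := 0) (c := 1) (by simp) (by fun_prop) (by fun_prop) fun t _ ht => key t ht
  · exact key z hz

/-- A regularised distance to `x₀`. -/
def regDist (x₀ x : ℝ) : ℝ := √(1 + (x - x₀) ^ 2)

lemma regDist_pos (x₀ x : ℝ) : 0 < regDist x₀ x := Real.sqrt_pos.2 (by positivity)

lemma abs_le_regDist (x₀ x : ℝ) : |x - x₀| ≤ regDist x₀ x :=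
  Real.abs_le_sqrt (by linarith)

lemma regDist_le (x₀ x : ℝ) : regDist x₀ x ≤ 1 + |x - x₀| := by
  rw [regDist, Real.sqrt_le_left (by positivity)]
  nlinarith [sq_abs (x - x₀), abs_nonneg (x - x₀)]

lemma hasDerivAt_regDist (x₀ x : ℝ) :
    HasDerivAt (regDist x₀) ((x - x₀) / regDist x₀ x) x := by
  have h1 : HasDerivAt (fun x : ℝ => 1 + (x - x₀) ^ 2) (2 * (x - x₀)) x :=
    ((((hasDerivAt_id x).sub_const x₀).pow 2).const_add 1).congr_deriv (by simp)
  refine (h1.sqrt (by positivity)).congr_deriv ?_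
  rw [← regDist]
  have := (regDist_pos x₀ x).ne'
  field_simp

lemma continuous_regDist (x₀ : ℝ) : Continuous (regDist x₀) := by unfold regDist; fun_prop

variable {τ T : ℝ} {L : LinFields}

/-- Finite speed of propagation for linear relaxation systems. -/
theorem LinSol.cone (h : LinSol τ T L) (hτ : 0 < τ) (hT : 0 < T) {ℓ x₀ ρ : ℝ} (hℓ : 0 ≤ ℓ)
    (he0 : ∀ t x, 0 ≤ L.ed τ t x)
    (hfl : ∀ t x, |L.A t x * (L.b t x * L.V t x + L.G t x)| ≤ ℓ * L.ed τ t x)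
    (hpr : ∀ R, ∃ C, ∀ t ∈ Icc 0 T, ∀ x, |x| ≤ R → L.pr τ t x ≤ C * L.ed τ t x)
    (h0 : ∀ x, regDist x₀ x < ρ → L.ed τ 0 x = 0) {t x : ℝ} (ht : t ∈ Icc 0 T)
    (hx : regDist x₀ x < ρ - ℓ * t) : L.ed τ t x = 0 := by
  obtain ⟨ψ, hψ⟩ : ∃ ψ : ℝ → ℝ → ℝ, ψ = fun t x => max 0 (ρ - ℓ * clampT T t - regDist x₀ x) :=
    ⟨_, rfl⟩
  have ψ0 : ∀ t x, 0 ≤ ψ t x := fun t x => by rw [hψ]; exact le_max_left _ _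
  have cc := continuous_clampT T
  have cr := continuous_regDist x₀
  have cψ : Continuous fun p : ℝ × ℝ => ψ p.1 p.2 := by
    rw [hψ]
    exact continuous_const.max (((continuous_const.sub ((cc.comp continuous_fst).const_mul ℓ)).sub
      (cr.comp continuous_snd)))
  have ced := h.ced
  have cpr := h.cpr
  have cfl : Continuous fun p : ℝ × ℝ => L.A p.1 p.2 * (L.b p.1 p.2 * L.V p.1 p.2 + L.G p.1 p.2) :=
    h.cA.mul ((h.cb.mul h.cV).add h.cG)
  have cd : Continuous fun p : ℝ × ℝ => (p.2 - x₀) / regDist x₀ p.2 :=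
    (continuous_snd.sub continuous_const).div (cr.comp continuous_snd) fun p => (regDist_pos _ _).ne'
  obtain ⟨R, hRdef⟩ : ∃ R, R = |x₀| + |ρ| := ⟨_, rfl⟩
  have hcl : ∀ t, 0 ≤ clampT T t := fun t => (clampT_mem hT.le t).1
  have hR : ∀ t x, R < |x| → ψ t x = 0 := fun t x hx => by
    rw [hψ]
    refine max_eq_left ?_
    have h1 := abs_le_regDist x₀ x
    have h2 := abs_sub_abs_le_abs_sub x x₀
    have h3 := le_abs_self ρ
    have h4 := mul_nonneg hℓ (hcl t)
    linarith
  obtain ⟨C', hC'⟩ := hpr R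
  obtain ⟨C, hC⟩ : ∃ C, C = max C' 0 := ⟨_, rfl⟩
  have hCpr : ∀ t ∈ Icc 0 T, ∀ x, |x| ≤ R → L.pr τ t x ≤ C * L.ed τ t x := fun t ht x hx =>
    (hC' t ht x hx).trans (mul_le_mul_of_nonneg_right (hC ▸ le_max_left _ _) (he0 t x))
  have hen := fun {s t} => h.energy hτ.ne' (φ := fun t x => ψ t x ^ 2)
    (φt := fun t x => 2 * ψ t x * (-ℓ)) (φx := fun t x => 2 * ψ t x * (-((x - x₀) / regDist x₀ x)))
    (R := R) (by fun_prop) (by fun_prop) (by fun_prop) (fun t x => by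
      rw [hψ]
      have := ((hasDerivAt_regDist x₀ x).const_sub (ρ - ℓ * clampT T t))
      exact (hasDerivAt_max_zero_sq _).comp x this) (fun t ht x => by
      rw [hψ]
      have h1 : HasDerivAt (fun s => ρ - ℓ * clampT T s - regDist x₀ x) (-ℓ) t := by
        refine ((((hasDerivAt_id t).const_mul ℓ).const_sub ρ).sub_const (regDist
          x₀ x)).congr_of_eventuallyEq ?_
          |>.congr_deriv (by simp)
        filter_upwards [Ioo_mem_nhds ht.1 ht.2] with s hs
        simp [clampT_of_mem (Ioo_subset_Icc_self hs)]
      exact (hasDerivAt_max_zero_sq _).comp t h1)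
    (fun t x hx => Or.inl (by simp [hR t x hx])) (s := s) (t := t)
  obtain ⟨y, hy⟩ : ∃ y : ℝ → ℝ, y = fun t => ∫ x, ψ t x ^ 2 * L.ed τ t x := ⟨_, rfl⟩
  have cy : Continuous y := by
    rw [hy]
    exact continuous_integral_far (R := R) (by fun_prop) fun t x hx => by simp [hR t x hx]
  have y0 : y 0 = 0 := by
    rw [hy]
    refine integral_eq_zero_of_ae (Eventually.of_forall fun x => ?_)
    by_cases hx : regDist x₀ x < ρ
    · simp [h0 x hx]
    · have : ψ 0 x = 0 := by
        rw [hψ]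
        refine max_eq_left ?_
        have := mul_nonneg hℓ (hcl 0)
        linarith [not_lt.1 hx]
      simp [this]
  have hle : ∀ t ∈ Icc 0 T, y t ≤ C * ∫ q in (0 : ℝ)..t, y q := by
    intro t ht
    have e := hen le_rfl ht.1 ht.2
    have e1 : y t = ∫ q in (0 : ℝ)..t, ∫ x, (ψ q x ^ 2 * L.pr τ q x + 2 * ψ q x * (-ℓ) * L.ed τ q x
        - 2 * ψ q x * (-((x - x₀) / regDist x₀ x)) *
          (L.A q x * (L.b q x * L.V q x + L.G q x))) := by
      rw [← e]
      have := y0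
      rw [hy] at this ⊢
      simp only at this ⊢
      rw [this, sub_zero]
    rw [e1, ← intervalIntegral.integral_const_mul]
    refine integral_mono_on ht.1 (Continuous.intervalIntegrable ?_ _ _)
      ((cy.const_mul C).intervalIntegrable _ _) fun q hq => ?_
    · exact continuous_integral_far (R := R) (by fun_prop) fun t x hx => by simp [hR t x hx]
    rw [hy]
    simp only
    rw [← MeasureTheory.integral_const_mul]
    have sl : Continuous fun x : ℝ => (q, x) := by fun_prop
    have c1 := cψ.comp sl
    have c2 := ced.comp sl
    have c3 := cpr.comp sl
    have c4 := cfl.comp sl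
    have c5 := cd.comp sl
    simp only [Function.comp_def] at c1 c2 c3 c4 c5
    refine integral_mono (integrable_of_far (R := R) (by fun_prop) fun x hx => by simp [hR q x hx])
      (integrable_of_far (R := R) (by fun_prop) fun x hx => by simp [hR q x hx]) fun x => ?_
    simp only
    by_cases hx : |x| ≤ R
    · have b1 := hCpr q ⟨hq.1, hq.2.trans ht.2⟩ x hx
      have b2 := hfl q x
      have b3 : |(x - x₀) / regDist x₀ x| ≤ 1 := by
        rw [abs_div, abs_of_pos (regDist_pos x₀ x), div_le_one (regDist_pos x₀ x)]
        exact abs_le_regDist x₀ x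
      have b4 : (x - x₀) / regDist x₀ x * (L.A q x * (L.b q x * L.V q x + L.G q x)) ≤
          ℓ * L.ed τ q x := by
        refine (le_abs_self _).trans ?_
        rw [abs_mul]
        exact (mul_le_mul b3 b2 (abs_nonneg _) zero_le_one).trans_eq (one_mul _)
      have b5 := mul_le_mul_of_nonneg_left b1 (sq_nonneg (ψ q x))
      have b6 := mul_le_mul_of_nonneg_left b4 (ψ0 q x)
      linarith
    · simp [hR q x (not_le.1 hx)]
  have hz : ∀ t ∈ Icc 0 T, (∫ q in (0 : ℝ)..t, y q) ≤ 0 := by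
    intro t ht
    have := gronwall_Ioo (y := fun t => ∫ q in (0 : ℝ)..t, y q) (y' := y) (L := C) (T := T)
      (continuous_primitive (fun _ _ => cy.intervalIntegrable _ _) 0).continuousOn
      (fun t _ => cy.integral_hasStrictDerivAt 0 t |>.hasDerivAt)
      (fun t ht => hle t (Ioo_subset_Icc_self ht)) t ht
    simpa using this
  have hyt : y t ≤ 0 := (hle t ht).trans
    (mul_nonpos_of_nonneg_of_nonpos (hC ▸ le_max_right _ _) (hz t ht))
  have sl : Continuous fun x : ℝ => (t, x) := by fun_prop
  have c1 := cψ.comp sl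
  have c2 := ced.comp sl
  simp only [Function.comp_def] at c1 c2
  have hnn : ∀ x, 0 ≤ ψ t x ^ 2 * L.ed τ t x := fun x => mul_nonneg (sq_nonneg _) (he0 t x)
  have hyz : y t = 0 := le_antisymm hyt (by rw [hy]; exact integral_nonneg hnn)
  have hzero : (fun x => ψ t x ^ 2 * L.ed τ t x) = 0 := by
    have hc : Continuous fun x => ψ t x ^ 2 * L.ed τ t x := by fun_prop
    refine (Continuous.ae_eq_iff_eq volume hc continuous_const).1 ?_
    rw [hy] at hyz
    exact (integral_eq_zero_iff_of_nonneg hnn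
      (integrable_of_far (R := R) hc fun x hx => by simp [hR t x hx])).1 hyz
  have h1 := congrFun hzero x
  simp only [Pi.zero_apply, mul_eq_zero] at h1
  rcases h1 with h1 | h1
  · exfalso
    have h2 : ψ t x = ρ - ℓ * t - regDist x₀ x := by
      rw [hψ]
      simp only
      rw [clampT_of_mem ht]
      exact max_eq_right (by linarith)
    have h3 := pow_eq_zero_iff (n := 2) (by norm_num) |>.1 h1
    linarith
  · exact h1

end

section

/-- A `C¹` solution of the relaxed system for times in `(0, T)`; the first order fields are
`vx, ux, Sx`. -/
structure C1Sol (a μ γ τ T : ℝ) (v u S vx ux Sx : ℝ → ℝ → ℝ) : Prop where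
  cv : Continuous fun p : ℝ × ℝ => v p.1 p.2
  cu : Continuous fun p : ℝ × ℝ => u p.1 p.2
  cS : Continuous fun p : ℝ × ℝ => S p.1 p.2
  cvx : Continuous fun p : ℝ × ℝ => vx p.1 p.2
  cux : Continuous fun p : ℝ × ℝ => ux p.1 p.2
  cSx : Continuous fun p : ℝ × ℝ => Sx p.1 p.2
  dv : ∀ t x, HasDerivAt (v t) (vx t x) x
  du : ∀ t x, HasDerivAt (u t) (ux t x) x
  dS : ∀ t x, HasDerivAt (S t) (Sx t x) x
  tv : ∀ t ∈ Ioo 0 T, ∀ x, HasDerivAt (fun s => v s x) (ux t x) t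
  tu : ∀ t ∈ Ioo 0 T, ∀ x, HasDerivAt (fun s => u s x) (Sx t x + bF γ (v t x) * vx t x) t
  tS : ∀ t ∈ Ioo 0 T, ∀ x, HasDerivAt (fun s => S s x)
    (τ⁻¹ * ((2 * a * τ * S t x + μ) / v t x * ux t x - S t x)) t
  pos : ∀ t x, 0 < v t x

variable {a μ γ τ T K : ℝ} {F : Fields} {v u S vx ux Sx : ℝ → ℝ → ℝ}

lemma CSol.c1Sol (hτ : 0 < τ) (h : CSol a μ γ τ⁻¹ T F) :
    C1Sol a μ γ τ T F.v F.u F.S F.vx F.ux F.Sx :=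
  ⟨h.cv, h.cu, h.cS, h.cvx, h.cux, h.cSx, h.dv, h.du, h.dS, h.tv, h.tu, h.tS' hτ, h.v_pos⟩

/-- The difference of a classical solution and another `C¹` solution. -/
def Fields.diffLin (F : Fields) (a μ γ τ : ℝ) (v u S vx ux Sx : ℝ → ℝ → ℝ) : LinFields where
  V t x := F.v t x - v t x
  A t x := F.u t x - u t x
  G t x := F.S t x - S t x
  Vx t x := F.vx t x - vx t x
  Ax t x := F.ux t x - ux t x
  Gx t x := F.Sx t x - Sx t x
  b t x := bF γ (F.v t x)
  bt t x := bdF γ (F.v t x) * F.ux t x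
  bx t x := bdF γ (F.v t x) * F.vx t x
  m := F.m a μ τ
  n := F.n a μ τ
  nt := F.nt a μ τ
  g₁ t x := (bF γ (F.v t x) - bF γ (v t x)) * vx t x
  g₂ t x := (F.m a μ τ t x - (2 * a * τ * S t x + μ) / v t x) * ux t x

lemma CSol.diffLin (ha : |a| ≤ 1) (hμ : 0 < μ) (hτ : 0 < τ) (h : CSol a μ γ τ⁻¹ T F)
    (w : C1Sol a μ γ τ T v u S vx ux Sx) :
    LinSol τ T (F.diffLin a μ γ τ v u S vx ux Sx) := by
  have hl := h.lin ha hμ hτ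
  have cb2 : Continuous fun p : ℝ × ℝ => bF γ (v p.1 p.2) :=
    (continuous_rpow_of_pos w.cv (fun p => w.pos _ _) _).const_mul γ
  have cm2 : Continuous fun p : ℝ × ℝ => (2 * a * τ * S p.1 p.2 + μ) / v p.1 p.2 :=
    Continuous.div ((w.cS.const_mul (2 * a * τ)).add continuous_const) w.cv
      fun p => (w.pos _ _).ne'
  refine ⟨h.cv.sub w.cv, h.cu.sub w.cu, h.cS.sub w.cS, h.cvx.sub w.cvx, h.cux.sub w.cux,
    h.cSx.sub w.cSx, hl.cb, hl.cbt, hl.cbx, hl.cm, hl.cn, hl.cnt, (h.cb.sub cb2).mul w.cvx,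
    (h.cm.sub cm2).mul w.cux, fun t x => (h.dv t x).sub (w.dv t x),
    fun t x => (h.du t x).sub (w.du t x), fun t x => (h.dS t x).sub (w.dS t x), hl.db,
    fun t ht x => (h.tv t ht x).sub (w.tv t ht x), fun t ht x => ?_, fun t ht x => ?_, hl.tb,
    hl.tn, hl.nm⟩
  · refine ((h.tu t ht x).sub (w.tu t ht x)).congr_deriv ?_
    simp only [Fields.diffLin]
    ring
  · refine ((h.tS' hτ t ht x).sub (w.tS t ht x)).congr_deriv ?_
    simp only [Fields.diffLin]
    ring

lemma exists_lip_bF (γ : ℝ) {l r : ℝ} (hl : 0 < l) : ∃ M, ∀ x ∈ Icc l r, ∀ y ∈ Icc l r,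
    |bF γ x - bF γ y| ≤ M * |x - y| := by
  have hp : ∀ v ∈ Icc l r, 0 < v := fun v hv => hl.trans_le hv.1
  have hc : ContinuousOn (bdF γ) (Icc l r) :=
    (continuousOn_id.rpow_const fun v hv => Or.inl (hp v hv).ne').const_mul (-(γ * (γ + 1)))
  obtain ⟨M, hM⟩ := isCompact_Icc.exists_bound_of_continuousOn hc
  refine ⟨M, fun x hx y hy => ?_⟩
  have := (convex_Icc l r).norm_image_sub_le_of_norm_hasDerivWithin_le (f := bF γ) (f' := bdF γ)
    (C := M) (fun z hz => ((hasDerivAt_bF (hasDerivAt_id z) (hp z hz)).congr_deriv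
      (mul_one _)).hasDerivWithinAt) hM hy hx
  simpa only [Real.norm_eq_abs] using this

lemma LinFields.ed_ge {L : LinFields} {t x : ℝ} (K1 : 1 ≤ K) (hτ : 0 < τ) (hτ1 : τ ≤ 1)
    (hb : 1 / K ≤ L.b t x) (hn : 1 / K ≤ L.n t x) :
    τ / (2 * K) * (L.V t x ^ 2 + L.A t x ^ 2 + L.G t x ^ 2) ≤ L.ed τ t x := by
  have K0 : 0 < K := by linarith
  have k1 : 1 / K ≤ 1 := by rw [div_le_one K0]; exact K1
  have e : τ / (2 * K) = 1 / 2 * (τ * (1 / K)) := by field_simp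
  have k0 : 0 < 1 / K := by positivity
  rw [e, LinFields.ed]
  generalize 1 / K = k at *
  have h1 : τ * k * L.V t x ^ 2 ≤ L.b t x * L.V t x ^ 2 := by
    gcongr
    nlinarith
  have h2 : τ * k * L.A t x ^ 2 ≤ 1 * L.A t x ^ 2 := by
    gcongr
    nlinarith
  have h3 : τ * (k * L.G t x ^ 2) ≤ τ * (L.n t x * L.G t x ^ 2) := by gcongr
  linarith

lemma LinFields.flux_le {L : LinFields} {t x : ℝ} (K1 : 1 ≤ K) (hτ : 0 < τ)
    (hb : 1 / K ≤ L.b t x) (hbK : L.b t x ≤ K) (hn : 1 / K ≤ L.n t x) :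
    |L.A t x * (L.b t x * L.V t x + L.G t x)| ≤ (2 + K + K / τ) * L.ed τ t x := by
  have K0 : 0 < K := by linarith
  have k0 : 0 < 1 / K := by positivity
  have b0 : 0 < L.b t x := by linarith
  have h1 : L.b t x * (L.b t x * L.V t x ^ 2) ≤ K * (L.b t x * L.V t x ^ 2) := by gcongr
  have h2 : L.G t x ^ 2 ≤ K / τ * (τ * (L.n t x * L.G t x ^ 2)) := by
    have : 1 / K * L.G t x ^ 2 ≤ L.n t x * L.G t x ^ 2 := by gcongr
    calc L.G t x ^ 2 = K / τ * (τ * (1 / K * L.G t x ^ 2)) := by field_simp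
      _ ≤ _ := by gcongr
  have hKτ : 0 < K / τ := by positivity
  have hG : 0 ≤ τ * (L.n t x * L.G t x ^ 2) :=
    mul_nonneg hτ.le (mul_nonneg (k0.le.trans hn) (sq_nonneg _))
  have hV : 0 ≤ L.b t x * L.V t x ^ 2 := by positivity
  rw [LinFields.ed]
  generalize τ * (L.n t x * L.G t x ^ 2) = g at *
  have hA := sq_nonneg (L.A t x)
  have m1 := mul_nonneg hKτ.le hV
  have m2 := mul_nonneg hKτ.le hA
  have m3 := mul_nonneg K0.le hG
  have m4 := mul_nonneg K0.le hA
  rw [abs_le]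
  constructor
  · nlinarith [sq_nonneg (L.A t x + L.b t x * L.V t x), sq_nonneg (L.A t x + L.G t x)]
  · nlinarith [sq_nonneg (L.A t x - L.b t x * L.V t x), sq_nonneg (L.A t x - L.G t x)]

lemma LinFields.pr_le {L : LinFields} {t x M : ℝ} (K1 : 1 ≤ K) (hτ : 0 < τ) (hτ1 : τ ≤ 1)
    (hb : 1 / K ≤ L.b t x) (hn : 1 / K ≤ L.n t x) (hnK : L.n t x ≤ K)
    (h1 : |L.bt t x| ≤ M) (h2 : |L.bx t x| ≤ M) (h3 : |L.nt t x| ≤ M)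
    (h4 : |L.g₁ t x| ≤ M * |L.V t x|) (h5 : |L.g₂ t x| ≤ M * (|L.V t x| + |L.G t x|)) :
    L.pr τ t x ≤ (4 + 2 * K) * M * (2 * K / τ) * L.ed τ t x := by
  have K0 : 0 < K := by linarith
  have M0 : 0 ≤ M := (abs_nonneg _).trans h1
  have k0 : 0 < 1 / K := by positivity
  have hed := LinFields.ed_ge K1 hτ hτ1 hb hn
  have n0 : 0 ≤ L.n t x := k0.le.trans hn
  suffices L.pr τ t x ≤ (4 + 2 * K) * M * (L.V t x ^ 2 + L.A t x ^ 2 + L.G t x ^ 2) by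
    refine this.trans ?_
    calc _ = (4 + 2 * K) * M * (2 * K / τ) *
          (τ / (2 * K) * (L.V t x ^ 2 + L.A t x ^ 2 + L.G t x ^ 2)) := by field_simp
      _ ≤ _ := by gcongr
  clear hed
  rw [LinFields.pr]
  have hK := K0.le
  generalize L.V t x = V at *
  generalize L.A t x = A at *
  generalize L.G t x = G at *
  have e1 : L.bt t x * V ^ 2 ≤ M * V ^ 2 := by gcongr; exact (le_abs_self _).trans h1
  have e2 : -(L.bx t x * V * A) ≤ M * (|V| * |A|) := by
    refine (neg_le_abs _).trans ?_
    rw [abs_mul, abs_mul, mul_assoc]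
    gcongr
  have e3 : A * L.g₁ t x ≤ M * (|V| * |A|) := by
    refine (le_abs_self _).trans ?_
    rw [abs_mul]
    calc |A| * |L.g₁ t x| ≤ |A| * (M * |V|) := by gcongr
      _ = _ := by ring
  have e4 : L.n t x * G * L.g₂ t x ≤ K * M * (|G| * (|V| + |G|)) := by
    refine (le_abs_self _).trans ?_
    rw [abs_mul, abs_mul, abs_of_nonneg n0]
    calc L.n t x * |G| * |L.g₂ t x| ≤ K * |G| * (M * (|V| + |G|)) := by gcongr
      _ = _ := by ring
  have e5 : τ * (L.nt t x * G ^ 2) ≤ 1 * (M * G ^ 2) := by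
    have : L.nt t x * G ^ 2 ≤ M * G ^ 2 := by gcongr; exact (le_abs_self _).trans h3
    calc τ * (L.nt t x * G ^ 2) ≤ τ * (M * G ^ 2) := by gcongr
      _ ≤ _ := by gcongr
  have e6 : 0 ≤ L.n t x * G ^ 2 := by positivity
  have f1 : |V| * |A| ≤ (V ^ 2 + A ^ 2) / 2 := by
    nlinarith [sq_nonneg (|V| - |A|), sq_abs V, sq_abs A]
  have f2 : |G| * (|V| + |G|) ≤ 3 / 2 * (V ^ 2 + G ^ 2) := by
    nlinarith [sq_nonneg (|V| - |G|), sq_abs V, sq_abs G]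
  have f1' := mul_le_mul_of_nonneg_left f1 M0
  have f2' := mul_le_mul_of_nonneg_left f2 (mul_nonneg hK M0)
  have p1 := mul_nonneg M0 (sq_nonneg V)
  have p2 := mul_nonneg M0 (sq_nonneg A)
  have p3 := mul_nonneg M0 (sq_nonneg G)
  have p4 := mul_nonneg hK p1
  have p5 := mul_nonneg hK p2
  have p6 := mul_nonneg hK p3
  nlinarith only [e1, e2, e3, e4, e5, e6, f1', f2', p1, p2, p3, p4, p5, p6]

end

section

variable {a μ γ τ T K : ℝ} {F F' : Fields} {v u S vx ux Sx : ℝ → ℝ → ℝ}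

/-- Uniqueness in the domain of dependence. -/
theorem CSol.cone_unique (hK : CoefBd γ μ K) (ha : |a| ≤ 1) (hμ : 0 < μ) (hτ : 0 < τ)
    (hτ1 : τ ≤ 1) (hT : 0 < T) (h : CSol a μ γ τ⁻¹ T F) (w : C1Sol a μ γ τ T v u S vx ux Sx)
    {x₀ ρ : ℝ}
    (h0 : ∀ x, |x - x₀| < ρ → F.v 0 x = v 0 x ∧ F.u 0 x = u 0 x ∧ F.S 0 x = S 0 x)
    {t x : ℝ} (ht : t ∈ Icc 0 T) (hx : 1 + |x - x₀| < ρ - (2 + K + K / τ) * t) :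
    F.v t x = v t x ∧ F.u t x = u t x ∧ F.S t x = S t x := by
  have K1 := hK.one_le
  have K0 : 0 < K := by linarith
  have hd := h.diffLin ha hμ hτ w
  obtain ⟨L, hL⟩ : ∃ L, L = F.diffLin a μ γ τ v u S vx ux Sx := ⟨_, rfl⟩
  rw [← hL] at hd
  have hb1 : ∀ t x, 1 / K ≤ L.b t x := fun t x => by rw [hL]; exact hK.b_ge _ (h.v_mem t x)
  have hb2 : ∀ t x, L.b t x ≤ K := fun t x => by rw [hL]; exact hK.b_le _ (h.v_mem t x)
  have hn1 : ∀ t x, 1 / K ≤ L.n t x := fun t x => by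
    rw [hL]; exact (hK.n_mem ha hμ hτ h t x).1
  have hn2 : ∀ t x, L.n t x ≤ K := fun t x => by
    rw [hL]; exact (hK.n_mem ha hμ hτ h t x).2
  have hge := fun t x => LinFields.ed_ge (L := L) K1 hτ hτ1 (hb1 t x) (hn1 t x)
  have he0 : ∀ t x, 0 ≤ L.ed τ t x := fun t x => le_trans (by positivity) (hge t x)
  have key : L.ed τ t x = 0 := by
    refine hd.cone hτ hT (ℓ := 2 + K + K / τ) (x₀ := x₀) (ρ := ρ) (by positivity) he0
      (fun t x => LinFields.flux_le K1 hτ (hb1 t x) (hb2 t x) (hn1 t x)) (fun R => ?_)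
      (fun y hy => ?_) ht ((regDist_le _ _).trans_lt hx)
    · have hQ : IsCompact (Icc 0 T ×ˢ Icc (-R) R) := isCompact_Icc.prod isCompact_Icc
      have bdd : ∀ {f : ℝ → ℝ → ℝ}, (Continuous fun p : ℝ × ℝ => f p.1 p.2) → ∃ M, 0 ≤ M ∧
          ∀ t ∈ Icc 0 T, ∀ x, |x| ≤ R → |f t x| ≤ M := fun {f} hf => by
        obtain ⟨M, hM⟩ := hQ.exists_bound_of_continuousOn hf.continuousOn
        exact ⟨max M 0, le_max_right _ _, fun t ht x hx =>
          (hM (t, x) ⟨ht, abs_le.1 hx⟩).trans (le_max_left _ _)⟩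
      obtain ⟨M1, p1, hM1⟩ := bdd hd.cbt
      obtain ⟨M2, p2, hM2⟩ := bdd hd.cbx
      obtain ⟨M3, p3, hM3⟩ := bdd hd.cnt
      obtain ⟨M4, p4, hM4⟩ := bdd w.cvx
      obtain ⟨M5, p5, hM5⟩ := bdd w.cux
      obtain ⟨M6, p6, hM6⟩ := bdd w.cv
      obtain ⟨M7, p7, hM7⟩ := bdd (f := fun t x => (v t x)⁻¹) (w.cv.inv₀ fun p => (w.pos _ _).ne')
      obtain ⟨M8, p8, hM8⟩ := bdd w.cS
      obtain ⟨l, hl, hlv⟩ : ∃ l > 0, ∀ t ∈ Icc 0 T, ∀ x, |x| ≤ R → v t x ∈ Icc l (M6 + 2) := by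
        refine ⟨(M7 + 1)⁻¹, by positivity, fun t ht x hx => ⟨?_,
          ((le_abs_self _).trans (hM6 t ht x hx)).trans (by linarith)⟩⟩
        have := (le_abs_self _).trans (hM7 t ht x hx)
        rw [inv_le_comm₀ (by positivity) (w.pos t x)]
        linarith
      obtain ⟨l', hl'⟩ : ∃ l', l' = min l (1 / 2) := ⟨_, rfl⟩
      obtain ⟨M9, hM9⟩ := exists_lip_bF γ (l := l') (r := M6 + 2) (by rw [hl']; positivity)
      have hm9 : ∀ t ∈ Icc 0 T, ∀ x, |x| ≤ R → |bF γ (F.v t x) - bF γ (v t x)| ≤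
          |M9| * |F.v t x - v t x| := fun t ht x hx => by
        refine (hM9 _ ⟨?_, ?_⟩ _ ⟨?_, ?_⟩).trans (mul_le_mul_of_nonneg_right (le_abs_self _)
          (abs_nonneg _))
        · rw [hl']; exact (min_le_right _ _).trans (h.v_mem t x).1
        · linarith [(h.v_mem t x).2]
        · rw [hl']; exact (min_le_left _ _).trans (hlv t ht x hx).1
        · exact (hlv t ht x hx).2
      obtain ⟨N, hN⟩ : ∃ N, N = 4 + (2 * M8 * 1 + μ) * 2 * M7 := ⟨_, rfl⟩
      have N0 : 0 ≤ N := by rw [hN]; positivity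
      obtain ⟨M, hM⟩ : ∃ M, M = M1 + M2 + M3 + |M9| * M4 + N * M5 := ⟨_, rfl⟩
      have q1 : 0 ≤ |M9| * M4 := by positivity
      have q2 : 0 ≤ N * M5 := by positivity
      refine ⟨(4 + 2 * K) * M * (2 * K / τ), fun t ht x hx => ?_⟩
      refine LinFields.pr_le K1 hτ hτ1 (hb1 t x) (hn1 t x) (hn2 t x)
        ((hM1 t ht x hx).trans (by linarith)) ((hM2 t ht x hx).trans (by linarith))
        ((hM3 t ht x hx).trans (by linarith)) ?_ ?_
      · rw [hL]
        simp only [Fields.diffLin]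
        rw [abs_mul]
        calc |bF γ (F.v t x) - bF γ (v t x)| * |vx t x|
            ≤ |M9| * |F.v t x - v t x| * M4 := by
              gcongr
              exacts [hm9 t ht x hx, hM4 t ht x hx]
          _ = |M9| * M4 * |F.v t x - v t x| := by ring
          _ ≤ _ := by gcongr; linarith
      · have hv1 := h.v_pos t x
        have hv2 := w.pos t x
        have e : L.g₂ t x = (2 * a * τ / F.v t x * (F.S t x - S t x) - (2 * a * τ * S t x + μ) *
            (v t x)⁻¹ / F.v t x * (F.v t x - v t x)) * ux t x := by
          rw [hL]
          simp only [Fields.diffLin, Fields.m, Fields.P]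
          field_simp
          ring
        have eV : L.V t x = F.v t x - v t x := by rw [hL]; rfl
        have eG : L.G t x = F.S t x - S t x := by rw [hL]; rfl
        rw [e, ← eV, ← eG, abs_mul]
        have hvi : (F.v t x)⁻¹ ≤ 2 := by
          rw [inv_le_comm₀ hv1 (by norm_num)]
          linarith [(h.v_mem t x).1]
        have hvi0 : 0 < (F.v t x)⁻¹ := inv_pos.2 hv1
        have r1 : |2 * a * τ / F.v t x * L.G t x| ≤ N * |L.G t x| := by
          rw [abs_mul]
          refine mul_le_mul_of_nonneg_right ?_ (abs_nonneg _)
          rw [div_eq_mul_inv, abs_mul, abs_mul, abs_mul, abs_two, abs_of_pos hτ, abs_of_pos hvi0]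
          calc 2 * |a| * τ * (F.v t x)⁻¹ ≤ 2 * 1 * 1 * 2 := by gcongr
            _ ≤ N := by
              rw [hN]
              have : 0 ≤ (2 * M8 * 1 + μ) * 2 * M7 := by positivity
              linarith
        have r2 : |(2 * a * τ * S t x + μ) * (v t x)⁻¹ / F.v t x * L.V t x| ≤ N * |L.V t x| := by
          rw [abs_mul]
          refine mul_le_mul_of_nonneg_right ?_ (abs_nonneg _)
          rw [div_eq_mul_inv, abs_mul, abs_mul, abs_of_pos hvi0]
          have s1 : |2 * a * τ * S t x + μ| ≤ 2 * M8 * 1 + μ := by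
            refine (abs_add_le _ _).trans ?_
            rw [abs_of_pos hμ, abs_mul, abs_mul, abs_mul, abs_two, abs_of_pos hτ]
            have : 2 * |a| * τ * |S t x| ≤ 2 * 1 * 1 * M8 := by
              gcongr
              exact hM8 t ht x hx
            linarith
          calc |2 * a * τ * S t x + μ| * |(v t x)⁻¹| * (F.v t x)⁻¹
              ≤ (2 * M8 * 1 + μ) * M7 * 2 := by
                gcongr
                exact hM7 t ht x hx
            _ ≤ N := by rw [hN]; linarith
        have r3 : |2 * a * τ / F.v t x * L.G t x - (2 * a * τ * S t x + μ) *
            (v t x)⁻¹ / F.v t x * L.V t x| ≤ N * (|L.V t x| + |L.G t x|) :=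
          (abs_sub _ _).trans (by linarith)
        calc _ ≤ N * (|L.V t x| + |L.G t x|) * M5 := by
              gcongr
              exact hM5 t ht x hx
          _ = N * M5 * (|L.V t x| + |L.G t x|) := by ring
          _ ≤ _ := by gcongr; linarith
    · obtain ⟨e1, e2, e3⟩ := h0 y ((abs_le_regDist _ _).trans_lt hy)
      rw [hL]
      simp [LinFields.ed, Fields.diffLin, e1, e2, e3]
  have h1 := hge t x
  rw [key] at h1
  have h2 : L.V t x ^ 2 + L.A t x ^ 2 + L.G t x ^ 2 ≤ 0 := by
    by_contra! hc
    have : 0 < τ / (2 * K) * (L.V t x ^ 2 + L.A t x ^ 2 + L.G t x ^ 2) := by positivity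
    linarith
  have hV := pow_eq_zero_iff (n := 2) (by norm_num) |>.1
    (le_antisymm (by nlinarith [sq_nonneg (L.A t x), sq_nonneg (L.G t x)]) (sq_nonneg (L.V t x)))
  have hA := pow_eq_zero_iff (n := 2) (by norm_num) |>.1
    (le_antisymm (by nlinarith [sq_nonneg (L.V t x), sq_nonneg (L.G t x)]) (sq_nonneg (L.A t x)))
  have hG := pow_eq_zero_iff (n := 2) (by norm_num) |>.1
    (le_antisymm (by nlinarith [sq_nonneg (L.A t x), sq_nonneg (L.V t x)]) (sq_nonneg (L.G t x)))
  rw [hL] at hV hA hG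
  exact ⟨sub_eq_zero.1 hV, sub_eq_zero.1 hA, sub_eq_zero.1 hG⟩

/-- Two fields agree at a point to all orders considered. -/
def Fields.EqAt (F F' : Fields) (t x : ℝ) : Prop :=
  F.v t x = F'.v t x ∧ F.u t x = F'.u t x ∧ F.S t x = F'.S t x ∧ F.vx t x = F'.vx t x ∧
  F.ux t x = F'.ux t x ∧ F.Sx t x = F'.Sx t x ∧ F.vxx t x = F'.vxx t x ∧
  F.uxx t x = F'.uxx t x ∧ F.Sxx t x = F'.Sxx t x

lemma deriv_eqOn_ball {f g f' g' : ℝ → ℝ} (hf : ∀ x, HasDerivAt f (f' x) x)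
    (hg : ∀ x, HasDerivAt g (g' x) x) {x₀ r : ℝ} (h : ∀ x, |x - x₀| < r → f x = g x) :
    ∀ x, |x - x₀| < r → f' x = g' x := fun x hx => by
  refine (hf x).unique ((hg x).congr_of_eventuallyEq ?_)
  have : Continuous fun x : ℝ => |x - x₀| := by fun_prop
  filter_upwards [this.continuousAt.eventually_lt continuousAt_const hx] with y hy
  exact h y hy

/-- Agreement of two classical solutions in the domain of dependence. -/
theorem CSol.cone_eqAt (hK : CoefBd γ μ K) (ha : |a| ≤ 1) (hμ : 0 < μ) (hτ : 0 < τ)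
    (hτ1 : τ ≤ 1) (hT : 0 < T) (h : CSol a μ γ τ⁻¹ T F) {T' : ℝ} (h' : CSol a μ γ τ⁻¹ T' F')
    (hTT : T ≤ T') {x₀ ρ : ℝ}
    (h0 : ∀ x, |x - x₀| < ρ → F.v 0 x = F'.v 0 x ∧ F.u 0 x = F'.u 0 x ∧ F.S 0 x = F'.S 0 x)
    {t x : ℝ} (ht : t ∈ Icc 0 T) (hx : 1 + |x - x₀| < ρ - (2 + K + K / τ) * t) :
    F.EqAt F' t x := by
  have w' := h'.c1Sol hτ
  have w : C1Sol a μ γ τ T F'.v F'.u F'.S F'.vx F'.ux F'.Sx :=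
    { w' with
      tv := fun t ht => w'.tv t ⟨ht.1, ht.2.trans_le hTT⟩
      tu := fun t ht => w'.tu t ⟨ht.1, ht.2.trans_le hTT⟩
      tS := fun t ht => w'.tS t ⟨ht.1, ht.2.trans_le hTT⟩ }
  have key : ∀ y, |y - x₀| < ρ - (2 + K + K / τ) * t - 1 →
      F.v t y = F'.v t y ∧ F.u t y = F'.u t y ∧ F.S t y = F'.S t y := fun y hy =>
    h.cone_unique hK ha hμ hτ hτ1 hT w h0 ht (by linarith)
  have e1 := deriv_eqOn_ball (h.dv t) (h'.dv t) fun y hy => (key y hy).1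
  have e2 := deriv_eqOn_ball (h.du t) (h'.du t) fun y hy => (key y hy).2.1
  have e3 := deriv_eqOn_ball (h.dS t) (h'.dS t) fun y hy => (key y hy).2.2
  have e4 := deriv_eqOn_ball (h.dvx t) (h'.dvx t) e1
  have e5 := deriv_eqOn_ball (h.dux t) (h'.dux t) e2
  have e6 := deriv_eqOn_ball (h.dSx t) (h'.dSx t) e3
  have hx' : |x - x₀| < ρ - (2 + K + K / τ) * t - 1 := by linarith
  obtain ⟨k1, k2, k3⟩ := key x hx'
  exact ⟨k1, k2, k3, e1 x hx', e2 x hx', e3 x hx', e4 x hx', e5 x hx', e6 x hx'⟩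

end

section

/-- `ζ` is a compactly supported `C²` function, bounded by `K` with its derivatives. -/
structure Cutoff (K : ℝ) (ζ ζ' ζ'' : ℝ → ℝ) : Prop where
  d : ∀ x, HasDerivAt ζ (ζ' x) x
  d' : ∀ x, HasDerivAt ζ' (ζ'' x) x
  c : Continuous ζ''
  b : ∀ x, |ζ x| ≤ K
  b' : ∀ x, |ζ' x| ≤ K
  b'' : ∀ x, |ζ'' x| ≤ K
  far : ∃ R, ∀ x, R < |x| → ζ x = 0

lemma Cutoff.sub {K : ℝ} {ζ ζ' ζ'' η η' η'' : ℝ → ℝ} (h : Cutoff K ζ ζ' ζ'')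
    (k : Cutoff K η η' η'') : Cutoff (2 * K) (fun x => ζ x - η x) (fun x => ζ' x - η' x)
      fun x => ζ'' x - η'' x := by
  obtain ⟨R, hR⟩ := h.far
  obtain ⟨R', hR'⟩ := k.far
  refine ⟨fun x => (h.d x).sub (k.d x), fun x => (h.d' x).sub (k.d' x), h.c.sub k.c,
    fun x => ?_, fun x => ?_, fun x => ?_, max R R', fun x hx => ?_⟩
  · linarith [abs_sub (ζ x) (η x), h.b x, k.b x]
  · linarith [abs_sub (ζ' x) (η' x), h.b' x, k.b' x]
  · linarith [abs_sub (ζ'' x) (η'' x), h.b'' x, k.b'' x]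
  · rw [hR x (lt_of_le_of_lt (le_max_left _ _) hx), hR' x (lt_of_le_of_lt (le_max_right _ _) hx),
      sub_zero]

lemma exists_cutoff : ∃ K ≥ (1 : ℝ), ∀ N ≥ (1 : ℝ), ∃ ζ ζ' ζ'' : ℝ → ℝ, Cutoff K ζ ζ' ζ'' ∧
    (∀ x, |x| ≤ N → ζ x = 1) ∧ ∀ x, 2 * N ≤ |x| → ζ x = 0 := by
  let f : ContDiffBump (0 : ℝ) := ⟨1, 2, one_pos, one_lt_two⟩
  have hf : ContDiff ℝ 2 f := f.contDiff
  have hs : HasCompactSupport f := f.hasCompactSupport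
  have hf1 : ContDiff ℝ 1 (deriv f) := by
    have : ContDiff ℝ (1 + 1) f := by simpa [one_add_one_eq_two] using hf
    exact (contDiff_succ_iff_deriv.1 this).2.2
  have d : ∀ x, HasDerivAt f (deriv f x) x := fun x =>
    (hf.differentiable (by norm_num) x).hasDerivAt
  have d' : ∀ x, HasDerivAt (deriv f) (deriv (deriv f) x) x := fun x =>
    (hf1.differentiable (by norm_num) x).hasDerivAt
  have c : Continuous (deriv (deriv f)) := hf1.continuous_deriv le_rfl
  obtain ⟨A, hA⟩ := hf.continuous.bounded_above_of_compact_support hs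
  obtain ⟨B, hB⟩ := hf1.continuous.bounded_above_of_compact_support hs.deriv
  obtain ⟨C, hC⟩ := c.bounded_above_of_compact_support hs.deriv.deriv
  simp only [Real.norm_eq_abs] at hA hB hC
  have A0 := (abs_nonneg _).trans (hA 0)
  have B0 := (abs_nonneg _).trans (hB 0)
  have C0 := (abs_nonneg _).trans (hC 0)
  refine ⟨1 + A + B + C, by linarith, fun N hN => ⟨fun x => f (x / N),
    fun x => deriv f (x / N) / N, fun x => deriv (deriv f) (x / N) / N / N, ?_, ?_, ?_⟩⟩
  · have N0 : 0 < N := by linarith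
    have dl : ∀ x : ℝ, HasDerivAt (fun y => y / N) (1 / N) x := fun x =>
      (hasDerivAt_id x).div_const N
    have key : ∀ {z B : ℝ}, |z| ≤ B → |z / N| ≤ B := fun {z B} h => by
      rw [abs_div, abs_of_pos N0]
      exact (div_le_self (abs_nonneg z) hN).trans h
    refine ⟨fun x => ?_, fun x => ?_, (c.comp (by fun_prop)).div_const N |>.div_const N,
      fun x => by linarith [hA (x / N)], fun x => by linarith [key (hB (x / N))],
      fun x => by linarith [key (key (hC (x / N)))], 2 * N, fun x hx => ?_⟩
    · have := (d (x / N)).comp x (dl x)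
      rw [mul_one_div] at this
      exact this
    · have := ((d' (x / N)).comp x (dl x)).div_const N
      rw [mul_one_div] at this
      exact this
    · refine f.zero_of_le_dist ?_
      rw [Real.dist_eq, sub_zero, abs_div, abs_of_pos N0]
      exact (le_div_iff₀ N0).2 hx.le
  · intro x hx
    refine f.one_of_mem_closedBall ?_
    have N0 : 0 < N := by linarith
    rw [Metric.mem_closedBall, Real.dist_eq, sub_zero, abs_div, abs_of_pos N0]
    exact (div_le_one N0).2 hx
  · intro x hx
    have N0 : 0 < N := by linarith
    refine f.zero_of_le_dist ?_
    rw [Real.dist_eq, sub_zero, abs_div, abs_of_pos N0]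
    exact (le_div_iff₀ N0).2 hx

/-- The functions in `D` are the successive derivatives of `v, u, S`, and the perturbation
of the rest state is of class `H²`. -/
structure Data.IsH2 (D : Data) (τ : ℝ) : Prop where
  dv : ∀ x, HasDerivAt D.v (D.v' x) x
  du : ∀ x, HasDerivAt D.u (D.u' x) x
  dS : ∀ x, HasDerivAt D.S (D.S' x) x
  dv' : ∀ x, HasDerivAt D.v' (D.v'' x) x
  du' : ∀ x, HasDerivAt D.u' (D.u'' x) x
  dS' : ∀ x, HasDerivAt D.S' (D.S'' x) x
  cv : Continuous D.v''
  cu : Continuous D.u''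
  cS : Continuous D.S''
  int : Integrable (D.yd τ)

/-- Truncation of the data. -/
def Data.cut (D : Data) (ζ ζ' ζ'' : ℝ → ℝ) : Data where
  v x := 1 + ζ x * (D.v x - 1)
  u x := ζ x * D.u x
  S x := ζ x * D.S x
  v' x := ζ' x * (D.v x - 1) + ζ x * D.v' x
  u' x := ζ' x * D.u x + ζ x * D.u' x
  S' x := ζ' x * D.S x + ζ x * D.S' x
  v'' x := ζ'' x * (D.v x - 1) + 2 * ζ' x * D.v' x + ζ x * D.v'' x
  u'' x := ζ'' x * D.u x + 2 * ζ' x * D.u' x + ζ x * D.u'' x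
  S'' x := ζ'' x * D.S x + 2 * ζ' x * D.S' x + ζ x * D.S'' x

variable {D : Data} {τ K : ℝ} {ζ ζ' ζ'' : ℝ → ℝ}

lemma Data.IsH2.cut_isC2 (h : D.IsH2 τ) (k : Cutoff K ζ ζ' ζ'') :
    (D.cut ζ ζ' ζ'').IsC2 := by
  obtain ⟨R, hR⟩ := k.far
  have c1 := continuous_of_hasDerivAt h.dv
  have c2 := continuous_of_hasDerivAt h.dv'
  have c3 := h.cv
  have c4 := continuous_of_hasDerivAt h.du
  have c5 := continuous_of_hasDerivAt h.du'
  have c6 := h.cu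
  have c7 := continuous_of_hasDerivAt h.dS
  have c8 := continuous_of_hasDerivAt h.dS'
  have c9 := h.cS
  have k1 := continuous_of_hasDerivAt k.d
  have k2 := continuous_of_hasDerivAt k.d'
  have k3 := k.c
  have d1 : ∀ {f f' : ℝ → ℝ}, (∀ x, HasDerivAt f (f' x) x) → ∀ x,
      HasDerivAt (fun x => ζ x * f x) (ζ' x * f x + ζ x * f' x) x := fun hf x =>
    (k.d x).mul (hf x)
  have d2 : ∀ {f f' f'' : ℝ → ℝ}, (∀ x, HasDerivAt f (f' x) x) →
      (∀ x, HasDerivAt f' (f'' x) x) → ∀ x, HasDerivAt (fun x => ζ' x * f x + ζ x * f' x)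
        (ζ'' x * f x + 2 * ζ' x * f' x + ζ x * f'' x) x := fun hf hf' x =>
    (((k.d' x).mul (hf x)).add ((k.d x).mul (hf' x))).congr_deriv (by ring)
  have dv1 : ∀ x, HasDerivAt (fun x => D.v x - 1) (D.v' x) x := fun x => (h.dv x).sub_const 1
  refine ⟨fun x => (d1 dv1 x).const_add 1, d1 h.du, d1 h.dS, d2 dv1 h.dv', d2 h.du h.du',
    d2 h.dS h.dS', ?_, ?_, ?_, R, fun x hx => ?_⟩
  · unfold Data.cut; fun_prop
  · unfold Data.cut; fun_prop
  · unfold Data.cut; fun_prop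
  · simp [Data.cut, hR x hx]

lemma cut_sq_le {p q r f f' f'' K : ℝ} (hp : |p| ≤ K) (hq : |q| ≤ K) (hr : |r| ≤ K) :
    (p * f) ^ 2 + (q * f + p * f') ^ 2 + (r * f + 2 * q * f' + p * f'') ^ 2
      ≤ 14 * K ^ 2 * (f ^ 2 + f' ^ 2 + f'' ^ 2) := by
  have e : ∀ {z w : ℝ}, |z| ≤ K → (z * w) ^ 2 ≤ K ^ 2 * w ^ 2 := fun {z w} h => by
    rw [mul_pow]
    exact mul_le_mul_of_nonneg_right (sq_le_sq' (abs_le.1 h).1 (abs_le.1 h).2) (sq_nonneg w)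
  have h1 := e (w := f) hp
  have h2 := e (w := f) hq
  have h3 := e (w := f') hp
  have h4 := e (w := f) hr
  have h5 := e (w := f') hq
  have h6 := e (w := f'') hp
  have i1 : (q * f + p * f') ^ 2 ≤ 2 * (q * f) ^ 2 + 2 * (p * f') ^ 2 := by
    linarith only [sq_nonneg (q * f - p * f'), show 2 * (q * f) ^ 2 + 2 * (p * f') ^ 2
      - (q * f + p * f') ^ 2 = (q * f - p * f') ^ 2 by ring]
  have i2 : (r * f + 2 * q * f' + p * f'') ^ 2
      ≤ 3 * (r * f) ^ 2 + 12 * (q * f') ^ 2 + 3 * (p * f'') ^ 2 := by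
    linarith only [sq_nonneg (r * f - 2 * (q * f')), sq_nonneg (r * f - p * f''),
      sq_nonneg (2 * (q * f') - p * f''),
      show 3 * (r * f) ^ 2 + 12 * (q * f') ^ 2 + 3 * (p * f'') ^ 2
      - (r * f + 2 * q * f' + p * f'') ^ 2 = (r * f - 2 * (q * f')) ^ 2 + (r * f - p * f'') ^ 2
        + (2 * (q * f') - p * f'') ^ 2 by ring]
  have p1 : 0 ≤ K ^ 2 * f ^ 2 := by positivity
  have p2 : 0 ≤ K ^ 2 * f' ^ 2 := by positivity
  have p3 : 0 ≤ K ^ 2 * f'' ^ 2 := by positivity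
  linarith

lemma Cutoff.cut_yd_le (k : Cutoff K ζ ζ' ζ'') (hτ : 0 < τ) (x : ℝ) :
    (D.cut ζ ζ' ζ'').yd τ x ≤ 14 * K ^ 2 * D.yd τ x := by
  have h1 := cut_sq_le (f := D.v x - 1) (f' := D.v' x) (f'' := D.v'' x) (k.b x) (k.b' x) (k.b'' x)
  have h2 := cut_sq_le (f := D.u x) (f' := D.u' x) (f'' := D.u'' x) (k.b x) (k.b' x) (k.b'' x)
  have h3 := mul_le_mul_of_nonneg_left
    (cut_sq_le (f := D.S x) (f' := D.S' x) (f'' := D.S'' x) (k.b x) (k.b' x) (k.b'' x)) hτ.le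
  simp only [Data.yd, Data.cut, add_sub_cancel_left]
  linarith

lemma Cutoff.cut_yd_eq_zero (k : Cutoff K ζ ζ' ζ'') {r : ℝ} (h : ∀ x, |x| < r → ζ x = 0) {x : ℝ}
    (hx : |x| < r) : (D.cut ζ ζ' ζ'').yd τ x = 0 := by
  have e1 := deriv_eqOn_ball (x₀ := 0) (r := r) k.d (fun x => hasDerivAt_const x (0 : ℝ))
    fun y hy => h y (by simpa using hy)
  have e2 := deriv_eqOn_ball (x₀ := 0) (r := r) k.d' (fun x => hasDerivAt_const x (0 : ℝ))
    fun y hy => e1 y hy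
  have hx' : |x - 0| < r := by simpa using hx
  simp [Data.yd, Data.cut, h x hx, e1 x hx', e2 x hx']

lemma Data.IsH2.integral_cut_le (h : D.IsH2 τ) (hτ : 0 < τ) (k : Cutoff K ζ ζ' ζ'') :
    ∫ x, (D.cut ζ ζ' ζ'').yd τ x ≤ 14 * K ^ 2 * ∫ x, D.yd τ x := by
  rw [← MeasureTheory.integral_const_mul]
  exact integral_mono (h.cut_isC2 k).integrable_yd (h.int.const_mul _) fun x => k.cut_yd_le hτ x

/-- Data truncated away from a large ball have small energy. -/
lemma Data.IsH2.exists_tail (h : D.IsH2 τ) (hτ : 0 < τ) (K : ℝ) {ε : ℝ} (hε : 0 < ε) :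
    ∃ r₀, ∀ r ≥ r₀, ∀ ζ ζ' ζ'' : ℝ → ℝ, Cutoff K ζ ζ' ζ'' → (∀ x, |x| < r → ζ x = 0) →
      ∫ x, (D.cut ζ ζ' ζ'').yd τ x ≤ ε := by
  obtain ⟨η, hη⟩ : ∃ η, η = ε / (14 * K ^ 2 + 1) := ⟨_, rfl⟩
  have η0 : 0 < η := by rw [hη]; positivity
  have ht : Tendsto (fun r : ℝ => ∫ x in -r..r, D.yd τ x) atTop (nhds (∫ x, D.yd τ x)) :=
    intervalIntegral_tendsto_integral h.int tendsto_neg_atTop_atBot tendsto_id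
  obtain ⟨r₀, hr₀⟩ := eventually_atTop.1 ((ht.eventually (lt_mem_nhds (sub_lt_self _ η0))).and
    (eventually_ge_atTop 0))
  refine ⟨r₀, fun r hr ζ ζ' ζ'' k hz => ?_⟩
  obtain ⟨h1, h2⟩ := hr₀ r hr
  have e : ∫ x, D.yd τ x = (∫ x in Ioo (-r) r, D.yd τ x) + ∫ x in (Ioo (-r) r)ᶜ, D.yd τ x :=
    (integral_add_compl measurableSet_Ioo h.int).symm
  rw [intervalIntegral.integral_of_le (by linarith), integral_Ioc_eq_integral_Ioo] at h1
  have e2 : ∫ x, (D.cut ζ ζ' ζ'').yd τ x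
      = ∫ x in (Ioo (-r) r)ᶜ, (D.cut ζ ζ' ζ'').yd τ x := by
    refine (setIntegral_eq_integral_of_forall_compl_eq_zero fun x hx => ?_).symm
    rw [notMem_compl_iff] at hx
    exact k.cut_yd_eq_zero hz (abs_lt.2 hx)
  have e3 : ∫ x in (Ioo (-r) r)ᶜ, (D.cut ζ ζ' ζ'').yd τ x
      ≤ ∫ x in (Ioo (-r) r)ᶜ, 14 * K ^ 2 * D.yd τ x :=
    setIntegral_mono (h.cut_isC2 k).integrable_yd.integrableOn (h.int.const_mul _).integrableOn
      fun x => k.cut_yd_le hτ x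
  rw [MeasureTheory.integral_const_mul] at e3
  have e4 : 14 * K ^ 2 * (∫ x in (Ioo (-r) r)ᶜ, D.yd τ x) ≤ 14 * K ^ 2 * η :=
    mul_le_mul_of_nonneg_left (by linarith) (by positivity)
  have e5 : (14 * K ^ 2 + 1) * η = ε := by rw [hη]; field_simp
  linarith

end

section

/-- Extension of the fields to negative times by their values at time zero. -/
def Fields.past (F : Fields) : Fields where
  v t x := F.v (max t 0) x
  u t x := F.u (max t 0) x
  S t x := F.S (max t 0) x
  vx t x := F.vx (max t 0) x
  ux t x := F.ux (max t 0) x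
  Sx t x := F.Sx (max t 0) x
  vxx t x := F.vxx (max t 0) x
  uxx t x := F.uxx (max t 0) x
  Sxx t x := F.Sxx (max t 0) x

lemma Fields.EqAt.symm {F G : Fields} {t x : ℝ} (h : F.EqAt G t x) : G.EqAt F t x := by
  obtain ⟨e1, e2, e3, e4, e5, e6, e7, e8, e9⟩ := h
  exact ⟨e1.symm, e2.symm, e3.symm, e4.symm, e5.symm, e6.symm, e7.symm, e8.symm, e9.symm⟩

lemma Fields.EqAt.yd {F G : Fields} {t x : ℝ} (h : F.EqAt G t x) (τ : ℝ) :
    F.Yd τ t x = G.Yd τ t x := by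
  obtain ⟨e1, e2, e3, e4, e5, e6, e7, e8, e9⟩ := h
  simp only [Fields.Yd, e1, e2, e3, e4, e5, e6, e7, e8, e9]

lemma Fields.EqAt.dens {F G : Fields} {t x : ℝ} (h : F.EqAt G t x) :
    F.dens t x = G.dens t x := by
  obtain ⟨e1, e2, e3, e4, e5, e6, e7, e8, e9⟩ := h
  simp only [Fields.dens, e3, e4, e5, e6, e7, e8, e9]

variable {a μ γ τ T K : ℝ} {D : Data}

/-- Patching of classical solutions along an exhaustion. -/
theorem exists_patch (hK : CoefBd γ μ K) (ha : |a| ≤ 1) (hμ : 0 < μ) (hτ : 0 < τ) (hτ1 : τ ≤ 1)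
    {F : ℕ → Fields} (h : ∀ N : ℕ, 0 < N → CSol a μ γ τ⁻¹ N (F N))
    (h0 : ∀ N : ℕ, 0 < N → ∀ x : ℝ, |x| < N →
      (F N).v 0 x = D.v x ∧ (F N).u 0 x = D.u x ∧ (F N).S 0 x = D.S x) :
    ∃ G : Fields, ∀ N : ℕ, ∀ t x, 1 + |x| + (2 + K + K / τ) * max t 0 < N →
      G.EqAt (F N).past t x := by
  have K1 := hK.one_le
  obtain ⟨ℓ, hℓ⟩ : ∃ ℓ, ℓ = 2 + K + K / τ := ⟨_, rfl⟩
  have hℓ1 : 1 ≤ ℓ := by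
    have : 0 < K / τ := by positivity
    rw [hℓ]; linarith
  have agree : ∀ N M : ℕ, N ≤ M → ∀ t x, 0 ≤ t → 1 + |x| + ℓ * t < N → (F N).EqAt (F M) t x := by
    intro N M hNM t x ht hx
    have hN : (0 : ℝ) < N := by
      have := abs_nonneg x
      have : 0 ≤ ℓ * t := by positivity
      linarith
    have hN' : 0 < N := Nat.cast_pos.1 hN
    have htN : t ≤ N := by
      have : t ≤ ℓ * t := le_mul_of_one_le_left ht hℓ1
      linarith [abs_nonneg x]
    have hNM' : (N : ℝ) ≤ M := by exact_mod_cast hNM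
    refine (h N hN').cone_eqAt hK ha hμ hτ hτ1 hN (h M (hN'.trans_le hNM)) hNM' (x₀ := 0) (ρ := N)
      (fun y hy => ?_) ⟨ht, htN⟩ (by rw [sub_zero, ← hℓ]; linarith)
    rw [sub_zero] at hy
    obtain ⟨e1, e2, e3⟩ := h0 N hN' y hy
    obtain ⟨e4, e5, e6⟩ := h0 M (hN'.trans_le hNM) y (hy.trans_le hNM')
    exact ⟨e1.trans e4.symm, e2.trans e5.symm, e3.trans e6.symm⟩
  obtain ⟨i, hi⟩ : ∃ i : ℝ → ℝ → ℕ, ∀ t x, 1 + |x| + ℓ * max t 0 < i t x :=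
    ⟨fun t x => ⌊1 + |x| + ℓ * max t 0⌋₊ + 1, fun t x => by
      push_cast; exact Nat.lt_floor_add_one _⟩
  refine ⟨⟨fun t x => (F (i t x)).v (max t 0) x, fun t x => (F (i t x)).u (max t 0) x,
    fun t x => (F (i t x)).S (max t 0) x, fun t x => (F (i t x)).vx (max t 0) x,
    fun t x => (F (i t x)).ux (max t 0) x, fun t x => (F (i t x)).Sx (max t 0) x,
    fun t x => (F (i t x)).vxx (max t 0) x, fun t x => (F (i t x)).uxx (max t 0) x,
    fun t x => (F (i t x)).Sxx (max t 0) x⟩, fun N t x hx => ?_⟩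
  rw [← hℓ] at hx
  have key : (F (i t x)).EqAt (F N) (max t 0) x := by
    rcases le_total (i t x) N with hN | hN
    · exact agree _ _ hN _ _ (le_max_right _ _) (hi t x)
    · exact (agree _ _ hN _ _ (le_max_right _ _) hx).symm
  exact key

/-- `F` solves the relaxed system globally in time, with energy bounded by `E`, uniformly
decaying tails, and locally coincides with a compactly supported perturbation of rest. -/
structure GSol (a μ γ τ K E : ℝ) (D : Data) (F : Fields) : Prop where
  loc : ∀ T R : ℝ, ∃ N > T, ∃ G : Fields, CSol a μ γ τ⁻¹ N G ∧
    (∀ x, |x| < N → G.v 0 x = D.v x ∧ G.u 0 x = D.u x ∧ G.S 0 x = D.S x) ∧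
    (∀ t ≤ T, ∀ x, |x| ≤ R → 1 + |x| < N - (2 + K + K / τ) * max t 0) ∧
    (∀ t ∈ Icc 0 T, (∫ x, G.Yd τ t x) ≤ E ∧ (∫ q in (0 : ℝ)..t, ∫ x, G.dens q x) ≤ E) ∧
    ∀ t ≤ T, ∀ x, |x| ≤ R → F.EqAt G.past t x
  tail : ∀ T : ℝ, ∀ ε > 0, ∃ R, ∀ t ∈ Icc 0 T, ∀ r, ∫ x in {x | R < |x| ∧ |x| ≤ r}, F.Yd τ t x ≤ ε

/-- Global existence for data of class `H²`. -/
theorem exists_gSol (ha : |a| ≤ 1) (hμ : 0 < μ) (hγ : 1 < γ) (hK : CoefBd γ μ K) :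
    ∃ δ > 0, ∃ C > 0, ∀ τ : ℝ, 0 < τ → τ ≤ 1 → ∀ D : Data, D.IsH2 τ → ∫ x, D.yd τ x ≤ δ →
      ∃ F : Fields, GSol a μ γ τ K (C * ∫ x, D.yd τ x) D F := by
  obtain ⟨δ, hδ, C, hC, hex⟩ := compact_existence ha hμ hγ
  obtain ⟨κ, hκ, hcut⟩ := exists_cutoff
  have K1 := hK.one_le
  refine ⟨δ / (14 * κ ^ 2), by positivity, C * (14 * κ ^ 2), by positivity,
    fun τ hτ hτ1 D hD hs => ?_⟩
  have hs' : 14 * κ ^ 2 * ∫ x, D.yd τ x ≤ δ := by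
    rw [le_div_iff₀ (by positivity)] at hs
    linarith
  choose! ζ ζ' ζ'' hζ hζ1 hζ0 using hcut
  have hF : ∀ N : ℕ, ∃ F : Fields, 0 < N → CSol a μ γ τ⁻¹ N F ∧
      F.slice 0 = D.cut (ζ N) (ζ' N) (ζ'' N) ∧ ∀ t ∈ Icc 0 (N : ℝ),
      (∫ x, F.Yd τ t x) ≤ C * (14 * κ ^ 2) * ∫ x, D.yd τ x ∧
      (∫ q in (0 : ℝ)..t, ∫ x, F.dens q x) ≤ C * (14 * κ ^ 2) * ∫ x, D.yd τ x := by
    intro N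
    rcases N.eq_zero_or_pos with rfl | hN
    · exact ⟨⟨0, 0, 0, 0, 0, 0, 0, 0, 0⟩, fun h => absurd h (lt_irrefl _)⟩
    have hN' : (1 : ℝ) ≤ N := by exact_mod_cast hN
    have hle := hD.integral_cut_le hτ (hζ N hN')
    obtain ⟨F, h1, h2, h3⟩ := hex τ hτ hτ1 _ (hD.cut_isC2 (hζ N hN')) (hle.trans hs') N
      (by linarith)
    have hle' := mul_le_mul_of_nonneg_left hle (by linarith : 0 ≤ C)
    rw [← mul_assoc] at hle'
    exact ⟨F, fun _ => ⟨h1, h2, fun t ht => ⟨(h3 t ht).1.trans hle', (h3 t ht).2.trans hle'⟩⟩⟩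
  choose F hF using hF
  have hcN : ∀ N : ℕ, 0 < N → (1 : ℝ) ≤ N := fun N hN => by exact_mod_cast hN
  have hF0 : ∀ N : ℕ, 0 < N → ∀ x, (F N).v 0 x = 1 + ζ N x * (D.v x - 1) ∧
      (F N).u 0 x = ζ N x * D.u x ∧ (F N).S 0 x = ζ N x * D.S x := fun N hN x => by
    have := (hF N hN).2.1
    exact ⟨congrArg (fun D => D.v x) this, congrArg (fun D => D.u x) this,
      congrArg (fun D => D.S x) this⟩
  have hF1 : ∀ N : ℕ, 0 < N → ∀ x : ℝ, |x| < N →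
      (F N).v 0 x = D.v x ∧ (F N).u 0 x = D.u x ∧ (F N).S 0 x = D.S x := fun N hN x hx => by
    obtain ⟨e1, e2, e3⟩ := hF0 N hN x
    rw [e1, e2, e3, hζ1 N (hcN N hN) x hx.le]
    simp
  obtain ⟨G, hG⟩ := exists_patch hK ha hμ hτ hτ1 (fun N hN => (hF N hN).1) hF1
  obtain ⟨ℓ, hℓ⟩ : ∃ ℓ, ℓ = 2 + K + K / τ := ⟨_, rfl⟩
  rw [← hℓ] at hG
  have hℓ1 : 1 ≤ ℓ := by
    have : 0 < K / τ := by positivity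
    rw [hℓ]; linarith
  have hbig : ∀ T R r : ℝ, ∃ N : ℕ, 0 < N ∧ T < N ∧ r < N ∧
      ∀ t ≤ T, ∀ x : ℝ, |x| ≤ R → 1 + |x| + ℓ * max t 0 < N := by
    intro T R r
    obtain ⟨N, hN⟩ := exists_nat_gt (1 + |R| + ℓ * max T 0 + |r|)
    have e1 : max T 0 ≤ ℓ * max T 0 := le_mul_of_one_le_left (le_max_right _ _) hℓ1
    have e2 : T ≤ max T 0 := le_max_left _ _
    have e3 : 0 ≤ max T 0 := le_max_right _ _
    have := abs_nonneg R
    have := abs_nonneg r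
    have := le_abs_self r
    refine ⟨N, Nat.cast_pos (α := ℝ) |>.1 (by linarith), by linarith, by linarith,
      fun t ht x hx => ?_⟩
    have : ℓ * max t 0 ≤ ℓ * max T 0 :=
      mul_le_mul_of_nonneg_left (max_le_max ht le_rfl) (by linarith)
    linarith [le_abs_self R]
  refine ⟨G, fun T R => ?_, fun T ε hε => ?_⟩
  · obtain ⟨N, hN, hTN, -, hx⟩ := hbig T R 0
    refine ⟨N, hTN, F N, (hF N hN).1, hF1 N hN, fun t ht x hxR => ?_, fun t ht => ?_,
      fun t ht x hxR => hG N t x (hx t ht x hxR)⟩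
    · rw [← hℓ]; linarith [hx t ht x hxR]
    · exact (hF N hN).2.2 t ⟨ht.1, ht.2.trans hTN.le⟩
  · obtain ⟨η, hη⟩ : ∃ η, η = min δ (ε / C) := ⟨_, rfl⟩
    have η0 : 0 < η := by rw [hη]; positivity
    have ηδ : η ≤ δ := hη ▸ min_le_left _ _
    have ηC : C * η ≤ ε := by
      have : η ≤ ε / C := hη ▸ min_le_right _ _
      rw [le_div_iff₀ (by linarith)] at this
      linarith
    obtain ⟨r₀, hr₀⟩ := hD.exists_tail hτ (2 * κ) η0
    obtain ⟨ρ, hρ⟩ : ∃ ρ, ρ = max r₀ 1 := ⟨_, rfl⟩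
    have ρ1 : 1 ≤ ρ := hρ ▸ le_max_right _ _
    have ρ0 : r₀ ≤ ρ := hρ ▸ le_max_left _ _
    refine ⟨1 + 2 * ρ + ℓ * max T 0, fun t ht r => ?_⟩
    have hT0 : 0 ≤ T := ht.1.trans ht.2
    obtain ⟨N, hN, hTN, hρN, hx⟩ := hbig T r ρ
    have hk := (hζ N (hcN N hN)).sub (hζ ρ ρ1)
    have hsm := hr₀ ρ ρ0 _ _ _ hk fun x hxρ => by
      rw [hζ1 ρ ρ1 x hxρ.le, hζ1 N (hcN N hN) x (by linarith), sub_self]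
    obtain ⟨H, h1, h2, h3⟩ := hex τ hτ hτ1 _ (hD.cut_isC2 hk) (hsm.trans ηδ) N (by linarith)
    obtain ⟨R', cH, -⟩ := h1.cfYd
    have hH := ((h3 t ⟨ht.1, by linarith [ht.2]⟩).1.trans
      (mul_le_mul_of_nonneg_left hsm (by linarith))).trans ηC
    have hms : MeasurableSet {x : ℝ | 1 + 2 * ρ + ℓ * max T 0 < |x| ∧ |x| ≤ r} :=
      (isOpen_lt continuous_const continuous_abs).measurableSet.inter
        (isClosed_le continuous_abs continuous_const).measurableSet
    have heq : ∀ x ∈ {x : ℝ | 1 + 2 * ρ + ℓ * max T 0 < |x| ∧ |x| ≤ r},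
        G.Yd τ t x = H.Yd τ t x := by
      intro x hxx
      have et : max t 0 = t := max_eq_left ht.1
      have e1 := (hG N t x (hx t ht.2 x hxx.2)).yd τ
      have e2 : (F N).past.Yd τ t x = (F N).Yd τ t x := by
        simp only [Fields.past, Fields.Yd, et]
      rw [e1, e2]
      refine (((hF N hN).1).cone_eqAt hK ha hμ hτ hτ1 (by linarith) h1 le_rfl (x₀ := x)
        (ρ := |x| - 2 * ρ) (fun y hy => ?_) ⟨ht.1, by linarith [ht.2]⟩ ?_).yd τ
      · have hy' : 2 * ρ ≤ |y| := by
          have := abs_sub_abs_le_abs_sub x y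
          rw [abs_sub_comm] at this
          linarith
        obtain ⟨e1, e2, e3⟩ := hF0 N hN y
        have z := hζ0 ρ ρ1 y hy'
        have g1 : H.v 0 y = 1 + (ζ N y - ζ ρ y) * (D.v y - 1) := congrArg (fun D => D.v y) h2
        have g2 : H.u 0 y = (ζ N y - ζ ρ y) * D.u y := congrArg (fun D => D.u y) h2
        have g3 : H.S 0 y = (ζ N y - ζ ρ y) * D.S y := congrArg (fun D => D.S y) h2
        rw [e1, e2, e3, g1, g2, g3, z]
        simp
      · rw [sub_self, abs_zero, ← hℓ]
        have : ℓ * t ≤ ℓ * max T 0 :=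
          mul_le_mul_of_nonneg_left (ht.2.trans (le_max_left _ _)) (by linarith)
        linarith [hxx.1]
    rw [setIntegral_congr_fun hms heq]
    exact (setIntegral_le_integral (cH.slice t)
      (Eventually.of_forall fun x => H.Yd_nonneg hτ t x)).trans hH

end

section

/-- Regularity, equations and pointwise bounds of a global solution. -/
structure GReg (a μ γ ν E : ℝ) (F : Fields) : Prop where
  cv : Continuous fun p : ℝ × ℝ => F.v p.1 p.2
  cu : Continuous fun p : ℝ × ℝ => F.u p.1 p.2
  cS : Continuous fun p : ℝ × ℝ => F.S p.1 p.2
  cvx : Continuous fun p : ℝ × ℝ => F.vx p.1 p.2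
  cux : Continuous fun p : ℝ × ℝ => F.ux p.1 p.2
  cSx : Continuous fun p : ℝ × ℝ => F.Sx p.1 p.2
  cvxx : Continuous fun p : ℝ × ℝ => F.vxx p.1 p.2
  cuxx : Continuous fun p : ℝ × ℝ => F.uxx p.1 p.2
  cSxx : Continuous fun p : ℝ × ℝ => F.Sxx p.1 p.2
  dv : ∀ t x, HasDerivAt (F.v t) (F.vx t x) x
  du : ∀ t x, HasDerivAt (F.u t) (F.ux t x) x
  dS : ∀ t x, HasDerivAt (F.S t) (F.Sx t x) x
  dvx : ∀ t x, HasDerivAt (F.vx t) (F.vxx t x) x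
  dux : ∀ t x, HasDerivAt (F.ux t) (F.uxx t x) x
  dSx : ∀ t x, HasDerivAt (F.Sx t) (F.Sxx t x) x
  tv : ∀ t > 0, ∀ x, HasDerivAt (fun s => F.v s x) (F.ux t x) t
  tu : ∀ t > 0, ∀ x, HasDerivAt (fun s => F.u s x) (F.Sx t x + bF γ (F.v t x) * F.vx t x) t
  tS : ∀ t > 0, ∀ x, HasDerivAt (fun s => F.S s x)
    (kF a μ ν (F.v t x) (F.S t x) * F.ux t x - ν * F.S t x) t
  hv : ∀ t x, |F.v t x - 1| ≤ 1 / 2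
  hS : ∀ t x, |F.S t x| ≤ μ * ν / 4
  hvx : ∀ t x, F.vx t x ^ 2 ≤ E
  hux : ∀ t x, F.ux t x ^ 2 ≤ E
  past : ∀ t ≤ 0, ∀ x, F.v t x = F.v 0 x ∧ F.u t x = F.u 0 x ∧ F.S t x = F.S 0 x

lemma continuous_of_eventually {f : ℝ → ℝ → ℝ} (h : ∀ t₀ x₀ : ℝ, ∃ g : ℝ → ℝ → ℝ,
    (Continuous fun p : ℝ × ℝ => g p.1 p.2) ∧
    ∀ t < t₀ + 1, ∀ x, |x| < |x₀| + 1 → f t x = g (max t 0) x) :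
    Continuous fun p : ℝ × ℝ => f p.1 p.2 := by
  refine continuous_iff_continuousAt.2 fun p => ?_
  obtain ⟨g, cg, hg⟩ := h p.1 p.2
  have c : Continuous fun p : ℝ × ℝ => g (max p.1 0) p.2 :=
    cg.comp (f := fun p : ℝ × ℝ => (max p.1 0, p.2)) (by fun_prop)
  refine c.continuousAt.congr ?_
  have o1 : ∀ᶠ q : ℝ × ℝ in nhds p, q.1 < p.1 + 1 :=
    (continuous_fst.continuousAt.eventually_lt continuousAt_const (lt_add_one p.1))
  have o2 : ∀ᶠ q : ℝ × ℝ in nhds p, |q.2| < |p.2| + 1 :=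
    (continuous_snd.abs.continuousAt.eventually_lt continuousAt_const (lt_add_one |p.2|))
  filter_upwards [o1, o2] with q h1 h2
  exact (hg q.1 h1 q.2 h2).symm

lemma hasDerivAt_of_eq_slab {f g : ℝ → ℝ} {g' x : ℝ} (hg : HasDerivAt g g' x)
    (h : ∀ y, |y| < |x| + 1 → f y = g y) : HasDerivAt f g' x := by
  refine hg.congr_of_eventuallyEq ?_
  filter_upwards [continuous_abs.continuousAt.eventually_lt continuousAt_const
    (lt_add_one |x|)] with y hy
  exact h y hy

lemma hasDerivAt_of_eq_past {f g : ℝ → ℝ} {g' t : ℝ} (ht : 0 < t) (hg : HasDerivAt g g' t)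
    (h : ∀ s < t + 1, f s = g (max s 0)) : HasDerivAt f g' t := by
  refine hg.congr_of_eventuallyEq ?_
  filter_upwards [Ioo_mem_nhds ht (lt_add_one t)] with s hs
  rw [h s hs.2, max_eq_left hs.1.le]

variable {a μ γ τ K E T : ℝ} {D : Data} {F G : Fields}

/-- Sobolev bounds for the derivatives of a compactly supported solution. -/
lemma CSol.sq_le (hτ : 0 < τ) (h : CSol a μ γ τ⁻¹ T F) {t : ℝ} (hE : ∫ x, F.Yd τ t x ≤ E) (x : ℝ) :
    F.vx t x ^ 2 ≤ E ∧ F.ux t x ^ 2 ≤ E := by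
  obtain ⟨-, h1, -, h2, -⟩ := (h.slice t).sobolev hτ x
  exact ⟨h1.trans hE, h2.trans hE⟩

theorem GSol.reg (hτ : 0 < τ) (h : GSol a μ γ τ K E D F) : GReg a μ γ τ⁻¹ E F := by
  have near : ∀ t₀ x₀ : ℝ, ∃ N > t₀, ∃ G, CSol a μ γ τ⁻¹ N G ∧
      (∀ t, t ≤ t₀ + 1 → (∫ x, G.Yd τ (max t 0) x) ≤ E) ∧
      ∀ t < t₀ + 1, ∀ x, |x| < |x₀| + 1 → F.EqAt G.past t x := by
    intro t₀ x₀
    obtain ⟨N, hN, G, h1, -, -, h4, h5⟩ := h.loc (max (t₀ + 1) 0) (|x₀| + 1)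
    have := le_max_left (t₀ + 1) 0
    exact ⟨N, by linarith, G, h1, fun t ht => (h4 _ ⟨le_max_right _ _, max_le_max ht le_rfl⟩).1,
      fun t ht x hx => h5 t (by linarith) x hx.le⟩
  constructor
  case cv => exact continuous_of_eventually fun t₀ x₀ =>
    let ⟨N, hN, G, h1, h2, h3⟩ := near t₀ x₀; ⟨G.v, h1.cv, fun t ht x hx => (h3 t ht x hx).1⟩
  case cu => exact continuous_of_eventually fun t₀ x₀ =>
    let ⟨N, hN, G, h1, h2, h3⟩ := near t₀ x₀; ⟨G.u, h1.cu, fun t ht x hx => (h3 t ht x hx).2.1⟩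
  case cS => exact continuous_of_eventually fun t₀ x₀ =>
    let ⟨N, hN, G, h1, h2, h3⟩ := near t₀ x₀; ⟨G.S, h1.cS, fun t ht x hx => (h3 t ht x hx).2.2.1⟩
  case cvx => exact continuous_of_eventually fun t₀ x₀ =>
    let ⟨N, hN, G, h1, h2, h3⟩ := near t₀ x₀
    ⟨G.vx, h1.cvx, fun t ht x hx => (h3 t ht x hx).2.2.2.1⟩
  case cux => exact continuous_of_eventually fun t₀ x₀ =>
    let ⟨N, hN, G, h1, h2, h3⟩ := near t₀ x₀
    ⟨G.ux, h1.cux, fun t ht x hx => (h3 t ht x hx).2.2.2.2.1⟩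
  case cSx => exact continuous_of_eventually fun t₀ x₀ =>
    let ⟨N, hN, G, h1, h2, h3⟩ := near t₀ x₀
    ⟨G.Sx, h1.cSx, fun t ht x hx => (h3 t ht x hx).2.2.2.2.2.1⟩
  case cvxx => exact continuous_of_eventually fun t₀ x₀ =>
    let ⟨N, hN, G, h1, h2, h3⟩ := near t₀ x₀
    ⟨G.vxx, h1.cvxx, fun t ht x hx => (h3 t ht x hx).2.2.2.2.2.2.1⟩
  case cuxx => exact continuous_of_eventually fun t₀ x₀ =>
    let ⟨N, hN, G, h1, h2, h3⟩ := near t₀ x₀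
    ⟨G.uxx, h1.cuxx, fun t ht x hx => (h3 t ht x hx).2.2.2.2.2.2.2.1⟩
  case cSxx => exact continuous_of_eventually fun t₀ x₀ =>
    let ⟨N, hN, G, h1, h2, h3⟩ := near t₀ x₀
    ⟨G.Sxx, h1.cSxx, fun t ht x hx => (h3 t ht x hx).2.2.2.2.2.2.2.2⟩
  case past =>
    intro t ht x
    obtain ⟨N, hN, G, h1, h2, h3⟩ := near 0 x
    obtain ⟨e1, e2, e3, -⟩ := h3 t (by linarith) x (lt_add_one _)
    obtain ⟨e4, e5, e6, -⟩ := h3 0 (by linarith) x (lt_add_one _)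
    simp only [Fields.past, max_eq_right ht, max_self] at e1 e2 e3 e4 e5 e6
    exact ⟨e1.trans e4.symm, e2.trans e5.symm, e3.trans e6.symm⟩
  case' tv => intro t ht x
  case' tu => intro t ht x
  case' tS => intro t ht x
  all_goals
    try intro t x
    obtain ⟨N, hN, G, h1, h2, h3⟩ := near t x
    have h4 := h3 t (lt_add_one _)
    obtain ⟨e1, e2, e3, e4, e5, e6, e7, e8, e9⟩ := h3 t (lt_add_one _) x (lt_add_one _)
    try rw [e1]
    try rw [e2]
    try rw [e3]
    try rw [e4]
    try rw [e5]
    try rw [e6]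
    try rw [e7]
    try rw [e8]
    try rw [e9]
  case dv => exact hasDerivAt_of_eq_slab (h1.dv _ x) fun y hy => (h4 y hy).1
  case du => exact hasDerivAt_of_eq_slab (h1.du _ x) fun y hy => (h4 y hy).2.1
  case dS => exact hasDerivAt_of_eq_slab (h1.dS _ x) fun y hy => (h4 y hy).2.2.1
  case dvx => exact hasDerivAt_of_eq_slab (h1.dvx _ x) fun y hy => (h4 y hy).2.2.2.1
  case dux => exact hasDerivAt_of_eq_slab (h1.dux _ x) fun y hy => (h4 y hy).2.2.2.2.1
  case dSx => exact hasDerivAt_of_eq_slab (h1.dSx _ x) fun y hy => (h4 y hy).2.2.2.2.2.1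
  case tv =>
    simp only [Fields.past, max_eq_left ht.le]
    exact hasDerivAt_of_eq_past ht (h1.tv t ⟨ht, hN⟩ x) fun s hs => (h3 s hs x (lt_add_one _)).1
  case tu =>
    simp only [Fields.past, max_eq_left ht.le]
    exact hasDerivAt_of_eq_past ht (h1.tu t ⟨ht, hN⟩ x) fun s hs => (h3 s hs x (lt_add_one _)).2.1
  case tS =>
    simp only [Fields.past, max_eq_left ht.le]
    exact hasDerivAt_of_eq_past ht (h1.tS t ⟨ht, hN⟩ x) fun s hs =>
      (h3 s hs x (lt_add_one _)).2.2.1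
  case hv => exact h1.hv _ x
  case hS => exact h1.hS _ x
  case hvx => exact (h1.sq_le hτ (h2 t (by linarith)) x).1
  case hux => exact (h1.sq_le hτ (h2 t (by linarith)) x).2

lemma GReg.cYd (h : GReg a μ γ τ⁻¹ E F) : Continuous fun p : ℝ × ℝ => F.Yd τ p.1 p.2 := by
  obtain ⟨c1, c2, c3, c4, c5, c6, c7, c8, c9, -⟩ := id h
  unfold Fields.Yd
  fun_prop

lemma GReg.cdens (h : GReg a μ γ τ⁻¹ E F) : Continuous fun p : ℝ × ℝ => F.dens p.1 p.2 := by
  obtain ⟨c1, c2, c3, c4, c5, c6, c7, c8, c9, -⟩ := id h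
  unfold Fields.dens
  fun_prop

/-- A nonnegative function with uniformly bounded integrals over bounded intervals. -/
lemma integrableOn_of_bounded {f : ℝ → ℝ} {A : Set ℝ} {C : ℝ}
    (hf : Continuous f) (h0 : ∀ x, 0 ≤ f x) (h : ∀ r : ℝ, ∫ x in A ∩ Icc (-r) r, f x ≤ C) :
    IntegrableOn f A ∧ ∫ x in A, f x ≤ C := by
  have cover : AECover (volume.restrict A) atTop fun r : ℝ => Icc (-r) r :=
    aecover_Icc tendsto_neg_atTop_atBot tendsto_id
  have hli : ∀ r : ℝ, IntegrableOn f (Icc (-r) r) := fun r =>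
    hf.continuousOn.integrableOn_Icc
  have e : ∀ r : ℝ, ∫ x in Icc (-r) r, f x ∂(volume.restrict A) ≤ C := fun r => by
    rw [Measure.restrict_restrict measurableSet_Icc, inter_comm]
    exact h r
  have hi : Integrable f (volume.restrict A) :=
    cover.integrable_of_integral_bounded_of_nonneg_ae C
      (fun r => by
        rw [IntegrableOn, Measure.restrict_restrict measurableSet_Icc]
        exact (hli r).mono_set inter_subset_left)
      (Eventually.of_forall h0) (Eventually.of_forall e)
  exact ⟨hi, le_of_tendsto (cover.integral_tendsto_of_countably_generated hi)
    (Eventually.of_forall e)⟩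

theorem GSol.energy (hτ : 0 < τ) (h : GSol a μ γ τ K E D F) {t : ℝ} (ht : 0 ≤ t) :
    Integrable (F.Yd τ t) ∧ ∫ x, F.Yd τ t x ≤ E := by
  have hr := h.reg hτ
  have := integrableOn_of_bounded (f := F.Yd τ t) (A := univ) (C := E)
    (hr.cYd.comp (by fun_prop : Continuous fun x : ℝ => (t, x))) (F.Yd_nonneg hτ t) fun r => by
      obtain ⟨N, hN, G, h1, -, -, h4, h5⟩ := h.loc t r
      rw [univ_inter, setIntegral_congr_fun (g := G.Yd τ t) measurableSet_Icc fun x hx => ?_]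
      · obtain ⟨R, cG, -⟩ := h1.cfYd
        exact (setIntegral_le_integral (cG.slice t)
          (Eventually.of_forall fun x => G.Yd_nonneg hτ t x)).trans (h4 t ⟨ht, le_rfl⟩).1
      · have := (h5 t le_rfl x (abs_le.2 hx)).yd τ
        rw [this]
        simp only [Fields.past, Fields.Yd, max_eq_left ht]
  rwa [integrableOn_univ, setIntegral_univ] at this

theorem GSol.tails (hτ : 0 < τ) (h : GSol a μ γ τ K E D F) (T : ℝ) {ε : ℝ} (hε : 0 < ε) :
    ∃ R, ∀ t ∈ Icc 0 T, ∫ x in {x | R < |x|}, F.Yd τ t x ≤ ε := by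
  have hr := h.reg hτ
  obtain ⟨R, hR⟩ := h.tail T ε hε
  refine ⟨R, fun t ht => (integrableOn_of_bounded
    (hr.cYd.comp (by fun_prop : Continuous fun x : ℝ => (t, x)))
    (F.Yd_nonneg hτ t) fun r => ?_).2⟩
  have e : {x : ℝ | R < |x|} ∩ Icc (-r) r = {x | R < |x| ∧ |x| ≤ r} := by
    ext x; simp [abs_le]
  rw [e]
  exact hR t ht r

theorem GSol.diss (h : GSol a μ γ τ K E D F) {T R : ℝ} (hT : 0 ≤ T) (hR : 0 ≤ R) :
    ∫ q in (0 : ℝ)..T, ∫ x in -R..R, F.dens q x ≤ E := by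
  obtain ⟨N, hN, G, h1, -, -, h4, h5⟩ := h.loc T R
  obtain ⟨R', -, cG⟩ := h1.cfYd
  refine le_trans ?_ (h4 T ⟨hT, le_rfl⟩).2
  have hc : Continuous fun q => ∫ x in -R..R, G.dens q x :=
    intervalIntegral.continuous_parametric_intervalIntegral_of_continuous' cG.cont _ _
  have e : ∫ q in (0 : ℝ)..T, ∫ x in -R..R, F.dens q x
      = ∫ q in (0 : ℝ)..T, ∫ x in -R..R, G.dens q x := by
    refine intervalIntegral.integral_congr fun q hq => ?_
    refine intervalIntegral.integral_congr fun x hx => ?_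
    rw [uIcc_of_le hT] at hq
    rw [uIcc_of_le (by linarith)] at hx
    have := (h5 q hq.2 x (abs_le.2 hx)).dens
    simp only [Fields.past, Fields.dens, max_eq_left hq.1] at this ⊢
    exact this
  rw [e]
  refine intervalIntegral.integral_mono_on hT (hc.intervalIntegrable _ _)
    (cG.cint.intervalIntegrable _ _) fun q _ => ?_
  rw [intervalIntegral.integral_of_le (by linarith)]
  exact setIntegral_le_integral (cG.slice q) (Eventually.of_forall fun x => G.dens_nonneg q x)

end

section

section Sobolev

variable {f f' f'' : ℝ → ℝ}

lemma hSq_one (hf : ∀ x, HasDerivAt f (f' x) x) :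
    HSq 1 f = (∫ x, f x ^ 2) + ∫ x, f' x ^ 2 := by
  have e : deriv f = f' := funext fun x => (hf x).deriv
  simp [HSq, Finset.sum_range_succ, iteratedDeriv_one, e]

lemma iteratedDeriv_two_eq (hf : ∀ x, HasDerivAt f (f' x) x) (hf' : ∀ x, HasDerivAt f' (f'' x) x) :
    iteratedDeriv 2 f = f'' := by
  have e : deriv f = f' := funext fun x => (hf x).deriv
  have e' : deriv f' = f'' := funext fun x => (hf' x).deriv
  rw [iteratedDeriv_succ, iteratedDeriv_one, e, e']

lemma hSq_two (hf : ∀ x, HasDerivAt f (f' x) x) (hf' : ∀ x, HasDerivAt f' (f'' x) x) :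
    HSq 2 f = (∫ x, f x ^ 2) + (∫ x, f' x ^ 2) + ∫ x, f'' x ^ 2 := by
  have e : deriv f = f' := funext fun x => (hf x).deriv
  simp [HSq, Finset.sum_range_succ, iteratedDeriv_one, e, iteratedDeriv_two_eq hf hf']

lemma contDiff_one_of_deriv (hf : ∀ x, HasDerivAt f (f' x) x) (c : Continuous f') :
    ContDiff ℝ 1 f := by
  have e : deriv f = f' := funext fun x => (hf x).deriv
  exact contDiff_one_iff_deriv.2 ⟨fun x => (hf x).differentiableAt, e ▸ c⟩

lemma memH_one (hf : ∀ x, HasDerivAt f (f' x) x) (c : Continuous f')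
    (h0 : Integrable fun x => f x ^ 2) (h1 : Integrable fun x => f' x ^ 2) : MemH 1 f := by
  have e : deriv f = f' := funext fun x => (hf x).deriv
  refine ⟨contDiff_one_of_deriv hf c, fun j hj => ?_⟩
  interval_cases j
  · simpa using h0
  · simpa [iteratedDeriv_one, e] using h1

lemma memH_two (hf : ∀ x, HasDerivAt f (f' x) x) (hf' : ∀ x, HasDerivAt f' (f'' x) x)
    (c : Continuous f'') (h0 : Integrable fun x => f x ^ 2) (h1 : Integrable fun x => f' x ^ 2)
    (h2 : Integrable fun x => f'' x ^ 2) : MemH 2 f := by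
  have e : deriv f = f' := funext fun x => (hf x).deriv
  refine ⟨?_, fun j hj => ?_⟩
  · have : ContDiff ℝ (1 + 1) f := contDiff_succ_iff_deriv.2
      ⟨fun x => (hf x).differentiableAt, by simp, e ▸ contDiff_one_of_deriv hf' c⟩
    simpa [one_add_one_eq_two] using this
  · interval_cases j
    · simpa using h0
    · simpa [iteratedDeriv_one, e] using h1
    · simpa [iteratedDeriv_two_eq hf hf'] using h2

end Sobolev

/-- `g` is continuous and dominated by the square root of the density `Y`. -/
def Tame (Y g : ℝ → ℝ → ℝ) : Prop :=
  (Continuous fun p : ℝ × ℝ => g p.1 p.2) ∧ ∃ C ≥ 0, ∀ t x, g t x ^ 2 ≤ C * Y t x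

/-- `g` is continuous and bounded. -/
def BddC (g : ℝ → ℝ → ℝ) : Prop :=
  (Continuous fun p : ℝ × ℝ => g p.1 p.2) ∧ ∃ C, ∀ t x, |g t x| ≤ C

variable {Y f g : ℝ → ℝ → ℝ}

lemma Tame.add (hf : Tame Y f) (hg : Tame Y g) : Tame Y fun t x => f t x + g t x := by
  obtain ⟨cf, A, hA, hf⟩ := hf
  obtain ⟨cg, B, hB, hg⟩ := hg
  refine ⟨cf.add cg, 2 * A + 2 * B, by positivity, fun t x => ?_⟩
  nlinarith [hf t x, hg t x, sq_nonneg (f t x - g t x)]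

lemma Tame.mul (hf : BddC f) (hg : Tame Y g) : Tame Y fun t x => f t x * g t x := by
  obtain ⟨cf, A, hf⟩ := hf
  obtain ⟨cg, B, hB, hg⟩ := hg
  refine ⟨cf.mul cg, A ^ 2 * B, by positivity, fun t x => ?_⟩
  rw [mul_pow, mul_assoc]
  exact mul_le_mul (sq_le_sq' (abs_le.1 (hf t x)).1 (abs_le.1 (hf t x)).2) (hg t x) (sq_nonneg _)
    (sq_nonneg _)

lemma BddC.mul (hf : BddC f) (hg : BddC g) : BddC fun t x => f t x * g t x := by
  obtain ⟨cf, A, hf⟩ := hf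
  obtain ⟨cg, B, hg⟩ := hg
  refine ⟨cf.mul cg, A * B, fun t x => ?_⟩
  rw [abs_mul]
  exact mul_le_mul (hf t x) (hg t x) (abs_nonneg _) ((abs_nonneg _).trans (hf t x))

lemma BddC.add (hf : BddC f) (hg : BddC g) : BddC fun t x => f t x + g t x := by
  obtain ⟨cf, A, hf⟩ := hf
  obtain ⟨cg, B, hg⟩ := hg
  exact ⟨cf.add cg, A + B, fun t x => (abs_add_le _ _).trans (add_le_add (hf t x) (hg t x))⟩

lemma BddC.const (c : ℝ) : BddC fun _ _ => c :=
  ⟨continuous_const, |c|, fun _ _ => le_rfl⟩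

/-- A density with finite integrals and uniformly small tails on bounded time intervals. -/
structure TailDensity (Y : ℝ → ℝ → ℝ) : Prop where
  nonneg : ∀ t x, 0 ≤ Y t x
  int : ∀ t, 0 ≤ t → Integrable (Y t)
  tail : ∀ T : ℝ, ∀ ε > 0, ∃ R, ∀ t ∈ Icc 0 T, ∫ x in {x | R < |x|}, Y t x ≤ ε

lemma Tame.integrable (hY : TailDensity Y) (hg : Tame Y g) {t : ℝ} (ht : 0 ≤ t) :
    Integrable fun x => g t x ^ 2 := by
  obtain ⟨cg, C, hC, hg⟩ := hg
  have sl : Continuous fun x : ℝ => (t, x) := by fun_prop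
  have c : Continuous (g t) := cg.comp sl
  refine ((hY.int t ht).const_mul C).mono' (by fun_prop) (Eventually.of_forall fun x => ?_)
  rw [Real.norm_eq_abs, abs_of_nonneg (sq_nonneg _)]
  exact hg t x

/-- A tame function is continuous in time with values in `L²`. -/
lemma Tame.tendsto (hY : TailDensity Y) (hg : Tame Y g) {s : ℝ} (hs : 0 ≤ s) :
    Tendsto (fun t => ∫ x, (g t x - g s x) ^ 2) (nhdsWithin s (Ici 0)) (nhds 0) := by
  have hgi : ∀ {t}, 0 ≤ t → Integrable fun x => g t x ^ 2 := fun ht => hg.integrable hY ht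
  obtain ⟨cg, C, hC, hg⟩ := hg
  have sl : ∀ t : ℝ, Continuous fun x : ℝ => (t, x) := fun t => by fun_prop
  have cs : ∀ t, Continuous (g t) := fun t => cg.comp (sl t)
  have hle : ∀ t x, (g t x - g s x) ^ 2 ≤ 2 * C * Y t x + 2 * C * Y s x := fun t x => by
    nlinarith [hg t x, hg s x, sq_nonneg (g t x + g s x)]
  have hInt : ∀ t, 0 ≤ t → Integrable fun x => (g t x - g s x) ^ 2 := fun t ht => by
    have c1 := cs t
    have c2 := cs s
    refine (((hY.int t ht).const_mul (2 * C)).add ((hY.int s hs).const_mul (2 * C))).mono'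
      (by fun_prop) (Eventually.of_forall fun x => ?_)
    rw [Real.norm_eq_abs, abs_of_nonneg (sq_nonneg _)]
    exact hle t x
  rw [Metric.tendsto_nhds]
  intro ε hε
  obtain ⟨η, hη⟩ : ∃ η, η = ε / (4 * (2 * C + 1)) := ⟨_, rfl⟩
  have η0 : 0 < η := by rw [hη]; positivity
  have ηε : (2 * C + 1) * η = ε / 4 := by rw [hη]; field_simp
  obtain ⟨R', hR'⟩ := hY.tail (s + 1) η η0
  obtain ⟨R, hR⟩ : ∃ R, R = max R' 0 := ⟨_, rfl⟩
  have R0 : 0 ≤ R := hR ▸ le_max_right _ _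
  have hms : MeasurableSet {x : ℝ | R < |x|} :=
    (isOpen_lt continuous_const continuous_abs).measurableSet
  have htail : ∀ t ∈ Icc 0 (s + 1), ∫ x in {x | R < |x|}, Y t x ≤ η := fun t ht =>
    (setIntegral_mono_set (hY.int t ht.1).integrableOn
      (Eventually.of_forall fun x => hY.nonneg t x)
      (Eventually.of_forall fun x hx => lt_of_le_of_lt (hR ▸ le_max_left R' 0) hx)).trans (hR' t ht)
  have ccomp : Continuous fun t => ∫ x in -R..R, (g t x - g s x) ^ 2 := by
    refine intervalIntegral.continuous_parametric_intervalIntegral_of_continuous' ?_ _ _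
    have c1 : Continuous fun p : ℝ × ℝ => g s p.2 := (cs s).comp continuous_snd
    exact (cg.sub c1).pow 2
  have ht0 : Tendsto (fun t => ∫ x in -R..R, (g t x - g s x) ^ 2) (nhdsWithin s (Ici 0))
      (nhds 0) := by
    have := (ccomp.tendsto s).mono_left (nhdsWithin_le_nhds (s := Ici 0))
    simpa using this
  have h1 : ∀ᶠ t in nhdsWithin s (Ici 0), t < s + 1 :=
    mem_nhdsWithin_of_mem_nhds (Iio_mem_nhds (lt_add_one s))
  filter_upwards [ht0.eventually (gt_mem_nhds (show 0 < ε / 4 by positivity)), h1,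
    self_mem_nhdsWithin] with t hA hB hC'
  have ht : 0 ≤ t := hC'
  have e1 : ∫ x, (g t x - g s x) ^ 2 = (∫ x in {x | R < |x|}, (g t x - g s x) ^ 2)
      + ∫ x in {x | R < |x|}ᶜ, (g t x - g s x) ^ 2 :=
    (integral_add_compl hms (hInt t ht)).symm
  have e2 : {x : ℝ | R < |x|}ᶜ = Icc (-R) R := by
    ext x; simp [abs_le]
  rw [e2, integral_Icc_eq_integral_Ioc, ← intervalIntegral.integral_of_le (by linarith)] at e1
  have e3 : ∫ x in {x | R < |x|}, (g t x - g s x) ^ 2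
      ≤ ∫ x in {x | R < |x|}, (2 * C * Y t x + 2 * C * Y s x) :=
    setIntegral_mono (hInt t ht).integrableOn
      (((hY.int t ht).const_mul _).add ((hY.int s hs).const_mul _)).integrableOn (hle t)
  rw [MeasureTheory.integral_add ((hY.int t ht).const_mul _).integrableOn
    ((hY.int s hs).const_mul _).integrableOn, MeasureTheory.integral_const_mul,
    MeasureTheory.integral_const_mul] at e3
  have e4 := mul_le_mul_of_nonneg_left (htail t ⟨ht, hB.le⟩) (by positivity : 0 ≤ 2 * C)
  have e5 := mul_le_mul_of_nonneg_left (htail s ⟨hs, by linarith⟩) (by positivity : 0 ≤ 2 * C)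
  have e6 : 0 ≤ ∫ x, (g t x - g s x) ^ 2 := integral_nonneg fun x => sq_nonneg _
  rw [dist_zero_right, Real.norm_eq_abs, abs_of_nonneg e6]
  linarith

lemma contH_one (hY : TailDensity Y) {e f fx : ℝ → ℝ → ℝ} (he : ∀ t, 0 ≤ t → e t = f t)
    (hf : ∀ t x, HasDerivAt (f t) (fx t x) x) (t0 : Tame Y f) (t1 : Tame Y fx) :
    ContH 1 (Ici 0) e := by
  intro s hs
  have := (t0.tendsto hY hs).add (t1.tendsto hY hs)
  rw [add_zero] at this
  refine this.congr' ?_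
  filter_upwards [self_mem_nhdsWithin] with t ht
  rw [he t ht, he s hs]
  exact (hSq_one (f := fun x => f t x - f s x) (f' := fun x => fx t x - fx s x)
    fun x => (hf t x).sub (hf s x)).symm

lemma contH_two (hY : TailDensity Y) {e f fx fxx : ℝ → ℝ → ℝ} (he : ∀ t, 0 ≤ t → e t = f t)
    (hf : ∀ t x, HasDerivAt (f t) (fx t x) x) (hfx : ∀ t x, HasDerivAt (fx t) (fxx t x) x)
    (t0 : Tame Y f) (t1 : Tame Y fx) (t2 : Tame Y fxx) : ContH 2 (Ici 0) e := by
  intro s hs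
  have := ((t0.tendsto hY hs).add (t1.tendsto hY hs)).add (t2.tendsto hY hs)
  rw [add_zero, add_zero] at this
  refine this.congr' ?_
  filter_upwards [self_mem_nhdsWithin] with t ht
  rw [he t ht, he s hs]
  exact (hSq_two (f := fun x => f t x - f s x) (f' := fun x => fx t x - fx s x)
    (f'' := fun x => fxx t x - fxx s x) (fun x => (hf t x).sub (hf s x))
    fun x => (hfx t x).sub (hfx s x)).symm

lemma regH_two (hY : TailDensity Y) {e f fx fxx ft ftx : ℝ → ℝ → ℝ}
    (he : ∀ t, 0 ≤ t → e t = f t)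
    (het : ∀ t, 0 ≤ t → ∀ x, HasDerivAt (fun s => e s x) (ft t x) t)
    (hf : ∀ t x, HasDerivAt (f t) (fx t x) x) (hfx : ∀ t x, HasDerivAt (fx t) (fxx t x) x)
    (hft : ∀ t x, HasDerivAt (ft t) (ftx t x) x)
    (t0 : Tame Y f) (t1 : Tame Y fx) (t2 : Tame Y fxx) (t3 : Tame Y ft) (t4 : Tame Y ftx) :
    RegH 2 (Ici 0) e := by
  have sl : ∀ t : ℝ, Continuous fun x : ℝ => (t, x) := fun t => by fun_prop
  have hpt : ∀ t, 0 ≤ t → pt e t = ft t := fun t ht => funext fun x => (het t ht x).deriv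
  refine ⟨fun t ht => ?_, contH_two hY he hf hfx t0 t1 t2,
    fun x t ht => (het t ht x).differentiableAt, fun t ht => ?_, contH_one hY hpt hft t3 t4⟩
  · rw [he t ht]
    exact memH_two (hf t) (hfx t) (t2.1.comp (sl t)) (t0.integrable hY ht) (t1.integrable hY ht)
      (t2.integrable hY ht)
  · have := memH_one (hft t) (t4.1.comp (sl t)) (t3.integrable hY ht) (t4.integrable hY ht)
    rw [← hpt t ht] at this
    exact this

lemma contDiff_of_partial {f ft fx : ℝ → ℝ → ℝ} (ct : Continuous fun p : ℝ × ℝ => ft p.1 p.2)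
    (cx : Continuous fun p : ℝ × ℝ => fx p.1 p.2)
    (ht : ∀ t x, HasDerivAt (fun s => f s x) (ft t x) t)
    (hx : ∀ t x, HasDerivAt (f t) (fx t x) x) : ContDiff ℝ 1 fun p : ℝ × ℝ => f p.1 p.2 := by
  have c1 : Continuous fun p : ℝ × ℝ => ContinuousLinearMap.toSpanSingleton ℝ (ft p.1 p.2) :=
    (ContinuousLinearMap.toSpanSingletonCLE (𝕜 := ℝ) (E := ℝ)).continuous.comp ct
  have c2 : Continuous fun p : ℝ × ℝ => ContinuousLinearMap.toSpanSingleton ℝ (fx p.1 p.2) :=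
    (ContinuousLinearMap.toSpanSingletonCLE (𝕜 := ℝ) (E := ℝ)).continuous.comp cx
  refine contDiff_one_iff_hasFDerivAt.2
    ⟨fun p => (ContinuousLinearMap.toSpanSingleton ℝ (ft p.1 p.2)).coprod
      (ContinuousLinearMap.toSpanSingleton ℝ (fx p.1 p.2)), ?_, fun p => ?_⟩
  · fun_prop
  · exact (hasStrictFDerivAt_uncurry_coprod (u := p) (f := f)
      (f₁ := fun t x => ContinuousLinearMap.toSpanSingleton ℝ (ft t x))
      (f₂ := fun t x => ContinuousLinearMap.toSpanSingleton ℝ (fx t x))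
      (Eventually.of_forall fun v => (ht v.1 v.2).hasFDerivAt)
      (Eventually.of_forall fun v => (hx v.1 v.2).hasFDerivAt) c1.continuousAt
      c2.continuousAt).hasFDerivAt

/-- Linear extension to negative times of a function which is `C¹` for `t ≥ 0`. -/
lemma exists_extension {f fx ft ftx : ℝ → ℝ → ℝ} (cf : Continuous fun p : ℝ × ℝ => f p.1 p.2)
    (cfx : Continuous fun p : ℝ × ℝ => fx p.1 p.2)
    (cft : Continuous fun p : ℝ × ℝ => ft p.1 p.2)
    (cftx : Continuous fun p : ℝ × ℝ => ftx p.1 p.2)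
    (hx : ∀ t x, HasDerivAt (f t) (fx t x) x)
    (htx : ∀ t x, HasDerivAt (ft t) (ftx t x) x)
    (ht : ∀ t > 0, ∀ x, HasDerivAt (fun s => f s x) (ft t x) t)
    (hp : ∀ t ≤ 0, ∀ x, f t x = f 0 x) :
    ∃ e : ℝ → ℝ → ℝ, (∀ t, 0 ≤ t → e t = f t) ∧
      (∀ t, 0 ≤ t → ∀ x, HasDerivAt (fun s => e s x) (ft t x) t) ∧
      ContDiff ℝ 1 fun p : ℝ × ℝ => e p.1 p.2 := by
  have he : ∀ t, 0 ≤ t → (fun x => f t x + min t 0 * ft 0 x) = f t := fun t ht => by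
    funext x; rw [min_eq_right ht]; ring
  have hsl : ∀ x : ℝ, Continuous fun t : ℝ => (t, x) := fun x => by fun_prop
  have cg : Continuous fun p : ℝ × ℝ => ft (max p.1 0) p.2 :=
    cft.comp (f := fun p : ℝ × ℝ => (max p.1 0, p.2)) (by fun_prop)
  have key : ∀ t ≠ 0, ∀ x,
      HasDerivAt (fun s => f s x + min s 0 * ft 0 x) (ft (max t 0) x) t := by
    intro t h0 x
    rcases lt_or_gt_of_ne h0 with h | h
    · rw [max_eq_right h.le]
      have : HasDerivAt (fun s => f 0 x + s * ft 0 x) (ft 0 x) t :=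
        (((hasDerivAt_id t).mul_const (ft 0 x)).const_add (f 0 x)).congr_deriv (by simp)
      refine this.congr_of_eventuallyEq ?_
      filter_upwards [Iio_mem_nhds h] with s hs
      rw [min_eq_left (le_of_lt hs), hp s (le_of_lt hs)]
    · rw [max_eq_left h.le]
      refine (ht t h x).congr_of_eventuallyEq ?_
      filter_upwards [Ioi_mem_nhds h] with s hs
      rw [min_eq_right (le_of_lt hs)]
      ring
  have key' : ∀ t x, HasDerivAt (fun s => f s x + min s 0 * ft 0 x) (ft (max t 0) x) t := by
    intro t x
    rcases eq_or_ne t 0 with rfl | h0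
    · have c1 : Continuous fun t => f t x := cf.comp (hsl x)
      exact hasDerivAt_of_punctured (a := -1) (c := 1) (G := fun t => ft (max t 0) x)
        ⟨by norm_num, by norm_num⟩ (by fun_prop) (cg.comp (hsl x)) fun t _ h0 => key t h0 x
    · exact key t h0 x
  refine ⟨fun t x => f t x + min t 0 * ft 0 x, he, fun t ht x => ?_, ?_⟩
  · have := key' t x
    rwa [max_eq_left ht] at this
  · refine contDiff_of_partial (fx := fun t x => fx t x + min t 0 * ftx 0 x) cg ?_ key'
      fun t x => (hx t x).add ((htx 0 x).const_mul _)
    have c0 : Continuous fun p : ℝ × ℝ => ftx 0 p.2 :=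
      cftx.comp (f := fun p : ℝ × ℝ => ((0 : ℝ), p.2)) (by fun_prop)
    fun_prop

end

section

variable {a μ γ ν τ K E : ℝ} {D : Data} {F : Fields}

lemma GReg.v_mem (h : GReg a μ γ ν E F) (t x : ℝ) : F.v t x ∈ Icc (1 / 2 : ℝ) (3 / 2) := by
  have := abs_le.1 (h.hv t x)
  constructor <;> linarith

lemma GReg.v_pos (h : GReg a μ γ ν E F) (t x : ℝ) : 0 < F.v t x := by
  have := (h.v_mem t x).1
  linarith

lemma GSol.tailDensity (hτ : 0 < τ) (h : GSol a μ γ τ K E D F) : TailDensity (F.Yd τ) :=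
  ⟨F.Yd_nonneg hτ, fun _ ht => (h.energy hτ ht).1, fun T _ hε => h.tails hτ T hε⟩

lemma Tame.of_le {Y g : ℝ → ℝ → ℝ} (hg : Continuous fun p : ℝ × ℝ => g p.1 p.2)
    (h : ∀ t x, g t x ^ 2 ≤ Y t x) : Tame Y g :=
  ⟨hg, 1, zero_le_one, fun t x => by rw [one_mul]; exact h t x⟩

lemma Tame.of_weighted {Y g : ℝ → ℝ → ℝ} (hτ : 0 < τ)
    (hg : Continuous fun p : ℝ × ℝ => g p.1 p.2)
    (h : ∀ t x, τ * g t x ^ 2 ≤ Y t x) : Tame Y g :=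
  ⟨hg, τ⁻¹, by positivity, fun t x => by
    rw [← div_eq_inv_mul, le_div_iff₀ hτ]
    linarith [h t x]⟩

/-- The components of the solution are dominated by the energy density. -/
lemma GReg.tame (hτ : 0 < τ) (h : GReg a μ γ τ⁻¹ E F) :
    (Tame (F.Yd τ) (fun t x => F.v t x - 1) ∧ Tame (F.Yd τ) F.vx ∧ Tame (F.Yd τ) F.vxx) ∧
    (Tame (F.Yd τ) F.u ∧ Tame (F.Yd τ) F.ux ∧ Tame (F.Yd τ) F.uxx) ∧
    Tame (F.Yd τ) F.S ∧ Tame (F.Yd τ) F.Sx ∧ Tame (F.Yd τ) F.Sxx := by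
  refine ⟨⟨.of_le (h.cv.sub continuous_const) fun t x => ?_, .of_le h.cvx fun t x => ?_,
    .of_le h.cvxx fun t x => ?_⟩, ⟨.of_le h.cu fun t x => ?_, .of_le h.cux fun t x => ?_,
    .of_le h.cuxx fun t x => ?_⟩, .of_weighted hτ h.cS fun t x => ?_,
    .of_weighted hτ h.cSx fun t x => ?_, .of_weighted hτ h.cSxx fun t x => ?_⟩
  all_goals
    have k : 0 ≤ τ * F.S t x ^ 2 ∧ 0 ≤ τ * F.Sx t x ^ 2 ∧ 0 ≤ τ * F.Sxx t x ^ 2 := by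
      refine ⟨?_, ?_, ?_⟩ <;> positivity
    unfold Fields.Yd
    linarith [sq_nonneg (F.v t x - 1), sq_nonneg (F.vx t x), sq_nonneg (F.vxx t x),
      sq_nonneg (F.u t x), sq_nonneg (F.ux t x), sq_nonneg (F.uxx t x), k.1, k.2.1, k.2.2]

/-- The coefficients of the system are continuous and bounded along the solution. -/
lemma GReg.bddC (hK : CoefBd γ μ K) (h : GReg a μ γ ν E F) :
    BddC (fun t x => bF γ (F.v t x)) ∧ BddC (fun t x => bdF γ (F.v t x)) ∧
    BddC (fun t x => (F.v t x)⁻¹) ∧ BddC F.S ∧ BddC F.vx ∧ BddC F.ux := by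
  have cp : ∀ p : ℝ, Continuous fun q : ℝ × ℝ => F.v q.1 q.2 ^ p := fun p =>
    continuous_rpow_of_pos h.cv (fun q => h.v_pos q.1 q.2) p
  refine ⟨⟨(cp _).const_mul _, K, fun t x => ?_⟩, ⟨?_, K, fun t x => hK.bd _ (h.v_mem t x)⟩,
    ⟨h.cv.inv₀ fun q => (h.v_pos q.1 q.2).ne', 2, fun t x => ?_⟩, ⟨h.cS, _, h.hS⟩,
    ⟨h.cvx, √E, fun t x => Real.abs_le_sqrt (h.hvx t x)⟩,
    ⟨h.cux, √E, fun t x => Real.abs_le_sqrt (h.hux t x)⟩⟩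
  · have := hK.b_ge _ (h.v_mem t x)
    have : 0 < 1 / K := one_div_pos.2 (zero_lt_one.trans_le hK.one_le)
    rw [abs_of_nonneg (by linarith)]
    exact hK.b_le _ (h.v_mem t x)
  · exact (cp _).const_mul _
  · rw [abs_of_pos (inv_pos.2 (h.v_pos t x))]
    exact inv_le_of_inv_le₀ (by norm_num) (by linarith [(h.v_mem t x).1])

lemma Tame.sub {Y f g : ℝ → ℝ → ℝ} (hf : Tame Y f) (hg : Tame Y g) :
    Tame Y fun t x => f t x - g t x := by
  have := hf.add (Tame.mul (BddC.const (-1)) hg)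
  simpa [sub_eq_add_neg] using this

theorem GSol.exists_solution (hK : CoefBd γ μ K) (hτ : 0 < τ) (h : GSol a μ γ τ K E D F) :
    ∃ v u S, IsGlobalSolution a μ γ τ D.v D.u D.S v u S ∧
      ∀ t, 0 ≤ t → v t = F.v t ∧ u t = F.u t ∧ S t = F.S t := by
  have hr := h.reg hτ
  have hY := h.tailDensity hτ
  obtain ⟨⟨tv0, tv1, tv2⟩, ⟨tu0, tu1, tu2⟩, tS0, tS1, tS2⟩ := hr.tame hτ
  obtain ⟨bb, bbd, biv, bS, bvx, bux⟩ := hr.bddC hK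
  have bk : BddC fun t x => kF a μ τ⁻¹ (F.v t x) (F.S t x) := by
    have := (((BddC.const (2 * a)).mul bS).add (BddC.const (μ * τ⁻¹))).mul biv
    simpa only [kF, div_eq_mul_inv] using this
  have tut := tS1.add (Tame.mul bb tv1)
  have tutx := (tS2.add (Tame.mul (bbd.mul bvx) tv1)).add (Tame.mul bb tv2)
  have tSt := (Tame.mul bk tu1).sub (Tame.mul (BddC.const τ⁻¹) tS0)
  have tStx := (((Tame.mul (((BddC.const (2 * a)).mul biv).mul bux) tS1).sub
    (Tame.mul ((bk.mul biv).mul bux) tv1)).add (Tame.mul bk tu2)).sub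
      (Tame.mul (BddC.const τ⁻¹) tS1)
  have dut : ∀ t x, HasDerivAt (fun y => F.Sx t y + bF γ (F.v t y) * F.vx t y)
      (F.Sxx t x + bdF γ (F.v t x) * F.vx t x * F.vx t x + bF γ (F.v t x) * F.vxx t x) x := by
    intro t x
    refine ((hr.dSx t x).add ((hasDerivAt_bF (hr.dv t x) (hr.v_pos t x)).mul
      (hr.dvx t x))).congr_deriv ?_
    ring
  have dSt : ∀ t x, HasDerivAt
      (fun y => kF a μ τ⁻¹ (F.v t y) (F.S t y) * F.ux t y - τ⁻¹ * F.S t y)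
      (2 * a * (F.v t x)⁻¹ * F.ux t x * F.Sx t x -
        kF a μ τ⁻¹ (F.v t x) (F.S t x) * (F.v t x)⁻¹ * F.ux t x * F.vx t x +
        kF a μ τ⁻¹ (F.v t x) (F.S t x) * F.uxx t x - τ⁻¹ * F.Sx t x) x := by
    intro t x
    refine (((hasDerivAt_kF (hr.dv t x) (hr.dS t x) (hr.v_pos t x)).mul
      (hr.dux t x)).sub ((hr.dS t x).const_mul τ⁻¹)).congr_deriv ?_
    simp only [div_eq_mul_inv]
    ring
  obtain ⟨v, ev, vt, cv⟩ := exists_extension hr.cv hr.cvx hr.cux hr.cuxx hr.dv hr.dux hr.tv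
    fun t ht x => (hr.past t ht x).1
  obtain ⟨u, eu, ut, cu⟩ := exists_extension hr.cu hr.cux tut.1 tutx.1 hr.du dut hr.tu
    fun t ht x => (hr.past t ht x).2.1
  obtain ⟨S, eS, St, cS⟩ := exists_extension hr.cS hr.cSx tSt.1 tStx.1 hr.dS dSt hr.tS
    fun t ht x => (hr.past t ht x).2.2
  refine ⟨v, u, S, ⟨fun x => ?_, fun t ht x => ?_, cv.contDiffOn, cu.contDiffOn, cS.contDiffOn,
    ?_, ?_, ?_⟩, fun t ht => ⟨ev t ht, eu t ht, eS t ht⟩⟩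
  · obtain ⟨N, hN, G, -, h2, h3, -, h5⟩ := h.loc 0 |x|
    have h4 := h3 0 le_rfl x le_rfl
    rw [max_self, mul_zero, sub_zero] at h4
    obtain ⟨e1, e2, e3, -⟩ := h5 0 le_rfl x le_rfl
    simp only [Fields.past, max_self] at e1 e2 e3
    rw [ev 0 le_rfl, eu 0 le_rfl, eS 0 le_rfl, e1, e2, e3]
    exact h2 x (by linarith)
  · have p0 := hr.v_pos t x
    have p1 : px u t x = F.ux t x := by rw [px, eu t ht, (hr.du t x).deriv]
    have p2 : px S t x = F.Sx t x := by rw [px, eS t ht, (hr.dS t x).deriv]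
    refine ⟨by rwa [ev t ht], ?_, ?_, ?_⟩
    · rw [pt, (vt t ht x).deriv, p1]
    · rw [pt, (ut t ht x).deriv, p2, ev t ht,
        (hasDerivAt_pressure (hr.dv t x) p0).deriv]
      ring
    · rw [pt, (St t ht x).deriv, p1, ev t ht, eS t ht, kF]
      field_simp
      ring
  · refine regH_two hY (f := fun t x => F.v t x - 1) (fun t ht => by rw [ev t ht])
      (fun t ht x => (vt t ht x).sub_const 1) (fun t x => (hr.dv t x).sub_const 1) hr.dvx hr.dux
      tv0 tv1 tv2 tu1 tu2
  · exact regH_two hY eu ut hr.du hr.dux dut tu0 tu1 tu2 tut tutx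
  · exact regH_two hY eS St hr.dS hr.dSx dSt tS0 tS1 tS2 tSt tStx

end

section

variable {a μ γ ν τ K E : ℝ} {D : Data} {F : Fields} {v u S : ℝ → ℝ → ℝ}

lemma GSol.bound_nonneg (hτ : 0 < τ) (h : GSol a μ γ τ K E D F) : 0 ≤ E :=
  (sq_nonneg _).trans ((h.reg hτ).hvx 0 0)

lemma GSol.integrable_sq (hτ : 0 < τ) (h : GSol a μ γ τ K E D F) {t : ℝ} (ht : 0 ≤ t) :
    (Integrable (fun x => (F.v t x - 1) ^ 2) ∧ Integrable (fun x => F.vx t x ^ 2) ∧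
      Integrable (fun x => F.vxx t x ^ 2)) ∧
    (Integrable (fun x => F.u t x ^ 2) ∧ Integrable (fun x => F.ux t x ^ 2) ∧
      Integrable (fun x => F.uxx t x ^ 2)) ∧
    Integrable (fun x => F.S t x ^ 2) ∧ Integrable (fun x => F.Sx t x ^ 2) ∧
      Integrable (fun x => F.Sxx t x ^ 2) := by
  have hY := h.tailDensity hτ
  obtain ⟨⟨tv0, tv1, tv2⟩, ⟨tu0, tu1, tu2⟩, tS0, tS1, tS2⟩ := (h.reg hτ).tame hτ
  exact ⟨⟨tv0.integrable hY ht, tv1.integrable hY ht, tv2.integrable hY ht⟩,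
    ⟨tu0.integrable hY ht, tu1.integrable hY ht, tu2.integrable hY ht⟩,
    tS0.integrable hY ht, tS1.integrable hY ht, tS2.integrable hY ht⟩

/-- The norms of the solution at time `t` as the integral of the energy density. -/
lemma GSol.energy_eq (hτ : 0 < τ) (h : GSol a μ γ τ K E D F) {t : ℝ} (ht : 0 ≤ t) :
    HSq 2 (fun x => F.v t x - 1) + HSq 2 (F.u t) + τ * HSq 2 (F.S t) = ∫ x, F.Yd τ t x := by
  have hr := h.reg hτ
  obtain ⟨⟨i1, i2, i3⟩, ⟨i4, i5, i6⟩, i7, i8, i9⟩ := h.integrable_sq hτ ht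
  rw [hSq_two (fun x => (hr.dv t x).sub_const 1) (hr.dvx t), hSq_two (hr.du t) (hr.dux t),
    hSq_two (hr.dS t) (hr.dSx t)]
  unfold Fields.Yd
  rw [MeasureTheory.integral_add (by fun_prop) (by fun_prop),
    MeasureTheory.integral_add (by fun_prop) (by fun_prop),
    MeasureTheory.integral_add (by fun_prop) (by fun_prop),
    MeasureTheory.integral_add (by fun_prop) (by fun_prop),
    MeasureTheory.integral_add (by fun_prop) (by fun_prop),
    MeasureTheory.integral_add (by fun_prop) (by fun_prop),
    MeasureTheory.integral_const_mul,
    MeasureTheory.integral_add (by fun_prop) (by fun_prop),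
    MeasureTheory.integral_add (by fun_prop) (by fun_prop)]

/-- The dissipation at time `t` as an integral of its density. -/
lemma GSol.dissipation_eq (hτ : 0 < τ) (h : GSol a μ γ τ K E D F) {t : ℝ} (ht : 0 ≤ t)
    (ev : v t = F.v t) (eu : u t = F.u t) (eS : S t = F.S t) :
    Integrable (F.dens t) ∧ Dn v u S t = ∫ x, F.dens t x := by
  have hr := h.reg hτ
  obtain ⟨⟨i1, i2, i3⟩, ⟨i4, i5, i6⟩, i7, i8, i9⟩ := h.integrable_sq hτ ht
  have e1 : (fun x => px v t x) = F.vx t := funext fun x => by rw [px, ev, (hr.dv t x).deriv]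
  have e2 : (fun x => px u t x) = F.ux t := funext fun x => by rw [px, eu, (hr.du t x).deriv]
  constructor
  · unfold Fields.dens
    fun_prop
  · rw [Dn, e1, e2, eS, hSq_one (hr.dvx t), hSq_one (hr.dux t), hSq_two (hr.dS t) (hr.dSx t)]
    unfold Fields.dens
    rw [MeasureTheory.integral_add (by fun_prop) (by fun_prop),
      MeasureTheory.integral_add (by fun_prop) (by fun_prop),
      MeasureTheory.integral_add (by fun_prop) (by fun_prop),
      MeasureTheory.integral_add (by fun_prop) (by fun_prop),
      MeasureTheory.integral_add (by fun_prop) (by fun_prop),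
      MeasureTheory.integral_add (by fun_prop) (by fun_prop)]

theorem GSol.estimate (hτ : 0 < τ) (h : GSol a μ γ τ K E D F)
    (he : ∀ t, 0 ≤ t → v t = F.v t ∧ u t = F.u t ∧ S t = F.S t) :
    sSup ((fun t => HSq 2 (fun x => v t x - 1) + HSq 2 (u t) + τ * HSq 2 (S t)) '' Ici 0)
      + (∫ t in Ioi (0 : ℝ), Dn v u S t) ≤ 2 * E := by
  have hr := h.reg hτ
  have E0 := h.bound_nonneg hτ
  have hsup : sSup ((fun t => HSq 2 (fun x => v t x - 1) + HSq 2 (u t) + τ * HSq 2 (S t)) '' Ici 0)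
      ≤ E := by
    refine csSup_le (nonempty_Ici.image _) ?_
    rintro _ ⟨t, ht, rfl⟩
    obtain ⟨e1, e2, e3⟩ := he t ht
    simp only [e1, e2, e3]
    rw [h.energy_eq hτ ht]
    exact (h.energy hτ ht).2
  have hD : ∀ t, 0 ≤ t → Integrable (F.dens t) ∧ Dn v u S t = ∫ x, F.dens t x := fun t ht =>
    h.dissipation_eq hτ ht (he t ht).1 (he t ht).2.1 (he t ht).2.2
  have hInt : ∫ t in Ioi (0 : ℝ), Dn v u S t ≤ E := by
    by_cases hi : IntegrableOn (fun t => Dn v u S t) (Ioi 0)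
    swap
    · rw [integral_undef hi]
      exact E0
    refine le_of_tendsto (intervalIntegral_tendsto_integral_Ioi 0 hi tendsto_id) ?_
    filter_upwards [eventually_ge_atTop 0] with T hT
    have hlim : Tendsto (fun R : ℝ => ∫ q in (0 : ℝ)..T, ∫ x in -R..R, F.dens q x) atTop
        (nhds (∫ q in (0 : ℝ)..T, Dn v u S q)) := by
      refine intervalIntegral.tendsto_integral_filter_of_dominated_convergence (fun t => Dn v u S t)
        (Eventually.of_forall fun R => ?_) ?_ ?_ (Eventually.of_forall fun q hq => ?_)
      · exact (intervalIntegral.continuous_parametric_intervalIntegral_of_continuous' hr.cdens _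
          _).aestronglyMeasurable
      · filter_upwards [eventually_ge_atTop 0] with R hR
        refine Eventually.of_forall fun q hq => ?_
        rw [uIoc_of_le hT] at hq
        obtain ⟨i1, i2⟩ := hD q hq.1.le
        rw [i2, intervalIntegral.integral_of_le (by linarith), Real.norm_eq_abs,
          abs_of_nonneg (integral_nonneg fun x => F.dens_nonneg q x)]
        exact setIntegral_le_integral i1 (Eventually.of_forall fun x => F.dens_nonneg q x)
      · rw [intervalIntegrable_iff_integrableOn_Ioc_of_le hT]
        exact hi.mono_set Ioc_subset_Ioi_self
      · rw [uIoc_of_le hT] at hq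
        obtain ⟨i1, i2⟩ := hD q hq.1.le
        rw [i2]
        exact intervalIntegral_tendsto_integral i1 tendsto_neg_atTop_atBot tendsto_id
    refine le_of_tendsto hlim ?_
    filter_upwards [eventually_ge_atTop 0] with R hR
    exact h.diss hT hR
  linarith

end

section

lemma clamp_contDiffOn {f : ℝ → ℝ → ℝ} {T : ℝ} (hT : 0 ≤ T)
    (hf : ContDiffOn ℝ 1 (fun p : ℝ × ℝ => f p.1 p.2) (Ici 0 ×ˢ univ)) :
    (Continuous fun p : ℝ × ℝ => f (clampT T p.1) p.2) ∧
    (Continuous fun p : ℝ × ℝ => px f (clampT T p.1) p.2) ∧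
    ∀ t x, HasDerivAt (f (clampT T t)) (px f (clampT T t) x) x := by
  have hm : ∀ p : ℝ × ℝ, (clampT T p.1, p.2) ∈ Ici (0 : ℝ) ×ˢ (univ : Set ℝ) := fun p =>
    ⟨(clampT_mem hT p.1).1, mem_univ _⟩
  have cc : Continuous fun p : ℝ × ℝ => (clampT T p.1, p.2) :=
    ((continuous_clampT T).comp continuous_fst).prodMk continuous_snd
  have hd : ∀ t x, HasDerivAt (f (clampT T t)) (fderivWithin ℝ (fun p : ℝ × ℝ => f p.1 p.2)
      (Ici 0 ×ˢ univ) (clampT T t, x) (0, 1)) x := by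
    intro t x
    have h1 := ((hf.differentiableOn one_ne_zero) _ (hm (t, x))).hasFDerivWithinAt
    have h2 : HasDerivWithinAt (fun y : ℝ => (clampT T t, y)) ((0 : ℝ), (1 : ℝ)) univ x :=
      ((hasDerivAt_const x _).prodMk (hasDerivAt_id x)).hasDerivWithinAt
    exact hasDerivWithinAt_univ.1
      (h1.comp_hasDerivWithinAt x h2 fun y _ => ⟨(clampT_mem hT t).1, mem_univ _⟩)
  have he : ∀ t x, px f (clampT T t) x = fderivWithin ℝ (fun p : ℝ × ℝ => f p.1 p.2)
      (Ici 0 ×ˢ univ) (clampT T t, x) (0, 1) := fun t x => (hd t x).deriv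
  refine ⟨hf.continuousOn.comp_continuous cc hm, ?_, fun t x => he t x ▸ hd t x⟩
  have := ((hf.continuousOn_fderivWithin ((uniqueDiffOn_Ici 0).prod uniqueDiffOn_univ)
    le_rfl).comp_continuous cc hm).clm_apply (continuous_const (y := ((0 : ℝ), (1 : ℝ))))
  exact this.congr fun p => (he p.1 p.2).symm

lemma clamp_hasDerivAt {f : ℝ → ℝ → ℝ} {f' t x T : ℝ} (ht : t ∈ Ioo 0 T)
    (h : HasDerivAt (fun s => f s x) f' t) : HasDerivAt (fun s => f (clampT T s) x) f' t := by
  refine h.congr_of_eventuallyEq ?_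
  filter_upwards [Ioo_mem_nhds ht.1 ht.2] with s hs
  rw [clampT_of_mem ⟨hs.1.le, hs.2.le⟩]

variable {a μ γ τ K E T : ℝ} {D : Data} {F : Fields} {v u S : ℝ → ℝ → ℝ}
  {v₀ u₀ S₀ : ℝ → ℝ}

lemma IsGlobalSolution.c1Sol (hτ : 0 < τ) (hT : 0 ≤ T)
    (h : IsGlobalSolution a μ γ τ v₀ u₀ S₀ v u S) :
    C1Sol a μ γ τ T (fun t => v (clampT T t)) (fun t => u (clampT T t)) (fun t => S (clampT T t))
      (fun t => px v (clampT T t)) (fun t => px u (clampT T t)) (fun t => px S (clampT T t)) := by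
  obtain ⟨-, hs, hv, hu, hS, rv, ru, rS⟩ := h
  obtain ⟨v1, v2, v3⟩ := clamp_contDiffOn hT hv
  obtain ⟨u1, u2, u3⟩ := clamp_contDiffOn hT hu
  obtain ⟨S1, S2, S3⟩ := clamp_contDiffOn hT hS
  refine ⟨v1, u1, S1, v2, u2, S2, v3, u3, S3, fun t ht x => ?_, fun t ht x => ?_,
    fun t ht x => ?_, fun t x => (hs _ (clampT_mem hT t).1 x).1⟩
  all_goals
    have ht0 : t ∈ Ici (0 : ℝ) := ht.1.le
    obtain ⟨p0, q1, q2, q3⟩ := hs t ht0 x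
    have d3 := v3 t x
    have ec : clampT T t = t := clampT_of_mem ⟨ht.1.le, ht.2.le⟩
    simp only [ec] at d3 ⊢
    refine clamp_hasDerivAt ht ?_
  · rw [← q1]
    have := (rv.2.2.1 x t ht0).add_const 1
    simp only [sub_add_cancel] at this
    exact this.hasDerivAt
  · refine (ru.2.2.1 x t ht0).hasDerivAt.congr_deriv ?_
    rw [(hasDerivAt_pressure d3 p0).deriv] at q2
    change pt u t x = _
    linarith
  · refine (rS.2.2.1 x t ht0).hasDerivAt.congr_deriv ?_
    change pt S t x = _
    field_simp at q3 ⊢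
    linarith

theorem GSol.unique (hK : CoefBd γ μ K) (ha : |a| ≤ 1) (hμ : 0 < μ) (hτ : 0 < τ) (hτ1 : τ ≤ 1)
    (h : GSol a μ γ τ K E D F) (hw : IsGlobalSolution a μ γ τ D.v D.u D.S v u S) {t : ℝ}
    (ht : 0 ≤ t) (x : ℝ) : v t x = F.v t x ∧ u t x = F.u t x ∧ S t x = F.S t x := by
  obtain ⟨N, hN, G, h1, h2, h3, -, h5⟩ := h.loc t |x|
  have N0 : 0 < N := by linarith
  have h6 := h3 t le_rfl x le_rfl
  rw [max_eq_left ht] at h6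
  obtain ⟨k1, k2, k3⟩ := h1.cone_unique hK ha hμ hτ hτ1 N0 (hw.c1Sol hτ N0.le) (x₀ := 0) (ρ := N)
    (fun y hy => by
      rw [sub_zero] at hy
      obtain ⟨e1, e2, e3⟩ := h2 y hy
      obtain ⟨e4, e5, e6⟩ := hw.1 y
      simp only [clampT_of_mem (left_mem_Icc.2 N0.le)]
      exact ⟨e1.trans e4.symm, e2.trans e5.symm, e3.trans e6.symm⟩)
    ⟨ht, hN.le⟩ (by rwa [sub_zero])
  rw [clampT_of_mem ⟨ht, hN.le⟩] at k1 k2 k3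
  obtain ⟨e1, e2, e3, -⟩ := h5 t le_rfl x le_rfl
  simp only [Fields.past, max_eq_left ht] at e1 e2 e3
  exact ⟨k1.symm.trans e1.symm, k2.symm.trans e2.symm, k3.symm.trans e3.symm⟩

lemma MemH.derivs {f : ℝ → ℝ} (h : MemH 2 f) :
    (∀ x, HasDerivAt f (deriv f x) x) ∧ (∀ x, HasDerivAt (deriv f) (deriv (deriv f) x) x) ∧
    Continuous (deriv (deriv f)) ∧ Integrable (fun x => f x ^ 2) ∧
    Integrable (fun x => deriv f x ^ 2) ∧ Integrable fun x => deriv (deriv f) x ^ 2 := by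
  obtain ⟨hc, hi⟩ := h
  have hc : ContDiff ℝ (1 + 1) f := by simpa [one_add_one_eq_two] using hc
  obtain ⟨c1, -, c2⟩ := contDiff_succ_iff_deriv.1 hc
  obtain ⟨c3, c4⟩ := contDiff_one_iff_deriv.1 c2
  refine ⟨fun x => (c1 x).hasDerivAt, fun x => (c3 x).hasDerivAt, c4, ?_, ?_, ?_⟩
  · simpa using hi 0 (by norm_num)
  · simpa [iteratedDeriv_one] using hi 1 (by norm_num)
  · simpa [iteratedDeriv_succ, iteratedDeriv_one] using hi 2 le_rfl

/-- Initial data of class `H²` together with their derivatives. -/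
lemma exists_data {τ : ℝ} (hτ : 0 < τ) (hv : MemH 2 fun x => v₀ x - 1) (hu : MemH 2 u₀)
    (hS : MemH 2 fun x => √τ * S₀ x) :
    ∃ D : Data, D.v = v₀ ∧ D.u = u₀ ∧ D.S = S₀ ∧ D.IsH2 τ ∧
      ∫ x, D.yd τ x = HSq 2 (fun x => v₀ x - 1) + HSq 2 u₀ + τ * HSq 2 S₀ := by
  have hS' : MemH 2 S₀ := by
    have r0 : √τ ≠ 0 := (Real.sqrt_pos.2 hτ).ne'
    obtain ⟨d1, d2, c, i0, i1, i2⟩ := hS.derivs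
    have e : ∀ g : ℝ → ℝ, Integrable (fun x => g x ^ 2) →
        Integrable fun x => ((√τ)⁻¹ * g x) ^ 2 := fun g hg => by
      simp only [mul_pow]
      exact hg.const_mul _
    have e0 : (fun x => (√τ)⁻¹ * (√τ * S₀ x)) = S₀ := by
      funext x
      field_simp
    have := memH_two (fun x => (d1 x).const_mul (√τ)⁻¹) (fun x => (d2 x).const_mul (√τ)⁻¹)
      (continuous_const.mul c) (e _ i0) (e _ i1) (e _ i2)
    rwa [e0] at this
  obtain ⟨dv, dv', cv, v0, v1, v2⟩ := hv.derivs
  obtain ⟨du, du', cu, u0, u1, u2⟩ := hu.derivs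
  obtain ⟨dS, dS', cS, S0, S1, S2⟩ := hS'.derivs
  refine ⟨⟨v₀, u₀, S₀, deriv fun x => v₀ x - 1, deriv u₀, deriv S₀,
    deriv (deriv fun x => v₀ x - 1), deriv (deriv u₀), deriv (deriv S₀)⟩, rfl, rfl, rfl,
    ⟨fun x => ?_, du, dS, dv', du', dS', cv, cu, cS, ?_⟩, ?_⟩
  · have := (dv x).add_const 1
    simpa only [sub_add_cancel] using this
  · unfold Data.yd
    fun_prop
  · rw [hSq_two dv dv', hSq_two du du', hSq_two dS dS']
    unfold Data.yd
    rw [MeasureTheory.integral_add (by fun_prop) (by fun_prop),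
      MeasureTheory.integral_add (by fun_prop) (by fun_prop),
      MeasureTheory.integral_add (by fun_prop) (by fun_prop),
      MeasureTheory.integral_add (by fun_prop) (by fun_prop),
      MeasureTheory.integral_add (by fun_prop) (by fun_prop),
      MeasureTheory.integral_add (by fun_prop) (by fun_prop),
      MeasureTheory.integral_const_mul,
      MeasureTheory.integral_add (by fun_prop) (by fun_prop),
      MeasureTheory.integral_add (by fun_prop) (by fun_prop)]

end

/-- Theorem 1.1 (global existence with uniform bounds): fix `a ∈ [-1,1]`, `μ > 0`
and `γ > 1`. There are `C₀ > 0` and `ε₀ > 0`, independent of `τ ∈ (0,1)` and of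
the initial data, such that for any data with `(v₀ - 1, u₀, √τ S₀) ∈ H²(ℝ)` and
`E₀ := ‖v₀-1‖²_{H²} + ‖u₀‖²_{H²} + τ‖S₀‖²_{H²} < ε₀`, the Cauchy problem for the
relaxed system has a unique global solution, which satisfies
`sup_{t≥0} (‖(v-1)(t)‖²_{H²} + ‖u(t)‖²_{H²} + τ‖S(t)‖²_{H²})
  + ∫₀^∞ (‖v_x‖²_{H¹} + ‖u_x‖²_{H¹} + ‖S‖²_{H²}) dt ≤ C₀ E₀`. -/
theorem global_existence
    (a μ γ : ℝ) (ha : a ∈ Icc (-1 : ℝ) 1) (hμ : 0 < μ) (hγ : 1 < γ) :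
    ∃ C₀ > (0 : ℝ), ∃ ε₀ > (0 : ℝ),
      ∀ τ ∈ Ioo (0 : ℝ) 1, ∀ v₀ u₀ S₀ : ℝ → ℝ,
        MemH 2 (fun x => v₀ x - 1) → MemH 2 u₀ →
        MemH 2 (fun x => Real.sqrt τ * S₀ x) →
        HSq 2 (fun x => v₀ x - 1) + HSq 2 u₀ + τ * HSq 2 S₀ < ε₀ →
        ∃ v u S : ℝ → ℝ → ℝ,
          IsGlobalSolution a μ γ τ v₀ u₀ S₀ v u S ∧
          (∀ v' u' S' : ℝ → ℝ → ℝ, IsGlobalSolution a μ γ τ v₀ u₀ S₀ v' u' S' →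
            ∀ t ∈ Ici (0 : ℝ), ∀ x : ℝ,
              v' t x = v t x ∧ u' t x = u t x ∧ S' t x = S t x) ∧
          sSup ((fun t => HSq 2 (fun x => v t x - 1) + HSq 2 (u t) + τ * HSq 2 (S t))
              '' Ici 0)
            + (∫ t in Ioi (0 : ℝ), Dn v u S t)
            ≤ C₀ * (HSq 2 (fun x => v₀ x - 1) + HSq 2 u₀ + τ * HSq 2 S₀) := by
  obtain ⟨K, hK⟩ := exists_coefBd hγ hμ
  have ha' : |a| ≤ 1 := abs_le.2 ha
  obtain ⟨δ, hδ, C, hC, H⟩ := exists_gSol ha' hμ hγ hK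
  refine ⟨2 * C, by positivity, δ, hδ, fun τ hτ v₀ u₀ S₀ hv hu hS hE => ?_⟩
  obtain ⟨D, rfl, rfl, rfl, hD, eD⟩ := exists_data hτ.1 hv hu hS
  obtain ⟨F, hF⟩ := H τ hτ.1 hτ.2.le D hD (by rw [eD]; exact hE.le)
  obtain ⟨v, u, S, hsol, he⟩ := hF.exists_solution hK hτ.1
  refine ⟨v, u, S, hsol, fun v' u' S' hw t ht x => ?_, ?_⟩
  · obtain ⟨e1, e2, e3⟩ := he t ht
    rw [e1, e2, e3]
    exact hF.unique hK ha' hμ hτ.1 hτ.2.le hw ht x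
  · refine (hF.estimate hτ.1 he).trans ?_
    rw [← eD]
    exact le_of_eq (by ring)
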